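/- (Short variation estimate.) Let n ≥ 2 be an integer, let Γ ∈ 𝒰, and let K be a homogeneous Calderón–Zygmund kernel on ℝ^n. If p ∈ (1,∞), r ∈ (2,∞) and r > p′/n (p′ = p/(p−1)), then there exists a constant C such that for every Schwartz function f on ℝ^n one has ‖ ( ∑_{j∈ℤ} V_r(H^{(u)}f(x) : u ∈ [2^j, 2^{j+1}])^r )^{1/r} ‖_{L^p(ℝ^n, dx)} ≤ C ‖f‖_{L^p(ℝ^n)}. -/

import Mathlib

open MeasureTheory Filter Set
open scoped ENNReal NNReal FourierTransform Topology

noncomputable section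

/-- `ℝⁿ` as a Euclidean space. -/
abbrev Rn (n : ℕ) := EuclideanSpace ℝ (Fin n)

/-- The class `𝒰` of phase functions: `Γ` is continuous on `[0,∞)`, smooth on `(0,∞)`,
`Γ(0) = 0`, `Γ′ > 0` on `(0,∞)`, with the bounds `c_{1,j} ≤ |s^j Γ^{(j)}(s)/Γ(s)|` for
`j = 1, 2` and `|s^j Γ^{(j)}(s)/Γ(s)| ≤ c_{2,j}` for all `j ≥ 1`. -/
structure IsGammaU (Γ : ℝ → ℝ) : Prop where
  continuousOn : ContinuousOn Γ (Set.Ici 0)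
  smooth : ContDiffOn ℝ (⊤ : ℕ∞) Γ (Set.Ioi 0)
  map_zero : Γ 0 = 0
  deriv_pos : ∀ s > (0 : ℝ), 0 < deriv Γ s
  lower : ∀ j ∈ ({1, 2} : Set ℕ), ∃ c > (0 : ℝ), ∀ s > (0 : ℝ),
    c ≤ |s ^ j * iteratedDeriv j Γ s / Γ s|
  upper : ∀ j : ℕ, 1 ≤ j → ∃ c > (0 : ℝ), ∀ s > (0 : ℝ),
    |s ^ j * iteratedDeriv j Γ s / Γ s| ≤ c

/-- `K` is a homogeneous Calderón–Zygmund kernel on `ℝⁿ`: `K(t) = Ω(t)/‖t‖ⁿ` with `Ω` smooth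
away from the origin, homogeneous of degree `0`, and of mean value zero on the unit sphere. -/
def IsHomCZKernel (n : ℕ) (K : Rn n → ℝ) : Prop :=
  ∃ Ω : Rn n → ℝ,
    ContDiffOn ℝ (⊤ : ℕ∞) Ω {x : Rn n | x ≠ 0} ∧
    (∀ c : ℝ, 0 < c → ∀ t : Rn n, Ω (c • t) = Ω t) ∧
    (∫ θ : Metric.sphere (0 : Rn n) 1, Ω θ ∂((volume : Measure (Rn n)).toSphere) = 0) ∧
    (∀ t : Rn n, t ≠ 0 → K t = Ω t / ‖t‖ ^ n)

/-- The `r`-variation of a family `(a_u)_{u ∈ 𝒦}`. -/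
def variation {ι : Type*} [LinearOrder ι] (r : ℝ) (𝒦 : Set ι) (a : ι → ℂ) : ℝ≥0∞ :=
  ⨆ (J : ℕ) (u : Fin (J + 1) → ι) (_ : StrictMono u) (_ : ∀ i, u i ∈ 𝒦),
    (∑ i : Fin J, (‖a (u i.succ) - a (u i.castSucc)‖₊ : ℝ≥0∞) ^ r) ^ (1 / r)

/-- The `λ`-jump counting function of a family `(a_u)_{u ∈ 𝒦}`. -/
def jumpCount {ι : Type*} [LinearOrder ι] (lam : ℝ) (𝒦 : Set ι) (a : ι → ℂ) : ℝ≥0∞ :=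
  ⨆ (J : ℕ) (s : Fin J → ι) (t : Fin J → ι) (_ : ∀ i, s i ∈ 𝒦) (_ : ∀ i, t i ∈ 𝒦)
    (_ : ∀ i, s i < t i) (_ : ∀ i j : Fin J, i < j → t i < s j)
    (_ : ∀ i, lam < ‖a (t i) - a (s i)‖), (J : ℝ≥0∞)

/-- The `L^p` norm of an `ℝ≥0∞`-valued function. -/
def lpNormENN {α : Type*} [MeasurableSpace α] (p : ℝ) (g : α → ℝ≥0∞) (μ : Measure α) : ℝ≥0∞ :=
  (∫⁻ x, g x ^ p ∂μ) ^ (1 / p)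

/-- The modulated singular integral `H^{(u)} f (x)`, defined as a principal value. -/
def pvH {n : ℕ} (Γ : ℝ → ℝ) (K : Rn n → ℝ) (u : ℝ) (f : Rn n → ℂ) (x : Rn n) : ℂ :=
  limUnder (𝓝[>] (0 : ℝ)) fun ε =>
    ∫ t in {t : Rn n | ε < ‖t‖ ∧ ‖t‖ < ε⁻¹},
      f (x - t) * Complex.exp (Complex.I * Complex.ofReal (u * Γ ‖t‖)) * Complex.ofReal (K t)

namespace ShortVar

section ENNRealTools

variable {α : Type*} [MeasurableSpace α] {μ : Measure α}

lemma lintegral_finset_sum_rpow_le {ι : Type*} {r : ℝ} (hr : 1 ≤ r) (f : ι → α → ℝ≥0∞)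
    (hf : ∀ i, AEMeasurable (f i) μ) (s : Finset ι) :
    (∫⁻ x, (∑ i ∈ s, f i x) ^ r ∂μ) ^ (1 / r) ≤ ∑ i ∈ s, (∫⁻ x, f i x ^ r ∂μ) ^ (1 / r) := by
  classical
  induction s using Finset.induction_on with
  | empty =>
    have : 0 < r := by linarith
    simp [this]
  | insert a s ha ih =>
    simp only [Finset.sum_insert ha]
    refine (ENNReal.lintegral_Lp_add_le (hf a) (Finset.aemeasurable_fun_sum s fun i _ => hf i)
      hr).trans ?_
    gcongr

/-- Minkowski's inequality for countable sums. -/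
lemma lintegral_tsum_rpow_le {ι : Type*} [Countable ι] {r : ℝ} (hr : 1 ≤ r) (f : ι → α → ℝ≥0∞)
    (hf : ∀ i, AEMeasurable (f i) μ) :
    (∫⁻ x, (∑' i, f i x) ^ r ∂μ) ^ (1 / r) ≤ ∑' i, (∫⁻ x, f i x ^ r ∂μ) ^ (1 / r) := by
  have hr0 : 0 < r := by linarith
  have h1 : ∀ x, (∑' i, f i x) ^ r = ⨆ s : Finset ι, (∑ i ∈ s, f i x) ^ r := by
    intro x
    rw [ENNReal.tsum_eq_iSup_sum]
    exact (ENNReal.orderIsoRpow r hr0).map_iSup _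
  simp_rw [h1]
  rw [lintegral_iSup_directed]
  · rw [show (⨆ s : Finset ι, ∫⁻ x, (∑ i ∈ s, f i x) ^ r ∂μ) ^ (1 / r)
      = ⨆ s : Finset ι, (∫⁻ x, (∑ i ∈ s, f i x) ^ r ∂μ) ^ (1 / r) from
      (ENNReal.orderIsoRpow (1 / r) (by positivity)).map_iSup _]
    exact iSup_le fun s => (lintegral_finset_sum_rpow_le hr f hf s).trans (ENNReal.sum_le_tsum s)
  · exact fun s => (Finset.aemeasurable_fun_sum s fun i _ => hf i).pow_const r
  · refine directed_of_isDirected_le fun s t hst x => ?_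
    dsimp only
    gcongr

lemma tsum_tsum_rpow_le {ι κ : Type*} [Countable ι] [Countable κ] {r : ℝ} (hr : 1 ≤ r)
    (a : κ → ι → ℝ≥0∞) :
    (∑' j, (∑' i, a j i) ^ r) ^ (1 / r) ≤ ∑' i, (∑' j, a j i ^ r) ^ (1 / r) := by
  let _ : MeasurableSpace κ := ⊤
  have := lintegral_tsum_rpow_le (μ := (Measure.count : Measure κ)) hr (fun i j => a j i)
    (fun i => (measurable_from_top).aemeasurable)
  simpa [lintegral_count] using this

/-- `2 ^ x` as an extended nonnegative real. -/
abbrev two (x : ℝ) : ℝ≥0∞ := (2 : ℝ≥0∞) ^ x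

lemma two_pos (x : ℝ) : 0 < two x := ENNReal.rpow_pos (by norm_num) (by norm_num)
lemma two_ne_top (x : ℝ) : two x ≠ ⊤ := ENNReal.rpow_ne_top_of_ne_zero (by norm_num) (by norm_num)
lemma two_add (x y : ℝ) : two (x + y) = two x * two y :=
  ENNReal.rpow_add _ _ (by norm_num) (by norm_num)
lemma two_rpow (x y : ℝ) : two x ^ y = two (x * y) := (ENNReal.rpow_mul _ _ _).symm
lemma two_mono {x y : ℝ} (h : x ≤ y) : two x ≤ two y :=
  ENNReal.rpow_le_rpow_of_exponent_le (by norm_num) h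
lemma two_neg (x : ℝ) : two (-x) = (two x)⁻¹ := ENNReal.rpow_neg _ _

lemma two_eq_ofReal (x : ℝ) : two x = ENNReal.ofReal ((2 : ℝ) ^ x) := by
  rw [← ENNReal.ofReal_rpow_of_pos (by norm_num)]; norm_num

lemma tsum_two_neg_abs_ne_top {s : ℝ} (hs : 0 < s) : ∑' b : ℤ, two (-(s * |(b : ℝ)|)) ≠ ⊤ := by
  have h0 : (2 : ℝ) ^ (-s) < 1 := Real.rpow_lt_one_of_one_lt_of_neg (by norm_num) (by linarith)
  have hg : Summable fun m : ℕ => ((2 : ℝ) ^ (-s)) ^ m :=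
    summable_geometric_of_lt_one (by positivity) h0
  have h : Summable fun b : ℤ => (2 : ℝ) ^ (-(s * |(b : ℝ)|)) := by
    refine Summable.of_nat_of_neg ?_ ?_
    · refine hg.congr fun m => ?_
      rw [← Real.rpow_natCast, ← Real.rpow_mul (by norm_num)]
      simp
    · refine hg.congr fun m => ?_
      rw [← Real.rpow_natCast, ← Real.rpow_mul (by norm_num)]
      simp
  simp_rw [two_eq_ofReal]
  exact h.tsum_ofReal_ne_top

lemma rpow_le_tsum_dyadic {q : ℝ} (hq : 0 < q) (S : ℝ≥0∞) :
    S ^ q ≤ ∑' a : ℤ, two ((a + 1) * q) * (if two a < S then 1 else 0) := by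
  rcases eq_or_ne S 0 with rfl | h0
  · simp [hq]
  rcases eq_or_ne S ⊤ with rfl | ht
  · have : ∑' a : ℤ, two ((a + 1) * q) * (if two a < (⊤ : ℝ≥0∞) then 1 else 0) = ⊤ := by
      refine top_le_iff.1 ((ENNReal.tsum_const_eq_top_of_ne_zero (α := ℕ) (c := (1 : ℝ≥0∞))
        one_ne_zero).symm.le.trans ?_)
      refine le_trans ?_ (ENNReal.tsum_comp_le_tsum_of_injective (f := fun m : ℕ => (m : ℤ))
        Nat.cast_injective _)
      refine ENNReal.tsum_le_tsum fun m => ?_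
      rw [if_pos (lt_top_iff_ne_top.2 (two_ne_top _)), mul_one]
      calc (1 : ℝ≥0∞) = two 0 := by simp
        _ ≤ _ := two_mono (by push_cast; positivity)
    rw [this]; exact le_top
  · obtain ⟨a, ha, ha'⟩ := ENNReal.exists_mem_Ioc_zpow h0 ht (y := 2) (by norm_num) (by norm_num)
    refine le_trans ?_ (ENNReal.le_tsum a)
    rw [if_pos, mul_one, ← two_rpow]
    · refine ENNReal.rpow_le_rpow ?_ hq.le
      refine ha'.trans (le_of_eq ?_)
      rw [← ENNReal.rpow_intCast]; push_cast; rfl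
    · rwa [two, ENNReal.rpow_intCast]

lemma lintegral_rpow_le_tsum_dyadic {q : ℝ} (hq : 0 < q) {S : α → ℝ≥0∞} (hS : Measurable S) :
    ∫⁻ x, S x ^ q ∂μ ≤ ∑' a : ℤ, two ((a + 1) * q) * μ {x | two a < S x} := by
  calc ∫⁻ x, S x ^ q ∂μ
      ≤ ∫⁻ x, ∑' a : ℤ, two ((a + 1) * q) * (if two a < S x then 1 else 0) ∂μ :=
        lintegral_mono fun x => rpow_le_tsum_dyadic hq (S x)
    _ = ∑' a : ℤ, ∫⁻ x, two ((a + 1) * q) * (if two a < S x then 1 else 0) ∂μ := by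
        refine lintegral_tsum fun a => Measurable.aemeasurable ?_
        exact (Measurable.ite (measurableSet_lt measurable_const hS) measurable_const
          measurable_const).const_mul _
    _ = _ := by
        congr 1 with a
        rw [lintegral_const_mul]
        · congr 1
          rw [← lintegral_indicator_one (measurableSet_lt measurable_const hS)]
          refine lintegral_congr fun x => ?_
          simp [indicator]
        · exact Measurable.ite (measurableSet_lt measurable_const hS) measurable_const
            measurable_const

lemma meas_lt_le_rpow {q : ℝ} (hq : 0 < q) {S : α → ℝ≥0∞} (hS : Measurable S) {t : ℝ≥0∞}
    (ht : t ≠ 0) (ht' : t ≠ ⊤) : μ {x | t < S x} ≤ (t⁻¹) ^ q * ∫⁻ x, S x ^ q ∂μ := by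
  have h := mul_meas_ge_le_lintegral₀ (μ := μ) (hS.pow_const q).aemeasurable (t ^ q)
  have h0 : t ^ q ≠ 0 := by simp [ht, ht']
  have h1 : t ^ q ≠ ⊤ := ENNReal.rpow_ne_top_of_nonneg hq.le ht'
  rw [ENNReal.inv_rpow, ← ENNReal.div_eq_inv_mul, ENNReal.le_div_iff_mul_le (Or.inl h0) (Or.inl h1),
    mul_comm]
  refine le_trans ?_ h
  gcongr
  intro hx
  exact ENNReal.rpow_le_rpow (le_of_lt hx) hq.le

lemma marcinkiewicz {q₀ p q₁ : ℝ} (h0 : 0 < q₀) (h1 : q₀ < p) (h2 : p < q₁) :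
    ∃ C : ℝ≥0∞, C ≠ ⊤ ∧ ∀ {α : Type} [MeasurableSpace α] (μ : Measure α) (g : ℤ → α → ℝ≥0∞)
      (e : ℤ → ℝ≥0∞) (A : ℝ≥0∞), (∀ i, Measurable (g i)) →
      (∀ i, ∫⁻ x, g i x ^ q₀ ∂μ ≤ A * e i) → (∀ i, ∫⁻ x, g i x ^ q₁ ∂μ ≤ A * e i) →
      ∫⁻ x, (∑' i : ℤ, two i * g i x) ^ p ∂μ ≤ C * A * ∑' i : ℤ, two (i * p) * e i := by
  have hp : 0 < p := h0.trans h1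
  have hq1 : 0 < q₁ := hp.trans h2
  obtain ⟨δ, hδ, hδ0, hδ1⟩ : ∃ δ > 0, δ * q₀ < p - q₀ ∧ δ * q₁ < q₁ - p := by
    refine ⟨min ((p - q₀) / q₀) ((q₁ - p) / q₁) / 2, by
      have := div_pos (sub_pos.2 h1) h0
      have := div_pos (sub_pos.2 h2) hq1
      positivity, ?_, ?_⟩
    · have h3 := div_pos (sub_pos.2 h1) h0
      have : min ((p - q₀) / q₀) ((q₁ - p) / q₁) / 2 < (p - q₀) / q₀ := by
        have := min_le_left ((p - q₀) / q₀) ((q₁ - p) / q₁)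
        linarith
      rwa [lt_div_iff₀ h0] at this
    · have h3 := div_pos (sub_pos.2 h2) hq1
      have : min ((p - q₀) / q₀) ((q₁ - p) / q₁) / 2 < (q₁ - p) / q₁ := by
        have := min_le_right ((p - q₀) / q₀) ((q₁ - p) / q₁)
        linarith
      rwa [lt_div_iff₀ hq1] at this
  obtain ⟨s, hs, hs0, hs1⟩ : ∃ s > 0, s ≤ p - q₀ - δ * q₀ ∧ s ≤ q₁ - p - δ * q₁ :=
    ⟨min (p - q₀ - δ * q₀) (q₁ - p - δ * q₁), lt_min (by linarith) (by linarith),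
      min_le_left _ _, min_le_right _ _⟩
  set Z : ℝ≥0∞ := ∑' b : ℤ, two (-(δ * |(b : ℝ)|)) with hZ
  have hZt : Z ≠ ⊤ := tsum_two_neg_abs_ne_top hδ
  have hZ0 : Z ≠ 0 := by
    have : two (-(δ * |((0 : ℤ) : ℝ)|)) ≤ Z := ENNReal.le_tsum (0 : ℤ)
    have h := two_pos (-(δ * |((0 : ℤ) : ℝ)|))
    exact (h.trans_le this).ne'
  set Z' : ℝ≥0∞ := ∑' b : ℤ, two (-(s * |(b : ℝ)|)) with hZ'
  have hZ't : Z' ≠ ⊤ := tsum_two_neg_abs_ne_top hs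
  refine ⟨two p * (Z ^ q₀ + Z ^ q₁) * Z', ?_, ?_⟩
  · refine ENNReal.mul_ne_top (ENNReal.mul_ne_top (two_ne_top _) (ENNReal.add_ne_top.2 ⟨?_, ?_⟩))
      hZ't
    · exact ENNReal.rpow_ne_top_of_nonneg h0.le hZt
    · exact ENNReal.rpow_ne_top_of_nonneg hq1.le hZt
  intro α _ μ g e A hg hg0 hg1
  set W : α → ℝ≥0∞ := fun x => ∑' i : ℤ, two i * g i x with hW
  have hWm : Measurable W := Measurable.tsum fun i => (hg i).const_mul _
  have key : ∀ a i : ℤ, two ((a + 1) * p) *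
      μ {x | Z⁻¹ * two (a - δ * |((i - a : ℤ) : ℝ)|) < two i * g i x} ≤
      two p * (Z ^ q₀ + Z ^ q₁) * A * (two (i * p) * e i) *
        two (-(s * |((i - a : ℤ) : ℝ)|)) := by
    intro a i
    have gen : ∀ q : ℝ, 0 < q → ∫⁻ x, g i x ^ q ∂μ ≤ A * e i →
        Z ^ q ≤ Z ^ q₀ + Z ^ q₁ →
        (a : ℝ) * p + (((i - a : ℤ) : ℝ) + δ * |((i - a : ℤ) : ℝ)|) * q ≤
          i * p - s * |((i - a : ℤ) : ℝ)| →
        two ((a + 1) * p) * μ {x | Z⁻¹ * two (a - δ * |((i - a : ℤ) : ℝ)|) < two i * g i x} ≤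
      two p * (Z ^ q₀ + Z ^ q₁) * A * (two (i * p) * e i) *
        two (-(s * |((i - a : ℤ) : ℝ)|)) := by
      intro q hq hgq hZq hexp
      have h1 := meas_lt_le_rpow (μ := μ) hq ((hg i).const_mul (two i))
        (t := Z⁻¹ * two (a - δ * |((i - a : ℤ) : ℝ)|))
        (mul_ne_zero (ENNReal.inv_ne_zero.2 hZt) (two_pos _).ne')
        (ENNReal.mul_ne_top (ENNReal.inv_ne_top.2 hZ0) (two_ne_top _))
      have h2 : ∫⁻ x, (two i * g i x) ^ q ∂μ = two (i * q) * ∫⁻ x, g i x ^ q ∂μ := by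
        rw [← lintegral_const_mul _ ((hg i).pow_const q)]
        refine lintegral_congr fun x => ?_
        rw [ENNReal.mul_rpow_of_nonneg _ _ hq.le, two_rpow]
      have h3 : (Z⁻¹ * two (a - δ * |((i - a : ℤ) : ℝ)|))⁻¹ ^ q =
          Z ^ q * two (-(a - δ * |((i - a : ℤ) : ℝ)|) * q) := by
        rw [ENNReal.mul_inv (Or.inr (two_ne_top _)) (Or.inr (two_pos _).ne'), inv_inv,
          ENNReal.mul_rpow_of_nonneg _ _ hq.le, ← two_neg, two_rpow]
      rw [h2, h3] at h1
      calc _ ≤ two ((a + 1) * p) * (Z ^ q * two (-(a - δ * |((i - a : ℤ) : ℝ)|) * q) *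
            (two (i * q) * (A * e i))) := by
            gcongr
            exact h1.trans (by gcongr)
        _ = Z ^ q * A * e i * (two ((a + 1) * p) * two (-(a - δ * |((i - a : ℤ) : ℝ)|) * q) *
            two (i * q)) := by ring
        _ ≤ (Z ^ q₀ + Z ^ q₁) * A * e i * (two p * two (i * p) *
            two (-(s * |((i - a : ℤ) : ℝ)|))) := by
            refine mul_le_mul' (mul_le_mul' (mul_le_mul' hZq le_rfl) le_rfl) ?_
            rw [← two_add, ← two_add, ← two_add, ← two_add]
            refine two_mono ?_
            push_cast at hexp ⊢
            linarith
        _ = _ := by ring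
    rcases le_total a i with hai | hai
    · refine gen q₀ h0 (hg0 i) le_self_add ?_
      have hb : (0 : ℝ) ≤ ((i - a : ℤ) : ℝ) := by exact_mod_cast sub_nonneg.2 hai
      rw [abs_of_nonneg hb]
      push_cast at hb ⊢
      nlinarith
    · refine gen q₁ hq1 (hg1 i) le_add_self ?_
      have hb : ((i - a : ℤ) : ℝ) ≤ 0 := by exact_mod_cast sub_nonpos.2 hai
      rw [abs_of_nonpos hb]
      push_cast at hb ⊢
      nlinarith
  have hsub : ∀ a : ℤ, {x | two a < W x} ⊆
      ⋃ i : ℤ, {x | Z⁻¹ * two (a - δ * |((i - a : ℤ) : ℝ)|) < two i * g i x} := by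
    intro a x hx
    by_contra hcon
    simp only [mem_iUnion, mem_ofPred_eq, not_exists, not_lt] at hcon hx
    refine absurd hx (not_lt.2 ?_)
    calc W x ≤ ∑' i : ℤ, Z⁻¹ * two (a - δ * |((i - a : ℤ) : ℝ)|) := ENNReal.tsum_le_tsum hcon
      _ = ∑' i : ℤ, Z⁻¹ * two a * two (-(δ * |((i - a : ℤ) : ℝ)|)) := by
          congr 1 with i
          rw [mul_assoc, ← two_add, ← sub_eq_add_neg]
      _ = Z⁻¹ * two a * Z := by
          rw [ENNReal.tsum_mul_left, hZ]
          congr 1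
          exact (Equiv.subRight a).tsum_eq (fun b : ℤ => two (-(δ * |(b : ℝ)|)))
      _ = two a := by
          rw [mul_right_comm, ENNReal.inv_mul_cancel hZ0 hZt, one_mul]
  calc ∫⁻ x, W x ^ p ∂μ ≤ ∑' a : ℤ, two ((a + 1) * p) * μ {x | two a < W x} :=
        lintegral_rpow_le_tsum_dyadic hp hWm
    _ ≤ ∑' a : ℤ, ∑' i : ℤ, two p * (Z ^ q₀ + Z ^ q₁) * A * (two (i * p) * e i) *
        two (-(s * |((i - a : ℤ) : ℝ)|)) := by
        refine ENNReal.tsum_le_tsum fun a => ?_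
        refine le_trans ?_ (ENNReal.tsum_le_tsum fun i => key a i)
        rw [ENNReal.tsum_mul_left]
        gcongr
        exact (measure_mono (hsub a)).trans (measure_iUnion_le _)
    _ = ∑' i : ℤ, ∑' a : ℤ, two p * (Z ^ q₀ + Z ^ q₁) * A * (two (i * p) * e i) *
        two (-(s * |((i - a : ℤ) : ℝ)|)) := ENNReal.tsum_comm
    _ = ∑' i : ℤ, two p * (Z ^ q₀ + Z ^ q₁) * A * (two (i * p) * e i) * Z' := by
        congr 1 with i
        rw [ENNReal.tsum_mul_left]
        congr 1
        exact (Equiv.subLeft i).tsum_eq (fun b : ℤ => two (-(s * |(b : ℝ)|)))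
    _ = two p * (Z ^ q₀ + Z ^ q₁) * Z' * A * ∑' i : ℤ, two (i * p) * e i := by
        rw [← ENNReal.tsum_mul_left]
        congr 1 with i
        ring

end ENNRealTools

section Variation

lemma le_variation {r : ℝ} {𝒦 : Set ℝ} {a : ℝ → ℂ} {J : ℕ} {u : Fin (J + 1) → ℝ}
    (hu : StrictMono u) (hm : ∀ i, u i ∈ 𝒦) :
    (∑ i : Fin J, ‖a (u i.succ) - a (u i.castSucc)‖ₑ ^ r) ^ (1 / r) ≤ variation r 𝒦 a := by
  unfold variation
  exact le_iSup_of_le J (le_iSup_of_le u (le_iSup_of_le hu (le_iSup_of_le hm le_rfl)))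

lemma variation_le {r : ℝ} {𝒦 : Set ℝ} {a : ℝ → ℂ} {B : ℝ≥0∞}
    (h : ∀ (J : ℕ) (u : Fin (J + 1) → ℝ), StrictMono u → (∀ i, u i ∈ 𝒦) →
      (∑ i : Fin J, ‖a (u i.succ) - a (u i.castSucc)‖ₑ ^ r) ^ (1 / r) ≤ B) :
    variation r 𝒦 a ≤ B := by
  unfold variation
  exact iSup_le fun J => iSup_le fun u => iSup_le fun hu => iSup_le fun hm => h J u hu hm

lemma variation_comp_le {r : ℝ} {𝒦 𝒦' : Set ℝ} {a : ℝ → ℂ} {c : ℝ} (hc : 0 < c)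
    (h : ∀ u ∈ 𝒦, c⁻¹ * u ∈ 𝒦') : variation r 𝒦 a ≤ variation r 𝒦' fun v => a (c * v) := by
  refine variation_le fun J u hu hm => ?_
  have h1 : ∀ x, c * (c⁻¹ * x) = x := fun x => by field_simp
  have := le_variation (r := r) (𝒦 := 𝒦') (a := fun v => a (c * v)) (u := fun i => c⁻¹ * u i)
    (fun i j hij => mul_lt_mul_of_pos_left (hu hij) (by positivity)) (fun i => h _ (hm i))
  simpa only [h1] using this

lemma enorm_le_tsum_of_hasSum {ι : Type*} {a : ι → ℂ} {b : ℂ} (h : HasSum a b) :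
    ‖b‖ₑ ≤ ∑' i, ‖a i‖ₑ :=
  le_of_tendsto h.enorm (Eventually.of_forall fun s =>
    (enorm_sum_le s a).trans (ENNReal.sum_le_tsum s))

/-- Countable subadditivity of the variation. -/
lemma variation_le_tsum {ι : Type*} [Countable ι] {r : ℝ} (hr : 1 ≤ r) {𝒦 : Set ℝ}
    {a : ι → ℝ → ℂ} {b : ℝ → ℂ} (h : ∀ u ∈ 𝒦, HasSum (fun i => a i u) (b u)) :
    variation r 𝒦 b ≤ ∑' i, variation r 𝒦 (a i) := by
  refine variation_le fun J u hu hm => ?_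
  calc (∑ j : Fin J, ‖b (u j.succ) - b (u j.castSucc)‖ₑ ^ r) ^ (1 / r)
      ≤ (∑ j : Fin J, (∑' i, ‖a i (u j.succ) - a i (u j.castSucc)‖ₑ) ^ r) ^ (1 / r) := by
        gcongr with j
        exact enorm_le_tsum_of_hasSum ((h _ (hm _)).sub (h _ (hm _)))
    _ ≤ ∑' i, (∑ j : Fin J, ‖a i (u j.succ) - a i (u j.castSucc)‖ₑ ^ r) ^ (1 / r) := by
        have := tsum_tsum_rpow_le hr (fun (j : Fin J) i => ‖a i (u j.succ) - a i (u j.castSucc)‖ₑ)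
        simpa only [tsum_fintype] using this
    _ ≤ _ := ENNReal.tsum_le_tsum fun i => le_variation hu hm

lemma variation_const_mul {r : ℝ} (hr : 0 < r) {𝒦 : Set ℝ} (c : ℂ) (a : ℝ → ℂ) :
    variation r 𝒦 (fun u => c * a u) ≤ ‖c‖ₑ * variation r 𝒦 a := by
  refine variation_le fun J u hu hm => ?_
  refine le_trans (le_of_eq ?_) (mul_le_mul_right (le_variation (r := r) hu hm) ‖c‖ₑ)
  simp_rw [← mul_sub, enorm_mul, ENNReal.mul_rpow_of_nonneg _ _ hr.le, ← Finset.mul_sum]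
  rw [ENNReal.mul_rpow_of_nonneg _ _ (by positivity), ← ENNReal.rpow_mul,
    mul_one_div_cancel hr.ne', ENNReal.rpow_one]

lemma variation_two_sq_ge {𝒦 : Set ℝ} {a : ℝ → ℂ} {J : ℕ} {u : Fin (J + 1) → ℝ}
    (hu : StrictMono u) (hm : ∀ i, u i ∈ 𝒦) :
    ∑ i : Fin J, ‖a (u i.succ) - a (u i.castSucc)‖ₑ ^ (2 : ℝ) ≤ variation 2 𝒦 a ^ (2 : ℝ) := by
  have := ENNReal.rpow_le_rpow (le_variation (r := 2) (a := a) hu hm) (z := 2) (by norm_num)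
  rwa [← ENNReal.rpow_mul, one_div_mul_cancel (by norm_num), ENNReal.rpow_one] at this

lemma enorm_sub_le_variation_two {𝒦 : Set ℝ} {a : ℝ → ℂ} {u v : ℝ} (hu : u ∈ 𝒦) (hv : v ∈ 𝒦) :
    ‖a u - a v‖ₑ ≤ variation 2 𝒦 a := by
  wlog huv : v < u generalizing u v
  · rcases eq_or_lt_of_le (not_lt.1 huv) with h | h
    · simp [h]
    · rw [enorm_sub_rev]; exact this hv hu h
  have := le_variation (r := 2) (a := a) (𝒦 := 𝒦) (J := 1) (u := ![v, u])
    (by intro i j hij; fin_cases i <;> fin_cases j <;> simp_all)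
    (by intro i; fin_cases i <;> simp [hu, hv])
  simp only [Finset.univ_unique, Finset.sum_singleton] at this
  rw [← ENNReal.rpow_mul, mul_one_div_cancel (by norm_num), ENNReal.rpow_one] at this
  simpa using this

lemma variation_rpow_le {r : ℝ} (hr : 2 < r) {𝒦 : Set ℝ} {a : ℝ → ℂ} {D : ℝ≥0∞}
    (hD : ∀ u ∈ 𝒦, ∀ v ∈ 𝒦, ‖a u - a v‖ₑ ≤ D) :
    variation r 𝒦 a ^ r ≤ D ^ (r - 2) * variation 2 𝒦 a ^ (2 : ℝ) := by
  have hr0 : 0 < r := by linarith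
  have : variation r 𝒦 a ≤ (D ^ (r - 2) * variation 2 𝒦 a ^ (2 : ℝ)) ^ (1 / r) := by
    refine variation_le fun J u hu hm => ?_
    gcongr
    refine le_trans ?_ (mul_le_mul_right (variation_two_sq_ge hu hm) _)
    rw [Finset.mul_sum]
    refine Finset.sum_le_sum fun i _ => ?_
    calc ‖a (u i.succ) - a (u i.castSucc)‖ₑ ^ r
        = ‖a (u i.succ) - a (u i.castSucc)‖ₑ ^ (r - 2) *
          ‖a (u i.succ) - a (u i.castSucc)‖ₑ ^ (2 : ℝ) := by
          rw [← ENNReal.rpow_add_of_nonneg _ _ (by linarith) (by norm_num)]; congr 1; ring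
      _ ≤ _ := by
          refine mul_le_mul' (ENNReal.rpow_le_rpow (hD _ (hm _) _ (hm _)) (by linarith)) le_rfl
  calc _ ≤ ((D ^ (r - 2) * variation 2 𝒦 a ^ (2 : ℝ)) ^ (1 / r)) ^ r := by gcongr
    _ = _ := by rw [← ENNReal.rpow_mul, one_div_mul_cancel hr0.ne', ENNReal.rpow_one]

lemma tsum_variation_rpow_le {ι : Type*} {r : ℝ} (hr : 2 < r) {𝒦 : Set ℝ} {a : ι → ℝ → ℂ}
    {D T : ℝ≥0∞} (hD : ∀ k, ∀ u ∈ 𝒦, ∀ v ∈ 𝒦, ‖a k u - a k v‖ₑ ≤ D)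
    (hT : ∑' k, variation 2 𝒦 (a k) ^ (2 : ℝ) ≤ T ^ (2 : ℝ)) :
    (∑' k, variation r 𝒦 (a k) ^ r) ^ (1 / r) ≤ min D T ^ (1 - 2 / r) * T ^ (2 / r) := by
  have hr0 : 0 < r := by linarith
  have hD' : ∀ k, ∀ u ∈ 𝒦, ∀ v ∈ 𝒦, ‖a k u - a k v‖ₑ ≤ min D T := by
    intro k u hu v hv
    refine le_min (hD k u hu v hv) ?_
    have h1 : variation 2 𝒦 (a k) ^ (2 : ℝ) ≤ T ^ (2 : ℝ) := (ENNReal.le_tsum k).trans hT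
    exact (enorm_sub_le_variation_two hu hv).trans
      ((ENNReal.rpow_le_rpow_iff (by norm_num)).1 h1)
  calc (∑' k, variation r 𝒦 (a k) ^ r) ^ (1 / r)
      ≤ (∑' k, min D T ^ (r - 2) * variation 2 𝒦 (a k) ^ (2 : ℝ)) ^ (1 / r) := by
        gcongr with k
        exact variation_rpow_le hr (hD' k)
    _ ≤ (min D T ^ (r - 2) * T ^ (2 : ℝ)) ^ (1 / r) := by
        rw [ENNReal.tsum_mul_left]; gcongr
    _ = _ := by
        rw [ENNReal.mul_rpow_of_nonneg _ _ (by positivity), ← ENNReal.rpow_mul,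
          ← ENNReal.rpow_mul]
        congr 2 <;> field_simp

lemma sum_fin_sub (f : ℕ → ℝ) (J : ℕ) :
    ∑ i : Fin J, (f (i + 1) - f i) = f J - f 0 := by
  rw [Fin.sum_univ_eq_sum_range (fun i => f (i + 1) - f i), Finset.sum_range_sub]

lemma sq_sub_le_of_hasDerivAt {F G : ℝ → ℂ} {lam a b : ℝ} (hlam : 0 < lam) (hab : a ≤ b)
    (h1 : b - a ≤ 1)
    (hF : ∀ v, HasDerivAt F (Complex.I * lam * G v) v) (hG : Continuous G) :
    ‖F b - F a‖ ^ 2 ≤ 8 * lam * ∫ v in a..b, (‖F v‖ ^ 2 + ‖G v‖ ^ 2) := by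
  have hFc : Continuous F := continuous_iff_continuousAt.2 fun v => (hF v).continuousAt
  have hI0 : 0 ≤ ∫ v in a..b, ‖F v‖ ^ 2 :=
    intervalIntegral.integral_nonneg hab fun v _ => by positivity
  have hI1 : 0 ≤ ∫ v in a..b, ‖G v‖ ^ 2 :=
    intervalIntegral.integral_nonneg hab fun v _ => by positivity
  have hadd : ∫ v in a..b, (‖F v‖ ^ 2 + ‖G v‖ ^ 2) =
      (∫ v in a..b, ‖F v‖ ^ 2) + ∫ v in a..b, ‖G v‖ ^ 2 :=
    intervalIntegral.integral_add
      ((by fun_prop : Continuous fun v => ‖F v‖ ^ 2).intervalIntegrable _ _)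
      ((by fun_prop : Continuous fun v => ‖G v‖ ^ 2).intervalIntegrable _ _)
  set I0 := ∫ v in a..b, ‖F v‖ ^ 2
  set I1 := ∫ v in a..b, ‖G v‖ ^ 2
  rw [hadd]
  by_cases hsm : lam * (b - a) ≤ 1
  · have e1 : F b - F a = ∫ v in a..b, Complex.I * lam * G v :=
      (intervalIntegral.integral_eq_sub_of_hasDerivAt (fun v _ => hF v)
        ((by fun_prop : Continuous fun v => Complex.I * lam * G v).intervalIntegrable _ _)).symm
    have e2 : ‖F b - F a‖ ≤ lam * ∫ v in a..b, ‖G v‖ := by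
      rw [e1, ← intervalIntegral.integral_const_mul]
      refine (intervalIntegral.norm_integral_le_integral_norm hab).trans (le_of_eq ?_)
      congr 1 with v
      simp [abs_of_pos hlam]
    have e3 : (∫ v in a..b, ‖G v‖) ^ 2 ≤ (b - a) * I1 := by
      have hq : ∀ t : ℝ, 0 ≤ I1 - 2 * t * (∫ v in a..b, ‖G v‖) + t ^ 2 * (b - a) := by
        intro t
        have : ∫ v in a..b, (‖G v‖ - t) ^ 2 =
            I1 - 2 * t * (∫ v in a..b, ‖G v‖) + t ^ 2 * (b - a) := by
          have e : ∀ v, (‖G v‖ - t) ^ 2 = ‖G v‖ ^ 2 - 2 * t * ‖G v‖ + t ^ 2 := fun v => by ring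
          simp_rw [e]
          rw [intervalIntegral.integral_add, intervalIntegral.integral_sub,
            intervalIntegral.integral_const_mul, intervalIntegral.integral_const]
          · simp [mul_comm]; rfl
          all_goals exact (by fun_prop : Continuous _).intervalIntegrable _ _
        rw [← this]
        exact intervalIntegral.integral_nonneg hab fun v _ => by positivity
      rcases eq_or_lt_of_le hab with rfl | hlt
      · simp
      · have h := hq ((∫ v in a..b, ‖G v‖) / (b - a))
        have hp : 0 < b - a := sub_pos.2 hlt
        field_simp at h
        nlinarith
    have e4 : 0 ≤ ∫ v in a..b, ‖G v‖ :=
      intervalIntegral.integral_nonneg hab fun v _ => by positivity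
    calc ‖F b - F a‖ ^ 2 ≤ (lam * ∫ v in a..b, ‖G v‖) ^ 2 := by gcongr
      _ ≤ lam * (lam * (b - a)) * I1 := by rw [mul_pow]; nlinarith [sq_nonneg lam]
      _ ≤ lam * 1 * I1 := by gcongr
      _ ≤ _ := by nlinarith
  · push Not at hsm
    have hbd : ∀ c ∈ Icc a b, ∀ d ∈ Icc a b, c ≤ d →
        |‖F d‖ ^ 2 - ‖F c‖ ^ 2| ≤ lam * (I0 + I1) := by
      intro c hc d hd hcd
      have hder : ∀ v, HasDerivAt (fun v => ‖F v‖ ^ 2)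
          (2 * inner ℝ (F v) (Complex.I * lam * G v)) v := fun v => (hF v).norm_sq
      have hcont : Continuous fun v => 2 * inner ℝ (F v) (Complex.I * lam * G v) := by fun_prop
      rw [← intervalIntegral.integral_eq_sub_of_hasDerivAt (fun v _ => hder v)
        (hcont.intervalIntegrable _ _)]
      refine (intervalIntegral.abs_integral_le_integral_abs hcd).trans ?_
      rw [← hadd, ← intervalIntegral.integral_const_mul]
      refine (intervalIntegral.integral_mono_on hcd (g := fun v => lam * (‖F v‖ ^ 2 + ‖G v‖ ^ 2))
        ((by fun_prop : Continuous _).intervalIntegrable _ _)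
        ((by fun_prop : Continuous _).intervalIntegrable _ _) ?_).trans ?_
      · intro v _
        rw [abs_mul, abs_two]
        have := abs_real_inner_le_norm (F v) (Complex.I * lam * G v)
        have e : ‖Complex.I * lam * G v‖ = lam * ‖G v‖ := by simp [abs_of_pos hlam]
        rw [e] at this
        nlinarith [sq_nonneg (‖F v‖ - ‖G v‖)]
      · refine intervalIntegral.integral_mono_interval hc.1 hcd hd.2 ?_
          ((by fun_prop : Continuous _).intervalIntegrable _ _)
        exact Eventually.of_forall fun v => by positivity
    obtain ⟨c, hc, hmin⟩ := isCompact_Icc.exists_isMinOn (nonempty_Icc.2 hab)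
      (by fun_prop : ContinuousOn (fun v => ‖F v‖ ^ 2) (Icc a b))
    have hc0 : ‖F c‖ ^ 2 ≤ lam * I0 := by
      have h2 : (b - a) * ‖F c‖ ^ 2 ≤ I0 := by
        have := intervalIntegral.integral_mono_on (μ := volume) hab (f := fun _ => ‖F c‖ ^ 2)
          (g := fun v => ‖F v‖ ^ 2) (continuous_const.intervalIntegrable _ _)
          ((by fun_prop : Continuous _).intervalIntegrable _ _) (fun v hv => hmin hv)
        simpa using this
      calc ‖F c‖ ^ 2 ≤ (lam * (b - a)) * ‖F c‖ ^ 2 := by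
            nlinarith [sq_nonneg ‖F c‖]
        _ = lam * ((b - a) * ‖F c‖ ^ 2) := by ring
        _ ≤ _ := by gcongr
    have hb := hbd c hc b ⟨hab, le_rfl⟩ hc.2
    have ha := hbd a ⟨le_rfl, hab⟩ c hc hc.1
    rw [abs_le] at ha hb
    have h3 : ‖F b - F a‖ ^ 2 ≤ 2 * ‖F b‖ ^ 2 + 2 * ‖F a‖ ^ 2 := by
      have := norm_sub_le (F b) (F a)
      nlinarith [sq_nonneg (‖F b‖ - ‖F a‖), norm_nonneg (F b - F a)]
    nlinarith [mul_nonneg hlam.le hI1]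

lemma variation_two_sq_le {F G : ℝ → ℂ} {lam : ℝ} (hlam : 0 < lam)
    (hF : ∀ v, HasDerivAt F (Complex.I * lam * G v) v) (hG : Continuous G) :
    variation 2 (Icc 1 2) F ^ (2 : ℝ) ≤ ENNReal.ofReal (8 * lam) *
      ((∫⁻ v in Icc (1 : ℝ) 2, ‖F v‖ₑ ^ 2) + ∫⁻ v in Icc (1 : ℝ) 2, ‖G v‖ₑ ^ 2) := by
  have hFc : Continuous F := continuous_iff_continuousAt.2 fun v => (hF v).continuousAt
  set h : ℝ → ℝ := fun v => ‖F v‖ ^ 2 + ‖G v‖ ^ 2 with hh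
  have hhc : Continuous h := by fun_prop
  have hii : ∀ a b, IntervalIntegrable h volume a b := fun a b => hhc.intervalIntegrable a b
  have e : (∫⁻ v in Icc (1 : ℝ) 2, ‖F v‖ₑ ^ 2) + ∫⁻ v in Icc (1 : ℝ) 2, ‖G v‖ₑ ^ 2 =
      ENNReal.ofReal (∫ v in (1 : ℝ)..2, h v) := by
    rw [← lintegral_add_left (by fun_prop), intervalIntegral.integral_of_le (by norm_num),
      ← integral_Icc_eq_integral_Ioc, ofReal_integral_eq_lintegral_ofReal]
    · refine lintegral_congr fun v => ?_
      rw [hh, ENNReal.ofReal_add (by positivity) (by positivity), ← enorm_norm (F v),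
        ← enorm_norm (G v), Real.enorm_of_nonneg (norm_nonneg _),
        Real.enorm_of_nonneg (norm_nonneg _), ENNReal.ofReal_pow (norm_nonneg _),
        ENNReal.ofReal_pow (norm_nonneg _)]
    · exact hhc.continuousOn.integrableOn_Icc
    · exact Eventually.of_forall fun v => by simp only [hh]; positivity
  rw [e, ← ENNReal.ofReal_mul (by positivity)]
  have : variation 2 (Icc 1 2) F ≤
      ENNReal.ofReal (8 * lam * ∫ v in (1 : ℝ)..2, h v) ^ (1 / (2 : ℝ)) := by
    refine variation_le fun J u hu hm => ?_
    gcongr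
    set w : ℕ → ℝ := fun i => ∫ v in (1 : ℝ)..(u (Fin.ofNat (J + 1) i)), h v with hw
    have step : ∀ i : Fin J, ‖F (u i.succ) - F (u i.castSucc)‖ₑ ^ (2 : ℝ) ≤
        ENNReal.ofReal (8 * lam * (w (i + 1) - w i)) := by
      intro i
      have h1 : Fin.ofNat (J + 1) (i + 1 : ℕ) = i.succ := by ext; simp
      have h2 : Fin.ofNat (J + 1) (i : ℕ) = i.castSucc := by
        ext; simp
      rw [hw]
      dsimp only
      rw [h1, h2, intervalIntegral.integral_interval_sub_left (hii _ _) (hii _ _),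
        ← enorm_norm, Real.enorm_of_nonneg (norm_nonneg _), ENNReal.rpow_ofNat,
        ← ENNReal.ofReal_pow (norm_nonneg _)]
      refine ENNReal.ofReal_le_ofReal (sq_sub_le_of_hasDerivAt hlam
        (hu (Fin.castSucc_lt_succ)).le ?_ hF hG)
      have := (hm i.succ).2
      have := (hm i.castSucc).1
      linarith
    have hwmono : ∀ i : Fin J, 0 ≤ 8 * lam * (w (i + 1) - w i) := by
      intro i
      have h1 : Fin.ofNat (J + 1) (i + 1 : ℕ) = i.succ := by ext; simp
      have h2 : Fin.ofNat (J + 1) (i : ℕ) = i.castSucc := by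
        ext; simp
      rw [hw]
      dsimp only
      rw [h1, h2, intervalIntegral.integral_interval_sub_left (hii _ _) (hii _ _)]
      refine mul_nonneg (by positivity) (intervalIntegral.integral_nonneg
        (hu (Fin.castSucc_lt_succ)).le fun v _ => by simp only [hh]; positivity)
    calc _ ≤ ∑ i : Fin J, ENNReal.ofReal (8 * lam * (w (i + 1) - w i)) :=
          Finset.sum_le_sum fun i _ => step i
      _ = ENNReal.ofReal (8 * lam * (w J - w 0)) := by
          rw [← ENNReal.ofReal_sum_of_nonneg fun i _ => hwmono i, ← Finset.mul_sum, sum_fin_sub]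
      _ ≤ _ := by
          refine ENNReal.ofReal_le_ofReal ?_
          gcongr
          have h0 : 0 ≤ w 0 := intervalIntegral.integral_nonneg (hm _).1
            fun v _ => by simp only [hh]; positivity
          have h1 : w J ≤ ∫ v in (1 : ℝ)..2, h v :=
            intervalIntegral.integral_mono_interval le_rfl (hm _).1 (hm _).2
              (Eventually.of_forall fun v => by simp only [hh]; positivity) (hii _ _)
          linarith
  calc _ ≤ (ENNReal.ofReal (8 * lam * ∫ v in (1 : ℝ)..2, h v) ^ (1 / (2 : ℝ))) ^ (2 : ℝ) := by
        gcongr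
    _ = _ := by
        rw [← ENNReal.rpow_mul, one_div_mul_cancel (by norm_num), ENNReal.rpow_one]

end Variation

section Dyadic

variable {n : ℕ}

/-- The index of the dyadic cube of side `2 ^ (-m)` containing `x`. -/
def idx (m : ℤ) (x : Rn n) : Fin n → ℤ := fun i => ⌊(2 : ℝ) ^ m * x i⌋

/-- The dyadic cube of side `2 ^ (-m)` with index `a`. -/
def cube (m : ℤ) (a : Fin n → ℤ) : Set (Rn n) := {x | idx m x = a}

/-- The volume of a dyadic cube of side `2 ^ (-m)`. -/
def cvol (n : ℕ) (m : ℤ) : ℝ≥0∞ := two (-(m * n))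

lemma mem_cube_idx (m : ℤ) (x : Rn n) : x ∈ cube m (idx m x) := rfl

lemma measurable_idx (m : ℤ) : Measurable (idx m : Rn n → Fin n → ℤ) :=
  measurable_pi_lambda _ fun i => by unfold idx; fun_prop

lemma measurableSet_cube (m : ℤ) (a : Fin n → ℤ) : MeasurableSet (cube m a) :=
  measurable_idx m (measurableSet_singleton a)

lemma cvol_pos (m : ℤ) : cvol n m ≠ 0 := (two_pos _).ne'
lemma cvol_ne_top (m : ℤ) : cvol n m ≠ ⊤ := two_ne_top _

lemma cvol_sub_one (m : ℤ) : cvol n (m - 1) = two n * cvol n m := by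
  unfold cvol
  rw [← two_add]
  congr 1
  push_cast
  ring

lemma mem_cube_iff {m : ℤ} {a : Fin n → ℤ} {x : Rn n} :
    x ∈ cube m a ↔ ∀ i, (a i : ℝ) * 2 ^ (-m) ≤ x i ∧ x i < (a i + 1) * 2 ^ (-m) := by
  have h2 : (0 : ℝ) < 2 ^ m := by positivity
  simp only [cube, idx, mem_ofPred_eq, funext_iff, Int.floor_eq_iff, zpow_neg, ← div_eq_mul_inv,
    div_le_iff₀ h2, lt_div_iff₀ h2, mul_comm]

lemma volume_cube (m : ℤ) (a : Fin n → ℤ) : volume (cube m a) = cvol n m := by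
  have h : cube m a = (MeasurableEquiv.toLp 2 (Fin n → ℝ)).symm ⁻¹'
      (Set.pi univ fun i => Ico ((a i : ℝ) * 2 ^ (-m)) ((a i + 1) * 2 ^ (-m))) := by
    ext x
    rw [mem_cube_iff]
    simp
  rw [h, (EuclideanSpace.volume_preserving_symm_measurableEquiv_toLp (Fin n)).measure_preimage
    (MeasurableSet.univ_pi fun i => measurableSet_Ico).nullMeasurableSet, volume_pi_pi]
  have : ∀ i, volume (Ico ((a i : ℝ) * 2 ^ (-m)) ((a i + 1) * 2 ^ (-m))) = two (-m) := by
    intro i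
    rw [Real.volume_Ico, two_eq_ofReal]
    congr 1
    rw [← Int.cast_neg, Real.rpow_intCast]
    ring
  simp only [this, Finset.prod_const, Finset.card_univ, Fintype.card_fin, cvol]
  rw [← ENNReal.rpow_natCast, two_rpow]
  congr 1
  ring

lemma idx_eq_of_le {m m' : ℤ} (h : m ≤ m') {x y : Rn n} (hxy : idx m' x = idx m' y) :
    idx m x = idx m y := by
  obtain ⟨k, rfl⟩ : ∃ k : ℕ, m' = m + k := ⟨(m' - m).toNat, by omega⟩
  have key : ∀ z : Rn n, ∀ i, idx m z i = idx (m + k) z i / ((2 ^ k : ℕ) : ℤ) := by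
    intro z i
    unfold idx
    rw [← Int.floor_div_natCast]
    congr 1
    rw [zpow_add₀ (by norm_num), zpow_natCast]
    push_cast
    field_simp
  ext i
  rw [key, key, hxy]

lemma cube_subset {m m' : ℤ} (h : m ≤ m') (x : Rn n) :
    cube m' (idx m' x) ⊆ cube m (idx m x) := fun _ hy => idx_eq_of_le h hy

lemma norm_sub_le_of_mem_cube {m : ℤ} {a : Fin n → ℤ} {x y : Rn n} (hx : x ∈ cube m a)
    (hy : y ∈ cube m a) : ‖x - y‖ ≤ n * 2 ^ (-m) := by
  rw [mem_cube_iff] at hx hy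
  have h : ∀ i, ‖(x - y) i‖ ≤ (2 : ℝ) ^ (-m) := by
    intro i
    have := hx i
    have := hy i
    rw [PiLp.sub_apply, Real.norm_eq_abs, abs_le]
    constructor <;> nlinarith
  calc ‖x - y‖ ≤ ∑ i, ‖(x - y) i‖ := by
        rw [EuclideanSpace.norm_eq]
        refine Real.sqrt_le_iff.2 ⟨by positivity, ?_⟩
        exact Finset.sum_sq_le_sq_sum_of_nonneg fun i _ => norm_nonneg _
    _ ≤ ∑ i : Fin n, (2 : ℝ) ^ (-m) := Finset.sum_le_sum fun i _ => h i
    _ = _ := by simp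

/-- The points contained in a dyadic cube on which `h` has average greater than `α`. -/
def Om (h : Rn n → ℝ≥0∞) (α : ℝ≥0∞) : Set (Rn n) :=
  {x | ∃ m : ℤ, α * cvol n m < ∫⁻ y in cube m (idx m x), h y}

/-- The maximal dyadic cubes on which `h` has average greater than `α`. -/
def Stop (h : Rn n → ℝ≥0∞) (α : ℝ≥0∞) : Set (ℤ × (Fin n → ℤ)) :=
  {q | α * cvol n q.1 < ∫⁻ y in cube q.1 q.2, h y ∧
    ∀ m' < q.1, ∀ x ∈ cube q.1 q.2, ∫⁻ y in cube m' (idx m' x), h y ≤ α * cvol n m'}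

/-- The averages of `h` over all sufficiently large dyadic cubes are at most `α`. -/
def EvSmall (h : Rn n → ℝ≥0∞) (α : ℝ≥0∞) : Prop :=
  ∃ m₀ : ℤ, ∀ m ≤ m₀, ∀ x : Rn n, ∫⁻ y in cube m (idx m x), h y ≤ α * cvol n m

variable {h : Rn n → ℝ≥0∞} {α β : ℝ≥0∞}

lemma EvSmall.mono (hs : EvSmall h α) (hαβ : α ≤ β) : EvSmall h β := by
  obtain ⟨m₀, hm⟩ := hs
  exact ⟨m₀, fun m hmm x => (hm m hmm x).trans (by gcongr)⟩

lemma stop_eq {q q' : ℤ × (Fin n → ℤ)} (hq : q ∈ Stop h α) (hq' : q' ∈ Stop h α) {x : Rn n}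
    (hx : x ∈ cube q.1 q.2) (hx' : x ∈ cube q'.1 q'.2) : q = q' := by
  obtain ⟨m, a⟩ := q
  obtain ⟨m', a'⟩ := q'
  have e : idx m x = a := hx
  have e' : idx m' x = a' := hx'
  subst e; subst e'
  rcases lt_trichotomy m m' with hlt | rfl | hlt
  · exact absurd hq.1 (not_lt.2 (hq'.2 m hlt x hx'))
  · rfl
  · exact absurd hq'.1 (not_lt.2 (hq.2 m' hlt x hx))

lemma exists_stop_of_avg (hs : EvSmall h α) {x : Rn n} {m : ℤ}
    (hm : α * cvol n m < ∫⁻ y in cube m (idx m x), h y) :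
    ∃ q ∈ Stop h α, q.1 ≤ m ∧ x ∈ cube q.1 q.2 := by
  obtain ⟨m₀, hm₀⟩ := hs
  obtain ⟨k, hk, hmin⟩ := Int.exists_least_of_bdd
    (P := fun k => α * cvol n k < ∫⁻ y in cube k (idx k x), h y)
    ⟨m₀, fun k hk => by
      by_contra hcon
      exact absurd hk (not_lt.2 (hm₀ k (not_le.1 hcon).le x))⟩ ⟨m, hm⟩
  refine ⟨(k, idx k x), ⟨hk, fun m' hm' y hy => ?_⟩, hmin m hm, rfl⟩
  have : idx m' y = idx m' x := idx_eq_of_le hm'.le hy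
  rw [this]
  by_contra hcon
  exact absurd (hmin m' (not_le.1 hcon)) (not_le.2 hm')

lemma om_eq_iUnion (hs : EvSmall h α) : Om h α = ⋃ q : Stop h α, cube q.1.1 q.1.2 := by
  ext x
  simp only [mem_iUnion]
  constructor
  · rintro ⟨m, hm⟩
    obtain ⟨q, hq, -, hx⟩ := exists_stop_of_avg hs hm
    exact ⟨⟨q, hq⟩, hx⟩
  · rintro ⟨⟨⟨m, a⟩, hq⟩, hx⟩
    have e : idx m x = a := hx
    exact ⟨m, by rw [e]; exact hq.1⟩

lemma pairwise_disjoint_stop : Pairwise (Function.onFun Disjoint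
    fun q : Stop h α => (cube q.1.1 q.1.2 : Set (Rn n))) := by
  intro q q' hne
  refine Set.disjoint_left.2 fun x hx hx' => hne (Subtype.ext ?_)
  exact stop_eq q.2 q'.2 hx hx'

lemma measurableSet_om (hs : EvSmall h α) : MeasurableSet (Om h α) := by
  rw [om_eq_iUnion hs]
  exact MeasurableSet.iUnion fun q => measurableSet_cube _ _

lemma lintegral_om (hs : EvSmall h α) (f : Rn n → ℝ≥0∞) :
    ∫⁻ x in Om h α, f x = ∑' q : Stop h α, ∫⁻ x in cube q.1.1 q.1.2, f x := by
  rw [om_eq_iUnion hs, lintegral_iUnion (fun q => measurableSet_cube _ _) pairwise_disjoint_stop]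

lemma volume_om (hs : EvSmall h α) : volume (Om h α) = ∑' q : Stop h α, cvol n q.1.1 := by
  have := lintegral_om hs (fun _ => 1)
  simpa [volume_cube] using this

lemma mul_volume_om_le (hs : EvSmall h α) : α * volume (Om h α) ≤ ∫⁻ x in Om h α, h x := by
  rw [volume_om hs, lintegral_om hs, ← ENNReal.tsum_mul_left]
  exact ENNReal.tsum_le_tsum fun q => q.2.1.le

lemma mem_om_of_continuousAt {x : Rn n} (hc : ContinuousAt h x) (hx : α < h x) : x ∈ Om h α := by
  obtain ⟨β, hαβ, hβ⟩ := exists_between hx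
  have h1 : ∀ᶠ y in 𝓝 x, β < h y := hc.eventually (lt_mem_nhds hβ)
  obtain ⟨ε, hε, hball⟩ := Metric.eventually_nhds_iff.1 h1
  obtain ⟨N, hN⟩ : ∃ N : ℕ, n * (2 : ℝ) ^ (-(N : ℤ)) < ε := by
    have : Tendsto (fun N : ℕ => n * (2 : ℝ) ^ (-(N : ℤ))) atTop (𝓝 (n * 0)) := by
      refine Tendsto.const_mul _ ?_
      simp_rw [zpow_neg, zpow_natCast]
      exact tendsto_inv_atTop_zero.comp (tendsto_pow_atTop_atTop_of_one_lt (by norm_num))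
    rw [mul_zero] at this
    exact (this.eventually (gt_mem_nhds hε)).exists
  refine ⟨N, ?_⟩
  have hle : β * cvol n N ≤ ∫⁻ y in cube N (idx N x), h y := by
    rw [← volume_cube N (idx N x), ← setLIntegral_const]
    refine setLIntegral_mono' (measurableSet_cube _ _) fun y hy => (hball ?_).le
    rw [dist_eq_norm]
    exact (norm_sub_le_of_mem_cube hy (mem_cube_idx _ x)).trans_lt hN
  refine lt_of_lt_of_le ?_ hle
  exact (ENNReal.mul_lt_mul_iff_left (cvol_pos _) (cvol_ne_top _)).2 hαβ

lemma evSmall_of_sq (hm : AEMeasurable h) (h2 : ∫⁻ x, h x ^ (2 : ℝ) ≠ ⊤) (hn : n ≠ 0)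
    (hα : α ≠ 0) : EvSmall h α := by
  set I := ∫⁻ x, h x ^ (2 : ℝ) with hI
  have hlim : Tendsto (fun N : ℕ => two (-((N : ℝ) * n)) * I) atTop (𝓝 0) := by
    have h0 : Tendsto (fun N : ℕ => two (-((N : ℝ) * n))) atTop (𝓝 0) := by
      have e : ∀ N : ℕ, two (-((N : ℝ) * n)) = (two (-n)) ^ N := by
        intro N
        rw [← ENNReal.rpow_natCast, two_rpow]; congr 1; ring
      simp_rw [e]
      refine ENNReal.tendsto_pow_atTop_nhds_zero_of_lt_one ?_
      rw [two_eq_ofReal, ENNReal.ofReal_lt_one]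
      exact Real.rpow_lt_one_of_one_lt_of_neg (by norm_num)
        (by simp only [Left.neg_neg_iff, Nat.cast_pos]; omega)
    simpa using ENNReal.Tendsto.mul_const h0 (Or.inr h2)
  have hα2 : 0 < α ^ (2 : ℝ) ⊓ 1 := by
    simp only [lt_inf_iff, zero_lt_one, and_true]
    refine pos_iff_ne_zero.2 ?_
    simp [hα]
  obtain ⟨N, hN⟩ := (eventually_atTop.1 (hlim.eventually (gt_mem_nhds hα2)))
  refine ⟨-N, fun m hmN x => ?_⟩
  obtain ⟨k, rfl⟩ : ∃ k : ℕ, m = -k := ⟨(-m).toNat, by omega⟩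
  have hk := (hN k (by omega)).le.trans inf_le_left
  have hcv : cvol n (-(k : ℤ)) = (two (-((k : ℝ) * n)))⁻¹ := by
    rw [cvol, ← two_neg]; congr 1; push_cast; ring
  have hI2 : I ≤ α ^ (2 : ℝ) * cvol n (-(k : ℤ)) := by
    rw [hcv, ← ENNReal.div_eq_inv_mul.trans (mul_comm _ _), ENNReal.le_div_iff_mul_le
      (Or.inl (two_pos _).ne') (Or.inl (two_ne_top _)), mul_comm]
    exact hk
  have hCS := ENNReal.lintegral_mul_le_Lp_mul_Lq
    (volume.restrict (cube (-(k : ℤ)) (idx (-(k : ℤ)) x))) (Real.HolderConjugate.two_two)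
    hm.restrict (aemeasurable_const (b := (1 : ℝ≥0∞)))
  simp only [Pi.mul_apply, mul_one, ENNReal.one_rpow, lintegral_const, one_mul,
    Measure.restrict_apply_univ, volume_cube] at hCS
  refine hCS.trans ?_
  calc _ ≤ I ^ (1 / (2 : ℝ)) * cvol n (-(k : ℤ)) ^ (1 / (2 : ℝ)) := by
        gcongr
        exact setLIntegral_le_lintegral _ _
    _ ≤ (α ^ (2 : ℝ) * cvol n (-(k : ℤ))) ^ (1 / (2 : ℝ)) * cvol n (-(k : ℤ)) ^ (1 / (2 : ℝ)) := by
        gcongr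
    _ = _ := by
        rw [ENNReal.mul_rpow_of_nonneg _ _ (by norm_num), ← ENNReal.rpow_mul, mul_assoc,
          ← ENNReal.rpow_add _ _ (cvol_pos _) (cvol_ne_top _)]
        norm_num

end Dyadic

section JohnNirenberg

variable {n : ℕ} {g : Rn n → ℝ≥0∞} {A α : ℝ≥0∞}

/-- `g` has mean oscillation at most `A` over dyadic cubes. -/
def DyadicBMO (g : Rn n → ℝ≥0∞) (A : ℝ≥0∞) : Prop :=
  ∀ (m : ℤ) (x : Rn n), ∃ (c : ℝ≥0∞) (o : Rn n → ℝ≥0∞), Measurable o ∧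
    (∀ y ∈ cube m (idx m x), g y ≤ c + o y ∧ c ≤ g y + o y) ∧
    ∫⁻ y in cube m (idx m x), o y ≤ A * cvol n m

lemma om_anti {β : ℝ≥0∞} (h : α ≤ β) : Om g β ⊆ Om g α := by
  rintro x ⟨m, hm⟩
  exact ⟨m, lt_of_le_of_lt (by gcongr) hm⟩

lemma stop_inter {β : ℝ≥0∞} (hs : EvSmall g α) (h : α ≤ β) {q q' : ℤ × (Fin n → ℤ)}
    (hq : q ∈ Stop g α) (hq' : q' ∈ Stop g β) {x : Rn n} (hx : x ∈ cube q.1 q.2)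
    (hx' : x ∈ cube q'.1 q'.2) : (cube q'.1 q'.2 : Set (Rn n)) ⊆ cube q.1 q.2 := by
  obtain ⟨m', a'⟩ := q'
  have e' : idx m' x = a' := hx'
  subst e'
  obtain ⟨q'', hq'', hle, hx''⟩ := exists_stop_of_avg hs (x := x) (m := m')
    (lt_of_le_of_lt (by gcongr) hq'.1)
  obtain rfl := stop_eq hq hq'' hx hx''
  obtain ⟨m, a⟩ := q
  have e : idx m x = a := hx
  subst e
  exact cube_subset hle x

lemma john_nirenberg_step (hg : Measurable g) (hs : EvSmall g α) (hα : α ≠ ⊤) (hA : A ≠ 0)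
    (hA' : A ≠ ⊤) (hB : DyadicBMO g A) :
    2 * volume (Om g (α + (2 * two n + 1) * A)) ≤ volume (Om g α) := by
  set β := α + (2 * two n + 1) * A with hβ
  have hαβ : α ≤ β := le_self_add
  have hsβ := hs.mono hαβ
  have hmβ := measurableSet_om hsβ
  have hdec : volume (Om g β) = ∑' q : Stop g α, volume (Om g β ∩ cube q.1.1 q.1.2) := by
    have := lintegral_om hs ((Om g β).indicator 1)
    rw [lintegral_indicator_one hmβ, Measure.restrict_apply hmβ,
      inter_eq_left.2 (om_anti hαβ)] at this
    rw [this]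
    congr 1 with q
    rw [lintegral_indicator_one hmβ, Measure.restrict_apply hmβ]
  rw [hdec, volume_om hs, ← ENNReal.tsum_mul_left]
  refine ENNReal.tsum_le_tsum fun ⟨⟨m, a⟩, hq⟩ => ?_
  dsimp only
  rcases (Om g β ∩ cube m a).eq_empty_or_nonempty with he | ⟨x, hxβ, hx⟩
  · simp [he]
  have e : idx m x = a := hx
  subst e
  set Q := (cube m (idx m x) : Set (Rn n)) with hQ
  have hQm : MeasurableSet Q := measurableSet_cube _ _
  set V := volume (Om g β ∩ Q) with hV
  have hVt : V ≠ ⊤ := ((measure_mono inter_subset_right).trans_lt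
    (by rw [hQ, volume_cube]; exact (cvol_ne_top m).lt_top)).ne
  have h1 : β * V ≤ ∫⁻ y in Om g β ∩ Q, g y := by
    have e1 : V = ∑' q' : Stop g β, volume (cube q'.1.1 q'.1.2 ∩ Q) := by
      have := lintegral_om hsβ (Q.indicator 1)
      rw [lintegral_indicator_one hQm, Measure.restrict_apply hQm, inter_comm] at this
      rw [hV, this]
      congr 1 with q
      rw [lintegral_indicator_one hQm, Measure.restrict_apply hQm, inter_comm]
    have e2 : ∫⁻ y in Om g β ∩ Q, g y =
        ∑' q' : Stop g β, ∫⁻ y in cube q'.1.1 q'.1.2 ∩ Q, g y := by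
      have := lintegral_om hsβ (Q.indicator g)
      rw [lintegral_indicator hQm, Measure.restrict_restrict hQm, inter_comm] at this
      rw [this]
      congr 1 with q
      rw [lintegral_indicator hQm, Measure.restrict_restrict hQm, inter_comm]
    rw [e1, e2, ← ENNReal.tsum_mul_left]
    refine ENNReal.tsum_le_tsum fun ⟨q', hq'⟩ => ?_
    dsimp only
    rcases (cube q'.1 q'.2 ∩ Q).eq_empty_or_nonempty with he | ⟨y, hy', hy⟩
    · simp [he]
    · rw [inter_eq_left.2 (stop_inter hs hαβ hq hq' hy hy'), volume_cube]
      exact hq'.1.le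
  obtain ⟨c, o, hom, hco, ho⟩ := hB (m - 1) x
  have hQP : Q ⊆ cube (m - 1) (idx (m - 1) x) := cube_subset (by omega) x
  have hc : c ≤ α + A := by
    have h2 : c * cvol n (m - 1) ≤ (α + A) * cvol n (m - 1) := by
      calc c * cvol n (m - 1) = ∫⁻ _ in cube (m - 1) (idx (m - 1) x), c := by
            rw [setLIntegral_const, volume_cube]
        _ ≤ ∫⁻ y in cube (m - 1) (idx (m - 1) x), (g y + o y) :=
            setLIntegral_mono' (measurableSet_cube _ _) fun y hy => (hco y hy).2
        _ = (∫⁻ y in cube (m - 1) (idx (m - 1) x), g y) +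
            ∫⁻ y in cube (m - 1) (idx (m - 1) x), o y := lintegral_add_left hg _
        _ ≤ α * cvol n (m - 1) + A * cvol n (m - 1) :=
            add_le_add (hq.2 (m - 1) (by simp) x hx) ho
        _ = _ := by ring
    exact (ENNReal.mul_le_mul_iff_left (cvol_pos _) (cvol_ne_top _)).1 h2
  have h3 : ∫⁻ y in Om g β ∩ Q, g y ≤ (α + A) * V + A * (two n * cvol n m) := by
    calc ∫⁻ y in Om g β ∩ Q, g y ≤ ∫⁻ y in Om g β ∩ Q, (c + o y) :=
          setLIntegral_mono' (hmβ.inter hQm) fun y hy => (hco y (hQP hy.2)).1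
      _ = c * V + ∫⁻ y in Om g β ∩ Q, o y := by
          rw [lintegral_add_left measurable_const, setLIntegral_const]
      _ ≤ _ := by
          refine add_le_add (by gcongr) ?_
          rw [← cvol_sub_one]
          exact (lintegral_mono_set (inter_subset_right.trans hQP)).trans ho
  have h4 : (α + A) * V + (two n * A) * (2 * V) ≤ (α + A) * V + (two n * A) * cvol n m := by
    calc _ = β * V := by rw [hβ]; ring
      _ ≤ _ := h1.trans h3
      _ = _ := by ring
  have h5 := (ENNReal.add_le_add_iff_left
    (ENNReal.mul_ne_top (ENNReal.add_ne_top.2 ⟨hα, hA'⟩) hVt)).1 h4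
  exact (ENNReal.mul_le_mul_iff_right (mul_ne_zero (two_pos _).ne' hA)
    (ENNReal.mul_ne_top (two_ne_top _) hA')).1 h5

lemma sq_mul_volume_om_le (hg : Measurable g) (hs : EvSmall g A) :
    A ^ (2 : ℝ) * volume (Om g A) ≤ ∫⁻ x, g x ^ (2 : ℝ) := by
  refine le_trans ?_ (setLIntegral_le_lintegral (Om g A) _)
  rw [volume_om hs, lintegral_om hs, ← ENNReal.tsum_mul_left]
  refine ENNReal.tsum_le_tsum fun ⟨q, hq⟩ => ?_
  dsimp only
  set I := ∫⁻ x in cube q.1 q.2, g x ^ (2 : ℝ)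
  have hCS := ENNReal.lintegral_mul_le_Lp_mul_Lq
    (volume.restrict (cube q.1 q.2)) (Real.HolderConjugate.two_two)
    hg.aemeasurable (aemeasurable_const (b := (1 : ℝ≥0∞)))
  simp only [Pi.mul_apply, mul_one, ENNReal.one_rpow, lintegral_const, one_mul,
    Measure.restrict_apply_univ, volume_cube] at hCS
  have h1 : (A * cvol n q.1) ^ (2 : ℝ) ≤ I * cvol n q.1 := by
    calc _ ≤ (I ^ (1 / (2 : ℝ)) * cvol n q.1 ^ (1 / (2 : ℝ))) ^ (2 : ℝ) := by
          exact ENNReal.rpow_le_rpow (hq.1.le.trans hCS) (by norm_num)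
      _ = _ := by
          rw [← ENNReal.mul_rpow_of_nonneg _ _ (by norm_num), ← ENNReal.rpow_mul]; norm_num
  have h2 : A ^ (2 : ℝ) * cvol n q.1 * cvol n q.1 ≤ I * cvol n q.1 := by
    refine le_trans (le_of_eq ?_) h1
    rw [ENNReal.mul_rpow_of_nonneg _ _ (by norm_num), mul_assoc]
    congr 1
    rw [ENNReal.rpow_two, sq]
  exact (ENNReal.mul_le_mul_iff_left (cvol_pos _) (cvol_ne_top _)).1 h2

lemma tsum_linear_rpow_mul_ne_top (K : ℕ) (P : ℝ) :
    ∑' i : ℕ, (1 + (K : ℝ≥0∞) * (i + 1)) ^ P * (2⁻¹ : ℝ≥0∞) ^ i ≠ ⊤ := by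
  obtain ⟨M, hM⟩ := exists_nat_ge P
  have hsum : Summable fun i : ℕ =>
      ((1 + K : ℝ) ^ M * 2 * (((i + 1 : ℕ) : ℝ) ^ M * (1 / 2 : ℝ) ^ (i + 1))) := by
    refine Summable.mul_left _ ?_
    have h := summable_pow_mul_geometric_of_norm_lt_one M (by norm_num : ‖(1 / 2 : ℝ)‖ < 1)
    exact (summable_nat_add_iff (f := fun i : ℕ => (i : ℝ) ^ M * (1 / 2 : ℝ) ^ i) 1).2 h
  refine ne_top_of_le_ne_top hsum.tsum_ofReal_ne_top (ENNReal.tsum_le_tsum fun i => ?_)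
  have e : (1 + K * (i + 1) : ℝ≥0∞) = ENNReal.ofReal (1 + K * (i + 1)) := by
    rw [ENNReal.ofReal_add (by norm_num) (by positivity), ENNReal.ofReal_mul (by positivity),
      ENNReal.ofReal_add (by positivity) (by norm_num)]
    simp
  have e2 : (2⁻¹ : ℝ≥0∞) = ENNReal.ofReal (1 / 2) := by
    rw [one_div, ENNReal.ofReal_inv_of_pos (by norm_num)]; simp
  have h1 : (1 : ℝ) ≤ 1 + K * (i + 1) := by
    have : (0 : ℝ) ≤ K * (i + 1) := by positivity
    linarith
  rw [e, e2, ENNReal.ofReal_rpow_of_pos (by positivity), ← ENNReal.ofReal_pow (by norm_num),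
    ← ENNReal.ofReal_mul (by positivity)]
  refine ENNReal.ofReal_le_ofReal ?_
  calc (1 + K * (i + 1) : ℝ) ^ P * (1 / 2) ^ i ≤ (1 + K * (i + 1) : ℝ) ^ M * (1 / 2) ^ i := by
        gcongr
        rw [← Real.rpow_natCast]
        exact Real.rpow_le_rpow_of_exponent_le h1 hM
    _ ≤ ((1 + K) * (i + 1) : ℝ) ^ M * (1 / 2) ^ i := by
        gcongr
        have : (0 : ℝ) ≤ i := by positivity
        nlinarith
    _ = _ := by
        push_cast
        rw [mul_pow, pow_succ (1 / 2 : ℝ)]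
        ring

/-- The John–Nirenberg inequality, in the form of an `L^P` bound. -/
lemma john_nirenberg (hn : n ≠ 0) {P : ℝ} (hP : 2 < P) :
    ∃ C : ℝ≥0∞, C ≠ ⊤ ∧ ∀ (g : Rn n → ℝ≥0∞) (A : ℝ≥0∞), Continuous g → (∀ x, g x ≠ ⊤) →
      A ≠ 0 → A ≠ ⊤ → ∫⁻ x, g x ^ (2 : ℝ) ≠ ⊤ → DyadicBMO g A →
      ∫⁻ x, g x ^ P ≤ C * A ^ (P - 2) * ∫⁻ x, g x ^ (2 : ℝ) := by
  set K : ℕ := 2 * 2 ^ n + 1 with hK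
  have hKe : (K : ℝ≥0∞) = 2 * two n + 1 := by
    rw [hK]; push_cast; simp [two]
  set S₀ := ∑' i : ℕ, (1 + (K : ℝ≥0∞) * (i + 1)) ^ P * (2⁻¹ : ℝ≥0∞) ^ i with hS
  have hP0 : 0 < P := by linarith
  refine ⟨(1 + K : ℝ≥0∞) ^ (P - 2) + S₀, ?_, ?_⟩
  · refine ENNReal.add_ne_top.2 ⟨?_, tsum_linear_rpow_mul_ne_top K P⟩
    refine ENNReal.rpow_ne_top_of_nonneg (by linarith) ?_
    exact ENNReal.add_ne_top.2 ⟨ENNReal.one_ne_top, ENNReal.natCast_ne_top K⟩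
  intro g A hgc hgt hA hA' h2 hB
  have hg : Measurable g := hgc.measurable
  have hs := evSmall_of_sq hg.aemeasurable h2 hn hA
  set αs : ℕ → ℝ≥0∞ := fun i => A * (1 + K * i) with hαs
  have hαt : ∀ i, αs i ≠ ⊤ := fun i => ENNReal.mul_ne_top hA' (ENNReal.add_ne_top.2
    ⟨ENNReal.one_ne_top, ENNReal.mul_ne_top (ENNReal.natCast_ne_top K) (ENNReal.natCast_ne_top i)⟩)
  have hαA : ∀ i, A ≤ αs i := fun i => le_mul_of_one_le_right' le_self_add
  have hvol : ∀ i, volume (Om g (αs i)) ≤ (2⁻¹ : ℝ≥0∞) ^ i * volume (Om g A) := by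
    intro i
    induction i with
    | zero => simp [hαs]
    | succ i ih =>
      have h := john_nirenberg_step hg (hs.mono (hαA i)) (hαt i) hA hA' hB
      rw [← hKe] at h
      have e : αs (i + 1) = αs i + K * A := by simp only [hαs]; push_cast; ring
      rw [e, pow_succ, mul_comm _ (2⁻¹ : ℝ≥0∞), mul_assoc, ← ENNReal.div_eq_inv_mul,
        ENNReal.le_div_iff_mul_le (by simp) (by simp), mul_comm]
      exact h.trans ih
  have hvolA : volume (Om g A) ≤ A ^ (-2 : ℝ) * ∫⁻ x, g x ^ (2 : ℝ) := by
    rw [ENNReal.rpow_neg, ← ENNReal.div_eq_inv_mul, ENNReal.le_div_iff_mul_le, mul_comm]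
    · exact sq_mul_volume_om_le hg hs
    · exact Or.inl (by simp [hA])
    · exact Or.inl (ENNReal.rpow_ne_top_of_nonneg (by norm_num) hA')
  have hpt : ∀ x, g x ^ P ≤ αs 1 ^ (P - 2) * g x ^ (2 : ℝ) +
      ∑' i : ℕ, αs (i + 1) ^ P * (Om g (αs i)).indicator 1 x := by
    intro x
    by_cases hx : g x ≤ αs 1
    · refine le_trans ?_ le_self_add
      calc g x ^ P = g x ^ (P - 2) * g x ^ (2 : ℝ) := by
            rw [← ENNReal.rpow_add_of_nonneg _ _ (by linarith) (by norm_num)]; congr 1; ring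
        _ ≤ _ := by
            refine mul_le_mul' (ENNReal.rpow_le_rpow hx (by linarith)) le_rfl
    · refine le_trans ?_ le_add_self
      have hex : ∃ i, g x ≤ αs i := by
        obtain ⟨i, hi⟩ := ENNReal.exists_nat_gt (ENNReal.div_ne_top (hgt x) hA)
        refine ⟨i, ?_⟩
        have h3 : g x ≤ i * A := (ENNReal.div_le_iff_le_mul (Or.inl hA) (Or.inl hA')).1 hi.le
        refine h3.trans ?_
        rw [mul_comm]
        simp only [hαs]
        gcongr
        refine le_trans ?_ le_add_self
        refine le_mul_of_one_le_left' ?_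
        rw [hK]; push_cast; exact le_add_self
      classical
      have hi0 : Nat.find hex ≠ 0 := by
        intro h0
        have := Nat.find_spec hex
        rw [h0] at this
        refine hx (this.trans ?_)
        simp only [hαs]
        gcongr
        simp
      obtain ⟨i, hi⟩ := Nat.exists_eq_succ_of_ne_zero hi0
      have hle : g x ≤ αs (i + 1) := by have := Nat.find_spec hex; rwa [hi] at this
      have hlt : αs i < g x := not_le.1 (Nat.find_min hex (by omega))
      refine le_trans ?_ (ENNReal.le_tsum i)
      rw [indicator_of_mem (mem_om_of_continuousAt hgc.continuousAt hlt)]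
      simp only [Pi.one_apply, mul_one]
      gcongr
  have hmeas : ∀ i, MeasurableSet (Om g (αs i)) := fun i => measurableSet_om (hs.mono (hαA i))
  calc ∫⁻ x, g x ^ P ≤ ∫⁻ x, (αs 1 ^ (P - 2) * g x ^ (2 : ℝ) +
      ∑' i : ℕ, αs (i + 1) ^ P * (Om g (αs i)).indicator 1 x) := lintegral_mono hpt
    _ = αs 1 ^ (P - 2) * (∫⁻ x, g x ^ (2 : ℝ)) + ∑' i : ℕ, αs (i + 1) ^ P * volume (Om g (αs i)) := by
        rw [lintegral_add_left ((hg.pow_const _).const_mul _), lintegral_const_mul _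
          (hg.pow_const _), lintegral_tsum]
        · congr 2 with i
          rw [lintegral_const_mul _ (measurable_one.indicator (hmeas i)),
            lintegral_indicator_one (hmeas i)]
        · exact fun i => ((measurable_one.indicator (hmeas i)).const_mul _).aemeasurable
    _ ≤ αs 1 ^ (P - 2) * (∫⁻ x, g x ^ (2 : ℝ)) + ∑' i : ℕ, αs (i + 1) ^ P *
        ((2⁻¹ : ℝ≥0∞) ^ i * (A ^ (-2 : ℝ) * ∫⁻ x, g x ^ (2 : ℝ))) := by
        gcongr with i
        exact (hvol i).trans (by gcongr)
    _ = _ := by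
        have e : ∀ i : ℕ, αs (i + 1) ^ P *
            ((2⁻¹ : ℝ≥0∞) ^ i * (A ^ (-2 : ℝ) * ∫⁻ x, g x ^ (2 : ℝ))) =
            (A ^ (P - 2) * ∫⁻ x, g x ^ (2 : ℝ)) *
              ((1 + (K : ℝ≥0∞) * (i + 1)) ^ P * (2⁻¹ : ℝ≥0∞) ^ i) := by
          intro i
          simp only [hαs]
          rw [ENNReal.mul_rpow_of_nonneg _ _ hP0.le, sub_eq_add_neg,
            ENNReal.rpow_add _ _ hA hA']
          push_cast
          ring
        simp_rw [e]
        rw [ENNReal.tsum_mul_left, ← hS]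
        simp only [hαs, Nat.cast_one, mul_one]
        rw [ENNReal.mul_rpow_of_nonneg _ _ (by linarith)]
        ring

end JohnNirenberg

section Lacunary

/-- The sequence `ρ` is positive and lacunary with ratio `b`. -/
structure IsLac (ρ : ℤ → ℝ) (b : ℝ) : Prop where
  one_lt : 1 < b
  pos : ∀ k, 0 < ρ k
  step : ∀ k, b * ρ k ≤ ρ (k + 1)

lemma IsLac.le_add {ρ : ℤ → ℝ} {b : ℝ} (h : IsLac ρ b) (k : ℤ) (j : ℕ) :
    b ^ j * ρ k ≤ ρ (k + j) := by
  have := h.one_lt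
  induction j with
  | zero => simp
  | succ j ih =>
    calc b ^ (j + 1) * ρ k = b * (b ^ j * ρ k) := by ring
      _ ≤ b * ρ (k + j) := by gcongr
      _ ≤ ρ (k + j + 1) := h.step _
      _ = _ := by push_cast; rw [add_assoc]

lemma IsLac.strictMono {ρ : ℤ → ℝ} {b : ℝ} (h : IsLac ρ b) : StrictMono ρ :=
  strictMono_int_of_lt_succ fun k => by
    have := h.step k
    have := h.pos k
    have := h.one_lt
    nlinarith

/-- The geometric constant attached to a lacunary ratio. -/
def lacC (b θ : ℝ) : ℝ≥0∞ := (1 - ENNReal.ofReal (b ^ (-θ)))⁻¹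

lemma lacC_ne_top {b θ : ℝ} (hb : 1 < b) (hθ : 0 < θ) : lacC b θ ≠ ⊤ := by
  have : ENNReal.ofReal (b ^ (-θ)) < 1 := by
    rw [ENNReal.ofReal_lt_one]
    exact Real.rpow_lt_one_of_one_lt_of_neg hb (by linarith)
  exact ENNReal.inv_ne_top.2 (tsub_pos_of_lt this).ne'

lemma IsLac.tsum_le {ρ : ℤ → ℝ} {b : ℝ} (h : IsLac ρ b) {θ r : ℝ} (hθ : 0 < θ) (hr : 0 < r) :
    ∑' k, (if r ≤ ρ k then ENNReal.ofReal ((r / ρ k) ^ θ) else 0) ≤ lacC b θ := by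
  have hb := h.one_lt
  by_cases hex : ∃ k, r ≤ ρ k
  swap
  · push Not at hex
    simp [not_le.2 (hex _)]
  obtain ⟨k₁, hk₁⟩ := hex
  obtain ⟨J, hJ⟩ := pow_unbounded_of_one_lt (ρ k₁ / r) hb
  have hlow : ∀ k, r ≤ ρ k → k₁ - J ≤ k := by
    intro k hk
    by_contra hcon
    have h1 := h.le_add (k₁ - J) J
    have h2 := h.strictMono (not_le.1 hcon)
    rw [sub_add_cancel] at h1
    rw [div_lt_iff₀ hr] at hJ
    have : b ^ J * r ≤ b ^ J * ρ (k₁ - J) := by gcongr; linarith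
    linarith
  obtain ⟨k₀, hk₀, hmin⟩ := Int.exists_least_of_bdd (P := fun k => r ≤ ρ k)
    ⟨k₁ - J, hlow⟩ ⟨k₁, hk₁⟩
  have hsupp : Function.support (fun k => if r ≤ ρ k then ENNReal.ofReal ((r / ρ k) ^ θ) else 0) ⊆
      range fun j : ℕ => k₀ + j := by
    intro k hk
    have : r ≤ ρ k := by
      by_contra hcon
      simp [hcon] at hk
    have := hmin k this
    exact ⟨(k - k₀).toNat, by simp; omega⟩
  rw [← Function.Injective.tsum_eq (fun i j hij => by simpa using hij) hsupp, lacC,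
    ← ENNReal.tsum_geometric]
  refine ENNReal.tsum_le_tsum fun j => ?_
  split_ifs with hj
  · rw [← ENNReal.ofReal_pow (by positivity)]
    refine ENNReal.ofReal_le_ofReal ?_
    have h1 := h.le_add k₀ j
    have hp := h.pos (k₀ + j)
    calc (r / ρ (k₀ + j)) ^ θ ≤ (b⁻¹ ^ j) ^ θ := by
          refine Real.rpow_le_rpow (by positivity) ?_ hθ.le
          rw [div_le_iff₀ hp, inv_pow, ← div_eq_inv_mul, le_div_iff₀ (by positivity), mul_comm]
          exact (mul_le_mul_of_nonneg_left hk₀ (by positivity)).trans h1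
      _ = (b ^ (-θ)) ^ j := by
          rw [← Real.rpow_natCast, ← Real.rpow_natCast, ← Real.rpow_mul (by positivity),
            ← Real.rpow_mul (by positivity), Real.inv_rpow (by positivity),
            ← Real.rpow_neg (by positivity)]
          congr 1; ring
  · exact bot_le

lemma IsLac.inv_neg {ρ : ℤ → ℝ} {b : ℝ} (h : IsLac ρ b) : IsLac (fun k => (ρ (-k))⁻¹) b where
  one_lt := h.one_lt
  pos k := inv_pos.2 (h.pos _)
  step k := by
    have h1 := h.step (-(k + 1))
    rw [show -(k + 1) + 1 = -k by ring] at h1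
    have h2 := h.pos (-k)
    have h3 := h.pos (-(k + 1))
    rw [← div_eq_mul_inv, div_le_iff₀ h2, ← div_eq_inv_mul, le_div_iff₀ h3]
    exact h1

lemma IsLac.tsum_min_le {ρ : ℤ → ℝ} {b : ℝ} (h : IsLac ρ b) {θ r : ℝ} (hθ : 0 < θ) (hr : 0 < r) :
    ∑' k, ENNReal.ofReal (min (r / ρ k) (ρ k / r) ^ θ) ≤ 2 * lacC b θ := by
  have h1 := h.tsum_le hθ hr
  have h2 := h.inv_neg.tsum_le hθ (inv_pos.2 hr)
  rw [← (Equiv.neg ℤ).tsum_eq] at h2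
  rw [two_mul]
  refine le_trans ?_ (add_le_add h1 h2)
  rw [← ENNReal.tsum_add]
  refine ENNReal.tsum_le_tsum fun k => ?_
  have hk := h.pos k
  simp only [Equiv.neg_apply, neg_neg]
  by_cases hc : r ≤ ρ k
  · rw [if_pos hc]
    refine le_trans (ENNReal.ofReal_le_ofReal ?_) le_self_add
    exact Real.rpow_le_rpow (le_min (by positivity) (by positivity)) (min_le_left _ _) hθ.le
  · rw [if_pos (inv_anti₀ hk (not_le.1 hc).le)]
    refine le_trans (ENNReal.ofReal_le_ofReal ?_) le_add_self
    refine Real.rpow_le_rpow (le_min (by positivity) (by positivity)) ?_ hθ.le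
    refine (min_le_right _ _).trans (le_of_eq ?_)
    field_simp

end Lacunary

section MixedNorm

/-- The product of counting measure and Lebesgue measure on `[1, 2]`. -/
def pm : Measure (ℤ × ℝ) := (Measure.count : Measure ℤ).prod (volume.restrict (Icc 1 2))

/-- The mixed norm `ℓ²(L²([1, 2]))`. -/
def nrm (F : ℤ → ℝ → ℝ≥0∞) : ℝ≥0∞ := (∫⁻ p, F p.1 p.2 ^ (2 : ℝ) ∂pm) ^ (1 / (2 : ℝ))

lemma measurable_uncurry_int {β : Type*} [MeasurableSpace β] {F : ℤ → ℝ → β}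
    (hF : ∀ k, Measurable (F k)) : Measurable fun p : ℤ × ℝ => F p.1 p.2 :=
  measurable_from_prod_countable_right hF

lemma nrm_sq {F : ℤ → ℝ → ℝ≥0∞} (hF : ∀ k, Measurable (F k)) :
    nrm F ^ (2 : ℝ) = ∑' k, ∫⁻ v in Icc (1 : ℝ) 2, F k v ^ (2 : ℝ) := by
  rw [nrm, ← ENNReal.rpow_mul, one_div_mul_cancel (by norm_num), ENNReal.rpow_one, pm,
    lintegral_prod _ ((measurable_uncurry_int hF).pow_const _).aemeasurable, lintegral_count]

lemma nrm_add_le {F G : ℤ → ℝ → ℝ≥0∞} (hF : ∀ k, Measurable (F k)) (hG : ∀ k, Measurable (G k)) :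
    nrm (fun k v => F k v + G k v) ≤ nrm F + nrm G :=
  ENNReal.lintegral_Lp_add_le (measurable_uncurry_int hF).aemeasurable
    (measurable_uncurry_int hG).aemeasurable (by norm_num)

lemma nrm_tsum_le {ι : Type*} [Countable ι] {F : ι → ℤ → ℝ → ℝ≥0∞}
    (hF : ∀ i k, Measurable (F i k)) :
    nrm (fun k v => ∑' i, F i k v) ≤ ∑' i, nrm (F i) :=
  lintegral_tsum_rpow_le (μ := pm) (r := 2) one_le_two (fun i (p : ℤ × ℝ) => F i p.1 p.2)
    fun i => (measurable_uncurry_int (hF i)).aemeasurable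

lemma nrm_mono {F G : ℤ → ℝ → ℝ≥0∞} (h : ∀ k v, F k v ≤ G k v) : nrm F ≤ nrm G := by
  unfold nrm
  gcongr
  exact h _ _

lemma nrm_le_tsum {F : ℤ → ℝ → ℝ≥0∞} (hF : ∀ k, Measurable (F k)) :
    nrm F ≤ ∑' k, (∫⁻ v in Icc (1 : ℝ) 2, F k v ^ (2 : ℝ)) ^ (1 / (2 : ℝ)) := by
  set a : ℤ → ℝ≥0∞ := fun k => (∫⁻ v in Icc (1 : ℝ) 2, F k v ^ (2 : ℝ)) ^ (1 / (2 : ℝ)) with ha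
  have h1 : nrm F ^ (2 : ℝ) ≤ (∑' k, a k) ^ (2 : ℝ) := by
    rw [nrm_sq hF, ENNReal.rpow_two, sq, ← ENNReal.tsum_mul_right]
    refine ENNReal.tsum_le_tsum fun k => ?_
    refine le_trans (le_of_eq ?_) (mul_le_mul_right (ENNReal.le_tsum k) (a k))
    rw [ha]
    dsimp only
    rw [← ENNReal.rpow_add_of_nonneg _ _ (by norm_num) (by norm_num)]
    norm_num
  exact (ENNReal.rpow_le_rpow_iff (by norm_num)).1 h1

end MixedNorm

section Kernel

variable {n : ℕ}

/-- A family of kernels `κ k v` adapted to the scales `ρ k`, with Lipschitz constant `X`. -/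
structure KerFam (ρ : ℤ → ℝ) (C₀ X : ℝ) (κ : ℤ → ℝ → Rn n → ℂ) : Prop where
  cont : ∀ k, Continuous fun p : ℝ × Rn n => κ k p.1 p.2
  supp : ∀ k v t, C₀ * ρ k < ‖t‖ → κ k v t = 0
  size : ∀ k v t, ‖κ k v t‖ ≤ C₀ / ρ k ^ n
  lip : ∀ k, ∀ v ∈ Icc (1 : ℝ) 2, ∀ t s, ‖κ k v t - κ k v s‖ ≤ C₀ * X / ρ k ^ (n + 1) * ‖t - s‖

/-- Convolution of `f` with the kernel `κ k v`. -/
def T (κ : ℤ → ℝ → Rn n → ℂ) (k : ℤ) (f : Rn n → ℂ) (x : Rn n) (v : ℝ) : ℂ :=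
  ∫ s, f s * κ k v (x - s)

/-- The square function associated with the family `κ`. -/
def SS (κ : ℤ → ℝ → Rn n → ℂ) (f : Rn n → ℂ) (x : Rn n) : ℝ≥0∞ :=
  nrm fun k v => ‖T κ k f x v‖ₑ

variable {ρ : ℤ → ℝ} {C₀ X : ℝ} {κ : ℤ → ℝ → Rn n → ℂ} {f g : Rn n → ℂ}

lemma KerFam.integrable (hκ : KerFam ρ C₀ X κ) (hf : Integrable f) (k : ℤ) (x : Rn n) (v : ℝ) :
    Integrable fun s => f s * κ k v (x - s) := by
  have hc : Continuous fun s => κ k v (x - s) :=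
    (hκ.cont k).comp (by fun_prop : Continuous fun s : Rn n => ((v, x - s) : ℝ × Rn n))
  exact hf.mul_bdd hc.aestronglyMeasurable (Eventually.of_forall fun s => hκ.size k v _)

lemma KerFam.continuous_T (hκ : KerFam ρ C₀ X κ) (hf : Integrable f) (k : ℤ) :
    Continuous fun p : Rn n × ℝ => T κ k f p.1 p.2 := by
  refine continuous_of_dominated (bound := fun s => ‖f s‖ * (C₀ / ρ k ^ n))
    (fun p => (hκ.integrable hf k p.1 p.2).aestronglyMeasurable)
    (fun p => Eventually.of_forall fun s => ?_) (hf.norm.mul_const _)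
    (Eventually.of_forall fun s => ?_)
  · rw [norm_mul]
    gcongr
    exact hκ.size _ _ _
  · exact continuous_const.mul ((hκ.cont k).comp
      (by fun_prop : Continuous fun p : Rn n × ℝ => ((p.2, p.1 - s) : ℝ × Rn n)))

lemma KerFam.measurable_T (hκ : KerFam ρ C₀ X κ) (hf : Integrable f) (k : ℤ) (x : Rn n) :
    Measurable fun v => ‖T κ k f x v‖ₑ :=
  ((hκ.continuous_T hf k).comp
    (by fun_prop : Continuous fun v : ℝ => ((x, v) : Rn n × ℝ))).enorm.measurable

lemma KerFam.T_sub (hκ : KerFam ρ C₀ X κ) (hf : Integrable f) (hg : Integrable g) (k : ℤ)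
    (x : Rn n) (v : ℝ) : T κ k (fun s => f s - g s) x v = T κ k f x v - T κ k g x v := by
  unfold T
  rw [← integral_sub (hκ.integrable hf k x v) (hκ.integrable hg k x v)]
  congr 1 with s
  ring

lemma KerFam.SS_sq (hκ : KerFam ρ C₀ X κ) (hf : Integrable f) (x : Rn n) :
    SS κ f x ^ (2 : ℝ) = ∑' k, ∫⁻ v in Icc (1 : ℝ) 2, ‖T κ k f x v‖ₑ ^ (2 : ℝ) :=
  nrm_sq fun k => hκ.measurable_T hf k x

lemma KerFam.SS_le_add_sub (hκ : KerFam ρ C₀ X κ) (hf : Integrable f) (hg : Integrable g)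
    (x : Rn n) : SS κ f x ≤ SS κ g x + SS κ (fun s => f s - g s) x := by
  refine le_trans (nrm_mono fun k v => ?_) (nrm_add_le (fun k => hκ.measurable_T hg k x)
    fun k => hκ.measurable_T (hf.sub hg) k x)
  have : T κ k f x v = T κ k g x v + T κ k (fun s => f s - g s) x v := by
    rw [hκ.T_sub hf hg]; ring
  rw [this]
  exact enorm_add_le _ _

lemma KerFam.continuous_lintegral (hκ : KerFam ρ C₀ X κ) (hf : Integrable f) (k : ℤ) :
    Continuous fun x => ∫⁻ v in Icc (1 : ℝ) 2, ‖T κ k f x v‖ₑ ^ (2 : ℝ) := by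
  have hc := hκ.continuous_T hf k
  have e : ∀ x, ∫⁻ v in Icc (1 : ℝ) 2, ‖T κ k f x v‖ₑ ^ (2 : ℝ) =
      ENNReal.ofReal (∫ v in (1 : ℝ)..2, ‖T κ k f x v‖ ^ 2) := by
    intro x
    have hx : Continuous fun v => ‖T κ k f x v‖ ^ 2 :=
      ((hc.comp (by fun_prop : Continuous fun v : ℝ => ((x, v) : Rn n × ℝ))).norm).pow 2
    rw [intervalIntegral.integral_of_le (by norm_num), ← integral_Icc_eq_integral_Ioc,
      ofReal_integral_eq_lintegral_ofReal hx.continuousOn.integrableOn_Icc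
      (Eventually.of_forall fun v => by positivity)]
    refine lintegral_congr fun v => ?_
    rw [← enorm_norm, Real.enorm_of_nonneg (norm_nonneg _), ENNReal.rpow_two,
      ENNReal.ofReal_pow (norm_nonneg _)]
  simp_rw [e]
  refine ENNReal.continuous_ofReal.comp ?_
  refine intervalIntegral.continuous_parametric_intervalIntegral_of_continuous' ?_ _ _
  exact (hc.norm).pow 2

lemma KerFam.measurable_SS (hκ : KerFam ρ C₀ X κ) (hf : Integrable f) : Measurable (SS κ f) := by
  have e : SS κ f = fun x => (∑' k, ∫⁻ v in Icc (1 : ℝ) 2, ‖T κ k f x v‖ₑ ^ (2 : ℝ)) ^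
      (1 / (2 : ℝ)) := by
    ext x
    rw [← hκ.SS_sq hf x, ← ENNReal.rpow_mul]
    norm_num
  rw [e]
  exact (Measurable.tsum fun k => (hκ.continuous_lintegral hf k).measurable).pow_const _

lemma KerFam.enorm_T_le (hκ : KerFam ρ C₀ X κ) (hf : ∀ s, ‖f s‖ ≤ 1) (k : ℤ)
    (x : Rn n) (v : ℝ) : ‖T κ k f x v‖ₑ ≤
      ENNReal.ofReal (C₀ / ρ k ^ n) * volume (Metric.closedBall x (C₀ * ρ k) ∩ Function.support f) := by
  refine (enorm_integral_le_lintegral_enorm _).trans ?_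
  calc ∫⁻ s, ‖f s * κ k v (x - s)‖ₑ
      ≤ ∫⁻ s, (Metric.closedBall x (C₀ * ρ k) ∩ Function.support f).indicator
          (fun _ => ENNReal.ofReal (C₀ / ρ k ^ n)) s := by
        refine lintegral_mono fun s => ?_
        by_cases hs : s ∈ Metric.closedBall x (C₀ * ρ k) ∩ Function.support f
        · rw [indicator_of_mem hs, ← ofReal_norm]
          refine ENNReal.ofReal_le_ofReal ?_
          rw [norm_mul]
          calc _ ≤ 1 * (C₀ / ρ k ^ n) :=
                mul_le_mul (hf s) (hκ.size _ _ _) (norm_nonneg _) (by norm_num)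
            _ = _ := one_mul _
        · rw [indicator_of_notMem hs]
          by_cases h0 : f s = 0
          · simp [h0]
          · have : κ k v (x - s) = 0 := by
              refine hκ.supp _ _ _ ?_
              by_contra hcon
              refine hs ⟨?_, h0⟩
              rw [Metric.mem_closedBall, dist_comm, dist_eq_norm]
              exact not_lt.1 hcon
            simp [this]
    _ ≤ _ := lintegral_indicator_const_le _ _

end Kernel

section Far

variable {n : ℕ} {ρ : ℤ → ℝ} {C₀ X b : ℝ} {κ : ℤ → ℝ → Rn n → ℂ} {f : Rn n → ℂ}

lemma KerFam.nonneg (hκ : KerFam ρ C₀ X κ) (hρ : IsLac ρ b) : 0 ≤ C₀ := by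
  have h1 := (norm_nonneg _).trans (hκ.size 0 0 0)
  have h2 := hρ.pos 0
  by_contra hcon
  have : C₀ / ρ 0 ^ n < 0 := div_neg_of_neg_of_pos (not_le.1 hcon) (by positivity)
  linarith

lemma KerFam.enorm_T_le_of_integral_eq_zero (hκ : KerFam ρ C₀ X κ) (hρ : IsLac ρ b)
    (hX : 0 ≤ X) (hf : Integrable f)
    (h0 : ∫ s, f s = 0) {c : Rn n} {R : ℝ} (hs : ∀ s, R < ‖s - c‖ → f s = 0) (k : ℤ)
    (x : Rn n) {v : ℝ} (hv : v ∈ Icc (1 : ℝ) 2) :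
    ‖T κ k f x v‖ₑ ≤
      ENNReal.ofReal (2 * C₀ / ρ k ^ n * min 1 (X * R / ρ k)) * ∫⁻ s, ‖f s‖ₑ := by
  have hC := hκ.nonneg hρ
  have hk := hρ.pos k
  have e : T κ k f x v = ∫ s, f s * (κ k v (x - s) - κ k v (x - c)) := by
    unfold T
    simp_rw [mul_sub]
    rw [integral_sub (hκ.integrable hf k x v) (hf.mul_const _), integral_mul_const, h0]
    simp
  rw [e, ← lintegral_const_mul' _ _ ENNReal.ofReal_ne_top]
  refine (enorm_integral_le_lintegral_enorm _).trans (lintegral_mono fun s => ?_)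
  by_cases h : R < ‖s - c‖
  · simp [hs s h]
  rw [enorm_mul, mul_comm]
  refine mul_le_mul' ?_ le_rfl
  rw [← ofReal_norm]
  refine ENNReal.ofReal_le_ofReal ?_
  rw [mul_min_of_nonneg _ _ (by positivity)]
  refine le_min ?_ ?_
  · refine (norm_sub_le _ _).trans ?_
    have h1 := hκ.size k v (x - s)
    have h2 := hκ.size k v (x - c)
    calc _ ≤ C₀ / ρ k ^ n + C₀ / ρ k ^ n := add_le_add h1 h2
      _ = _ := by ring
  · refine (hκ.lip k v hv _ _).trans ?_
    have : ‖x - s - (x - c)‖ ≤ R := by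
      rw [show x - s - (x - c) = -(s - c) by abel, norm_neg]
      exact not_lt.1 h
    have hR : 0 ≤ R := (norm_nonneg _).trans this
    calc C₀ * X / ρ k ^ (n + 1) * ‖x - s - (x - c)‖ ≤ C₀ * X / ρ k ^ (n + 1) * R := by gcongr
      _ = C₀ / ρ k ^ n * (X * R / ρ k) := by field_simp; ring
      _ ≤ 2 * C₀ / ρ k ^ n * (X * R / ρ k) := by
        gcongr
        linarith

lemma KerFam.T_eq_zero (hκ : KerFam ρ C₀ X κ) {c : Rn n} {R : ℝ}
    (hs : ∀ s, R < ‖s - c‖ → f s = 0) {k : ℤ} {x : Rn n} (hx : C₀ * ρ k + R < ‖x - c‖) (v : ℝ) :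
    T κ k f x v = 0 := by
  unfold T
  rw [integral_eq_zero_of_ae]
  refine Eventually.of_forall fun s => ?_
  by_cases h : R < ‖s - c‖
  · simp [hs s h]
  · change f s * κ k v (x - s) = 0
    rw [hκ.supp k v (x - s), mul_zero]
    have : ‖x - c‖ ≤ ‖x - s‖ + ‖s - c‖ := by
      simpa using norm_add_le (x - s) (s - c)
    linarith

/-- The constant in the off-diagonal estimate. -/
def farC (n : ℕ) (C₀ b ε : ℝ) : ℝ≥0∞ :=
  ENNReal.ofReal (2 * C₀ * C₀ ^ ε) * volume (Metric.closedBall (0 : Rn n) (2 * C₀)) * lacC b ε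

lemma farC_ne_top {ε : ℝ} (hb : 1 < b) (hε : 0 < ε) : farC n C₀ b ε ≠ ⊤ :=
  ENNReal.mul_ne_top (ENNReal.mul_ne_top ENNReal.ofReal_ne_top measure_closedBall_lt_top.ne)
    (lacC_ne_top hb hε)

lemma KerFam.lintegral_SS_far_le (hκ : KerFam ρ C₀ X κ) (hρ : IsLac ρ b) (hC : 1 ≤ C₀)
    (hX : 1 ≤ X) {ε : ℝ} (hε : 0 < ε) (hε1 : ε ≤ 1) (hf : Integrable f)
    (h0 : ∫ s, f s = 0) {c : Rn n} {R : ℝ} (hR : 0 < R) (hs : ∀ s, R < ‖s - c‖ → f s = 0) :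
    ∫⁻ x in {x | 2 * R < ‖x - c‖}, SS κ f x ≤
      farC n C₀ b ε * ENNReal.ofReal (X ^ ε) * ∫⁻ s, ‖f s‖ₑ := by
  set I := ∫⁻ s, ‖f s‖ₑ with hI
  set V := volume (Metric.closedBall (0 : Rn n) (2 * C₀)) with hV
  have hpt : ∀ x, 2 * R < ‖x - c‖ → SS κ f x ≤
      ∑' k, (Metric.closedBall c (ρ k * (2 * C₀))).indicator (fun _ => if R / C₀ ≤ ρ k then
        ENNReal.ofReal (2 * C₀ / ρ k ^ n * (X * R / ρ k) ^ ε) * I else 0) x := by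
    intro x hx
    refine (nrm_le_tsum fun k => hκ.measurable_T hf k x).trans (ENNReal.tsum_le_tsum fun k => ?_)
    have hk := hρ.pos k
    by_cases hz : C₀ * ρ k + R < ‖x - c‖
    · simp [hκ.T_eq_zero hs hz]
    have hz' := not_lt.1 hz
    have h1 : R / C₀ ≤ ρ k := by
      rw [div_le_iff₀ (by linarith)]
      linarith
    have h2 : x ∈ Metric.closedBall c (ρ k * (2 * C₀)) := by
      rw [Metric.mem_closedBall, dist_eq_norm]
      rw [div_le_iff₀ (by linarith)] at h1
      linarith
    rw [indicator_of_mem h2, if_pos h1]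
    have hle : ∀ v ∈ Icc (1 : ℝ) 2, ‖T κ k f x v‖ₑ ^ (2 : ℝ) ≤
        (ENNReal.ofReal (2 * C₀ / ρ k ^ n * (X * R / ρ k) ^ ε) * I) ^ (2 : ℝ) := by
      intro v hv
      refine ENNReal.rpow_le_rpow ((hκ.enorm_T_le_of_integral_eq_zero hρ (by linarith) hf h0 hs k x
        hv).trans ?_) (by norm_num)
      refine mul_le_mul' (ENNReal.ofReal_le_ofReal ?_) le_rfl
      refine mul_le_mul_of_nonneg_left ?_ (by positivity)
      rcases le_total 1 (X * R / ρ k) with h | h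
      · exact (min_le_left _ _).trans (Real.one_le_rpow h hε.le)
      · refine (min_le_right _ _).trans ?_
        conv_lhs => rw [← Real.rpow_one (X * R / ρ k)]
        exact Real.rpow_le_rpow_of_exponent_ge (by positivity) h hε1
    calc (∫⁻ v in Icc (1 : ℝ) 2, ‖T κ k f x v‖ₑ ^ (2 : ℝ)) ^ (1 / (2 : ℝ))
        ≤ (∫⁻ v in Icc (1 : ℝ) 2,
            (ENNReal.ofReal (2 * C₀ / ρ k ^ n * (X * R / ρ k) ^ ε) * I) ^ (2 : ℝ)) ^ (1 / (2 : ℝ)) :=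
          ENNReal.rpow_le_rpow (setLIntegral_mono' measurableSet_Icc hle) (by norm_num)
      _ = _ := by
          rw [setLIntegral_const, Real.volume_Icc]
          norm_num
          rw [← ENNReal.rpow_natCast, ← ENNReal.rpow_mul]
          norm_num
  have hmeas : MeasurableSet {x : Rn n | 2 * R < ‖x - c‖} :=
    measurableSet_lt measurable_const (by fun_prop)
  calc ∫⁻ x in {x | 2 * R < ‖x - c‖}, SS κ f x
      ≤ ∫⁻ x in {x | 2 * R < ‖x - c‖}, ∑' k, (Metric.closedBall c (ρ k * (2 * C₀))).indicator
          (fun _ => if R / C₀ ≤ ρ k then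
            ENNReal.ofReal (2 * C₀ / ρ k ^ n * (X * R / ρ k) ^ ε) * I else 0) x :=
        setLIntegral_mono' hmeas hpt
    _ ≤ ∫⁻ x, ∑' k, (Metric.closedBall c (ρ k * (2 * C₀))).indicator
          (fun _ => if R / C₀ ≤ ρ k then
            ENNReal.ofReal (2 * C₀ / ρ k ^ n * (X * R / ρ k) ^ ε) * I else 0) x :=
        setLIntegral_le_lintegral _ _
    _ = ∑' k, (if R / C₀ ≤ ρ k then
            ENNReal.ofReal (2 * C₀ / ρ k ^ n * (X * R / ρ k) ^ ε) * I else 0) *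
            volume (Metric.closedBall c (ρ k * (2 * C₀))) := by
        rw [lintegral_tsum fun k =>
          (measurable_const.indicator Metric.isClosed_closedBall.measurableSet).aemeasurable]
        congr 1 with k
        rw [lintegral_indicator_const Metric.isClosed_closedBall.measurableSet]
    _ ≤ ∑' k, (ENNReal.ofReal (2 * C₀ * C₀ ^ ε) * V * ENNReal.ofReal (X ^ ε) * I) *
          (if R / C₀ ≤ ρ k then ENNReal.ofReal ((R / C₀ / ρ k) ^ ε) else 0) := by
        refine ENNReal.tsum_le_tsum fun k => ?_
        have hk := hρ.pos k
        split_ifs with h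
        · rw [Measure.addHaar_closedBall_mul _ _ hk.le (by linarith), ← hV]
          simp only [finrank_euclideanSpace, Fintype.card_fin]
          have e : 2 * C₀ / ρ k ^ n * (X * R / ρ k) ^ ε * ρ k ^ n =
              2 * C₀ * C₀ ^ ε * X ^ ε * (R / C₀ / ρ k) ^ ε := by
            rw [show X * R / ρ k = C₀ * X * (R / C₀ / ρ k) by field_simp,
              Real.mul_rpow (by positivity) (by positivity),
              Real.mul_rpow (by positivity) (by positivity)]
            field_simp
          have e' : ENNReal.ofReal (2 * C₀ / ρ k ^ n * (X * R / ρ k) ^ ε) *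
              ENNReal.ofReal (ρ k ^ n) = ENNReal.ofReal (2 * C₀ * C₀ ^ ε) *
              ENNReal.ofReal (X ^ ε) * ENNReal.ofReal ((R / C₀ / ρ k) ^ ε) := by
            rw [← ENNReal.ofReal_mul (by positivity), e, ENNReal.ofReal_mul (by positivity),
              ENNReal.ofReal_mul (by positivity)]
          calc _ = (ENNReal.ofReal (2 * C₀ / ρ k ^ n * (X * R / ρ k) ^ ε) *
              ENNReal.ofReal (ρ k ^ n)) * (I * V) := by ring
            _ ≤ _ := by rw [e']; exact le_of_eq (by ring)
        · simp
    _ ≤ (ENNReal.ofReal (2 * C₀ * C₀ ^ ε) * V * ENNReal.ofReal (X ^ ε) * I) * lacC b ε := by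
        rw [ENNReal.tsum_mul_left]
        exact mul_le_mul' le_rfl (hρ.tsum_le hε (by positivity))
    _ = _ := by rw [farC]; ring

end Far

section CZ

variable {n : ℕ}

lemma enorm_setAverage {s : Set (Rn n)} (hs : volume s ≠ ⊤) (f : Rn n → ℂ) :
    ‖⨍ x in s, f x‖ₑ ≤ (volume s)⁻¹ * ∫⁻ x in s, ‖f x‖ₑ := by
  by_cases h0 : volume s = 0
  · simp [Measure.restrict_eq_zero.2 h0]
  rw [setAverage_eq, enorm_smul]
  refine mul_le_mul' ?_ (enorm_integral_le_lintegral_enorm _)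
  rw [enorm_inv (by simpa [Measure.real, ENNReal.toReal_eq_zero_iff, hs] using h0)]
  rw [Measure.real, Real.enorm_of_nonneg ENNReal.toReal_nonneg, ENNReal.ofReal_toReal hs]

lemma evSmall_indicator {U : Set (Rn n)} (hn : n ≠ 0) (hU : MeasurableSet U)
    (hUt : volume U ≠ ⊤) {α : ℝ≥0∞} (hα : α ≠ 0) : EvSmall (U.indicator fun _ => 1) α := by
  refine evSmall_of_sq (measurable_const.indicator hU).aemeasurable ?_ hn hα
  have : ∀ x, (U.indicator (fun _ => (1 : ℝ≥0∞)) x) ^ (2 : ℝ) = U.indicator (fun _ => 1) x := by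
    intro x
    by_cases h : x ∈ U <;> simp [h]
  simp_rw [this]
  rw [lintegral_indicator_const hU]
  simpa using hUt

lemma exists_calderon_zygmund {f : Rn n → ℂ} {U : Set (Rn n)} (hn : n ≠ 0)
    (hU : MeasurableSet U) (hUt : volume U ≠ ⊤)
    (hfU : ∀ s, ‖f s‖ₑ ≤ U.indicator (fun _ => 1) s) {α : ℝ≥0∞} (hα : α ≠ 0) :
    ∃ g : Rn n → ℂ, Measurable g ∧
      (∀ s, ‖g s‖ₑ ≤ (Om (U.indicator fun _ => 1) α).indicator (fun _ => two n * α) s) ∧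
      ∀ q ∈ Stop (U.indicator fun _ => 1) α, (∫ s in cube q.1 q.2, (f s - g s) = 0) ∧
        ∫⁻ s in cube q.1 q.2, ‖f s - g s‖ₑ ≤ 2 * ∫⁻ s in cube q.1 q.2, ‖f s‖ₑ := by
  set h : Rn n → ℝ≥0∞ := U.indicator fun _ => 1 with hh
  have hs : EvSmall h α := evSmall_indicator hn hU hUt hα
  obtain ⟨g, hg, hgq⟩ := exists_measurable_piecewise (ι := Option (Stop h α))
    (fun o => o.elim (Om h α)ᶜ fun q => cube q.1.1 q.1.2)
    (fun o => by
      cases o with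
      | none => exact (measurableSet_om hs).compl
      | some q => exact measurableSet_cube _ _)
    (fun o _ => o.elim (0 : ℂ) fun q => ⨍ s in cube q.1.1 q.1.2, f s)
    (fun o => measurable_const) (by
      have key : ∀ q : Stop h α, (cube q.1.1 q.1.2 : Set (Rn n)) ⊆ Om h α := fun q => by
        rw [om_eq_iUnion hs]
        exact subset_iUnion (fun q : Stop h α => (cube q.1.1 q.1.2 : Set (Rn n))) q
      intro o o' hne x hx
      cases o with
      | none =>
        cases o' with
        | none => rfl
        | some q => exact absurd (key q hx.2) hx.1
      | some q =>
        cases o' with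
        | none => exact absurd (key q hx.1) hx.2
        | some q' => exact absurd (congrArg some (Subtype.ext (stop_eq q.2 q'.2 hx.1 hx.2))) hne)
  have hgc : ∀ q : Stop h α, ∀ s ∈ (cube q.1.1 q.1.2 : Set (Rn n)),
      g s = ⨍ s in cube q.1.1 q.1.2, f s := fun q s hs => hgq (some q) hs
  have hvt : ∀ q : ℤ × (Fin n → ℤ), volume (cube q.1 q.2 : Set (Rn n)) ≠ ⊤ := fun q => by
    rw [volume_cube]; exact cvol_ne_top _
  have hfi : ∀ q : ℤ × (Fin n → ℤ), ∫⁻ s in cube q.1 q.2, ‖f s‖ₑ ≠ ⊤ := fun q => by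
    refine ne_top_of_le_ne_top (hvt q) ?_
    calc ∫⁻ s in cube q.1 q.2, ‖f s‖ₑ ≤ ∫⁻ s in cube q.1 q.2, 1 := by
          refine lintegral_mono fun s => (hfU s).trans ?_
          exact indicator_le_self' (fun _ _ => bot_le) s
      _ = _ := by simp
  refine ⟨g, hg, fun s => ?_, fun q hq => ⟨?_, ?_⟩⟩
  · by_cases hsO : s ∈ Om h α
    · rw [indicator_of_mem hsO]
      rw [om_eq_iUnion hs, mem_iUnion] at hsO
      obtain ⟨q, hq⟩ := hsO
      rw [hgc q s hq]
      refine (enorm_setAverage (hvt q.1) f).trans ?_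
      rw [volume_cube, mul_comm, ← div_eq_mul_inv]
      refine ENNReal.div_le_of_le_mul ?_
      have e : idx q.1.1 s = q.1.2 := hq
      calc ∫⁻ x in cube q.1.1 q.1.2, ‖f x‖ₑ ≤ ∫⁻ x in cube q.1.1 q.1.2, h x :=
            lintegral_mono fun x => hfU x
        _ ≤ ∫⁻ x in cube (q.1.1 - 1) (idx (q.1.1 - 1) s), h x := by
            refine lintegral_mono_set ?_
            rw [← e]
            exact cube_subset (by omega) s
        _ ≤ α * cvol n (q.1.1 - 1) := q.2.2 _ (by omega) s hq
        _ = _ := by rw [cvol_sub_one]; ring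
    · have : g s = 0 := hgq none hsO
      simp [this]
  · have : ∫ s in cube q.1 q.2, (f s - g s) =
        ∫ s in cube q.1 q.2, (f s - ⨍ s in cube q.1 q.2, f s) :=
      setIntegral_congr_fun (measurableSet_cube _ _) fun s hs => by
        simp only [hgc ⟨q, hq⟩ s hs]
    rw [this]
    have : IsFiniteMeasure (volume.restrict (cube q.1 q.2 : Set (Rn n))) :=
      isFiniteMeasure_restrict.2 (hvt q)
    exact integral_sub_average _ f
  · calc ∫⁻ s in cube q.1 q.2, ‖f s - g s‖ₑ
        ≤ ∫⁻ s in cube q.1 q.2, (‖f s‖ₑ + (volume (cube q.1 q.2 : Set (Rn n)))⁻¹ *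
            ∫⁻ s in cube q.1 q.2, ‖f s‖ₑ) := by
          refine setLIntegral_mono' (measurableSet_cube _ _) fun s hs => ?_
          refine enorm_sub_le.trans (add_le_add le_rfl ?_)
          rw [hgc ⟨q, hq⟩ s hs]
          exact enorm_setAverage (hvt q) f
      _ = _ := by
          rw [lintegral_add_right _ measurable_const, setLIntegral_const, mul_comm, ← mul_assoc,
            ENNReal.mul_inv_cancel (by rw [volume_cube]; exact cvol_pos _) (hvt q), one_mul, two_mul]

end CZ

section Weak

variable {n : ℕ} {ρ : ℤ → ℝ} {C₀ X b : ℝ} {κ : ℤ → ℝ → Rn n → ℂ} {f : Rn n → ℂ}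

/-- The square function is bounded on `L²` with squared norm at most `B`. -/
def L2Bdd (κ : ℤ → ℝ → Rn n → ℂ) (B : ℝ≥0∞) : Prop :=
  ∀ f : Rn n → ℂ, Measurable f → Integrable f → (∃ M : ℝ, ∀ s, ‖f s‖ ≤ M) →
    ∫⁻ x, SS κ f x ^ (2 : ℝ) ≤ B * ∫⁻ x, ‖f x‖ₑ ^ (2 : ℝ)

lemma KerFam.SS_le_tsum (hκ : KerFam ρ C₀ X κ) (hf : Integrable f) {ι : Type*} [Countable ι]
    {A : ι → Set (Rn n)} (hA : ∀ i, MeasurableSet (A i)) (hd : Pairwise (Function.onFun Disjoint A))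
    (h0 : ∀ s ∉ ⋃ i, A i, f s = 0) (x : Rn n) :
    SS κ f x ≤ ∑' i, SS κ ((A i).indicator f) x := by
  refine le_trans (nrm_mono fun k v => ?_)
    (nrm_tsum_le fun i k => hκ.measurable_T (hf.indicator (hA i)) k x)
  refine enorm_le_tsum_of_hasSum ?_
  have h1 := hasSum_integral_iUnion hA hd (hκ.integrable hf k x v).integrableOn
  have e1 : ∫ s in ⋃ i, A i, f s * κ k v (x - s) = T κ k f x v :=
    setIntegral_eq_integral_of_forall_compl_eq_zero fun s hs => by rw [h0 s hs, zero_mul]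
  have e2 : ∀ i, ∫ s in A i, f s * κ k v (x - s) = T κ k ((A i).indicator f) x v := by
    intro i
    unfold T
    rw [← integral_indicator (hA i)]
    congr 1 with s
    by_cases hs : s ∈ A i <;> simp [hs]
  rw [e1] at h1
  simpa only [e2] using h1

lemma rpow_mul_meas_lt_le {S : Rn n → ℝ≥0∞} (hS : Measurable S) (c : ℝ≥0∞) :
    c ^ (2 : ℝ) * volume {x | c < S x} ≤ ∫⁻ x, S x ^ (2 : ℝ) := by
  refine le_trans (mul_le_mul' le_rfl (measure_mono fun x hx => ?_))
    (mul_meas_ge_le_lintegral (hS.pow_const (2 : ℝ)) (c ^ (2 : ℝ)))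
  exact ENNReal.rpow_le_rpow (show c < S x from hx).le (by norm_num)

lemma lintegral_enorm_sq_le {f : Rn n → ℂ} {E : Set (Rn n)} (hE : MeasurableSet E) {a : ℝ≥0∞}
    (hf : ∀ s, ‖f s‖ₑ ≤ E.indicator (fun _ => a) s) :
    ∫⁻ s, ‖f s‖ₑ ^ (2 : ℝ) ≤ a ^ (2 : ℝ) * volume E := by
  rw [← lintegral_indicator_const hE]
  refine lintegral_mono fun s => ?_
  have := hf s
  by_cases h : s ∈ E
  · rw [indicator_of_mem h] at this ⊢
    exact ENNReal.rpow_le_rpow this (by norm_num)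
  · rw [indicator_of_notMem h] at this
    simp [h, le_antisymm this bot_le]

lemma lintegral_enorm_le {f : Rn n → ℂ} {E : Set (Rn n)} (hE : MeasurableSet E) {a : ℝ≥0∞}
    (hf : ∀ s, ‖f s‖ₑ ≤ E.indicator (fun _ => a) s) :
    ∫⁻ s, ‖f s‖ₑ ≤ a * volume E := by
  rw [← lintegral_indicator_const hE]
  exact lintegral_mono hf

lemma integrable_of_le_indicator {f : Rn n → ℂ} {E : Set (Rn n)} (hm : Measurable f)
    (hE : MeasurableSet E) (hEt : volume E ≠ ⊤) {a : ℝ≥0∞} (ha : a ≠ ⊤)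
    (hf : ∀ s, ‖f s‖ₑ ≤ E.indicator (fun _ => a) s) : Integrable f :=
  ⟨hm.aestronglyMeasurable, lt_of_le_of_lt (lintegral_enorm_le hE hf)
    (ENNReal.mul_lt_top ha.lt_top hEt.lt_top)⟩

lemma norm_le_of_le_indicator {f : Rn n → ℂ} {E : Set (Rn n)} {a : ℝ≥0∞} (ha : a ≠ ⊤)
    (hf : ∀ s, ‖f s‖ₑ ≤ E.indicator (fun _ => a) s) (s : Rn n) : ‖f s‖ ≤ a.toReal := by
  have : ‖f s‖ₑ ≤ a := (hf s).trans (indicator_le_self' (fun _ _ => bot_le) s)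
  rw [← ofReal_norm] at this
  rwa [← ENNReal.ofReal_le_iff_le_toReal ha]

lemma lintegral_SS_bad_le (hκ : KerFam ρ C₀ X κ) (hρ : IsLac ρ b) (hC : 1 ≤ C₀)
    (hX : 1 ≤ X) {ε : ℝ} (hε : 0 < ε) (hε1 : ε ≤ 1) (hn : n ≠ 0) {ι : Type*} [Countable ι]
    {Q : ι → ℤ × (Fin n → ℤ)} (hd : Pairwise (Function.onFun Disjoint
      fun i => (cube (Q i).1 (Q i).2 : Set (Rn n))))
    (hf : Integrable f) (h0 : ∀ s ∉ ⋃ i, (cube (Q i).1 (Q i).2 : Set (Rn n)), f s = 0)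
    (hm : ∀ i, ∫ s in cube (Q i).1 (Q i).2, f s = 0) :
    ∃ G : Set (Rn n), MeasurableSet G ∧
      volume G ≤ ENNReal.ofReal ((2 * n : ℝ) ^ n) * volume (Metric.ball (0 : Rn n) 1) *
        ∑' i, cvol n (Q i).1 ∧
      ∫⁻ x in Gᶜ, SS κ f x ≤ farC n C₀ b ε * ENNReal.ofReal (X ^ ε) *
        ∑' i, ∫⁻ s in cube (Q i).1 (Q i).2, ‖f s‖ₑ := by
  have hn' : (0 : ℝ) < n := by positivity
  have hne : ∀ i, ∃ c : Rn n, c ∈ (cube (Q i).1 (Q i).2 : Set (Rn n)) := fun i =>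
    nonempty_of_measure_ne_zero (μ := volume) (by rw [volume_cube]; exact cvol_pos _)
  choose c hc using hne
  set R : ι → ℝ := fun i => n * 2 ^ (-(Q i).1) with hR
  have hRpos : ∀ i, 0 < R i := fun i => by positivity
  refine ⟨⋃ i, Metric.closedBall (c i) (2 * R i),
    MeasurableSet.iUnion fun i => Metric.isClosed_closedBall.measurableSet, ?_, ?_⟩
  · refine (measure_iUnion_le _).trans ?_
    rw [← ENNReal.tsum_mul_left]
    refine ENNReal.tsum_le_tsum fun i => ?_
    rw [Measure.addHaar_closedBall _ _ (by positivity)]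
    simp only [finrank_euclideanSpace, Fintype.card_fin]
    have e : ENNReal.ofReal ((2 * R i) ^ n) = ENNReal.ofReal ((2 * n : ℝ) ^ n) * cvol n (Q i).1 := by
      rw [cvol, two_eq_ofReal, ← ENNReal.ofReal_mul (by positivity), hR]
      congr 1
      rw [← mul_assoc, mul_pow]
      congr 1
      rw [← neg_mul, Real.rpow_mul (by norm_num), Real.rpow_natCast]
      congr 1
      rw [← Real.rpow_intCast]
      push_cast
      rfl
    rw [e]
    exact le_of_eq (by ring)
  · calc ∫⁻ x in (⋃ i, Metric.closedBall (c i) (2 * R i))ᶜ, SS κ f x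
        ≤ ∫⁻ x in (⋃ i, Metric.closedBall (c i) (2 * R i))ᶜ,
            ∑' i, SS κ ((cube (Q i).1 (Q i).2).indicator f) x :=
          lintegral_mono fun x => hκ.SS_le_tsum hf (fun i => measurableSet_cube _ _) hd h0 x
      _ = ∑' i, ∫⁻ x in (⋃ i, Metric.closedBall (c i) (2 * R i))ᶜ,
            SS κ ((cube (Q i).1 (Q i).2).indicator f) x :=
          lintegral_tsum fun i =>
            (hκ.measurable_SS (hf.indicator (measurableSet_cube _ _))).aemeasurable
      _ ≤ ∑' i, ∫⁻ x in {x | 2 * R i < ‖x - c i‖},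
            SS κ ((cube (Q i).1 (Q i).2).indicator f) x := by
          refine ENNReal.tsum_le_tsum fun i => lintegral_mono_set fun x hx => ?_
          simp only [mem_compl_iff, mem_iUnion, not_exists] at hx
          have := hx i
          rw [Metric.mem_closedBall, dist_eq_norm] at this
          exact not_le.1 this
      _ ≤ ∑' i, farC n C₀ b ε * ENNReal.ofReal (X ^ ε) *
            ∫⁻ s, ‖((cube (Q i).1 (Q i).2).indicator f) s‖ₑ := by
          refine ENNReal.tsum_le_tsum fun i => ?_
          refine hκ.lintegral_SS_far_le hρ hC hX hε hε1 (hf.indicator (measurableSet_cube _ _)) ?_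
            (hRpos i) fun s hs => ?_
          · rw [integral_indicator (measurableSet_cube _ _)]
            exact hm i
          · refine indicator_of_notMem (fun hmem => ?_) _
            exact absurd (norm_sub_le_of_mem_cube hmem (hc i)) (not_le.2 hs)
      _ = _ := by
          rw [ENNReal.tsum_mul_left]
          congr 2 with i
          simp_rw [enorm_indicator_eq_indicator_enorm]
          rw [lintegral_indicator (measurableSet_cube _ _)]

/-- Weak type bound for the square function on characteristic-type functions. -/
lemma weak_type (hρ : IsLac ρ b) (hC : 1 ≤ C₀) {ε : ℝ} (hε : 0 < ε) (hε1 : ε ≤ 1) (hn : n ≠ 0) :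
    ∃ C : ℝ≥0∞, C ≠ ⊤ ∧ ∀ (X : ℝ) (κ : ℤ → ℝ → Rn n → ℂ) (B : ℝ≥0∞), 1 ≤ X →
      KerFam ρ C₀ X κ → L2Bdd κ B → ∀ (f : Rn n → ℂ) (E : Set (Rn n)), Measurable f →
      MeasurableSet E → volume E ≠ ⊤ → (∀ s, ‖f s‖ₑ ≤ E.indicator (fun _ => 1) s) →
      ∀ α : ℝ≥0∞, α ≠ 0 → α ≠ ⊤ → α * volume {x | α < SS κ f x} ≤
        C * (B + ENNReal.ofReal (X ^ ε)) * volume E := by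
  set D : ℝ≥0∞ := ENNReal.ofReal ((2 * n : ℝ) ^ n) * volume (Metric.ball (0 : Rn n) 1) with hD
  have hDt : D ≠ ⊤ := ENNReal.mul_ne_top ENNReal.ofReal_ne_top measure_ball_lt_top.ne
  have hF : farC n C₀ b ε ≠ ⊤ := farC_ne_top hρ.one_lt hε
  have h2n : two n ≠ ⊤ := two_ne_top _
  refine ⟨1 + 8 * two n ^ 2 + 2 * D + 4 * farC n C₀ b ε, by finiteness, ?_⟩
  intro X κ B hX hκ hB f E hf hE hEt hfE α hα hαt
  set F := farC n C₀ b ε with hFdef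
  set Y := ENNReal.ofReal (X ^ ε) with hY
  have hY1 : 1 ≤ Y := by
    rw [hY, ENNReal.one_le_ofReal]
    exact Real.one_le_rpow hX hε.le
  have hfi : Integrable f := integrable_of_le_indicator hf hE hEt (by norm_num) hfE
  by_cases hα1 : 1 ≤ α
  · have h1 : α ^ (2 : ℝ) * volume {x | α < SS κ f x} ≤ B * volume E := by
      refine le_trans ?_ ((hB f hf hfi ⟨_, norm_le_of_le_indicator (by norm_num) hfE⟩).trans
        (mul_le_mul' le_rfl (lintegral_enorm_sq_le hE hfE)) |>.trans (by simp))
      exact rpow_mul_meas_lt_le (hκ.measurable_SS hfi) α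
    calc α * volume {x | α < SS κ f x} ≤ α ^ (2 : ℝ) * volume {x | α < SS κ f x} := by
          refine mul_le_mul' ?_ le_rfl
          rw [ENNReal.rpow_two, sq]
          exact le_mul_of_one_le_left bot_le hα1
      _ ≤ B * volume E := h1
      _ ≤ 1 * (B + Y) * volume E := by rw [one_mul]; gcongr; exact le_self_add
      _ ≤ _ := by gcongr; rw [add_assoc, add_assoc]; exact le_self_add
  rw [not_le] at hα1
  by_cases hE0 : volume E = 0
  · have hf0 : f =ᵐ[volume] 0 := by
      filter_upwards [measure_eq_zero_iff_ae_notMem.1 hE0] with s hs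
      have := hfE s
      rw [indicator_of_notMem hs] at this
      simpa using this
    have : ∀ x, SS κ f x = 0 := by
      intro x
      have hT : ∀ k v, T κ k f x v = 0 := fun k v => by
        unfold T
        refine integral_eq_zero_of_ae ?_
        filter_upwards [hf0] with s hs
        simp [hs]
      simp [SS, nrm, hT]
    simp [this]
  obtain ⟨U, hEU, hUo, hUE⟩ := Set.exists_isOpen_le_add E volume hE0
  rw [← two_mul] at hUE
  have hUt : volume U ≠ ⊤ := ne_top_of_le_ne_top (ENNReal.mul_ne_top (by norm_num) hEt) hUE
  set h : Rn n → ℝ≥0∞ := U.indicator fun _ => 1 with hh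
  have hs : EvSmall h α := evSmall_indicator hn hUo.measurableSet hUt hα
  have hfU : ∀ s, ‖f s‖ₑ ≤ h s := fun s => (hfE s).trans
    (indicator_le_indicator_of_subset hEU (fun _ => bot_le) s)
  obtain ⟨g, hg, hgO, hgq⟩ := exists_calderon_zygmund hn hUo.measurableSet hUt hfU hα
  have hOm := measurableSet_om hs
  have hO : α * volume (Om h α) ≤ 2 * volume E := by
    refine (mul_volume_om_le hs).trans ((setLIntegral_le_lintegral _ _).trans ?_)
    rw [hh, lintegral_indicator_const hUo.measurableSet, one_mul]
    exact hUE
  have hOt : volume (Om h α) ≠ ⊤ := fun hcon => by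
    rw [hcon, ENNReal.mul_top hα, top_le_iff] at hO
    exact ENNReal.mul_ne_top (by norm_num) hEt hO
  have hUO : U ⊆ Om h α := fun x hx => by
    refine mem_om_of_continuousAt ?_ ?_
    · refine (continuousAt_const (y := (1 : ℝ≥0∞))).congr ?_
      filter_upwards [hUo.mem_nhds hx] with y hy
      rw [hh, indicator_of_mem hy]
    · rw [hh, indicator_of_mem hx]
      exact hα1
  have hat : two n * α ≠ ⊤ := by finiteness
  have hgi : Integrable g := integrable_of_le_indicator hg hOm hOt hat hgO
  set β := fun s => f s - g s with hβ
  have hβi : Integrable β := hfi.sub hgi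
  have hg2 : volume {x | α / 2 < SS κ g x} * α ≤ 8 * two n ^ 2 * B * volume E := by
    have h1 : (α / 2) ^ (2 : ℝ) * volume {x | α / 2 < SS κ g x} ≤
        B * ((two n * α) ^ (2 : ℝ) * volume (Om h α)) := by
      refine le_trans ?_ ((hB g hg hgi ⟨_, norm_le_of_le_indicator hat hgO⟩).trans
        (mul_le_mul' le_rfl (lintegral_enorm_sq_le hOm hgO)))
      exact rpow_mul_meas_lt_le (hκ.measurable_SS hgi) _
    have key : ∀ V : ℝ≥0∞, α * (V * α) = 4 * ((α / 2) ^ (2 : ℝ) * V) := by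
      intro V
      rw [ENNReal.rpow_two]
      obtain ⟨γ, hγ⟩ : ∃ γ, γ = α / 2 := ⟨_, rfl⟩
      have : α = 2 * γ := by
        rw [hγ, ENNReal.mul_div_cancel (by norm_num) (by norm_num)]
      rw [← hγ, this]
      ring
    have h2 : α * (volume {x | α / 2 < SS κ g x} * α) ≤ α * (8 * two n ^ 2 * B * volume E) := by
      calc α * (volume {x | α / 2 < SS κ g x} * α)
          = 4 * ((α / 2) ^ (2 : ℝ) * volume {x | α / 2 < SS κ g x}) := by
            rw [key]
        _ ≤ 4 * (B * ((two n * α) ^ (2 : ℝ) * volume (Om h α))) := by gcongr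
        _ = α * (4 * B * two n ^ 2 * (α * volume (Om h α))) := by rw [ENNReal.rpow_two]; ring
        _ ≤ α * (4 * B * two n ^ 2 * (2 * volume E)) := by gcongr
        _ = _ := by ring
    exact (ENNReal.mul_le_mul_iff_right hα hαt).1 h2
  obtain ⟨G, hGm, hGv, hGi⟩ := lintegral_SS_bad_le (f := β) (Q := fun q : Stop h α => q.1) hκ hρ hC
    hX hε hε1 hn pairwise_disjoint_stop hβi (fun s hs' => by
      rw [← om_eq_iUnion hs] at hs'
      have h1 := hgO s
      rw [indicator_of_notMem hs'] at h1
      have h2 := hfU s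
      rw [hh, indicator_of_notMem fun h => hs' (hUO h)] at h2
      have h1' : g s = 0 := by simpa using h1
      have h2' : f s = 0 := by simpa using h2
      simp [hβ, h1', h2']) fun q => (hgq q.1 q.2).1
  rw [← volume_om hs] at hGv
  have hsum : ∑' q : Stop h α, ∫⁻ s in cube q.1.1 q.1.2, ‖β s‖ₑ ≤ 2 * volume E := by
    calc ∑' q : Stop h α, ∫⁻ s in cube q.1.1 q.1.2, ‖β s‖ₑ
        ≤ ∑' q : Stop h α, 2 * ∫⁻ s in cube q.1.1 q.1.2, ‖f s‖ₑ :=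
          ENNReal.tsum_le_tsum fun q => (hgq q.1 q.2).2
      _ = 2 * ∫⁻ s in Om h α, ‖f s‖ₑ := by rw [ENNReal.tsum_mul_left, lintegral_om hs]
      _ ≤ 2 * ∫⁻ s, ‖f s‖ₑ := by gcongr; exact Measure.restrict_le_self
      _ ≤ 2 * (1 * volume E) := by gcongr; exact lintegral_enorm_le hE hfE
      _ = _ := by rw [one_mul]
  have hb2 : volume (Gᶜ ∩ {x | α / 2 < SS κ β x}) * α ≤ 4 * F * Y * volume E := by
    have h1 : α / 2 * volume (Gᶜ ∩ {x | α / 2 < SS κ β x}) ≤ F * Y * (2 * volume E) := by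
      calc α / 2 * volume (Gᶜ ∩ {x | α / 2 < SS κ β x})
          ≤ α / 2 * volume.restrict Gᶜ {x | α / 2 ≤ SS κ β x} := by
            refine mul_le_mul' le_rfl ?_
            rw [inter_comm]
            refine le_trans ?_ (Measure.le_restrict_apply _ _)
            exact measure_mono (inter_subset_inter_left _ fun x hx =>
              (show α / 2 < SS κ β x from hx).le)
        _ ≤ ∫⁻ x in Gᶜ, SS κ β x := mul_meas_ge_le_lintegral (hκ.measurable_SS hβi) _
        _ ≤ _ := hGi.trans (mul_le_mul' le_rfl hsum)
    calc volume (Gᶜ ∩ {x | α / 2 < SS κ β x}) * α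
        = 2 * (α / 2 * volume (Gᶜ ∩ {x | α / 2 < SS κ β x})) := by
          rw [← mul_assoc, ENNReal.mul_div_cancel (by norm_num) (by norm_num), mul_comm]
      _ ≤ 2 * (F * Y * (2 * volume E)) := by gcongr
      _ = _ := by ring
  have hG2 : volume G * α ≤ 2 * D * volume E := by
    calc volume G * α ≤ D * volume (Om h α) * α := by gcongr
      _ = D * (α * volume (Om h α)) := by ring
      _ ≤ D * (2 * volume E) := by gcongr
      _ = _ := by ring
  have hsub : {x | α < SS κ f x} ⊆ {x | α / 2 < SS κ g x} ∪ (G ∪ (Gᶜ ∩ {x | α / 2 < SS κ β x})) := by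
    intro x hx
    by_contra hcon
    simp only [mem_union, mem_inter_iff, mem_compl_iff, mem_ofPred_eq, not_or, not_and, not_lt]
      at hcon hx
    have h1 := hcon.1
    have h2 := hcon.2.2 hcon.2.1
    have h3 := hκ.SS_le_add_sub hfi hgi x
    exact absurd (h3.trans (add_le_add h1 h2)) (by rw [ENNReal.add_halves]; exact not_le.2 hx)
  calc α * volume {x | α < SS κ f x}
      ≤ α * (volume {x | α / 2 < SS κ g x} + (volume G + volume (Gᶜ ∩ {x | α / 2 < SS κ β x}))) := by
        gcongr
        exact (measure_mono hsub).trans ((measure_union_le _ _).trans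
          (add_le_add le_rfl (measure_union_le _ _)))
    _ = volume {x | α / 2 < SS κ g x} * α +
          (volume G * α + volume (Gᶜ ∩ {x | α / 2 < SS κ β x}) * α) := by ring
    _ ≤ 8 * two n ^ 2 * B * volume E + (2 * D * volume E + 4 * F * Y * volume E) := by gcongr
    _ ≤ 8 * two n ^ 2 * (B + Y) * volume E + (2 * D * (B + Y) * volume E +
          4 * F * (B + Y) * volume E) := by
        have e1 : B ≤ B + Y := le_self_add
        have e2 : Y ≤ B + Y := le_add_self
        have e3 : 2 * D ≤ 2 * D * (B + Y) := le_mul_of_one_le_right bot_le (hY1.trans e2)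
        gcongr
    _ ≤ (B + Y) * volume E + (8 * two n ^ 2 * (B + Y) * volume E + (2 * D * (B + Y) * volume E +
          4 * F * (B + Y) * volume E)) := le_add_self
    _ = _ := by ring

end Weak

section Interpolation

variable {α : Type*} [MeasurableSpace α] {μ : Measure α}

lemma lintegral_rpow_le_of_weak {q Q : ℝ} (hq : 1 < q) (hQ : q < Q) :
    ∃ C : ℝ≥0∞, C ≠ ⊤ ∧ ∀ {α : Type} [MeasurableSpace α] (μ : Measure α) (S : α → ℝ≥0∞)
      (W : ℝ≥0∞), Measurable S →
      (∀ t : ℝ≥0∞, t ≠ 0 → t ≠ ⊤ → t * μ {x | t < S x} ≤ W) →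
      (∀ t : ℝ≥0∞, t ≠ 0 → t ≠ ⊤ → t ^ Q * μ {x | t < S x} ≤ W) →
      ∫⁻ x, S x ^ q ∂μ ≤ C * W := by
  obtain ⟨s, hs, h1, h2⟩ : ∃ s > 0, s ≤ q - 1 ∧ s ≤ Q - q :=
    ⟨min (q - 1) (Q - q), lt_min (by linarith) (by linarith), min_le_left _ _, min_le_right _ _⟩
  refine ⟨two q * ∑' a : ℤ, two (-(s * |(a : ℝ)|)),
    ENNReal.mul_ne_top (two_ne_top _) (tsum_two_neg_abs_ne_top hs), ?_⟩
  intro α _ μ S W hS hw1 hwQ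
  refine (lintegral_rpow_le_tsum_dyadic (by linarith) hS).trans ?_
  rw [mul_assoc, ← ENNReal.tsum_mul_right, ← ENNReal.tsum_mul_left]
  refine ENNReal.tsum_le_tsum fun a => ?_
  rw [show ((a : ℝ) + 1) * q = q + a * q by ring, two_add, mul_assoc]
  refine mul_le_mul' le_rfl ?_
  have e : ∀ P : ℝ, two a ^ P * μ {x | two a < S x} ≤ W → a * (q - P) ≤ -(s * |(a : ℝ)|) →
      two (a * q) * μ {x | two a < S x} ≤ two (-(s * |(a : ℝ)|)) * W := by
    intro P hP hle
    calc two (a * q) * μ {x | two a < S x}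
        = two (a * (q - P)) * (two a ^ P * μ {x | two a < S x}) := by
          rw [two_rpow, ← mul_assoc, ← two_add]
          congr 2; ring
      _ ≤ _ := mul_le_mul' (two_mono hle) hP
  rcases le_total (a : ℝ) 0 with ha | ha
  · refine e 1 (by simpa using hw1 (two a) (two_pos _).ne' (two_ne_top _)) ?_
    rw [abs_of_nonpos ha]
    nlinarith
  · refine e Q (hwQ (two a) (two_pos _).ne' (two_ne_top _)) ?_
    rw [abs_of_nonneg ha]
    nlinarith

lemma lintegral_le_of_tendsto {g : ℕ → α → ℝ≥0∞} {G : α → ℝ≥0∞} {W : ℝ≥0∞}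
    (hg : ∀ N, Measurable (g N)) (h : ∀ x, Tendsto (fun N => g N x) atTop (𝓝 (G x)))
    (hW : ∀ N, ∫⁻ x, g N x ∂μ ≤ W) : ∫⁻ x, G x ∂μ ≤ W := by
  calc ∫⁻ x, G x ∂μ = ∫⁻ x, liminf (fun N => g N x) atTop ∂μ := by simp_rw [(h _).liminf_eq]
    _ ≤ liminf (fun N => ∫⁻ x, g N x ∂μ) atTop := lintegral_liminf_le hg
    _ ≤ liminf (fun _ : ℕ => W) atTop := liminf_le_liminf (Eventually.of_forall hW)
    _ = W := liminf_const _

end Interpolation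

section Strong

variable {n : ℕ} {ρ : ℤ → ℝ} {C₀ b : ℝ}

lemma strong_type_lt_two (hρ : IsLac ρ b) (hC : 1 ≤ C₀) {ε : ℝ} (hε : 0 < ε) (hε1 : ε ≤ 1)
    (hn : n ≠ 0) {q : ℝ} (hq : 1 < q) (hq2 : q < 2) :
    ∃ C : ℝ≥0∞, C ≠ ⊤ ∧ ∀ (X : ℝ) (κ : ℤ → ℝ → Rn n → ℂ) (B : ℝ≥0∞), 1 ≤ X →
      KerFam ρ C₀ X κ → L2Bdd κ B → ∀ (f : Rn n → ℂ) (E : Set (Rn n)), Measurable f →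
      MeasurableSet E → volume E ≠ ⊤ → (∀ s, ‖f s‖ₑ ≤ E.indicator (fun _ => 1) s) →
      ∫⁻ x, SS κ f x ^ q ≤ C * (B + ENNReal.ofReal (X ^ ε)) * volume E := by
  obtain ⟨C, hCt, hw⟩ := weak_type (n := n) hρ hC hε hε1 hn
  obtain ⟨C', hCt', hi⟩ := lintegral_rpow_le_of_weak hq hq2
  refine ⟨C' * (1 + C), by finiteness, ?_⟩
  intro X κ B hX hκ hB f E hf hE hEt hfE
  have hfi : Integrable f := integrable_of_le_indicator hf hE hEt (by norm_num) hfE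
  rw [mul_assoc, mul_assoc]
  refine hi volume _ _ (hκ.measurable_SS hfi) (fun t h0 ht => ?_) fun t h0 ht => ?_
  · refine (hw X κ B hX hκ hB f E hf hE hEt hfE t h0 ht).trans ?_
    rw [mul_assoc]
    gcongr
    exact le_add_self
  · refine (rpow_mul_meas_lt_le (hκ.measurable_SS hfi) t).trans ?_
    refine (hB f hf hfi ⟨_, norm_le_of_le_indicator (by norm_num) hfE⟩).trans
      ((mul_le_mul' le_rfl (lintegral_enorm_sq_le hE hfE)).trans ?_)
    rw [ENNReal.one_rpow, one_mul, add_mul, one_mul, add_mul, add_assoc]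
    exact le_self_add

end Strong

section Maximal

variable {n : ℕ} {ρ : ℤ → ℝ} {C₀ b : ℝ}

/-- The maximal function of `E` over balls of radii comparable to `ρ k`. -/
def MM (ρ : ℤ → ℝ) (C₀ : ℝ) (E : Set (Rn n)) (x : Rn n) : ℝ≥0∞ :=
  ⨆ k, ENNReal.ofReal (1 / ρ k ^ n) * volume (Metric.closedBall x (C₀ * ρ k) ∩ E)

lemma measurable_MM {E : Set (Rn n)} (hE : MeasurableSet E) : Measurable (MM ρ C₀ E) := by
  refine Measurable.iSup fun k => Measurable.const_mul ?_ _
  have e : ∀ x : Rn n, volume (Metric.closedBall x (C₀ * ρ k) ∩ E) =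
      ∫⁻ y, ({p : Rn n × Rn n | dist p.2 p.1 ≤ C₀ * ρ k ∧ p.2 ∈ E}.indicator fun _ => 1) (x, y) := by
    intro x
    rw [← lintegral_indicator_one (Metric.isClosed_closedBall.measurableSet.inter hE)]
    rfl
  simp_rw [e]
  refine Measurable.lintegral_prod_right' (measurable_const.indicator ?_)
  exact (measurableSet_le (by fun_prop : Measurable fun p : Rn n × Rn n => dist p.2 p.1)
    measurable_const).inter (measurable_snd hE)

lemma MM_le (hρ : IsLac ρ b) (hC : 0 ≤ C₀) (E : Set (Rn n)) (x : Rn n) :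
    MM ρ C₀ E x ≤ volume (Metric.closedBall (0 : Rn n) C₀) := by
  refine iSup_le fun k => ?_
  have hk := hρ.pos k
  calc ENNReal.ofReal (1 / ρ k ^ n) * volume (Metric.closedBall x (C₀ * ρ k) ∩ E)
      ≤ ENNReal.ofReal (1 / ρ k ^ n) * volume (Metric.closedBall x (ρ k * C₀)) := by
        rw [mul_comm C₀]
        gcongr
        exact inter_subset_left
    _ = _ := by
        rw [Measure.addHaar_closedBall_mul _ _ hk.le hC, ← mul_assoc,
          ← ENNReal.ofReal_mul (by positivity)]
        simp [hk.ne']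

lemma mul_meas_MM_le (hρ : IsLac ρ b) (hC : 1 ≤ C₀) (hn : n ≠ 0) {E : Set (Rn n)}
    (hE : MeasurableSet E) (hEt : volume E ≠ ⊤)
    {t : ℝ≥0∞} (ht : t ≠ 0) (htt : t ≠ ⊤) :
    t * volume {x | t < MM ρ C₀ E x} ≤ volume (Metric.closedBall (0 : Rn n) (4 * C₀)) * volume E := by
  set V := volume (Metric.closedBall (0 : Rn n) (4 * C₀)) with hV
  set S : Set (Rn n × ℤ) := {q | t * ENNReal.ofReal (ρ q.2 ^ n) <
    volume (Metric.closedBall q.1 (C₀ * ρ q.2) ∩ E)} with hS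
  have hbdd : ∀ q ∈ S, C₀ * ρ q.2 ≤ C₀ * (1 + (volume E / t).toReal) := by
    intro q hq
    have hk := hρ.pos q.2
    have h1 : ENNReal.ofReal (ρ q.2 ^ n) ≤ volume E / t := by
      rw [ENNReal.le_div_iff_mul_le (Or.inl ht) (Or.inl htt), mul_comm]
      exact (le_of_lt hq).trans (measure_mono inter_subset_right)
    have h2 : ρ q.2 ^ n ≤ (volume E / t).toReal := by
      rwa [← ENNReal.ofReal_le_iff_le_toReal (by finiteness)]
    refine mul_le_mul_of_nonneg_left ?_ (by linarith)
    rcases le_total (ρ q.2) 1 with h | h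
    · linarith [(volume E / t).toReal_nonneg]
    · linarith [le_self_pow₀ h hn]
  obtain ⟨u, huS, hud, hu⟩ := Vitali.exists_disjoint_subfamily_covering_enlargement_closedBall S
    (fun q => q.1) (fun q => C₀ * ρ q.2) _ hbdd 4 (by norm_num)
  have huc : u.Countable := hud.countable_of_nonempty_interior fun q hq => by
    refine (Metric.nonempty_ball.2 ?_).mono (interior_mono Metric.ball_subset_closedBall |>.trans'
      Metric.isOpen_ball.interior_eq.ge)
    have := hρ.pos q.2
    positivity
  have hcov : {x | t < MM ρ C₀ E x} ⊆ ⋃ q ∈ u, Metric.closedBall q.1 (4 * (C₀ * ρ q.2)) := by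
    intro x hx
    obtain ⟨k, hk⟩ := lt_iSup_iff.1 (show t < MM ρ C₀ E x from hx)
    have hρk := hρ.pos k
    have hmem : (x, k) ∈ S := by
      have e1 : ENNReal.ofReal (1 / ρ k ^ n) * ENNReal.ofReal (ρ k ^ n) = 1 := by
        rw [← ENNReal.ofReal_mul (by positivity)]
        simp [hρk.ne']
      have := ENNReal.mul_lt_mul_right (a := ENNReal.ofReal (ρ k ^ n))
        (by simpa using pow_pos hρk n) ENNReal.ofReal_ne_top hk
      change t * ENNReal.ofReal (ρ k ^ n) < volume (Metric.closedBall x (C₀ * ρ k) ∩ E)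
      rw [mul_comm]
      calc _ < _ := this
        _ = (ENNReal.ofReal (1 / ρ k ^ n) * ENNReal.ofReal (ρ k ^ n)) *
          volume (Metric.closedBall x (C₀ * ρ k) ∩ E) := by ring
        _ = _ := by rw [e1, one_mul]
    obtain ⟨q, hq, hsub⟩ := hu _ hmem
    refine mem_biUnion hq (hsub ?_)
    exact Metric.mem_closedBall_self (by positivity)
  have hcnt : Countable u := huc.to_subtype
  calc t * volume {x | t < MM ρ C₀ E x}
      ≤ t * ∑' q : u, volume (Metric.closedBall q.1.1 (4 * (C₀ * ρ q.1.2))) := by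
        refine mul_le_mul' le_rfl ((measure_mono hcov).trans ?_)
        exact measure_biUnion_le _ huc _
    _ = ∑' q : u, t * volume (Metric.closedBall q.1.1 (4 * (C₀ * ρ q.1.2))) :=
        ENNReal.tsum_mul_left.symm
    _ ≤ ∑' q : u, V * volume (Metric.closedBall q.1.1 (C₀ * ρ q.1.2) ∩ E) := by
        refine ENNReal.tsum_le_tsum fun q => ?_
        have hk := hρ.pos q.1.2
        rw [show 4 * (C₀ * ρ q.1.2) = ρ q.1.2 * (4 * C₀) by ring,
          Measure.addHaar_closedBall_mul _ _ hk.le (by positivity), ← mul_assoc, mul_comm, ← hV]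
        refine mul_le_mul' le_rfl (le_of_lt ?_)
        simp only [finrank_euclideanSpace, Fintype.card_fin]
        exact huS q.2
    _ = V * ∑' q : u, volume (Metric.closedBall q.1.1 (C₀ * ρ q.1.2) ∩ E) := ENNReal.tsum_mul_left
    _ ≤ V * volume E := by
        refine mul_le_mul' le_rfl ?_
        rw [← measure_iUnion]
        · exact measure_mono (iUnion_subset fun q => inter_subset_right)
        · intro q q' hne
          exact ((hud q.2 q'.2 fun h => hne (Subtype.ext h)).mono inter_subset_left
            inter_subset_left)
        · exact fun q => Metric.isClosed_closedBall.measurableSet.inter hE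

lemma lintegral_MM_rpow_le (hρ : IsLac ρ b) (hC : 1 ≤ C₀) (hn : n ≠ 0) {q : ℝ} (hq : 1 < q) :
    ∃ C : ℝ≥0∞, C ≠ ⊤ ∧ ∀ E : Set (Rn n), MeasurableSet E → volume E ≠ ⊤ →
      ∫⁻ x, MM ρ C₀ E x ^ q ≤ C * volume E := by
  obtain ⟨C, hCt, hi⟩ := lintegral_rpow_le_of_weak hq (lt_add_one q)
  set V := volume (Metric.closedBall (0 : Rn n) (4 * C₀)) with hV
  set V₁ := volume (Metric.closedBall (0 : Rn n) C₀) with hV₁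
  have hVt : V ≠ ⊤ := measure_closedBall_lt_top.ne
  have hV₁t : V₁ ≠ ⊤ := measure_closedBall_lt_top.ne
  refine ⟨C * ((1 + V₁ ^ q) * V), ?_, fun E hE hEt => ?_⟩
  · have : V₁ ^ q ≠ ⊤ := ENNReal.rpow_ne_top_of_nonneg (by linarith) hV₁t
    finiteness
  rw [mul_assoc, mul_assoc]
  have key := fun (t : ℝ≥0∞) h0 htt => mul_meas_MM_le (t := t) hρ hC hn hE hEt h0 htt
  refine hi volume _ _ (measurable_MM hE) (fun t h0 ht => ?_) fun t h0 ht => ?_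
  · refine (key t h0 ht).trans ?_
    rw [add_mul, one_mul]
    exact le_self_add
  · by_cases hlt : t < V₁
    · calc t ^ (q + 1) * volume {x | t < MM ρ C₀ E x}
          = t ^ q * (t * volume {x | t < MM ρ C₀ E x}) := by
            rw [ENNReal.rpow_add_of_nonneg _ _ (by linarith) (by norm_num), ENNReal.rpow_one,
              mul_assoc]
        _ ≤ V₁ ^ q * (V * volume E) := by
            refine mul_le_mul' (ENNReal.rpow_le_rpow hlt.le (by linarith)) (key t h0 ht)
        _ ≤ _ := mul_le_mul' le_add_self le_rfl
    · have : {x | t < MM ρ C₀ E x} = ∅ := by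
        ext x
        simp only [mem_ofPred_eq, mem_empty_iff_false, iff_false, not_lt]
        exact (MM_le hρ (by linarith) E x).trans (not_lt.1 hlt)
      simp [this]

end Maximal

section Osc

variable {n : ℕ} {ρ : ℤ → ℝ} {C₀ X b C₁ : ℝ} {κ : ℤ → ℝ → Rn n → ℂ} {f : Rn n → ℂ}

/-- The pointwise `L²` decay in the dilation parameter for bounded functions. -/
def PtDecay (κ : ℤ → ℝ → Rn n → ℂ) (D : ℝ) : Prop :=
  ∀ f : Rn n → ℂ, Measurable f → Integrable f → (∀ s, ‖f s‖ ≤ 1) → ∀ k x,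
    ∫⁻ v in Icc (1 : ℝ) 2, ‖T κ k f x v‖ₑ ^ (2 : ℝ) ≤ ENNReal.ofReal D

lemma KerFam.enorm_T_sub_le (hκ : KerFam ρ C₀ X κ) (hρ : IsLac ρ b) (hC : 1 ≤ C₀) (hX : 1 ≤ X)
    (hf : Integrable f) (hf1 : ∀ s, ‖f s‖ ≤ 1) {x y : Rn n} {R : ℝ} (hR : 0 ≤ R)
    (hxy : ‖y - x‖ ≤ R) (k : ℤ) {v : ℝ} (hv : v ∈ Icc (1 : ℝ) 2) :
    ‖T κ k f y v - T κ k f x v‖ₑ ≤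
      ENNReal.ofReal (2 * (volume (Metric.closedBall (0 : Rn n) C₀)).toReal * C₀ * (X * R / ρ k)) := by
  have hk := hρ.pos k
  have e : T κ k f y v - T κ k f x v = ∫ s, f s * (κ k v (y - s) - κ k v (x - s)) := by
    unfold T
    simp_rw [mul_sub]
    rw [integral_sub (hκ.integrable hf k y v) (hκ.integrable hf k x v)]
  rw [e]
  refine (enorm_integral_le_lintegral_enorm _).trans ?_
  set S : Set (Rn n) := Metric.closedBall y (ρ k * C₀) ∪ Metric.closedBall x (ρ k * C₀) with hS
  have hz : ∀ z s : Rn n, s ∉ Metric.closedBall z (ρ k * C₀) → κ k v (z - s) = 0 := by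
    intro z s hs
    refine hκ.supp _ _ _ ?_
    rw [Metric.mem_closedBall, dist_comm, dist_eq_norm, not_le] at hs
    linarith
  calc ∫⁻ s, ‖f s * (κ k v (y - s) - κ k v (x - s))‖ₑ
      ≤ ∫⁻ s, S.indicator (fun _ => ENNReal.ofReal (C₀ * X / ρ k ^ (n + 1) * R)) s := by
        refine lintegral_mono fun s => ?_
        by_cases hs : s ∈ S
        · rw [indicator_of_mem hs, ← ofReal_norm]
          refine ENNReal.ofReal_le_ofReal ?_
          rw [norm_mul]
          have h1 := hκ.lip k v hv (y - s) (x - s)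
          rw [show y - s - (x - s) = y - x by abel] at h1
          have h2 : C₀ * X / ρ k ^ (n + 1) * ‖y - x‖ ≤ C₀ * X / ρ k ^ (n + 1) * R := by gcongr
          calc _ ≤ 1 * (C₀ * X / ρ k ^ (n + 1) * R) :=
                mul_le_mul (hf1 s) (h1.trans h2) (norm_nonneg _) (by norm_num)
            _ = _ := one_mul _
        · rw [hS, mem_union, not_or] at hs
          simp [hz _ _ hs.1, hz _ _ hs.2]
    _ ≤ ENNReal.ofReal (C₀ * X / ρ k ^ (n + 1) * R) * volume S := lintegral_indicator_const_le _ _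
    _ ≤ ENNReal.ofReal (C₀ * X / ρ k ^ (n + 1) * R) *
          (2 * (ENNReal.ofReal (ρ k ^ n) * volume (Metric.closedBall (0 : Rn n) C₀))) := by
        refine mul_le_mul' le_rfl ((measure_union_le _ _).trans (le_of_eq ?_))
        rw [Measure.addHaar_closedBall_mul _ _ hk.le (by linarith),
          Measure.addHaar_closedBall_mul _ _ hk.le (by linarith), two_mul]
        simp only [finrank_euclideanSpace, Fintype.card_fin]
    _ = _ := by
        obtain ⟨W, hW⟩ : ∃ W, W = (volume (Metric.closedBall (0 : Rn n) C₀)).toReal := ⟨_, rfl⟩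
        have hW' : volume (Metric.closedBall (0 : Rn n) C₀) = ENNReal.ofReal W := by
          rw [hW, ENNReal.ofReal_toReal measure_closedBall_lt_top.ne]
        have hW0 : 0 ≤ W := hW ▸ ENNReal.toReal_nonneg
        rw [← hW, hW', ← ENNReal.ofReal_mul (by positivity), two_mul,
          ← ENNReal.ofReal_add (by positivity) (by positivity), ← ENNReal.ofReal_mul (by positivity)]
        congr 1
        field_simp
        ring

lemma PtDecay.sub_le (hκ : KerFam ρ C₀ X κ) {D : ℝ} (hD : 0 ≤ D) (hp : PtDecay κ D)
    (hm : Measurable f)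
    (hf : Integrable f) (hf1 : ∀ s, ‖f s‖ ≤ 1) (x y : Rn n) (k : ℤ) :
    (∫⁻ v in Icc (1 : ℝ) 2, ‖T κ k f y v - T κ k f x v‖ₑ ^ (2 : ℝ)) ^ (1 / (2 : ℝ)) ≤
      ENNReal.ofReal (2 * √D) := by
  have h1 : ∫⁻ v in Icc (1 : ℝ) 2, ‖T κ k f y v - T κ k f x v‖ₑ ^ (2 : ℝ) ≤
      ENNReal.ofReal ((2 * √D) ^ (2 : ℝ)) := by
    calc ∫⁻ v in Icc (1 : ℝ) 2, ‖T κ k f y v - T κ k f x v‖ₑ ^ (2 : ℝ)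
        ≤ ∫⁻ v in Icc (1 : ℝ) 2, (2 * ‖T κ k f y v‖ₑ ^ (2 : ℝ) + 2 * ‖T κ k f x v‖ₑ ^ (2 : ℝ)) := by
          refine lintegral_mono fun v => ?_
          refine (ENNReal.rpow_le_rpow enorm_sub_le (by norm_num)).trans ?_
          refine (ENNReal.rpow_add_le_mul_rpow_add_rpow _ _ (by norm_num)).trans (le_of_eq ?_)
          rw [show (2 : ℝ) - 1 = 1 by norm_num, ENNReal.rpow_one, mul_add]
      _ = 2 * (∫⁻ v in Icc (1 : ℝ) 2, ‖T κ k f y v‖ₑ ^ (2 : ℝ)) +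
            2 * ∫⁻ v in Icc (1 : ℝ) 2, ‖T κ k f x v‖ₑ ^ (2 : ℝ) := by
          rw [lintegral_add_left (((hκ.measurable_T hf k y).pow_const _).const_mul _),
            lintegral_const_mul _ ((hκ.measurable_T hf k y).pow_const _),
            lintegral_const_mul _ ((hκ.measurable_T hf k x).pow_const _)]
      _ ≤ 2 * ENNReal.ofReal D + 2 * ENNReal.ofReal D := by
          gcongr
          · exact hp f hm hf hf1 k y
          · exact hp f hm hf hf1 k x
      _ = _ := by
          rw [show (2 : ℝ≥0∞) = ENNReal.ofReal 2 by simp, ← ENNReal.ofReal_mul (by norm_num),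
            ← ENNReal.ofReal_add (by positivity) (by positivity)]
          congr 1
          rw [Real.rpow_two, mul_pow, Real.sq_sqrt hD]
          ring
  refine (ENNReal.rpow_le_rpow h1 (by norm_num)).trans (le_of_eq ?_)
  rw [ENNReal.ofReal_rpow_of_nonneg (by positivity) (by norm_num), ← Real.rpow_mul (by positivity)]
  norm_num

/-- Oscillation of the far part of the square function. -/
lemma nrm_T_sub_le (hρ : IsLac ρ b) (hC : 1 ≤ C₀) {ε : ℝ} (hε : 0 < ε) (hε1 : ε ≤ 1)
    (hC₁ : 0 ≤ C₁) :
    ∃ C : ℝ≥0∞, C ≠ ⊤ ∧ ∀ (X : ℝ) (κ : ℤ → ℝ → Rn n → ℂ), 1 ≤ X →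
      KerFam ρ C₀ X κ → PtDecay κ (C₁ / X) → ∀ (f : Rn n → ℂ), Measurable f → Integrable f →
      (∀ s, ‖f s‖ ≤ 1) → ∀ (x y : Rn n) (R : ℝ), 0 < R → ‖y - x‖ ≤ R →
      (∀ s, ‖s - x‖ ≤ 2 * R → f s = 0) →
      nrm (fun k v => ‖T κ k f y v - T κ k f x v‖ₑ) ≤ C * ENNReal.ofReal (X ^ (-(1 / 2) + ε)) := by
  set V := (volume (Metric.closedBall (0 : Rn n) C₀)).toReal with hV
  set M := 2 * √C₁ + 2 * V * C₀ with hM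
  have hV0 : 0 ≤ V := ENNReal.toReal_nonneg
  have hM0 : 0 ≤ M := by positivity
  set θ := 2 * ε / 3 with hθ
  have hθ0 : 0 < θ := by positivity
  have hθ1 : θ ≤ 1 := by linarith
  refine ⟨ENNReal.ofReal (M * C₀ ^ θ) * lacC b θ,
    ENNReal.mul_ne_top ENNReal.ofReal_ne_top (lacC_ne_top hρ.one_lt hθ0), ?_⟩
  intro X κ hX hκ hp f hm hf hf1 x y R hR hxy h0
  have hX0 : 0 < X := by linarith
  have hTm : ∀ k, Measurable fun v => ‖T κ k f y v - T κ k f x v‖ₑ := fun k =>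
    (((hκ.continuous_T hf k).comp (by fun_prop : Continuous fun v : ℝ => ((y, v) : Rn n × ℝ))).sub
      ((hκ.continuous_T hf k).comp
        (by fun_prop : Continuous fun v : ℝ => ((x, v) : Rn n × ℝ)))).enorm.measurable
  refine (nrm_le_tsum hTm).trans ?_
  have hterm : ∀ k, (∫⁻ v in Icc (1 : ℝ) 2, ‖T κ k f y v - T κ k f x v‖ₑ ^ (2 : ℝ)) ^ (1 / (2 : ℝ)) ≤
      ENNReal.ofReal (M * C₀ ^ θ) * ENNReal.ofReal (X ^ (-(1 / 2) + ε)) *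
        (if R / C₀ ≤ ρ k then ENNReal.ofReal ((R / C₀ / ρ k) ^ θ) else 0) := by
    intro k
    have hk := hρ.pos k
    by_cases hkR : R / C₀ ≤ ρ k
    · rw [if_pos hkR, ← ENNReal.ofReal_mul (by positivity), ← ENNReal.ofReal_mul (by positivity)]
      have b1 : (∫⁻ v in Icc (1 : ℝ) 2, ‖T κ k f y v - T κ k f x v‖ₑ ^ (2 : ℝ)) ^ (1 / (2 : ℝ)) ≤
          ENNReal.ofReal (M * X ^ (-(1 / 2) : ℝ)) := by
        refine (PtDecay.sub_le hκ (by positivity) hp hm hf hf1 x y k).trans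
          (ENNReal.ofReal_le_ofReal ?_)
        rw [Real.sqrt_div' _ hX0.le, Real.rpow_neg hX0.le, ← Real.sqrt_eq_rpow, hM,
          ← div_eq_mul_inv, ← mul_div_assoc]
        gcongr
        linarith [show 0 ≤ 2 * V * C₀ by positivity]
      have b2 : (∫⁻ v in Icc (1 : ℝ) 2, ‖T κ k f y v - T κ k f x v‖ₑ ^ (2 : ℝ)) ^ (1 / (2 : ℝ)) ≤
          ENNReal.ofReal (M * X ^ (-(1 / 2) : ℝ) * (X ^ (3 / 2 : ℝ) * R / ρ k)) := by
        calc _ ≤ (∫⁻ v in Icc (1 : ℝ) 2,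
              ENNReal.ofReal (2 * V * C₀ * (X * R / ρ k)) ^ (2 : ℝ)) ^ (1 / (2 : ℝ)) := by
              refine ENNReal.rpow_le_rpow (setLIntegral_mono' measurableSet_Icc fun v hv => ?_)
                (by norm_num)
              exact ENNReal.rpow_le_rpow
                (hκ.enorm_T_sub_le hρ hC hX hf hf1 hR.le hxy k hv) (by norm_num)
          _ = ENNReal.ofReal (2 * V * C₀ * (X * R / ρ k)) := by
              rw [setLIntegral_const, Real.volume_Icc]
              norm_num
              rw [← ENNReal.rpow_natCast, ← ENNReal.rpow_mul]
              norm_num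
          _ ≤ _ := by
              refine ENNReal.ofReal_le_ofReal ?_
              have e : X ^ (-(1 / 2) : ℝ) * (X ^ (3 / 2 : ℝ) * R / ρ k) = X * R / ρ k := by
                rw [mul_div_assoc, ← mul_assoc, ← Real.rpow_add hX0, mul_div_assoc]
                norm_num
              have e' : M * X ^ (-(1 / 2) : ℝ) * (X ^ (3 / 2 : ℝ) * R / ρ k) = M * (X * R / ρ k) := by
                rw [mul_assoc, e]
              rw [e']
              gcongr
              linarith [show 0 ≤ 2 * √C₁ by positivity]
      have e3 : M * C₀ ^ θ * X ^ (-(1 / 2) + ε) * (R / C₀ / ρ k) ^ θ =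
          M * X ^ (-(1 / 2) : ℝ) * (X ^ (3 / 2 : ℝ) * R / ρ k) ^ θ := by
        rw [show X ^ (3 / 2 : ℝ) * R / ρ k = C₀ * X ^ (3 / 2 : ℝ) * (R / C₀ / ρ k) by field_simp,
          Real.mul_rpow (by positivity) (by positivity),
          Real.mul_rpow (by positivity) (by positivity), ← Real.rpow_mul hX0.le,
          show 3 / 2 * θ = ε by rw [hθ]; ring, Real.rpow_add hX0]
        ring
      rw [e3]
      rcases le_total 1 (X ^ (3 / 2 : ℝ) * R / ρ k) with h | h
      · refine b1.trans (ENNReal.ofReal_le_ofReal ?_)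
        exact le_mul_of_one_le_right (by positivity) (Real.one_le_rpow h hθ0.le)
      · refine b2.trans (ENNReal.ofReal_le_ofReal ?_)
        refine mul_le_mul_of_nonneg_left ?_ (by positivity)
        conv_lhs => rw [← Real.rpow_one (X ^ (3 / 2 : ℝ) * R / ρ k)]
        exact Real.rpow_le_rpow_of_exponent_ge (by positivity) h hθ1
    · rw [if_neg hkR, mul_zero]
      rw [not_le, lt_div_iff₀ (by linarith)] at hkR
      have hz : ∀ z v, ‖z - x‖ ≤ R → T κ k f z v = 0 := by
        intro z v hzx
        unfold T
        refine integral_eq_zero_of_ae (Eventually.of_forall fun s => ?_)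
        change f s * κ k v (z - s) = 0
        by_cases hs : ‖s - x‖ ≤ 2 * R
        · rw [h0 s hs, zero_mul]
        · rw [hκ.supp k v, mul_zero]
          have : ‖s - x‖ ≤ ‖z - s‖ + ‖z - x‖ := by
            rw [norm_sub_rev z s]
            simpa using norm_add_le (s - z) (z - x)
          linarith
      simp [hz y _ hxy, hz x _ (by simpa using hR.le)]
  refine (ENNReal.tsum_le_tsum hterm).trans ?_
  rw [ENNReal.tsum_mul_left]
  refine (mul_le_mul' le_rfl (hρ.tsum_le hθ0 (by positivity))).trans (le_of_eq (by ring))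

end Osc

section LargeExponent

variable {n : ℕ} {ρ : ℤ → ℝ} {C₀ X b C₁ : ℝ} {κ : ℤ → ℝ → Rn n → ℂ} {f g : Rn n → ℂ} {D : ℝ}
  {B : ℝ≥0∞} {S : Finset ℤ}

lemma KerFam.SS_sub_le (hκ : KerFam ρ C₀ X κ) (hf : Integrable f) (hg : Integrable g) (x : Rn n) :
    SS κ (fun s => f s - g s) x ≤ SS κ f x + SS κ g x := by
  refine le_trans (nrm_mono fun k v => ?_) (nrm_add_le (fun k => hκ.measurable_T hf k x)
    fun k => hκ.measurable_T hg k x)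
  rw [hκ.T_sub hf hg]
  exact enorm_sub_le

lemma KerFam.SS_le_add_osc (hκ : KerFam ρ C₀ X κ) (hf : Integrable f) (x y : Rn n) :
    SS κ f y ≤ SS κ f x + nrm (fun k v => ‖T κ k f y v - T κ k f x v‖ₑ) := by
  refine le_trans (nrm_mono fun k v => ?_) (nrm_add_le (fun k => hκ.measurable_T hf k x)
    fun k => ?_)
  · conv_lhs => rw [show T κ k f y v = T κ k f x v + (T κ k f y v - T κ k f x v) by ring]
    exact enorm_add_le _ _
  · exact (((hκ.continuous_T hf k).comp
      (by fun_prop : Continuous fun v : ℝ => ((y, v) : Rn n × ℝ))).sub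
      ((hκ.continuous_T hf k).comp
        (by fun_prop : Continuous fun v : ℝ => ((x, v) : Rn n × ℝ)))).enorm.measurable

lemma setLIntegral_le_sqrt {α : Type*} [MeasurableSpace α] {μ : Measure α} {h : α → ℝ≥0∞}
    (hh : Measurable h) (Q : Set α) :
    ∫⁻ x in Q, h x ∂μ ≤ μ Q ^ (1 / (2 : ℝ)) * (∫⁻ x, h x ^ (2 : ℝ) ∂μ) ^ (1 / (2 : ℝ)) := by
  have := ENNReal.lintegral_mul_le_Lp_mul_Lq (μ.restrict Q)
    (Real.HolderConjugate.two_two) (f := fun _ => 1) (g := h) aemeasurable_const hh.aemeasurable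
  simp only [Pi.mul_apply, one_mul, ENNReal.one_rpow, lintegral_one,
    Measure.restrict_apply_univ] at this
  refine this.trans (mul_le_mul' le_rfl (ENNReal.rpow_le_rpow ?_ (by norm_num)))
  exact setLIntegral_le_lintegral _ _

lemma dyadicBMO_SS (hρ : IsLac ρ b) (hC : 1 ≤ C₀) {ε : ℝ} (hε : 0 < ε) (hε1 : ε ≤ 1)
    (hn : n ≠ 0) (hC₁ : 0 ≤ C₁) :
    ∃ C : ℝ≥0∞, C ≠ ⊤ ∧ C ≠ 0 ∧ ∀ (X : ℝ) (κ : ℤ → ℝ → Rn n → ℂ) (B : ℝ≥0∞), 1 ≤ X →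
      KerFam ρ C₀ X κ → L2Bdd κ B → PtDecay κ (C₁ / X) → ∀ (f : Rn n → ℂ), Measurable f →
      Integrable f → (∀ s, ‖f s‖ ≤ 1) →
      DyadicBMO (SS κ f) (C * (B ^ (1 / (2 : ℝ)) + ENNReal.ofReal (X ^ (-(1 / 2) + ε)))) := by
  obtain ⟨C, hCt, ho⟩ := nrm_T_sub_le (n := n) hρ hC hε hε1 hC₁
  obtain ⟨V, hV⟩ : ∃ V, V = volume (Metric.closedBall (0 : Rn n) 1) := ⟨_, rfl⟩
  have hVt : V ≠ ⊤ := hV ▸ measure_closedBall_lt_top.ne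
  set W := (ENNReal.ofReal ((2 * n) ^ n) * V) ^ (1 / (2 : ℝ)) with hW
  have hWt : W ≠ ⊤ := ENNReal.rpow_ne_top_of_nonneg (by norm_num) (by finiteness)
  refine ⟨W + C + 1, by finiteness, by simp, ?_⟩
  intro X κ B hX hκ hB hp f hm hf hf1 m x
  set R : ℝ := n * 2 ^ (-m) with hR
  have hn0 : (0 : ℝ) < n := by positivity
  have hR0 : 0 < R := by positivity
  set f₁ := (Metric.closedBall x (2 * R)).indicator f with hf₁
  have hf₁m : Measurable f₁ := hm.indicator Metric.isClosed_closedBall.measurableSet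
  have hf₁i : Integrable f₁ := hf.indicator Metric.isClosed_closedBall.measurableSet
  have hf₁1 : ∀ s, ‖f₁ s‖ ≤ 1 := fun s => (norm_indicator_le_norm_self _ _).trans (hf1 s)
  have hf₂i : Integrable fun s => f s - f₁ s := hf.sub hf₁i
  set d := C * ENNReal.ofReal (X ^ (-(1 / 2) + ε)) with hd
  have hf₂0 : ∀ s, ‖s - x‖ ≤ 2 * R → f s - f₁ s = 0 := by
    intro s hs
    rw [hf₁, indicator_of_mem (by rwa [Metric.mem_closedBall, dist_eq_norm]), sub_self]
  have hf₂1 : ∀ s, ‖f s - f₁ s‖ ≤ 1 := by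
    intro s
    by_cases hs : ‖s - x‖ ≤ 2 * R
    · rw [hf₂0 s hs]; simp
    · rw [hf₁, indicator_of_notMem (by rwa [Metric.mem_closedBall, dist_eq_norm]), sub_zero]
      exact hf1 s
  have hosc : ∀ y z : Rn n, ‖y - x‖ ≤ R → ‖z - x‖ ≤ R → (y = x ∨ z = x) →
      SS κ (fun s => f s - f₁ s) y ≤ SS κ (fun s => f s - f₁ s) z + d := by
    intro y z hy hz hyz
    refine (hκ.SS_le_add_osc hf₂i z y).trans (add_le_add le_rfl ?_)
    rcases hyz with rfl | rfl
    · refine (nrm_mono fun k v => ?_).trans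
        (ho X κ hX hκ hp _ (hm.sub hf₁m) hf₂i hf₂1 _ z R hR0 hz hf₂0)
      rw [← enorm_neg, neg_sub]
      exact le_rfl
    · exact ho X κ hX hκ hp _ (hm.sub hf₁m) hf₂i hf₂1 _ y R hR0 hy hf₂0
  refine ⟨SS κ (fun s => f s - f₁ s) x, fun y => SS κ f₁ y + d,
    (hκ.measurable_SS hf₁i).add_const _, fun y hy => ?_, ?_⟩
  · have hyx : ‖y - x‖ ≤ R := norm_sub_le_of_mem_cube hy (mem_cube_idx m x)
    have hxx : ‖x - x‖ ≤ R := by simpa using hR0.le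
    constructor
    · calc SS κ f y ≤ SS κ f₁ y + SS κ (fun s => f s - f₁ s) y := hκ.SS_le_add_sub hf hf₁i y
        _ ≤ SS κ f₁ y + (SS κ (fun s => f s - f₁ s) x + d) := by
            gcongr; exact hosc y x hyx hxx (Or.inr rfl)
        _ = _ := by ring
    · calc _ ≤ SS κ (fun s => f s - f₁ s) y + d := hosc x y hxx hyx (Or.inl rfl)
        _ ≤ SS κ f y + SS κ f₁ y + d := by
            gcongr; exact hκ.SS_sub_le hf hf₁i y
        _ = _ := by rw [add_assoc]
  · rw [lintegral_add_right _ measurable_const, setLIntegral_const, volume_cube]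
    have h1 : ∫⁻ y in cube m (idx m x), SS κ f₁ y ≤ W * B ^ (1 / (2 : ℝ)) * cvol n m := by
      refine (setLIntegral_le_sqrt (hκ.measurable_SS hf₁i) _).trans ?_
      have hb : ∀ s, ‖f₁ s‖ₑ ≤ (Metric.closedBall x (2 * R)).indicator (fun _ => 1) s := by
        intro s
        by_cases hs : s ∈ Metric.closedBall x (2 * R)
        · rw [indicator_of_mem hs, ← ofReal_norm, ENNReal.ofReal_le_one]
          exact hf₁1 s
        · rw [hf₁, indicator_of_notMem hs]; simp
      have hball : volume (Metric.closedBall x (2 * R)) =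
          ENNReal.ofReal ((2 * n) ^ n) * V * cvol n m := by
        rw [Measure.addHaar_closedBall' _ _ (by positivity), finrank_euclideanSpace,
          Fintype.card_fin, ← hV, cvol,
          two_eq_ofReal, mul_right_comm, ← ENNReal.ofReal_mul (by positivity)]
        congr 2
        rw [hR, ← mul_assoc, mul_pow]
        congr 1
        rw [← Real.rpow_intCast, ← Real.rpow_natCast, ← Real.rpow_mul (by norm_num)]
        push_cast
        congr 1
        ring
      have h2 : ∫⁻ y, SS κ f₁ y ^ (2 : ℝ) ≤ B * (ENNReal.ofReal ((2 * n) ^ n) * V * cvol n m) := by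
        refine (hB f₁ hf₁m hf₁i ⟨1, hf₁1⟩).trans (mul_le_mul' le_rfl ?_)
        refine (lintegral_enorm_sq_le Metric.isClosed_closedBall.measurableSet hb).trans ?_
        rw [hball]; simp
      refine (mul_le_mul' le_rfl (ENNReal.rpow_le_rpow h2 (by norm_num))).trans (le_of_eq ?_)
      rw [volume_cube, ENNReal.mul_rpow_of_nonneg _ _ (by norm_num),
        ENNReal.mul_rpow_of_nonneg _ _ (by norm_num), ← hW]
      have : cvol n m ^ (1 / (2 : ℝ)) * cvol n m ^ (1 / (2 : ℝ)) = cvol n m := by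
        rw [← ENNReal.rpow_add_of_nonneg _ _ (by norm_num) (by norm_num)]
        norm_num
      calc _ = W * B ^ (1 / (2 : ℝ)) * (cvol n m ^ (1 / (2 : ℝ)) * cvol n m ^ (1 / (2 : ℝ))) := by
            ring
        _ = _ := by rw [this]
    calc _ ≤ W * B ^ (1 / (2 : ℝ)) * cvol n m + d * cvol n m := by gcongr
      _ = (W * B ^ (1 / (2 : ℝ)) + C * ENNReal.ofReal (X ^ (-(1 / 2) + ε))) * cvol n m := by
          rw [hd]; ring
      _ ≤ _ := by
          gcongr
          rw [mul_add]
          gcongr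
          · rw [add_assoc]; exact le_self_add
          · rw [add_right_comm]; exact le_add_self

/-- The family of kernels with only the scales in `S` retained. -/
def trunc (S : Finset ℤ) (κ : ℤ → ℝ → Rn n → ℂ) : ℤ → ℝ → Rn n → ℂ :=
  fun k v t => if k ∈ S then κ k v t else 0

lemma T_trunc (k : ℤ) (x : Rn n) (v : ℝ) :
    T (trunc S κ) k f x v = if k ∈ S then T κ k f x v else 0 := by
  unfold T trunc
  split_ifs <;> simp

lemma KerFam.trunc (hκ : KerFam ρ C₀ X κ) (hρ : IsLac ρ b) (hC : 0 ≤ C₀) (hX : 0 ≤ X) :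
    KerFam ρ C₀ X (trunc S κ) where
  cont k := by
    by_cases h : k ∈ S
    · simpa [ShortVar.trunc, h] using hκ.cont k
    · simpa [ShortVar.trunc, h] using continuous_const
  supp k v t ht := by
    simp only [ShortVar.trunc, hκ.supp k v t ht, ite_self]
  size k v t := by
    have := hρ.pos k
    unfold ShortVar.trunc
    split_ifs
    · exact hκ.size k v t
    · simp; positivity
  lip k v hv t s := by
    have := hρ.pos k
    unfold ShortVar.trunc
    split_ifs
    · exact hκ.lip k v hv t s
    · simp; positivity

lemma SS_trunc_le (x : Rn n) : SS (trunc S κ) f x ≤ SS κ f x := by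
  refine nrm_mono fun k v => ?_
  rw [T_trunc]
  split_ifs <;> simp

lemma KerFam.SS_trunc_eq (hκ : KerFam ρ C₀ X κ) (hρ : IsLac ρ b) (hC : 0 ≤ C₀) (hX : 0 ≤ X)
    (hf : Integrable f) (x : Rn n) : SS (ShortVar.trunc S κ) f x =
      (∑ k ∈ S, ∫⁻ v in Icc (1 : ℝ) 2, ‖T κ k f x v‖ₑ ^ (2 : ℝ)) ^ (1 / (2 : ℝ)) := by
  have h := (hκ.trunc (S := S) hρ hC hX).SS_sq hf x
  rw [tsum_eq_sum (s := S) (fun k hk => by simp [T_trunc, hk])] at h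
  rw [Finset.sum_congr rfl (g := fun k => ∫⁻ v in Icc (1 : ℝ) 2, ‖T κ k f x v‖ₑ ^ (2 : ℝ))
    fun k hk => by simp only [T_trunc, if_pos hk]] at h
  rw [← h, ← ENNReal.rpow_mul]
  norm_num

/-- The strong type estimate for large exponents. -/
lemma strong_type_gt_two (hρ : IsLac ρ b) (hC : 1 ≤ C₀) {ε : ℝ} (hε : 0 < ε) (hε1 : ε ≤ 1)
    (hn : n ≠ 0) (hC₁ : 0 ≤ C₁) {P : ℝ} (hP : 2 < P) :
    ∃ C : ℝ≥0∞, C ≠ ⊤ ∧ ∀ (X : ℝ) (κ : ℤ → ℝ → Rn n → ℂ) (B : ℝ≥0∞), 1 ≤ X → B ≠ ⊤ →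
      KerFam ρ C₀ X κ → L2Bdd κ B → PtDecay κ (C₁ / X) → ∀ (f : Rn n → ℂ) (E : Set (Rn n)),
      Measurable f → MeasurableSet E → volume E ≠ ⊤ →
      (∀ s, ‖f s‖ₑ ≤ E.indicator (fun _ => 1) s) →
      ∫⁻ x, SS κ f x ^ P ≤
        C * (B ^ (1 / (2 : ℝ)) + ENNReal.ofReal (X ^ (-(1 / 2) + ε))) ^ (P - 2) * B * volume E := by
  obtain ⟨C, hCt, hC0, hbmo⟩ := dyadicBMO_SS hρ hC hε hε1 hn hC₁
  obtain ⟨C', hCt', hjn⟩ := john_nirenberg hn hP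
  refine ⟨C' * C ^ (P - 2), ENNReal.mul_ne_top hCt'
    (ENNReal.rpow_ne_top_of_nonneg (by linarith) hCt), ?_⟩
  intro X κ B hX hBt hκ hB hp f E hf hE hEt hfE
  have hX0 : 0 < X := by linarith
  have hC00 : 0 ≤ C₀ := by linarith
  have hfi : Integrable f := integrable_of_le_indicator hf hE hEt (by norm_num) hfE
  have hf1 : ∀ s, ‖f s‖ ≤ 1 := by
    simpa using norm_le_of_le_indicator (by norm_num) hfE
  set A := C * (B ^ (1 / (2 : ℝ)) + ENNReal.ofReal (X ^ (-(1 / 2) + ε))) with hA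
  have hA0 : A ≠ 0 := by
    refine mul_ne_zero hC0 (ne_of_gt ?_)
    refine lt_of_lt_of_le ?_ le_add_self
    rw [ENNReal.ofReal_pos]; positivity
  have hAt : A ≠ ⊤ := ENNReal.mul_ne_top hCt (ENNReal.add_ne_top.2
    ⟨ENNReal.rpow_ne_top_of_nonneg (by norm_num) hBt, ENNReal.ofReal_ne_top⟩)
  set g : ℕ → Rn n → ℝ≥0∞ := fun N => SS (trunc (Finset.Icc (-N : ℤ) N) κ) f with hg
  have hgm : ∀ N, Measurable (g N) := fun N =>
    (hκ.trunc hρ hC00 hX0.le).measurable_SS hfi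
  have hfin : ∀ k x, ∫⁻ v in Icc (1 : ℝ) 2, ‖T κ k f x v‖ₑ ^ (2 : ℝ) ≠ ⊤ := fun k x =>
    ((hp f hf hfi hf1 k x).trans_lt ENNReal.ofReal_lt_top).ne
  refine lintegral_le_of_tendsto (g := fun N x => g N x ^ P)
    (fun N => (hgm N).pow_const _) (fun x => ?_) fun N => ?_
  · refine ((ENNReal.continuous_rpow_const).tendsto _).comp ?_
    have e : SS κ f x = (∑' k, ∫⁻ v in Icc (1 : ℝ) 2, ‖T κ k f x v‖ₑ ^ (2 : ℝ)) ^
        (1 / (2 : ℝ)) := by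
      rw [← hκ.SS_sq hfi x, ← ENNReal.rpow_mul]
      norm_num
    simp_rw [hg, hκ.SS_trunc_eq hρ hC00 hX0.le hfi x, e]
    refine ((ENNReal.continuous_rpow_const).tendsto _).comp ?_
    refine (ENNReal.summable.hasSum : HasSum _ _).comp ?_
    exact Finset.tendsto_Icc_neg
  · have hB' : L2Bdd (trunc (Finset.Icc (-N : ℤ) N) κ) B := by
      intro f hf hfi hM
      refine le_trans (lintegral_mono fun x => ?_) (hB f hf hfi hM)
      exact ENNReal.rpow_le_rpow (SS_trunc_le x) (by norm_num)
    have hp' : PtDecay (trunc (Finset.Icc (-N : ℤ) N) κ) (C₁ / X) := by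
      intro f hf hfi hM k x
      refine le_trans (lintegral_mono fun v => ?_) (hp f hf hfi hM k x)
      rw [T_trunc]
      split_ifs <;> simp
    have hcont : Continuous (g N) := by
      have : g N = fun x => (∑ k ∈ Finset.Icc (-N : ℤ) N,
          ∫⁻ v in Icc (1 : ℝ) 2, ‖T κ k f x v‖ₑ ^ (2 : ℝ)) ^ (1 / (2 : ℝ)) :=
        funext fun x => hκ.SS_trunc_eq hρ hC00 hX0.le hfi x
      rw [this]
      exact ENNReal.continuous_rpow_const.comp
        (continuous_finsetSum _ fun k _ => hκ.continuous_lintegral hfi k)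
    have h2 : ∫⁻ x, g N x ^ (2 : ℝ) ≤ B * volume E := by
      refine (hB' f hf hfi ⟨1, hf1⟩).trans (mul_le_mul' le_rfl ?_)
      simpa using lintegral_enorm_sq_le hE hfE
    refine (hjn (g N) A hcont (fun x => ?_) hA0 hAt
      (h2.trans_lt (ENNReal.mul_lt_top hBt.lt_top hEt.lt_top)).ne
      (hbmo X _ B hX (hκ.trunc hρ hC00 hX0.le) hB' hp' f hf hfi hf1)).trans ?_
    · rw [hg]
      dsimp only
      rw [hκ.SS_trunc_eq hρ hC00 hX0.le hfi x]
      exact ENNReal.rpow_ne_top_of_nonneg (by norm_num)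
        (ENNReal.sum_ne_top.2 fun k _ => hfin k x)
    · rw [hA, ENNReal.mul_rpow_of_nonneg _ _ (by linarith)]
      refine (mul_le_mul' le_rfl h2).trans (le_of_eq (by ring))

end LargeExponent

section Plancherel

variable {n : ℕ} {ρ : ℤ → ℝ} {C₀ X : ℝ} {κ : ℤ → ℝ → Rn n → ℂ}

lemma enorm_rpow_two_eq (z : ℂ) : ‖z‖ₑ ^ (2 : ℝ) = ENNReal.ofReal (‖z‖ ^ 2) := by
  rw [← ofReal_norm, ENNReal.rpow_two, ENNReal.ofReal_pow (norm_nonneg _)]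

lemma lintegral_fourier_sq (f : SchwartzMap (Rn n) ℂ) :
    ∫⁻ ξ, ‖𝓕 (⇑f) ξ‖ₑ ^ (2 : ℝ) = ∫⁻ x, ‖f x‖ₑ ^ (2 : ℝ) := by
  have h := SchwartzMap.integral_norm_sq_fourier f
  simp_rw [enorm_rpow_two_eq]
  rw [← ofReal_integral_eq_lintegral_ofReal, ← ofReal_integral_eq_lintegral_ofReal]
  · rw [← h]; rfl
  · exact (f.memLp 2).integrable_norm_pow (by norm_num)
  · exact Eventually.of_forall fun _ => by positivity
  · exact ((𝓕 f).memLp 2 volume).integrable_norm_pow (by norm_num)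
  · exact Eventually.of_forall fun _ => by positivity

lemma KerFam.hasCompactSupport (hκ : KerFam ρ C₀ X κ) (k : ℤ) (v : ℝ) :
    HasCompactSupport (κ k v) := by
  refine HasCompactSupport.intro (isCompact_closedBall (0 : Rn n) (C₀ * ρ k)) fun t ht => ?_
  refine hκ.supp k v t ?_
  simpa using ht

lemma KerFam.lintegral_T_sq (hκ : KerFam ρ C₀ X κ) (hs : ∀ k v, ContDiff ℝ (⊤ : ℕ∞) (κ k v))
    (f : SchwartzMap (Rn n) ℂ) (k : ℤ) (v : ℝ) :
    ∫⁻ x, ‖T κ k f x v‖ₑ ^ (2 : ℝ) = ∫⁻ ξ, ‖𝓕 (⇑f) ξ‖ₑ ^ (2 : ℝ) * ‖𝓕 (κ k v) ξ‖ₑ ^ (2 : ℝ) := by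
  set g : SchwartzMap (Rn n) ℂ := (hκ.hasCompactSupport k v).toSchwartzMap (hs k v) with hg
  set B : ℂ →L[ℂ] ℂ →L[ℂ] ℂ := ContinuousLinearMap.mul ℂ ℂ with hB
  have h1 : ∀ x, T κ k f x v = SchwartzMap.convolution B f g x := by
    intro x
    rw [SchwartzMap.convolution_apply, convolution_def]
    rfl
  simp_rw [h1]
  rw [← lintegral_fourier_sq]
  refine lintegral_congr fun ξ => ?_
  have h2 : 𝓕 (⇑(SchwartzMap.convolution B f g)) ξ = 𝓕 (⇑f) ξ * 𝓕 (κ k v) ξ := by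
    rw [← SchwartzMap.fourier_coe, SchwartzMap.fourier_convolution,
      SchwartzMap.pairing_apply_apply]
    rfl
  rw [h2, enorm_mul, ENNReal.mul_rpow_of_nonneg _ _ (by norm_num)]

lemma KerFam.continuous_fourier (hκ : KerFam ρ C₀ X κ) (k : ℤ) :
    Continuous fun p : Rn n × ℝ => 𝓕 (κ k p.2) p.1 := by
  simp_rw [Real.fourier_eq]
  set S := Metric.closedBall (0 : Rn n) (C₀ * ρ k) with hS
  refine continuous_of_dominated
    (bound := S.indicator fun _ => C₀ / ρ k ^ n)
    (fun p => ?_) (fun p => Eventually.of_forall fun t => ?_) ?_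
    (Eventually.of_forall fun t => ?_)
  · have : Continuous fun t => κ k p.2 t :=
      (hκ.cont k).comp (by fun_prop : Continuous fun t : Rn n => ((p.2, t) : ℝ × Rn n))
    refine Continuous.aestronglyMeasurable ?_
    exact Continuous.smul (by fun_prop) this
  · rw [Circle.norm_smul]
    by_cases ht : t ∈ S
    · rw [indicator_of_mem ht]; exact hκ.size _ _ _
    · rw [indicator_of_notMem ht, hκ.supp]
      · simp
      · simpa [hS] using ht
  · exact (integrable_indicator_iff Metric.isClosed_closedBall.measurableSet).2
      (integrableOn_const measure_closedBall_lt_top.ne)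
  · refine Continuous.smul (by fun_prop) ?_
    exact (hκ.cont k).comp (by fun_prop : Continuous fun p : Rn n × ℝ => ((p.2, t) : ℝ × Rn n))

lemma KerFam.lintegral_SS_sq_schwartz (hκ : KerFam ρ C₀ X κ)
    (hs : ∀ k v, ContDiff ℝ (⊤ : ℕ∞) (κ k v)) {B : ℝ≥0∞}
    (hB : ∀ᵐ ξ : Rn n, ∑' k, ∫⁻ v in Icc (1 : ℝ) 2, ‖𝓕 (κ k v) ξ‖ₑ ^ (2 : ℝ) ≤ B)
    (f : SchwartzMap (Rn n) ℂ) :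
    ∫⁻ x, SS κ f x ^ (2 : ℝ) ≤ B * ∫⁻ x, ‖f x‖ₑ ^ (2 : ℝ) := by
  have hm : ∀ k, Measurable fun p : Rn n × ℝ => ‖𝓕 (κ k p.2) p.1‖ₑ ^ (2 : ℝ) := fun k =>
    (hκ.continuous_fourier k).enorm.measurable.pow_const _
  have hT : ∀ k, Measurable fun p : Rn n × ℝ => ‖T κ k f p.1 p.2‖ₑ ^ (2 : ℝ) := fun k =>
    (hκ.continuous_T f.integrable k).enorm.measurable.pow_const _
  have hf : Measurable fun ξ => ‖𝓕 (⇑f) ξ‖ₑ ^ (2 : ℝ) :=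
    (𝓕 f).continuous.enorm.measurable.pow_const _
  have hsw : ∀ k, ∫⁻ x, ∫⁻ v in Icc (1 : ℝ) 2, ‖T κ k f x v‖ₑ ^ (2 : ℝ) =
      ∫⁻ ξ, ‖𝓕 (⇑f) ξ‖ₑ ^ (2 : ℝ) * ∫⁻ v in Icc (1 : ℝ) 2, ‖𝓕 (κ k v) ξ‖ₑ ^ (2 : ℝ) := by
    intro k
    have e1 := lintegral_lintegral_swap (μ := volume) (ν := volume.restrict (Icc (1 : ℝ) 2))
      (f := fun x v => ‖T κ k f x v‖ₑ ^ (2 : ℝ)) (hT k).aemeasurable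
    have e2 := lintegral_lintegral_swap (μ := volume) (ν := volume.restrict (Icc (1 : ℝ) 2))
      (f := fun ξ v => ‖𝓕 (⇑f) ξ‖ₑ ^ (2 : ℝ) * ‖𝓕 (κ k v) ξ‖ₑ ^ (2 : ℝ))
      ((hf.comp measurable_fst).mul (hm k)).aemeasurable
    rw [e1]
    simp_rw [hκ.lintegral_T_sq hs f k]
    rw [← e2]
    refine lintegral_congr fun ξ => ?_
    refine lintegral_const_mul _ (Measurable.pow_const ?_ _)
    exact ((hκ.continuous_fourier k).comp
      (by fun_prop : Continuous fun v : ℝ => ((ξ, v) : Rn n × ℝ))).enorm.measurable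
  calc ∫⁻ x, SS κ f x ^ (2 : ℝ)
      = ∫⁻ x, ∑' k, ∫⁻ v in Icc (1 : ℝ) 2, ‖T κ k f x v‖ₑ ^ (2 : ℝ) :=
        lintegral_congr fun x => hκ.SS_sq f.integrable x
    _ = ∑' k, ∫⁻ x, ∫⁻ v in Icc (1 : ℝ) 2, ‖T κ k f x v‖ₑ ^ (2 : ℝ) :=
        lintegral_tsum fun k => (Measurable.lintegral_prod_right' (hT k)).aemeasurable
    _ = ∑' k, ∫⁻ ξ, ‖𝓕 (⇑f) ξ‖ₑ ^ (2 : ℝ) * ∫⁻ v in Icc (1 : ℝ) 2, ‖𝓕 (κ k v) ξ‖ₑ ^ (2 : ℝ) := by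
        congr 1 with k; exact hsw k
    _ = ∫⁻ ξ, ‖𝓕 (⇑f) ξ‖ₑ ^ (2 : ℝ) * ∑' k, ∫⁻ v in Icc (1 : ℝ) 2, ‖𝓕 (κ k v) ξ‖ₑ ^ (2 : ℝ) := by
        have hmk : ∀ k, Measurable fun ξ : Rn n =>
            ∫⁻ v in Icc (1 : ℝ) 2, ‖𝓕 (κ k v) ξ‖ₑ ^ (2 : ℝ) :=
          fun k => Measurable.lintegral_prod_right' (hm k)
        simp_rw [← ENNReal.tsum_mul_left]
        exact (lintegral_tsum fun k => (hf.mul (hmk k)).aemeasurable).symm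
    _ ≤ ∫⁻ ξ, ‖𝓕 (⇑f) ξ‖ₑ ^ (2 : ℝ) * B := by
        refine lintegral_mono_ae ?_
        filter_upwards [hB] with ξ hξ
        gcongr
    _ = _ := by rw [lintegral_mul_const _ hf, lintegral_fourier_sq, mul_comm]

lemma KerFam.tendsto_T (hκ : KerFam ρ C₀ X κ) {f : Rn n → ℂ} {g : ℕ → Rn n → ℂ}
    (hf : Integrable f) (hg : ∀ N, Integrable (g N))
    (h : Tendsto (fun N => ∫⁻ s, ‖f s - g N s‖ₑ ^ (2 : ℝ)) atTop (𝓝 0)) (k : ℤ) (x : Rn n)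
    (v : ℝ) : Tendsto (fun N => T κ k (g N) x v) atTop (𝓝 (T κ k f x v)) := by
  have hc : Continuous fun s => κ k v (x - s) :=
    (hκ.cont k).comp (by fun_prop : Continuous fun s : Rn n => ((v, x - s) : ℝ × Rn n))
  have hκm : MemLp (fun s => κ k v (x - s)) 2 :=
    hc.memLp_of_hasCompactSupport ((hκ.hasCompactSupport k v).comp_homeomorph (Homeomorph.subLeft x))
  set W := (∫⁻ s, ‖κ k v (x - s)‖ₑ ^ (2 : ℝ)) ^ (1 / (2 : ℝ)) with hW
  have hWt : W ≠ ⊤ := by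
    have := hκm.eLpNorm_ne_top
    rw [eLpNorm_eq_lintegral_rpow_enorm_toReal (by norm_num) (by norm_num)] at this
    simpa [hW] using this
  rw [tendsto_iff_edist_tendsto_0]
  have hb : ∀ N, edist (T κ k (g N) x v) (T κ k f x v) ≤
      (∫⁻ s, ‖f s - g N s‖ₑ ^ (2 : ℝ)) ^ (1 / (2 : ℝ)) * W := by
    intro N
    rw [edist_comm, edist_eq_enorm_sub, ← hκ.T_sub hf (hg N)]
    unfold T
    refine (enorm_integral_le_lintegral_enorm _).trans ?_
    simp_rw [enorm_mul]
    exact ENNReal.lintegral_mul_le_Lp_mul_Lq volume Real.HolderConjugate.two_two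
      (hf.sub (hg N)).aestronglyMeasurable.enorm hc.enorm.aemeasurable
  refine tendsto_of_tendsto_of_tendsto_of_le_of_le tendsto_const_nhds ?_ (fun _ => bot_le) hb
  have h2 := (ENNReal.continuous_rpow_const (y := 1 / (2 : ℝ))).tendsto 0 |>.comp h
  rw [ENNReal.zero_rpow_of_pos (by norm_num)] at h2
  have h3 := ENNReal.Tendsto.mul_const h2 (b := W) (Or.inr hWt)
  rwa [zero_mul] at h3

/-- `L²` boundedness of the square function from bounds for the multipliers. -/
lemma KerFam.l2Bdd (hκ : KerFam ρ C₀ X κ) (hs : ∀ k v, ContDiff ℝ (⊤ : ℕ∞) (κ k v)) {B : ℝ≥0∞}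
    (hBt : B ≠ ⊤)
    (hB : ∀ᵐ ξ : Rn n, ∑' k, ∫⁻ v in Icc (1 : ℝ) 2, ‖𝓕 (κ k v) ξ‖ₑ ^ (2 : ℝ) ≤ B) :
    L2Bdd κ B := by
  intro f hm hf hM
  obtain ⟨M, hM⟩ := hM
  have hf2t : ∫⁻ s, ‖f s‖ₑ ^ (2 : ℝ) ≠ ⊤ := by
    refine ne_top_of_le_ne_top (b := ENNReal.ofReal M * ∫⁻ s, ‖f s‖ₑ)
      (ENNReal.mul_ne_top ENNReal.ofReal_ne_top hf.2.ne) ?_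
    rw [← lintegral_const_mul _ hm.enorm]
    refine lintegral_mono fun s => ?_
    rw [ENNReal.rpow_two, sq]
    gcongr
    rw [← ofReal_norm]
    exact ENNReal.ofReal_le_ofReal (hM s)
  have hl : ∀ h : Rn n → ℂ, eLpNorm h 2 volume = (∫⁻ s, ‖h s‖ₑ ^ (2 : ℝ)) ^ (1 / (2 : ℝ)) := by
    intro h
    rw [eLpNorm_eq_lintegral_rpow_enorm_toReal (by norm_num) (by norm_num)]
    simp
  have hl2 : ∀ h : Rn n → ℂ, ∫⁻ s, ‖h s‖ₑ ^ (2 : ℝ) = eLpNorm h 2 volume ^ (2 : ℝ) := by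
    intro h
    rw [hl, ← ENNReal.rpow_mul]
    norm_num
  have hf2 : MemLp f 2 := ⟨hm.aestronglyMeasurable, by
    rw [hl]; exact ENNReal.rpow_lt_top_of_nonneg (by norm_num) hf2t⟩
  have hex : ∀ N : ℕ, ∃ g : SchwartzMap (Rn n) ℂ,
      eLpNorm (f - ⇑g) 2 volume ≤ ENNReal.ofReal (1 / (N + 1)) := by
    intro N
    obtain ⟨g, hg, hg', hgε⟩ := MemLp.exist_eLpNorm_sub_le (by norm_num) (by norm_num) hf2
      (ε := 1 / ((N : ℝ) + 1)) (by positivity)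
    exact ⟨hg.toSchwartzMap hg', hgε⟩
  choose g hg using hex
  have hz : Tendsto (fun N : ℕ => ENNReal.ofReal (1 / ((N : ℝ) + 1))) atTop (𝓝 0) := by
    have := ENNReal.tendsto_ofReal tendsto_one_div_add_atTop_nhds_zero_nat
    simpa using this
  have hgt : Tendsto (fun N => ∫⁻ s, ‖f s - g N s‖ₑ ^ (2 : ℝ)) atTop (𝓝 0) := by
    have h1 : Tendsto (fun N => eLpNorm (f - ⇑(g N)) 2 volume) atTop (𝓝 0) :=
      tendsto_of_tendsto_of_tendsto_of_le_of_le tendsto_const_nhds hz (fun _ => bot_le) hg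
    have h2 := (ENNReal.continuous_rpow_const (y := (2 : ℝ))).tendsto 0 |>.comp h1
    rw [ENNReal.zero_rpow_of_pos (by norm_num)] at h2
    refine h2.congr fun N => ?_
    exact (hl2 _).symm
  have hT := fun k x v => hκ.tendsto_T hf (fun N => (g N).integrable) hgt k x v
  have hsq : ∀ h : Rn n → ℂ, Integrable h → ∀ x, SS κ h x ^ (2 : ℝ) =
      ∫⁻ p, ‖T κ p.1 h x p.2‖ₑ ^ (2 : ℝ) ∂pm := by
    intro h _ x
    rw [SS, nrm, ← ENNReal.rpow_mul]
    norm_num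
  have hpt : ∀ x, SS κ f x ^ (2 : ℝ) ≤ liminf (fun N => SS κ (g N) x ^ (2 : ℝ)) atTop := by
    intro x
    simp_rw [hsq _ (g _).integrable, hsq f hf]
    refine le_trans (le_of_eq ?_) (lintegral_liminf_le fun N =>
      (measurable_uncurry_int fun k => hκ.measurable_T (g N).integrable k x).pow_const _)
    refine lintegral_congr fun p => ?_
    refine (Tendsto.liminf_eq ?_).symm
    exact ((ENNReal.continuous_rpow_const (y := (2 : ℝ))).tendsto _).comp
      ((continuous_enorm.tendsto _).comp (hT p.1 x p.2))
  calc ∫⁻ x, SS κ f x ^ (2 : ℝ) ≤ ∫⁻ x, liminf (fun N => SS κ (g N) x ^ (2 : ℝ)) atTop :=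
        lintegral_mono hpt
    _ ≤ liminf (fun N => ∫⁻ x, SS κ (g N) x ^ (2 : ℝ)) atTop :=
        lintegral_liminf_le fun N => (hκ.measurable_SS (g N).integrable).pow_const _
    _ ≤ liminf (fun N : ℕ =>
          B * (eLpNorm f 2 volume + ENNReal.ofReal (1 / ((N : ℝ) + 1))) ^ (2 : ℝ)) atTop := by
        refine liminf_le_liminf (Eventually.of_forall fun N => ?_)
        refine (hκ.lintegral_SS_sq_schwartz hs hB (g N)).trans ?_
        rw [hl2]
        gcongr
        have h1 : ⇑(g N) = f - (f - ⇑(g N)) := by simp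
        rw [h1]
        refine (eLpNorm_sub_le hm.aestronglyMeasurable
          (hf.sub (g N).integrable).aestronglyMeasurable (by norm_num)).trans ?_
        gcongr
        exact hg N
    _ = B * ∫⁻ x, ‖f x‖ₑ ^ (2 : ℝ) := by
        refine Tendsto.liminf_eq ?_
        rw [hl2]
        refine ENNReal.Tendsto.const_mul ?_ (Or.inr hBt)
        refine ((ENNReal.continuous_rpow_const (y := (2 : ℝ))).tendsto _).comp ?_
        have := hz.const_add (eLpNorm f 2 volume)
        rwa [add_zero] at this

end Plancherel

section Summation

variable {n : ℕ} {ρ : ℤ → ℝ} {C₀ X : ℝ} {κ : ℤ → ℝ → Rn n → ℂ}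

lemma norm_integral_le_of_support {α : Type*} [MeasurableSpace α] {μ : Measure α} {g : α → ℂ}
    {S : Set α} {M : ℝ} (hSt : μ S ≠ ⊤) (h0 : ∀ x, x ∉ S → g x = 0)
    (hM : ∀ x ∈ S, ‖g x‖ ≤ M) : ‖∫ x, g x ∂μ‖ ≤ M * μ.real S := by
  rw [← setIntegral_eq_integral_of_forall_compl_eq_zero (s := S) h0]
  exact norm_setIntegral_le_of_norm_le_const hSt.lt_top hM

/-- The volume of the unit ball, as a real number. -/
def unitVol (n : ℕ) : ℝ := volume.real (Metric.closedBall (0 : Rn n) 1)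

lemma unitVol_nonneg : 0 ≤ unitVol n := measureReal_nonneg

lemma real_closedBall (x : Rn n) {r : ℝ} (hr : 0 ≤ r) :
    volume.real (Metric.closedBall x r) = r ^ n * unitVol n := by
  rw [unitVol, Measure.real, Measure.real, Measure.addHaar_closedBall' _ _ hr, ENNReal.toReal_mul,
    ENNReal.toReal_ofReal (by positivity)]
  simp only [finrank_euclideanSpace, Fintype.card_fin]

lemma KerFam.integrable_ker (hκ : KerFam ρ C₀ X κ) (k : ℤ) (v : ℝ) : Integrable (κ k v) :=
  ((hκ.cont k).comp (by fun_prop : Continuous fun t : Rn n => ((v, t) : ℝ × Rn n)))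
    |>.integrable_of_hasCompactSupport (hκ.hasCompactSupport k v)

lemma KerFam.norm_fourier_le_mul (hκ : KerFam ρ C₀ X κ) (hC : 0 ≤ C₀) (hρ : ∀ k, 0 < ρ k)
    {k : ℤ} {v : ℝ} (hm : ∫ t, κ k v t = 0) (ξ : Rn n) :
    ‖𝓕 (κ k v) ξ‖ ≤ 2 * Real.pi * C₀ ^ (n + 2) * unitVol n * (ρ k * ‖ξ‖) := by
  have hρk := hρ k
  have hint : Integrable fun t => Real.fourierChar (-inner ℝ t ξ) • κ k v t :=
    (Real.fourierIntegral_convergent_iff ξ).2 (hκ.integrable_ker k v)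
  have h1 : 𝓕 (κ k v) ξ = ∫ t, (Real.fourierChar (-inner ℝ t ξ) • κ k v t - κ k v t) := by
    rw [Real.fourier_eq, integral_sub hint (hκ.integrable_ker k v), hm, sub_zero]
  rw [h1]
  refine (norm_integral_le_of_support (S := Metric.closedBall 0 (C₀ * ρ k))
    (M := 2 * Real.pi * (‖ξ‖ * (C₀ * ρ k)) * (C₀ / ρ k ^ n))
    measure_closedBall_lt_top.ne (fun t ht => ?_) fun t ht => ?_).trans (le_of_eq ?_)
  · rw [hκ.supp k v t (by simpa using ht)]; simp
  · have h2 : Real.fourierChar (-inner ℝ t ξ) • κ k v t - κ k v t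
        = ((Real.fourierChar (-inner ℝ t ξ) : ℂ) - 1) * κ k v t := by
      rw [Circle.smul_def, smul_eq_mul]; ring
    rw [h2, norm_mul]
    have h3 : ‖(Real.fourierChar (-inner ℝ t ξ) : ℂ) - 1‖ ≤ 2 * Real.pi * (‖ξ‖ * (C₀ * ρ k)) := by
      rw [Real.fourierChar_apply, mul_comm _ Complex.I]
      refine (Real.norm_exp_I_mul_ofReal_sub_one_le).trans ?_
      rw [Real.norm_eq_abs, abs_mul, abs_of_pos (by positivity : 0 < 2 * Real.pi), abs_neg]
      gcongr
      refine (abs_real_inner_le_norm t ξ).trans ?_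
      rw [mul_comm]
      gcongr
      simpa using ht
    exact mul_le_mul h3 (hκ.size k v t) (norm_nonneg _) (by positivity)
  · rw [real_closedBall _ (by positivity), mul_pow]
    field_simp
    ring

lemma KerFam.norm_fourier_le_div (hκ : KerFam ρ C₀ X κ) (hC : 0 ≤ C₀) (hX : 0 ≤ X)
    (hρ : ∀ k, 0 < ρ k)
    {k : ℤ} {v : ℝ} (hv : v ∈ Icc (1 : ℝ) 2) {ξ : Rn n} (hξ : ξ ≠ 0) :
    ‖𝓕 (κ k v) ξ‖ ≤ C₀ ^ (n + 1) * unitVol n * (X / (ρ k * ‖ξ‖)) := by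
  have hρk := hρ k
  have hξ' : 0 < ‖ξ‖ := norm_pos_iff.2 hξ
  set h : Rn n := (1 / (2 * ‖ξ‖ ^ 2)) • ξ with hh
  have hhn : ‖h‖ = 1 / (2 * ‖ξ‖) := by
    rw [hh, norm_smul, Real.norm_of_nonneg (by positivity)]
    field_simp
  rw [Real.fourier_eq,
    fourierIntegral_eq_half_sub_half_period_translate hξ (hκ.integrable_ker k v), norm_smul]
  set S := Metric.closedBall (0 : Rn n) (C₀ * ρ k) ∪ Metric.closedBall (-h) (C₀ * ρ k) with hS
  have hS1 : volume.real S ≤ 2 * ((C₀ * ρ k) ^ n * unitVol n) := by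
    refine (measureReal_union_le _ _).trans ?_
    rw [real_closedBall _ (by positivity), real_closedBall _ (by positivity)]
    linarith
  have hSt : volume S ≠ ⊤ := (measure_union_lt_top measure_closedBall_lt_top
    measure_closedBall_lt_top).ne
  have h1 := norm_integral_le_of_support (μ := volume) (S := S)
    (g := fun t => Real.fourierChar (-inner ℝ t ξ) • (κ k v t - κ k v (t + h)))
    (M := C₀ * X / ρ k ^ (n + 1) * (1 / (2 * ‖ξ‖))) hSt (fun t ht => ?_) fun t ht => ?_
  · calc _ ≤ ‖(1 / 2 : ℂ)‖ * (C₀ * X / ρ k ^ (n + 1) * (1 / (2 * ‖ξ‖)) * volume.real S) := by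
          gcongr
      _ ≤ ‖(1 / 2 : ℂ)‖ * (C₀ * X / ρ k ^ (n + 1) * (1 / (2 * ‖ξ‖)) *
            (2 * ((C₀ * ρ k) ^ n * unitVol n))) := by gcongr
      _ = C₀ ^ (n + 1) * unitVol n * (X / (ρ k * ‖ξ‖)) * (1 / 2) := by
          have : ‖(1 / 2 : ℂ)‖ = 1 / 2 := by norm_num
          rw [this, mul_pow]
          field_simp
          ring
      _ ≤ C₀ ^ (n + 1) * unitVol n * (X / (ρ k * ‖ξ‖)) * 1 := by
          have := unitVol_nonneg (n := n)
          gcongr; norm_num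
      _ = _ := mul_one _
  · rw [hS, mem_union, not_or] at ht
    have e1 : κ k v t = 0 := hκ.supp k v t (by simpa using ht.1)
    have e2 : κ k v (t + h) = 0 := hκ.supp k v _ (by simpa [dist_eq_norm] using ht.2)
    rw [e1, e2]; simp
  · rw [Circle.norm_smul]
    refine (hκ.lip k v hv _ _).trans (le_of_eq ?_)
    rw [sub_add_cancel_left, norm_neg, hhn]

lemma ofReal_interp {I : ℝ≥0∞} {A D μ θ : ℝ} (hA : 0 < A) (hD : 0 < D) (hμ : 0 < μ)
    (hθ : 0 ≤ θ) (hθ1 : θ ≤ 1)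
    (h1 : I ≤ ENNReal.ofReal A) (h2 : I ≤ ENNReal.ofReal (D * μ ^ 2)) :
    I ≤ ENNReal.ofReal (A ^ (1 - θ) * D ^ θ) * ENNReal.ofReal (μ ^ (2 * θ)) := by
  have hsplit : I = I ^ (1 - θ) * I ^ θ := by
    rw [← ENNReal.rpow_add_of_nonneg _ _ (by linarith) hθ]
    simp
  rw [hsplit]
  calc _ ≤ ENNReal.ofReal A ^ (1 - θ) * ENNReal.ofReal (D * μ ^ 2) ^ θ :=
        mul_le_mul' (ENNReal.rpow_le_rpow h1 (by linarith)) (ENNReal.rpow_le_rpow h2 hθ)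
    _ = _ := by
        rw [ENNReal.ofReal_rpow_of_pos hA, ENNReal.ofReal_rpow_of_pos (by positivity),
          ← ENNReal.ofReal_mul (by positivity), ← ENNReal.ofReal_mul (by positivity),
          Real.mul_rpow hD.le (by positivity), Real.rpow_mul hμ.le, Real.rpow_two]
        ring_nf

/-- Summing scale-invariant multiplier bounds over a lacunary family of scales. -/
lemma l2Bdd_of_fourier {b s ε C₂ : ℝ} (hρ : IsLac ρ b) (hC : 0 < C₀) (hn : n ≠ 0) (hs0 : 0 ≤ s)
    (hε : 0 < ε) (hε1 : ε ≤ 1) (hC₂ : 0 < C₂) :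
    ∃ C : ℝ≥0∞, C ≠ ⊤ ∧ ∀ (X : ℝ) (κ : ℤ → ℝ → Rn n → ℂ), 1 ≤ X → KerFam ρ C₀ X κ →
      (∀ k v, ContDiff ℝ (⊤ : ℕ∞) (κ k v)) → (∀ k v, ∫ t, κ k v t = 0) →
      (∀ k ξ, ∫⁻ v in Icc (1 : ℝ) 2, ‖𝓕 (κ k v) ξ‖ₑ ^ (2 : ℝ) ≤ ENNReal.ofReal (C₂ * X ^ (-s))) →
      L2Bdd κ (C * ENNReal.ofReal (X ^ (-s + ε))) := by
  set θ := ε / (1 + s) with hθd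
  have hθ : 0 < θ := by positivity
  have hθ1 : θ ≤ 1 := by rw [hθd, div_le_one (by positivity)]; linarith
  set G : ℝ := 2 * Real.pi * C₀ ^ (n + 2) * unitVol n + C₀ ^ (n + 1) * unitVol n + 1 with hG
  have hV := unitVol_nonneg (n := n)
  have hG0 : 0 < G := by have := Real.pi_pos; positivity
  refine ⟨ENNReal.ofReal (C₂ ^ (1 - θ) * (G ^ 2) ^ θ) * (2 * lacC b (2 * θ)),
    ENNReal.mul_ne_top ENNReal.ofReal_ne_top
      (ENNReal.mul_ne_top (by simp) (lacC_ne_top hρ.one_lt (by positivity))),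
    fun X κ hX hκ hs hm hI => ?_⟩
  have hX0 : 0 < X := by linarith
  have hconst : ENNReal.ofReal (C₂ ^ (1 - θ) * (G ^ 2) ^ θ) * (2 * lacC b (2 * θ)) *
      ENNReal.ofReal (X ^ (-s + ε)) = ENNReal.ofReal ((C₂ * X ^ (-s)) ^ (1 - θ) *
        (G ^ 2 * X) ^ θ) * (2 * lacC b (2 * θ)) := by
    have : (C₂ * X ^ (-s)) ^ (1 - θ) * (G ^ 2 * X) ^ θ =
        C₂ ^ (1 - θ) * (G ^ 2) ^ θ * X ^ (-s + ε) := by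
      rw [Real.mul_rpow hC₂.le (by positivity), Real.mul_rpow (by positivity) hX0.le,
        ← Real.rpow_mul hX0.le]
      have : -s + ε = -s * (1 - θ) + θ := by rw [hθd]; field_simp; ring
      rw [this, Real.rpow_add hX0]; ring
    rw [this, ENNReal.ofReal_mul (by positivity : 0 ≤ C₂ ^ (1 - θ) * (G ^ 2) ^ θ)]
    ring
  rw [hconst]
  refine hκ.l2Bdd hs (ENNReal.mul_ne_top ENNReal.ofReal_ne_top
      (ENNReal.mul_ne_top (by simp) (lacC_ne_top hρ.one_lt (by positivity)))) ?_
  have : Nonempty (Fin n) := ⟨⟨0, Nat.pos_of_ne_zero hn⟩⟩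
  have hae : ∀ᵐ ξ : Rn n, ξ ≠ 0 := by
    rw [ae_iff]; simp
  filter_upwards [hae] with ξ hξ
  have hξ' : 0 < ‖ξ‖ := norm_pos_iff.2 hξ
  set r := X ^ (1 / 2 : ℝ) / ‖ξ‖ with hr
  have hr0 : 0 < r := by positivity
  have hXX : X ^ (1 / 2 : ℝ) * X ^ (1 / 2 : ℝ) = X := by
    rw [← Real.rpow_add hX0]; norm_num
  have hY : 0 < X ^ (1 / 2 : ℝ) := by positivity
  have hptw : ∀ k, ∀ v ∈ Icc (1 : ℝ) 2, ‖𝓕 (κ k v) ξ‖ ≤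
      G * X ^ (1 / 2 : ℝ) * min (r / ρ k) (ρ k / r) := by
    intro k v hv
    have hρk := hρ.pos k
    have hpi := Real.pi_pos
    rw [mul_min_of_nonneg _ _ (by positivity)]
    refine le_min ?_ ?_
    · refine (hκ.norm_fourier_le_div hC.le hX0.le hρ.pos hv hξ).trans ?_
      calc C₀ ^ (n + 1) * unitVol n * (X / (ρ k * ‖ξ‖)) ≤ G * (X / (ρ k * ‖ξ‖)) := by
            gcongr
            have : 0 ≤ 2 * Real.pi * C₀ ^ (n + 2) * unitVol n := by positivity
            rw [hG]; linarith
        _ = G * X ^ (1 / 2 : ℝ) * (r / ρ k) := by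
            nth_rw 1 [← hXX]
            rw [hr]; field_simp
    · refine (hκ.norm_fourier_le_mul hC.le hρ.pos (hm k v) ξ).trans ?_
      calc _ ≤ G * (ρ k * ‖ξ‖) := by
            gcongr
            have : 0 ≤ C₀ ^ (n + 1) * unitVol n := by positivity
            rw [hG]; linarith
        _ = G * X ^ (1 / 2 : ℝ) * (ρ k / r) := by
            rw [hr]; field_simp
  have hk : ∀ k, ∫⁻ v in Icc (1 : ℝ) 2, ‖𝓕 (κ k v) ξ‖ₑ ^ (2 : ℝ) ≤
      ENNReal.ofReal ((C₂ * X ^ (-s)) ^ (1 - θ) * (G ^ 2 * X) ^ θ) *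
        ENNReal.ofReal (min (r / ρ k) (ρ k / r) ^ (2 * θ)) := by
    intro k
    have hρk := hρ.pos k
    refine ofReal_interp (by positivity) (by positivity) (by positivity) hθ.le hθ1 (hI k ξ) ?_
    calc ∫⁻ v in Icc (1 : ℝ) 2, ‖𝓕 (κ k v) ξ‖ₑ ^ (2 : ℝ)
        ≤ ∫⁻ v in Icc (1 : ℝ) 2, ENNReal.ofReal (G ^ 2 * X * min (r / ρ k) (ρ k / r) ^ 2) := by
          refine setLIntegral_mono measurable_const fun v hv => ?_
          rw [enorm_rpow_two_eq]
          refine ENNReal.ofReal_le_ofReal ?_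
          calc ‖𝓕 (κ k v) ξ‖ ^ 2 ≤ (G * X ^ (1 / 2 : ℝ) * min (r / ρ k) (ρ k / r)) ^ 2 := by
                gcongr; exact hptw k v hv
            _ = _ := by
                nth_rw 2 [← hXX]; ring
      _ = _ := by
          rw [setLIntegral_const, Real.volume_Icc]; norm_num
  calc ∑' k, ∫⁻ v in Icc (1 : ℝ) 2, ‖𝓕 (κ k v) ξ‖ₑ ^ (2 : ℝ) ≤ _ := ENNReal.tsum_le_tsum hk
    _ ≤ _ := by
        rw [ENNReal.tsum_mul_left]
        gcongr
        exact hρ.tsum_min_le (by positivity) hr0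

end Summation

section GaussSchur

variable {α : Type*} [MeasurableSpace α] {ν : Measure α}

lemma ofReal_mul_le_add_sq (a b : ℝ≥0∞) : a * b ≤ a ^ (2 : ℝ) + b ^ (2 : ℝ) := by
  simp only [ENNReal.rpow_two, sq]
  rcases le_total a b with h | h
  · exact (mul_le_mul' h le_rfl).trans le_add_self
  · exact (mul_le_mul' le_rfl h).trans le_self_add

lemma lintegral_gaussian_comp_le {φ : α → ℝ} (hφ : Measurable φ) {D : ℝ≥0∞}
    (hν : ν.map φ ≤ D • volume) {lam : ℝ} (hlam : 0 < lam) (c : ℝ) :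
    ∫⁻ b, ENNReal.ofReal (Real.exp (-(lam ^ 2 / 4) * (φ b - c) ^ 2)) ∂ν ≤
      D * ENNReal.ofReal (2 * Real.sqrt Real.pi / lam) := by
  have hint : Integrable fun y : ℝ => Real.exp (-(lam ^ 2 / 4) * (y - c) ^ 2) :=
    (integrable_exp_neg_mul_sq (by positivity : 0 < lam ^ 2 / 4)).comp_sub_right c
  calc ∫⁻ b, ENNReal.ofReal (Real.exp (-(lam ^ 2 / 4) * (φ b - c) ^ 2)) ∂ν
      = ∫⁻ y, ENNReal.ofReal (Real.exp (-(lam ^ 2 / 4) * (y - c) ^ 2)) ∂(ν.map φ) := by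
        rw [lintegral_map (by fun_prop) hφ]
    _ ≤ ∫⁻ y, ENNReal.ofReal (Real.exp (-(lam ^ 2 / 4) * (y - c) ^ 2)) ∂(D • volume) :=
        lintegral_mono' hν le_rfl
    _ = D * ENNReal.ofReal (2 * Real.sqrt Real.pi / lam) := by
        rw [lintegral_smul_measure, ← ofReal_integral_eq_lintegral_ofReal hint
          (Eventually.of_forall fun _ => (Real.exp_pos _).le),
          integral_sub_right_eq_self (fun y : ℝ => Real.exp (-(lam ^ 2 / 4) * y ^ 2)) c,
          integral_gaussian]
        have : Real.sqrt (Real.pi / (lam ^ 2 / 4)) = 2 * Real.sqrt Real.pi / lam := by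
          rw [show Real.pi / (lam ^ 2 / 4) = Real.pi * (2 / lam) ^ 2 by field_simp; norm_num,
            Real.sqrt_mul Real.pi_pos.le, Real.sqrt_sq (by positivity)]
          ring
        rw [this]; rfl

lemma integral_gaussian_mul_cexp (s : ℝ) :
    ∫ u : ℝ, Complex.exp (Complex.I * s * u) * Complex.exp (-1 * u ^ 2) =
      ((Real.sqrt Real.pi * Real.exp (-(s ^ 2 / 4)) : ℝ) : ℂ) := by
  rw [fourierIntegral_gaussian (by norm_num)]
  push_cast
  rw [Real.sqrt_eq_rpow, Complex.ofReal_cpow Real.pi_pos.le]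
  congr 1
  · simp
  · congr 1; ring_nf

/-- An `L²` estimate for oscillatory integrals whose phase has a bounded density. -/
lemma lintegral_oscillatory_sq_le [IsFiniteMeasure ν] {φ : α → ℝ} (hφ : Measurable φ) {D : ℝ≥0∞}
    (hν : ν.map φ ≤ D • volume) {lam : ℝ} (hlam : 0 < lam) (R : ℝ) {w : α → ℂ}
    (hw : AEStronglyMeasurable w ν) {M : ℝ} (hM : ∀ a, ‖w a‖ ≤ M) :
    ∫⁻ u in Icc (-R) R, ‖∫ a, Complex.exp (Complex.I * (lam * u * φ a : ℝ)) * w a ∂ν‖ₑ ^ (2 : ℝ) ≤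
      ENNReal.ofReal (Real.exp (R ^ 2) * (4 * Real.pi / lam)) * D * ∫⁻ a, ‖w a‖ₑ ^ (2 : ℝ) ∂ν := by
  set F : ℝ → ℂ := fun u => ∫ a, Complex.exp (Complex.I * (lam * u * φ a : ℝ)) * w a ∂ν with hF
  have hexp : ∀ x : ℝ, ‖Complex.exp (Complex.I * x)‖ = 1 := fun x => by
    rw [mul_comm]; exact Complex.norm_exp_ofReal_mul_I x
  have hFm : ∀ u : ℝ, AEStronglyMeasurable
      (fun a => Complex.exp (Complex.I * (lam * u * φ a : ℝ)) * w a) ν := fun u =>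
    (Measurable.aestronglyMeasurable (by fun_prop)).mul hw
  have hFc : Continuous F := by
    refine continuous_of_dominated (bound := fun _ => M) hFm
      (fun u => Eventually.of_forall fun a => ?_) (integrable_const _)
      (Eventually.of_forall fun a => by fun_prop)
    rw [norm_mul, hexp, one_mul]
    exact hM a
  have hFb : ∀ u, ‖F u‖ ≤ M * ν.real univ := fun u =>
    norm_integral_le_of_norm_le_const (Eventually.of_forall fun a => by
      rw [norm_mul, hexp, one_mul]; exact hM a)
  set E : ℝ → α × α → ℂ := fun u p =>
    Complex.exp (-1 * (u : ℂ) ^ 2) * (Complex.exp (Complex.I * (lam * u * φ p.1 : ℝ)) * w p.1 *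
      (starRingEnd ℂ) (Complex.exp (Complex.I * (lam * u * φ p.2 : ℝ)) * w p.2)) with hE
  have hgauss : Integrable fun u : ℝ => Real.exp (-1 * u ^ 2) :=
    integrable_exp_neg_mul_sq one_pos
  have hng : ∀ u : ℝ, ‖Complex.exp (-1 * (u : ℂ) ^ 2)‖ = Real.exp (-1 * u ^ 2) := fun u => by
    rw [← Complex.norm_exp_ofReal]; push_cast; rfl
  have hEint : Integrable (Function.uncurry E) ((volume : Measure ℝ).prod (ν.prod ν)) := by
    have h1 : Integrable (fun p : ℝ × (α × α) => Real.exp (-1 * p.1 ^ 2) * (M * M))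
        ((volume : Measure ℝ).prod (ν.prod ν)) := by
      refine Integrable.mul_prod hgauss (integrable_const _)
    refine h1.mono ?_ (Eventually.of_forall fun p => ?_)
    · have hw1 : AEStronglyMeasurable (fun p : ℝ × (α × α) => w p.2.1)
          ((volume : Measure ℝ).prod (ν.prod ν)) := (hw.comp_fst).comp_snd
      have hw2 : AEStronglyMeasurable (fun p : ℝ × (α × α) => w p.2.2)
          ((volume : Measure ℝ).prod (ν.prod ν)) := (hw.comp_snd).comp_snd
      refine AEStronglyMeasurable.mul (Measurable.aestronglyMeasurable (by fun_prop)) ?_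
      refine ((Measurable.aestronglyMeasurable (by fun_prop)).mul hw1).mul ?_
      exact Complex.continuous_conj.comp_aestronglyMeasurable
        ((Measurable.aestronglyMeasurable (by fun_prop)).mul hw2)
    · have hM0 : 0 ≤ M := (norm_nonneg _).trans (hM p.2.1)
      simp only [Function.uncurry, hE]
      rw [norm_mul, norm_mul, RCLike.norm_conj, norm_mul, norm_mul, hexp, hexp, hng, one_mul,
        one_mul, Real.norm_of_nonneg (by positivity)]
      gcongr
      · exact hM _
      · exact hM _
  have hsq : ∀ u, ∫ p, E u p ∂(ν.prod ν) = ((Real.exp (-1 * u ^ 2) * ‖F u‖ ^ 2 : ℝ) : ℂ) := by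
    intro u
    rw [hE]
    simp only
    rw [integral_const_mul, integral_prod_mul
      (fun a => Complex.exp (Complex.I * (lam * u * φ a : ℝ)) * w a)
      (fun a => (starRingEnd ℂ) (Complex.exp (Complex.I * (lam * u * φ a : ℝ)) * w a)),
      integral_conj, Complex.mul_conj, Complex.normSq_eq_norm_sq]
    simp only [hF]
    push_cast
    rfl
  have hin : ∀ p : α × α, ∫ u, E u p = ((Real.sqrt Real.pi *
      Real.exp (-(lam ^ 2 / 4) * (φ p.1 - φ p.2) ^ 2) : ℝ) : ℂ) *
        (w p.1 * (starRingEnd ℂ) (w p.2)) := by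
    intro p
    have h1 : ∀ u : ℝ, E u p = Complex.exp (Complex.I * (lam * (φ p.1 - φ p.2) : ℝ) * u) *
        Complex.exp (-1 * (u : ℂ) ^ 2) * (w p.1 * (starRingEnd ℂ) (w p.2)) := by
      intro u
      have h2 : Complex.exp (Complex.I * (lam * u * φ p.1 : ℝ)) *
          (starRingEnd ℂ) (Complex.exp (Complex.I * (lam * u * φ p.2 : ℝ))) =
          Complex.exp (Complex.I * (lam * (φ p.1 - φ p.2) : ℝ) * u) := by
        rw [← Complex.exp_conj, ← Complex.exp_add]
        congr 1
        rw [map_mul, Complex.conj_I, Complex.conj_ofReal]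
        push_cast; ring
      simp only [hE]
      rw [← h2, map_mul]
      ring
    simp_rw [h1]
    rw [integral_mul_const, integral_gaussian_mul_cexp]
    congr 3
    ring_nf
  have hZ : ∫⁻ u, ENNReal.ofReal (Real.exp (-1 * u ^ 2) * ‖F u‖ ^ 2) ≤
      ∫⁻ p, ‖∫ u, E u p‖ₑ ∂(ν.prod ν) := by
    rw [← ofReal_integral_eq_lintegral_ofReal]
    · have : (‖(∫ u, ((Real.exp (-1 * u ^ 2) * ‖F u‖ ^ 2 : ℝ) : ℂ))‖ₑ) ≤
          ∫⁻ p, ‖∫ u, E u p‖ₑ ∂(ν.prod ν) := by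
        simp_rw [← hsq]
        rw [integral_integral_swap hEint]
        exact enorm_integral_le_lintegral_enorm _
      refine le_trans (le_of_eq ?_) this
      rw [integral_complex_ofReal, ← ofReal_norm, Complex.norm_real, Real.norm_of_nonneg]
      exact integral_nonneg fun _ => by positivity
    · refine (hgauss.mul_const ((M * ν.real univ) ^ 2)).mono
        (Continuous.aestronglyMeasurable (by fun_prop)) (Eventually.of_forall fun u => ?_)
      rw [Real.norm_of_nonneg (by positivity), Real.norm_of_nonneg (by positivity)]
      gcongr
      exact hFb u
    · exact Eventually.of_forall fun _ => by positivity
  set k : α → α → ℝ≥0∞ := fun a b =>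
    ENNReal.ofReal (Real.exp (-(lam ^ 2 / 4) * (φ b - φ a) ^ 2)) with hk
  have hkm : Measurable (Function.uncurry k) := by
    simp only [hk, Function.uncurry_def]; fun_prop
  have hwm : AEMeasurable (fun a => ‖w a‖ₑ ^ (2 : ℝ)) ν := hw.enorm.pow_const _
  set W := ∫⁻ a, ‖w a‖ₑ ^ (2 : ℝ) ∂ν with hW
  set G := D * ENNReal.ofReal (2 * Real.sqrt Real.pi / lam) with hG
  have hpm : AEMeasurable (fun p : α × α => ‖w p.1‖ₑ ^ (2 : ℝ) * k p.1 p.2) (ν.prod ν) :=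
    (hwm.comp_fst).mul hkm.aemeasurable
  have h1 : ∫⁻ p : α × α, ‖w p.1‖ₑ ^ (2 : ℝ) * k p.1 p.2 ∂(ν.prod ν) ≤ W * G := by
    rw [lintegral_prod _ hpm]
    calc _ ≤ ∫⁻ a, ‖w a‖ₑ ^ (2 : ℝ) * G ∂ν := by
          refine lintegral_mono fun a => ?_
          simp only
          rw [lintegral_const_mul _ (by simp only [hk]; fun_prop)]
          exact mul_le_mul' le_rfl (lintegral_gaussian_comp_le hφ hν hlam (φ a))
      _ = W * G := by rw [lintegral_mul_const'' _ hwm]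
  have h2 : ∫⁻ p : α × α, ‖w p.2‖ₑ ^ (2 : ℝ) * k p.1 p.2 ∂(ν.prod ν) ≤ W * G := by
    rw [← lintegral_prod_swap]
    refine le_trans (le_of_eq (lintegral_congr fun p => ?_)) h1
    simp only [Prod.fst_swap, Prod.snd_swap, hk]
    congr 4
    ring
  have h3 : ∫⁻ p, ‖∫ u, E u p‖ₑ ∂(ν.prod ν) ≤
      ENNReal.ofReal (Real.sqrt Real.pi) * (W * G + W * G) := by
    calc ∫⁻ p, ‖∫ u, E u p‖ₑ ∂(ν.prod ν)
        ≤ ∫⁻ p, ENNReal.ofReal (Real.sqrt Real.pi) * (‖w p.1‖ₑ ^ (2 : ℝ) * k p.1 p.2 +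
            ‖w p.2‖ₑ ^ (2 : ℝ) * k p.1 p.2) ∂(ν.prod ν) := by
          refine lintegral_mono fun p => ?_
          simp only
          rw [hin, enorm_mul, enorm_mul, ← add_mul]
          have e1 : ‖((Real.sqrt Real.pi *
              Real.exp (-(lam ^ 2 / 4) * (φ p.1 - φ p.2) ^ 2) : ℝ) : ℂ)‖ₑ =
                ENNReal.ofReal (Real.sqrt Real.pi) * k p.1 p.2 := by
            rw [← ofReal_norm, Complex.norm_real, Real.norm_of_nonneg (by positivity),
              ENNReal.ofReal_mul (by positivity)]
            simp only [hk]
            congr 4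
            ring
          have e2 : ‖(starRingEnd ℂ) (w p.2)‖ₑ = ‖w p.2‖ₑ := by
            rw [← ofReal_norm, RCLike.norm_conj, ofReal_norm]
          rw [e1, e2, mul_assoc, mul_comm (k p.1 p.2)]
          gcongr
          exact ofReal_mul_le_add_sq _ _
      _ ≤ _ := by
          rw [lintegral_const_mul' _ _ ENNReal.ofReal_ne_top]
          gcongr
          rw [lintegral_add_left' hpm]
          exact add_le_add h1 h2
  calc ∫⁻ u in Icc (-R) R, ‖F u‖ₑ ^ (2 : ℝ)
      ≤ ∫⁻ u in Icc (-R) R, ENNReal.ofReal (Real.exp (R ^ 2)) *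
          ENNReal.ofReal (Real.exp (-1 * u ^ 2) * ‖F u‖ ^ 2) := by
        refine setLIntegral_mono (by fun_prop) fun u hu => ?_
        rw [enorm_rpow_two_eq, ← ENNReal.ofReal_mul (Real.exp_pos _).le, ← mul_assoc,
          ← Real.exp_add]
        refine ENNReal.ofReal_le_ofReal ?_
        have : (1 : ℝ) ≤ Real.exp (R ^ 2 + -1 * u ^ 2) := by
          refine Real.one_le_exp ?_
          nlinarith [sq_le_sq' hu.1 hu.2]
        nlinarith [sq_nonneg ‖F u‖]
    _ ≤ ∫⁻ u, ENNReal.ofReal (Real.exp (R ^ 2)) *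
          ENNReal.ofReal (Real.exp (-1 * u ^ 2) * ‖F u‖ ^ 2) := setLIntegral_le_lintegral _ _
    _ ≤ ENNReal.ofReal (Real.exp (R ^ 2)) *
          (ENNReal.ofReal (Real.sqrt Real.pi) * (W * G + W * G)) := by
        rw [lintegral_const_mul' _ _ ENNReal.ofReal_ne_top]
        gcongr
        exact hZ.trans h3
    _ = _ := by
        have : ENNReal.ofReal (Real.exp (R ^ 2) * (4 * Real.pi / lam)) =
            ENNReal.ofReal (Real.exp (R ^ 2)) * (ENNReal.ofReal (Real.sqrt Real.pi) *
              (2 * ENNReal.ofReal (2 * Real.sqrt Real.pi / lam))) := by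
          rw [← ENNReal.ofReal_ofNat 2, ← ENNReal.ofReal_mul (by norm_num),
            ← ENNReal.ofReal_mul (by positivity), ← ENNReal.ofReal_mul (by positivity)]
          congr 2
          have := Real.mul_self_sqrt Real.pi_pos.le
          field_simp
          nlinarith
        rw [this, hG]
        ring

end GaussSchur

section Pushforward

lemma map_restrict_le_of_expanding {φ : ℝ → ℝ} (hφ : Measurable φ) {J : Set ℝ} {c : ℝ} (hc : 0 < c)
    (h : ∀ x ∈ J, ∀ y ∈ J, c * |x - y| ≤ |φ x - φ y|) :
    (volume.restrict J).map φ ≤ ENNReal.ofReal c⁻¹ • (volume : Measure ℝ) := by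
  refine Measure.le_iff.2 fun A hA => ?_
  rw [Measure.map_apply hφ hA, Measure.restrict_apply (hφ hA), Measure.smul_apply, smul_eq_mul]
  set S := φ ⁻¹' A ∩ J with hS
  have hinj : InjOn φ S := by
    intro x hx y hy hxy
    have := h x hx.2 y hy.2
    rw [hxy, sub_self, abs_zero] at this
    have h2 : |x - y| = 0 := le_antisymm (by
      by_contra! h3
      nlinarith) (abs_nonneg _)
    linarith [abs_eq_zero.1 h2]
  have himg : Function.invFunOn φ S '' (φ '' S) = S := by
    rw [image_image]
    conv_rhs => rw [← image_id S]
    exact image_congr fun x hx => hinj.leftInvOn_invFunOn hx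
  have hlip : LipschitzOnWith (Real.toNNReal c⁻¹) (Function.invFunOn φ S) (φ '' S) := by
    refine LipschitzOnWith.of_dist_le_mul ?_
    rintro _ ⟨x, hx, rfl⟩ _ ⟨y, hy, rfl⟩
    rw [hinj.leftInvOn_invFunOn hx, hinj.leftInvOn_invFunOn hy,
      Real.coe_toNNReal _ (by positivity), Real.dist_eq, Real.dist_eq]
    rw [inv_mul_eq_div, le_div_iff₀ hc, mul_comm]
    exact h x hx.2 y hy.2
  have := hlip.hausdorffMeasure_image_le zero_le_one
  rw [himg, hausdorffMeasure_real, ENNReal.rpow_one] at this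
  refine this.trans ?_
  refine mul_le_mul' le_rfl (measure_mono ?_)
  rintro _ ⟨x, hx, rfl⟩
  exact hx.1

variable {n : ℕ}

/-- The part of `ℝⁿ` between two concentric spheres. -/
def shell (n : ℕ) (a b : ℝ) : Set (Rn n) := {t | a ≤ ‖t‖ ∧ ‖t‖ ≤ b}

lemma measurableSet_shell (a b : ℝ) : MeasurableSet (shell n a b) :=
  (measurableSet_le measurable_const measurable_norm).inter
    (measurableSet_le measurable_norm measurable_const)

lemma volume_shell_ne_top (a b : ℝ) : volume (shell n a b) ≠ ⊤ := by
  refine ne_top_of_le_ne_top (measure_closedBall_lt_top (x := (0 : Rn n)) (r := b)).ne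
    (measure_mono fun t ht => ?_)
  simpa using ht.2

lemma map_norm_shell_le (hn : n ≠ 0) {a b : ℝ} (ha : 0 < a) :
    ((volume : Measure (Rn n)).restrict (shell n a b)).map norm ≤
      ENNReal.ofReal (n * volume.real (Metric.ball (0 : Rn n) 1) * b ^ (n - 1)) •
        (volume : Measure ℝ).restrict (Icc a b) := by
  have : Nonempty (Fin n) := ⟨⟨0, Nat.pos_of_ne_zero hn⟩⟩
  refine Measure.le_iff.2 fun A hA => ?_
  rw [Measure.map_apply measurable_norm hA, Measure.restrict_apply (measurable_norm hA),
    Measure.smul_apply, smul_eq_mul, Measure.restrict_apply hA]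
  set S := A ∩ Icc a b with hS
  have hSm : MeasurableSet S := hA.inter measurableSet_Icc
  have h1 := integral_fun_norm_addHaar (volume : Measure (Rn n)) (S.indicator fun _ => (1 : ℝ))
  have h2 : ∫ x : Rn n, S.indicator (fun _ => (1 : ℝ)) ‖x‖ =
      volume.real (norm ⁻¹' A ∩ shell n a b) := by
    have : (fun x : Rn n => S.indicator (fun _ => (1 : ℝ)) ‖x‖) =
        (norm ⁻¹' A ∩ shell n a b).indicator 1 := by
      ext x
      simp only [indicator, hS, shell]
      rfl
    rw [this, integral_indicator_one]
    exact (measurable_norm hA).inter (measurableSet_shell a b)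
  have hVt : volume S ≠ ⊤ :=
    ne_top_of_le_ne_top (by simp) (measure_mono (inter_subset_right : S ⊆ Icc a b))
  have h3 : ∫ y in Ioi (0 : ℝ), y ^ (n - 1) • S.indicator (fun _ => (1 : ℝ)) y ≤
      b ^ (n - 1) * volume.real S := by
    have e : ∀ y, y ^ (n - 1) • S.indicator (fun _ => (1 : ℝ)) y =
        S.indicator (fun y => y ^ (n - 1)) y := by
      intro y
      by_cases hy : y ∈ S <;> simp [hy]
    simp_rw [e]
    have hsub : S ⊆ Ioi 0 := fun y hy => ha.trans_le hy.2.1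
    rw [setIntegral_indicator hSm, inter_eq_self_of_subset_right hsub]
    refine (le_abs_self _).trans ?_
    rw [← Real.norm_eq_abs]
    refine norm_setIntegral_le_of_norm_le_const hVt.lt_top fun y hy => ?_
    rw [Real.norm_of_nonneg (pow_nonneg (ha.le.trans hy.2.1) _)]
    exact pow_le_pow_left₀ (ha.le.trans hy.2.1) hy.2.2 _
  rw [h2] at h1
  simp only [finrank_euclideanSpace, Fintype.card_fin, nsmul_eq_mul, smul_eq_mul] at h1 h3
  have hT : volume (norm ⁻¹' A ∩ shell n a b) ≠ ⊤ :=
    ne_top_of_le_ne_top (volume_shell_ne_top a b) (measure_mono inter_subset_right)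
  rw [← ENNReal.ofReal_toReal hT, ← ENNReal.ofReal_toReal hVt, ← ENNReal.ofReal_mul']
  · refine ENNReal.ofReal_le_ofReal ?_
    change volume.real _ ≤ _
    rw [h1]
    have : 0 ≤ (n : ℝ) * volume.real (Metric.ball (0 : Rn n) 1) := by positivity
    calc _ = (n : ℝ) * volume.real (Metric.ball (0 : Rn n) 1) * _ := by rw [mul_assoc]
      _ ≤ (n : ℝ) * volume.real (Metric.ball (0 : Rn n) 1) * (b ^ (n - 1) * volume.real S) := by
        gcongr
      _ = _ := by rw [← mul_assoc]; rfl
  · exact ENNReal.toReal_nonneg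

lemma map_shell_le (hn : n ≠ 0) {φ : ℝ → ℝ} (hφ : Measurable φ) {a b : ℝ} (ha : 0 < a)
    {c : ℝ} (hc : 0 < c) (h : ∀ x ∈ Icc a b, ∀ y ∈ Icc a b, c * |x - y| ≤ |φ x - φ y|) :
    ((volume : Measure (Rn n)).restrict (shell n a b)).map (fun t => φ ‖t‖) ≤
      ENNReal.ofReal (n * volume.real (Metric.ball (0 : Rn n) 1) * b ^ (n - 1) * c⁻¹) •
        (volume : Measure ℝ) := by
  have h1 : ((volume : Measure (Rn n)).restrict (shell n a b)).map (fun t => φ ‖t‖) =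
      (((volume : Measure (Rn n)).restrict (shell n a b)).map norm).map φ :=
    (Measure.map_map hφ measurable_norm).symm
  rw [h1, ENNReal.ofReal_mul' (by positivity), mul_smul]
  refine (Measure.map_mono (map_norm_shell_le hn ha) hφ).trans ?_
  rw [Measure.map_smul]
  refine Measure.le_iff.2 fun A hA => ?_
  simp only [Measure.smul_apply, smul_eq_mul]
  exact mul_le_mul' le_rfl (map_restrict_le_of_expanding hφ hc h A)

/-- A homogeneous function of mean value zero on the sphere integrates to zero against radial
functions. -/
lemma integral_radial_mul_eq_zero (hn : n ≠ 0) {Ω : Rn n → ℝ}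
    (hΩ : ∀ c : ℝ, 0 < c → ∀ t : Rn n, Ω (c • t) = Ω t)
    (h0 : ∫ θ : Metric.sphere (0 : Rn n) 1, Ω θ ∂((volume : Measure (Rn n)).toSphere) = 0)
    (h : ℝ → ℂ) : ∫ t : Rn n, h ‖t‖ * (Ω t : ℂ) = 0 := by
  have : Nonempty (Fin n) := ⟨⟨0, Nat.pos_of_ne_zero hn⟩⟩
  set μ : Measure (Rn n) := volume
  have e1 : ∫ t : Rn n, h ‖t‖ * (Ω t : ℂ) =
      ∫ x : ({(0 : Rn n)}ᶜ : Set (Rn n)), h ‖x.1‖ * (Ω x.1 : ℂ) ∂(μ.comap (↑)) := by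
    rw [integral_subtype_comap (measurableSet_singleton _).compl fun x : Rn n =>
      h ‖x‖ * (Ω x : ℂ), restrict_compl_singleton]
  have e2 := μ.measurePreserving_homeomorphUnitSphereProd.integral_comp
    (Homeomorph.measurableEmbedding _)
    (fun p : Metric.sphere (0 : Rn n) 1 × Ioi (0 : ℝ) => (Ω p.1 : ℂ) * h p.2)
  rw [e1]
  refine Eq.trans ?_ (e2.trans ?_)
  · congr 1 with x
    have hx : 0 < ‖x.1‖ := norm_pos_iff.2 x.2
    have e3 : Ω ((homeomorphUnitSphereProd (Rn n) x).1 : Rn n) = Ω x.1 := by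
      rw [homeomorphUnitSphereProd_apply_fst_coe, hΩ _ (inv_pos.2 hx)]
    rw [e3, homeomorphUnitSphereProd_apply_snd_coe, mul_comm]
  · rw [integral_prod_mul (fun θ : Metric.sphere (0 : Rn n) 1 => (Ω θ : ℂ))
      (fun s : Ioi (0 : ℝ) => h s), integral_complex_ofReal, h0]
    simp

end Pushforward

section UnitPhase

lemma monotone_div_of_deriv {f f' : ℝ → ℝ} (hpos : ∀ s > 0, 0 < f s)
    (hd : ∀ s > 0, HasDerivAt f (f' s) s) {c : ℝ} (h : ∀ s > 0, c * f s ≤ s * f' s) {s t : ℝ}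
    (hs : 0 < s) (hst : s ≤ t) : (t / s) ^ c * f s ≤ f t := by
  have hm : MonotoneOn (fun s => Real.log (f s) - c * Real.log s) (Ioi 0) := by
    have hder : ∀ x > 0, HasDerivAt (fun s => Real.log (f s) - c * Real.log s)
        (f' x / f x - c * x⁻¹) x := fun x hx =>
      ((hd x hx).log (hpos x hx).ne').sub ((Real.hasDerivAt_log hx.ne').const_mul c)
    refine monotoneOn_of_deriv_nonneg (convex_Ioi 0)
      (fun x hx => (hder x hx).continuousAt.continuousWithinAt)
      (fun x hx => (hder x (by simpa using hx)).differentiableAt.differentiableWithinAt)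
      fun x hx => ?_
    have hx0 : 0 < x := by simpa using hx
    rw [(hder x hx0).deriv, sub_nonneg, ← div_eq_mul_inv, div_le_div_iff₀ hx0 (hpos x hx0)]
    linarith [h x hx0]
  have ht : 0 < t := hs.trans_le hst
  have h1 := hm (mem_Ioi.2 hs) (mem_Ioi.2 ht) hst
  simp only at h1
  rw [← Real.log_le_log_iff (by have := hpos s hs; positivity) (hpos t ht),
    Real.log_mul (by positivity) (hpos s hs).ne', Real.log_rpow (by positivity),
    Real.log_div ht.ne' hs.ne']
  linarith

lemma le_rpow_mul_of_deriv {f f' : ℝ → ℝ} (hpos : ∀ s > 0, 0 < f s)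
    (hd : ∀ s > 0, HasDerivAt f (f' s) s) {c : ℝ} (h : ∀ s > 0, s * f' s ≤ c * f s) {s t : ℝ}
    (hs : 0 < s) (hst : s ≤ t) : f t ≤ (t / s) ^ c * f s := by
  have ht : 0 < t := hs.trans_le hst
  have h1 := monotone_div_of_deriv (f := fun s => (f s)⁻¹) (f' := fun s => -f' s / f s ^ 2)
    (fun s hs => inv_pos.2 (hpos s hs)) (fun s hs => (hd s hs).inv (hpos s hs).ne') (c := -c)
    (fun s hs => by
      have := hpos s hs
      have h2 := h s hs
      rw [show s * (-f' s / f s ^ 2) = -(s * f' s) / f s ^ 2 by ring, le_div_iff₀ (by positivity),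
        show -c * (f s)⁻¹ * f s ^ 2 = -(c * f s) by field_simp]
      linarith) hs hst
  rw [Real.rpow_neg (by positivity), ← mul_inv] at h1
  have h2 := hpos s hs
  exact (inv_le_inv₀ (by positivity) (hpos t ht)).1 h1

/-- A normalised phase, given together with its derivatives `g j`, subject to scale-invariant
bounds. -/
structure UnitPhase (c : ℕ → ℝ) (c₁ : ℝ) (g : ℕ → ℝ → ℝ) : Prop where
  cont : Continuous (g 0)
  nonpos : ∀ s ≤ 0, g 0 s = 0
  smooth : ContDiffOn ℝ (⊤ : ℕ∞) (g 0) (Ioi 0)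
  pos : ∀ s > 0, 0 < g 0 s
  one : g 0 1 = 1
  hasDerivAt : ∀ j, ∀ s > 0, HasDerivAt (g j) (g (j + 1) s) s
  lower : ∀ s > 0, c₁ * g 0 s ≤ s * g 1 s
  upper : ∀ j, ∀ s > 0, |s ^ j * g j s| ≤ c j * g 0 s

variable {c : ℕ → ℝ} {c₁ : ℝ} {g : ℕ → ℝ → ℝ}

/-- The radius of the shells supporting the unit-scale kernels. -/
def shellRad (c₁ : ℝ) : ℝ := 2 ^ (1 / c₁)

lemma one_lt_shellRad (h : 0 < c₁) : 1 < shellRad c₁ :=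
  Real.one_lt_rpow one_lt_two (by positivity)

lemma UnitPhase.upper_one (hg : UnitPhase c c₁ g) {s : ℝ} (hs : 0 < s) :
    s * g 1 s ≤ c 1 * g 0 s := by
  have := hg.upper 1 s hs
  rw [pow_one] at this
  exact (le_abs_self _).trans this

lemma UnitPhase.one_pos (hg : UnitPhase c c₁ g) (hc₁ : 0 < c₁) {s : ℝ} (hs : 0 < s) :
    0 < g 1 s := by
  have h1 := hg.lower s hs
  have h2 := hg.pos s hs
  have : 0 < c₁ * g 0 s := by positivity
  exact pos_of_mul_pos_right (this.trans_le h1) hs.le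

lemma UnitPhase.mem_shell (hg : UnitPhase c c₁ g) (hc₁ : 0 < c₁) {s : ℝ}
    (hs : g 0 s ∈ Icc (1 / 2 : ℝ) 2) : s ∈ Icc (shellRad c₁)⁻¹ (shellRad c₁) := by
  have hβ : 0 < shellRad c₁ := by have := one_lt_shellRad hc₁; linarith
  have hβc : shellRad c₁ ^ c₁ = 2 := by
    rw [shellRad, ← Real.rpow_mul (by norm_num)]
    field_simp
    simp
  have hs0 : 0 < s := by
    by_contra! h
    rw [hg.nonpos s h] at hs
    have := hs.1
    norm_num at this
  rcases le_total s 1 with h | h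
  · have h1 := monotone_div_of_deriv hg.pos (hg.hasDerivAt 0) hg.lower hs0 h
    rw [hg.one] at h1
    refine ⟨?_, h.trans (one_lt_shellRad hc₁).le⟩
    have h2 : (1 / s) ^ c₁ ≤ shellRad c₁ ^ c₁ := by
      rw [hβc]
      have : 0 ≤ (1 / s) ^ c₁ := by positivity
      nlinarith [hs.1]
    have h3 := (Real.rpow_le_rpow_iff (by positivity) hβ.le hc₁).1 h2
    rw [inv_le_comm₀ hβ hs0, ← one_div]
    exact h3
  · have h1 := monotone_div_of_deriv hg.pos (hg.hasDerivAt 0) hg.lower zero_lt_one h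
    rw [hg.one, div_one, mul_one] at h1
    refine ⟨(inv_le_one_of_one_le₀ (one_lt_shellRad hc₁).le).trans h, ?_⟩
    refine (Real.rpow_le_rpow_iff hs0.le hβ.le hc₁).1 ?_
    rw [hβc]
    exact h1.trans hs.2

/-- The open interval on which the phases are controlled. -/
def phaseInt (c₁ : ℝ) : Set ℝ := Ioo (3 * shellRad c₁)⁻¹ (3 * shellRad c₁)

lemma phaseInt_pos (hc₁ : 0 < c₁) {s : ℝ} (hs : s ∈ phaseInt c₁) : 0 < s := by
  have := one_lt_shellRad hc₁
  exact lt_trans (by positivity) hs.1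

lemma UnitPhase.zero_le (hg : UnitPhase c c₁ g) (hc₁ : 0 < c₁) :
    ∀ s ∈ phaseInt c₁, g 0 s ≤ (3 * shellRad c₁) ^ c 1 ∧ ((3 * shellRad c₁) ^ c 1)⁻¹ ≤ g 0 s := by
  intro s hs
  have hs0 := phaseInt_pos hc₁ hs
  have hβ := one_lt_shellRad hc₁
  have hb : 1 ≤ 3 * shellRad c₁ := by linarith
  have hc1 : 0 ≤ c 1 := by
    have h1 := hg.upper 1 1 zero_lt_one
    rw [hg.one, mul_one] at h1
    exact (abs_nonneg _).trans h1
  have hB1 : 1 ≤ (3 * shellRad c₁) ^ c 1 := Real.one_le_rpow hb hc1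
  have hmono : ∀ {x y : ℝ}, 0 < x → x ≤ y → g 0 x ≤ g 0 y := fun {x y} hx hxy => by
    have h1 := monotone_div_of_deriv hg.pos (hg.hasDerivAt 0) hg.lower hx hxy
    refine le_trans ?_ h1
    have : 1 ≤ (y / x) ^ c₁ := Real.one_le_rpow ((one_le_div hx).2 hxy) hc₁.le
    nlinarith [hg.pos x hx]
  rcases le_total s 1 with h | h
  · refine ⟨((hmono hs0 h).trans hg.one.le).trans hB1, ?_⟩
    have h1 := le_rpow_mul_of_deriv hg.pos (hg.hasDerivAt 0) (fun s hs => hg.upper_one hs) hs0 h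
    rw [hg.one] at h1
    rw [inv_le_iff_one_le_mul₀' (by positivity)]
    refine h1.trans ?_
    have := hg.pos s hs0
    gcongr
    rw [one_div, inv_le_comm₀ hs0 (by positivity)]
    exact hs.1.le
  · refine ⟨?_, (inv_le_one_of_one_le₀ hB1).trans (hg.one.ge.trans (hmono zero_lt_one h))⟩
    have h1 := le_rpow_mul_of_deriv hg.pos (hg.hasDerivAt 0) (fun s hs => hg.upper_one hs)
      zero_lt_one h
    rw [hg.one, div_one, mul_one] at h1
    refine h1.trans ?_
    gcongr
    exact hs.2.le

lemma UnitPhase.exists_bound (c : ℕ → ℝ) (hc₁ : 0 < c₁) (j : ℕ) :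
    ∃ M : ℝ, 0 ≤ M ∧ ∀ g, UnitPhase c c₁ g → ∀ s ∈ phaseInt c₁, |g j s| ≤ M := by
  have hβ := one_lt_shellRad hc₁
  refine ⟨|c j| * (3 * shellRad c₁) ^ c 1 * (3 * shellRad c₁) ^ j, by positivity,
    fun g hg s hs => ?_⟩
  have hs0 := phaseInt_pos hc₁ hs
  have h1 := hg.upper j s hs0
  rw [abs_mul, abs_of_pos (pow_pos hs0 j)] at h1
  have h2 : |g j s| = (s ^ j * |g j s|) * (s⁻¹) ^ j := by
    rw [inv_pow]; field_simp
  rw [h2]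
  have h3 : s⁻¹ ≤ 3 * shellRad c₁ := by
    rw [inv_le_comm₀ hs0 (by positivity)]; exact hs.1.le
  have h4 := hg.pos s hs0
  have h5 : s ^ j * |g j s| ≤ |c j| * (3 * shellRad c₁) ^ c 1 :=
    h1.trans (mul_le_mul (le_abs_self _) (hg.zero_le hc₁ s hs).1 h4.le (abs_nonneg _))
  exact mul_le_mul h5 (pow_le_pow_left₀ (by positivity) h3 j) (by positivity) (by positivity)

lemma UnitPhase.exists_inv_bound (c : ℕ → ℝ) (hc₁ : 0 < c₁) :
    ∃ M : ℝ, 0 < M ∧ ∀ g, UnitPhase c c₁ g → ∀ s ∈ phaseInt c₁, (g 1 s)⁻¹ ≤ M := by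
  have hβ := one_lt_shellRad hc₁
  refine ⟨3 * shellRad c₁ * (c₁⁻¹ * (3 * shellRad c₁) ^ c 1), by positivity, fun g hg s hs => ?_⟩
  have hs0 := phaseInt_pos hc₁ hs
  have h4 := hg.pos s hs0
  have h5 := hg.one_pos hc₁ hs0
  have h6 : (g 0 s)⁻¹ ≤ (3 * shellRad c₁) ^ c 1 := by
    rw [inv_le_comm₀ h4 (by positivity)]
    exact (hg.zero_le hc₁ s hs).2
  calc (g 1 s)⁻¹ = s * (s * g 1 s)⁻¹ := by field_simp
    _ ≤ s * (c₁ * g 0 s)⁻¹ := by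
        have := hg.lower s hs0
        gcongr
    _ = s * (c₁⁻¹ * (g 0 s)⁻¹) := by rw [mul_inv]
    _ ≤ _ := by
        gcongr
        exact hs.2.le

end UnitPhase

section Symbols

variable {ι : Type*} {U : Set ℝ} {d : ι → ℝ → ℝ}

/-- Families of functions on `U` that stay uniformly bounded after `N` applications of the
operators `(d i)⁻¹ d/ds`. -/
def SymbolClass (U : Set ℝ) (d : ι → ℝ → ℝ) : ℕ → (ι → ℝ → ℂ) → Prop
  | 0, f => (∀ i, ContinuousOn (f i) U) ∧ ∃ B : ℝ, ∀ i, ∀ s ∈ U, ‖f i s‖ ≤ B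
  | N + 1, f => ((∀ i, ContinuousOn (f i) U) ∧ ∃ B : ℝ, ∀ i, ∀ s ∈ U, ‖f i s‖ ≤ B) ∧
      ∃ h : ι → ℝ → ℂ, (∀ i, ∀ s ∈ U, HasDerivAt (f i) (d i s * h i s) s) ∧ SymbolClass U d N h

namespace SymbolClass

variable {N : ℕ} {f g : ι → ℝ → ℂ}

lemma bound : ∀ {N : ℕ} {f : ι → ℝ → ℂ}, SymbolClass U d N f →
    (∀ i, ContinuousOn (f i) U) ∧ ∃ B : ℝ, ∀ i, ∀ s ∈ U, ‖f i s‖ ≤ B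
  | 0, _, h => h
  | _ + 1, _, h => h.1

lemma of_succ : ∀ {N : ℕ} {f : ι → ℝ → ℂ}, SymbolClass U d (N + 1) f → SymbolClass U d N f
  | 0, _, h => h.1
  | _ + 1, _, ⟨h1, h, h2, h3⟩ => ⟨h1, h, h2, of_succ h3⟩

lemma const : ∀ {N : ℕ} {a : ι → ℂ} {B : ℝ}, (∀ i, ‖a i‖ ≤ B) →
    SymbolClass U d N fun i _ => a i
  | 0, _, B, h => ⟨fun _ => continuousOn_const, B, fun i _ _ => h i⟩
  | _ + 1, _, B, h => ⟨⟨fun _ => continuousOn_const, B, fun i _ _ => h i⟩, fun _ _ => 0,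
      fun i s _ => by simpa using hasDerivAt_const s _, const (a := fun _ => 0) (B := 0) (by simp)⟩

lemma add : ∀ {N : ℕ} {f g : ι → ℝ → ℂ}, SymbolClass U d N f → SymbolClass U d N g →
    SymbolClass U d N fun i s => f i s + g i s := by
  have key : ∀ {f g : ι → ℝ → ℂ},
      ((∀ i, ContinuousOn (f i) U) ∧ ∃ B : ℝ, ∀ i, ∀ s ∈ U, ‖f i s‖ ≤ B) →
      ((∀ i, ContinuousOn (g i) U) ∧ ∃ B : ℝ, ∀ i, ∀ s ∈ U, ‖g i s‖ ≤ B) →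
      ((∀ i, ContinuousOn (fun s => f i s + g i s) U) ∧
        ∃ B : ℝ, ∀ i, ∀ s ∈ U, ‖f i s + g i s‖ ≤ B) := by
    rintro f g ⟨hf, B, hB⟩ ⟨hg, B', hB'⟩
    exact ⟨fun i => (hf i).add (hg i), B + B', fun i s hs =>
      (norm_add_le _ _).trans (add_le_add (hB i s hs) (hB' i s hs))⟩
  intro N
  induction N with
  | zero => exact fun hf hg => key hf hg
  | succ N ih =>
    rintro f g ⟨hf, h, hh, hs⟩ ⟨hg, k, hk, hs'⟩
    refine ⟨key hf hg, fun i s => h i s + k i s, fun i s hsU => ?_, ih hs hs'⟩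
    rw [mul_add]
    exact (hh i s hsU).add (hk i s hsU)

lemma mul : ∀ {N : ℕ} {f g : ι → ℝ → ℂ}, SymbolClass U d N f → SymbolClass U d N g →
    SymbolClass U d N fun i s => f i s * g i s := by
  have key : ∀ {f g : ι → ℝ → ℂ},
      ((∀ i, ContinuousOn (f i) U) ∧ ∃ B : ℝ, ∀ i, ∀ s ∈ U, ‖f i s‖ ≤ B) →
      ((∀ i, ContinuousOn (g i) U) ∧ ∃ B : ℝ, ∀ i, ∀ s ∈ U, ‖g i s‖ ≤ B) →
      ((∀ i, ContinuousOn (fun s => f i s * g i s) U) ∧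
        ∃ B : ℝ, ∀ i, ∀ s ∈ U, ‖f i s * g i s‖ ≤ B) := by
    rintro f g ⟨hf, B, hB⟩ ⟨hg, B', hB'⟩
    refine ⟨fun i => (hf i).mul (hg i), |B| * |B'|, fun i s hs => ?_⟩
    rw [norm_mul]
    exact mul_le_mul ((hB i s hs).trans (le_abs_self _)) ((hB' i s hs).trans (le_abs_self _))
      (norm_nonneg _) (abs_nonneg _)
  intro N
  induction N with
  | zero => exact fun hf hg => key hf hg
  | succ N ih =>
    intro f g hf' hg'
    obtain ⟨hf, h, hh, hs⟩ := hf'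
    obtain ⟨hg, k, hk, hs'⟩ := hg'
    refine ⟨key hf hg, fun i s => h i s * g i s + f i s * k i s, fun i s hsU => ?_,
      (ih hs (of_succ ⟨hg, k, hk, hs'⟩)).add (ih (of_succ ⟨hf, h, hh, hs⟩) hs')⟩
    exact ((hh i s hsU).mul (hk i s hsU)).congr_deriv (by ring)

lemma succ_of_deriv (hU : ∀ i, ∀ s ∈ U, HasDerivAt (f i) (d i s * g i s) s)
    (hB : ∃ B : ℝ, ∀ i, ∀ s ∈ U, ‖f i s‖ ≤ B) (hg : SymbolClass U d N g) :
    SymbolClass U d (N + 1) f :=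
  ⟨⟨fun i s hs => (hU i s hs).continuousAt.continuousWithinAt, hB⟩, g, hU, hg⟩

/-- Repeated integration by parts against `exp (i μ γ)`. -/
lemma exists_integral_le {W : ι → ℝ} {γ γ' : ι → ℝ → ℝ} (hW : ∀ i, 0 < W i)
    {a b a' b' : ℝ} (ha : a < a') (hab : a' ≤ b') (hb : b' < b)
    (hγ : ∀ i, ∀ s ∈ Ioo a b, HasDerivAt (γ i) (γ' i s) s)
    (hγ'c : ∀ i, ContinuousOn (γ' i) (Ioo a b)) (hγ'0 : ∀ i, ∀ s ∈ Ioo a b, 0 < γ' i s)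
    {B' : ℝ} (hB' : ∀ i, ∀ s ∈ Ioo a b, γ' i s ≤ B') :
    ∀ {N : ℕ} {f : ι → ℝ → ℂ}, SymbolClass (Ioo a b) (fun i s => W i * γ' i s) N f →
      (∀ i, ∀ s ∈ Ioo a b, s ∉ Icc a' b' → f i s = 0) →
      ∃ C : ℝ, 0 ≤ C ∧ ∀ i, ∀ μ : ℝ, 0 < μ →
        ‖∫ s in Ioo a b, Complex.exp (Complex.I * (μ * γ i s : ℝ)) * (f i s * γ' i s)‖ ≤
          C * (W i / μ) ^ N := by
  intro N
  have hB0 : 0 ≤ |B'| := abs_nonneg _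
  induction N with
  | zero =>
    rintro f ⟨hf, B, hB⟩ -
    refine ⟨|B| * |B'| * (b - a), by have : 0 ≤ b - a := by linarith
                                     positivity, fun i μ hμ => ?_⟩
    refine (norm_setIntegral_le_of_norm_le_const (C := |B| * |B'|) (by simp) fun s hs => ?_).trans
      (by simp [Real.volume_real_Ioo_of_le (show a ≤ b by linarith)])
    rw [norm_mul, mul_comm Complex.I, Complex.norm_exp_ofReal_mul_I, one_mul, norm_mul]
    refine mul_le_mul ((hB i s hs).trans (le_abs_self _)) ?_ (norm_nonneg _) (abs_nonneg _)
    rw [Complex.norm_real, Real.norm_of_nonneg (hγ'0 i s hs).le]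
    exact (hB' i s hs).trans (le_abs_self _)
  | succ N ih =>
    rintro f ⟨hf, h, hh, hs⟩ hf0
    have hh0 : ∀ i, ∀ s ∈ Ioo a b, s ∉ Icc a' b' → h i s = 0 := by
      intro i s hs hs'
      have hev : f i =ᶠ[𝓝 s] fun _ => 0 := by
        filter_upwards [isOpen_Ioo.mem_nhds hs, isClosed_Icc.isOpen_compl.mem_nhds hs'] with t h1 h2
        exact hf0 i t h1 h2
      have h1 := (hh i s hs).unique ((hasDerivAt_const s (0 : ℂ)).congr_of_eventuallyEq hev)
      have h2 : ((W i * γ' i s : ℝ) : ℂ) ≠ 0 :=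
        Complex.ofReal_ne_zero.2 (mul_pos (hW i) (hγ'0 i s hs)).ne'
      exact (mul_eq_zero.1 h1).resolve_left h2
    obtain ⟨C, hC, hCi⟩ := ih hs hh0
    refine ⟨C, hC, fun i μ hμ => ?_⟩
    obtain ⟨a₀, ha₀, ha₀'⟩ := exists_between ha
    obtain ⟨b₀, hb₀', hb₀⟩ := exists_between hb
    have hsub : Icc a₀ b₀ ⊆ Ioo a b := fun s hs => ⟨ha₀.trans_le hs.1, hs.2.trans_lt hb₀⟩
    have hred : ∀ F : ℝ → ℂ, (∀ s ∈ Ioo a b, s ∉ Icc a' b' → F s = 0) →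
        ∫ s in Ioo a b, F s = ∫ s in a₀..b₀, F s := by
      intro F hF
      rw [intervalIntegral.integral_of_le (by linarith)]
      refine (setIntegral_eq_of_subset_of_forall_sdiff_eq_zero measurableSet_Ioo
        (Ioc_subset_Icc_self.trans hsub) fun s hs => hF s hs.1 fun h => hs.2 ?_)
      exact ⟨by linarith [h.1], by linarith [h.2]⟩
    have huIcc : uIcc a₀ b₀ = Icc a₀ b₀ := uIcc_of_le (by linarith)
    have hE : ∀ s ∈ Ioo a b, HasDerivAt (fun s => Complex.exp (Complex.I * (μ * γ i s : ℝ)))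
        (Complex.exp (Complex.I * (μ * γ i s : ℝ)) * (Complex.I * (μ * γ' i s : ℝ))) s :=
      fun s hs => (((hγ i s hs).const_mul μ).ofReal_comp.const_mul Complex.I).cexp
    have hγ'c' : ContinuousOn (fun s => ((γ' i s : ℝ) : ℂ)) (Ioo a b) :=
      Complex.continuous_ofReal.comp_continuousOn (hγ'c i)
    have hEc : ContinuousOn (fun s => Complex.exp (Complex.I * (μ * γ i s : ℝ))) (Ioo a b) :=
      fun s hs => (hE s hs).continuousAt.continuousWithinAt
    have hhc := hs.bound.1 i
    have hibp := intervalIntegral.integral_mul_deriv_eq_deriv_mul (a := a₀) (b := b₀)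
      (u := f i) (u' := fun s => (W i * γ' i s : ℝ) * h i s)
      (v := fun s => Complex.exp (Complex.I * (μ * γ i s : ℝ)))
      (v' := fun s => Complex.exp (Complex.I * (μ * γ i s : ℝ)) * (Complex.I * (μ * γ' i s : ℝ)))
      (fun s hs => hh i s (hsub (huIcc ▸ hs))) (fun s hs => hE s (hsub (huIcc ▸ hs)))
      (ContinuousOn.intervalIntegrable (by
        rw [huIcc]
        refine ContinuousOn.mono ?_ hsub
        push_cast
        exact (continuousOn_const.mul hγ'c').mul hhc))
      (ContinuousOn.intervalIntegrable (by
        rw [huIcc]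
        refine ContinuousOn.mono ?_ hsub
        push_cast
        push_cast at hEc
        exact hEc.mul (continuousOn_const.mul (continuousOn_const.mul hγ'c'))))
    rw [hf0 i a₀ (hsub ⟨le_rfl, by linarith⟩) (fun h => by linarith [h.1]),
      hf0 i b₀ (hsub ⟨by linarith, le_rfl⟩) (fun h => by linarith [h.2])] at hibp
    have h1 : ∫ s in Ioo a b, Complex.exp (Complex.I * (μ * γ i s : ℝ)) * (f i s * γ' i s) =
        (Complex.I * μ)⁻¹ * ∫ s in a₀..b₀, f i s *
          (Complex.exp (Complex.I * (μ * γ i s : ℝ)) * (Complex.I * (μ * γ' i s : ℝ))) := by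
      rw [hred _ fun s hs hs' => by rw [hf0 i s hs hs']; simp,
        ← intervalIntegral.integral_const_mul]
      congr 1 with s
      have : (μ : ℂ) ≠ 0 := Complex.ofReal_ne_zero.2 hμ.ne'
      push_cast
      field_simp
    have h2 : ∫ s in a₀..b₀, ((W i * γ' i s : ℝ) : ℂ) * h i s *
          Complex.exp (Complex.I * (μ * γ i s : ℝ)) =
        W i * ∫ s in Ioo a b, Complex.exp (Complex.I * (μ * γ i s : ℝ)) * (h i s * γ' i s) := by
      rw [hred _ fun s hs hs' => by rw [hh0 i s hs hs']; simp,
        ← intervalIntegral.integral_const_mul]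
      congr 1 with s
      push_cast
      ring
    rw [h1, hibp, h2, zero_mul, zero_mul, sub_zero, zero_sub, norm_mul, norm_neg, norm_inv,
      norm_mul, norm_mul, Complex.norm_I, one_mul, Complex.norm_real, Complex.norm_real,
      Real.norm_of_nonneg hμ.le, Real.norm_of_nonneg (hW i).le, pow_succ]
    calc μ⁻¹ * (W i * _) ≤ μ⁻¹ * (W i * (C * (W i / μ) ^ N)) := by
          have := hCi i μ hμ
          have := (hW i).le
          gcongr
      _ = _ := by field_simp

end SymbolClass

end Symbols

section PhaseSymbols

/-- Pairs of a phase and a frequency. -/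
def PhaseIdx (c : ℕ → ℝ) (c₁ : ℝ) : Type := {p : (ℕ → ℝ → ℝ) × ℝ // UnitPhase c c₁ p.1}

/-- The weight of the symbol class attached to a phase and a frequency. -/
def phaseWt {c : ℕ → ℝ} {c₁ : ℝ} (i : PhaseIdx c c₁) (s : ℝ) : ℝ := (1 + |i.1.2|) * i.1.1 1 s

variable {c : ℕ → ℝ} {c₁ : ℝ}

/-- The symbol class attached to phases and frequencies. -/
abbrev PhaseSymbol (N : ℕ) (f : PhaseIdx c c₁ → ℝ → ℂ) : Prop :=
  SymbolClass (phaseInt c₁) phaseWt N f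

lemma phaseWt_mul (hc₁ : 0 < c₁) (i : PhaseIdx c c₁) {s : ℝ} (hs : s ∈ phaseInt c₁) (z : ℂ) :
    phaseWt i s * (((1 + |i.1.2|)⁻¹ : ℝ) * (((i.1.1 1 s)⁻¹ : ℝ) * z)) = z := by
  have h1 : ((i.1.1 1 s : ℝ) : ℂ) ≠ 0 :=
    Complex.ofReal_ne_zero.2 (i.2.one_pos hc₁ (phaseInt_pos hc₁ hs)).ne'
  have h2 : ((1 + |i.1.2| : ℝ) : ℂ) ≠ 0 := Complex.ofReal_ne_zero.2 (by positivity)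
  unfold phaseWt
  push_cast at h2 ⊢
  field_simp

lemma phaseSymbol_inv_weight (N : ℕ) :
    PhaseSymbol (c := c) (c₁ := c₁) N fun i _ => (((1 + |i.1.2|)⁻¹ : ℝ) : ℂ) := by
  refine SymbolClass.const (B := 1) fun i => ?_
  rw [Complex.norm_real, Real.norm_of_nonneg (by positivity)]
  exact inv_le_one_of_one_le₀ (by linarith [abs_nonneg i.1.2])

lemma phaseSymbol_inv_and_deriv (hc₁ : 0 < c₁) (N : ℕ) :
    (PhaseSymbol (c := c) (c₁ := c₁) N fun i s => (((i.1.1 1 s)⁻¹ : ℝ) : ℂ)) ∧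
      ∀ j, PhaseSymbol (c := c) (c₁ := c₁) N fun i s => ((i.1.1 j s : ℝ) : ℂ) := by
  have hder : ∀ (i : PhaseIdx c c₁) (j : ℕ), ∀ s ∈ phaseInt c₁,
      HasDerivAt (fun s => ((i.1.1 j s : ℝ) : ℂ)) ((i.1.1 (j + 1) s : ℝ) : ℂ) s :=
    fun i j s hs => (i.2.hasDerivAt j s (phaseInt_pos hc₁ hs)).ofReal_comp
  have hinv : ∀ (i : PhaseIdx c c₁), ∀ s ∈ phaseInt c₁,
      HasDerivAt (fun s => (((i.1.1 1 s)⁻¹ : ℝ) : ℂ))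
        (((-i.1.1 2 s / i.1.1 1 s ^ 2 : ℝ)) : ℂ) s := fun i s hs =>
    ((i.2.hasDerivAt 1 s (phaseInt_pos hc₁ hs)).inv
      (i.2.one_pos hc₁ (phaseInt_pos hc₁ hs)).ne').ofReal_comp
  have hB1 : ∃ B : ℝ, ∀ i : PhaseIdx c c₁, ∀ s ∈ phaseInt c₁, ‖(((i.1.1 1 s)⁻¹ : ℝ) : ℂ)‖ ≤ B := by
    obtain ⟨M, -, hM⟩ := UnitPhase.exists_inv_bound c hc₁
    refine ⟨M, fun i s hs => ?_⟩
    rw [Complex.norm_real, Real.norm_of_nonneg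
      (inv_nonneg.2 (i.2.one_pos hc₁ (phaseInt_pos hc₁ hs)).le)]
    exact hM _ i.2 s hs
  have hB2 : ∀ j, ∃ B : ℝ, ∀ i : PhaseIdx c c₁, ∀ s ∈ phaseInt c₁, ‖((i.1.1 j s : ℝ) : ℂ)‖ ≤ B := by
    intro j
    obtain ⟨M, -, hM⟩ := UnitPhase.exists_bound c hc₁ j
    refine ⟨M, fun i s hs => ?_⟩
    rw [Complex.norm_real, Real.norm_eq_abs]
    exact hM _ i.2 s hs
  induction N with
  | zero =>
    exact ⟨⟨fun i s hs => (hinv i s hs).continuousAt.continuousWithinAt, hB1⟩,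
      fun j => ⟨fun i s hs => (hder i j s hs).continuousAt.continuousWithinAt, hB2 j⟩⟩
  | succ N ih =>
    refine ⟨SymbolClass.succ_of_deriv (fun i s hs => ?_) hB1 ((phaseSymbol_inv_weight N).mul
        (ih.1.mul ((SymbolClass.const (a := fun _ => (-1 : ℂ)) (B := 1) (by simp)).mul
          ((ih.2 2).mul (ih.1.mul ih.1))))),
      fun j => SymbolClass.succ_of_deriv (fun i s hs => ?_) (hB2 j)
        ((phaseSymbol_inv_weight N).mul (ih.1.mul (ih.2 (j + 1))))⟩
    · refine (hinv i s hs).congr_deriv ?_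
      rw [phaseWt_mul hc₁ i hs]
      push_cast
      field_simp
    · refine (hder i j s hs).congr_deriv ?_
      rw [phaseWt_mul hc₁ i hs]

lemma phaseSymbol_cutoff (hc₁ : 0 < c₁) (N : ℕ) : ∀ {η : ℝ → ℝ}, ContDiff ℝ (⊤ : ℕ∞) η →
    HasCompactSupport η → PhaseSymbol (c := c) (c₁ := c₁) N fun i s => ((η (i.1.1 0 s) : ℝ) : ℂ) := by
  have hb : ∀ {η : ℝ → ℝ}, Continuous η → HasCompactSupport η →
      ∃ B : ℝ, ∀ i : PhaseIdx c c₁, ∀ s ∈ phaseInt c₁, ‖((η (i.1.1 0 s) : ℝ) : ℂ)‖ ≤ B := by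
    intro η h1 h2
    obtain ⟨B, hB⟩ := h2.exists_bound_of_continuous h1
    exact ⟨B, fun i s _ => by rw [Complex.norm_real]; exact hB _⟩
  induction N with
  | zero =>
    intro η h1 h2
    exact ⟨fun i => (Complex.continuous_ofReal.comp (h1.continuous.comp i.2.cont)).continuousOn,
      hb h1.continuous h2⟩
  | succ N ih =>
    intro η h1 h2
    refine SymbolClass.succ_of_deriv (fun i s hs => ?_) (hb h1.continuous h2)
      ((phaseSymbol_inv_weight N).mul (ih (η := deriv η) (h1.deriv' (n := (⊤ : ℕ∞))) h2.deriv))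
    have h3 := ((h1.differentiable (by simp)).differentiableAt.hasDerivAt.comp s
      (i.2.hasDerivAt 0 s (phaseInt_pos hc₁ hs))).ofReal_comp
    refine h3.congr_deriv ?_
    have h4 : ((1 + |i.1.2| : ℝ) : ℂ) ≠ 0 := Complex.ofReal_ne_zero.2 (by positivity)
    unfold phaseWt
    push_cast at h4 ⊢
    field_simp

lemma phaseSymbol_id (hc₁ : 0 < c₁) (N : ℕ) :
    PhaseSymbol (c := c) (c₁ := c₁) N fun _ s => (s : ℂ) := by
  have hb : ∃ B : ℝ, ∀ _ : PhaseIdx c c₁, ∀ s ∈ phaseInt c₁, ‖(s : ℂ)‖ ≤ B :=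
    ⟨3 * shellRad c₁, fun _ s hs => by
      rw [Complex.norm_real, Real.norm_of_nonneg (phaseInt_pos hc₁ hs).le]; exact hs.2.le⟩
  refine SymbolClass.of_succ (SymbolClass.succ_of_deriv (fun i s hs => ?_) hb
    ((phaseSymbol_inv_weight N).mul ((phaseSymbol_inv_and_deriv hc₁ N).1.mul
      (SymbolClass.const (a := fun _ => (1 : ℂ)) (B := 1) (by simp)))))
  rw [phaseWt_mul hc₁ i hs]
  exact Complex.ofRealCLM.hasDerivAt (x := s)

lemma phaseSymbol_exp (hc₁ : 0 < c₁) (N : ℕ) :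
    PhaseSymbol (c := c) (c₁ := c₁) N
      fun i s => Complex.exp (((-(2 * Real.pi * s ^ 2 * i.1.2) : ℝ) : ℂ) * Complex.I) := by
  have hder : ∀ (i : PhaseIdx c c₁), ∀ s,
      HasDerivAt (fun s : ℝ => Complex.exp (((-(2 * Real.pi * s ^ 2 * i.1.2) : ℝ) : ℂ) * Complex.I))
        (Complex.exp (((-(2 * Real.pi * s ^ 2 * i.1.2) : ℝ) : ℂ) * Complex.I) *
          (((-(2 * Real.pi * (2 * s) * i.1.2) : ℝ) : ℂ) * Complex.I)) s := by
    intro i s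
    have h1 : HasDerivAt (fun s : ℝ => -(2 * Real.pi * s ^ 2 * i.1.2))
        (-(2 * Real.pi * (2 * s) * i.1.2)) s := by
      exact (((hasDerivAt_pow 2 s).const_mul (2 * Real.pi)).mul_const i.1.2).neg.congr_deriv
        (by simp)
    exact (h1.ofReal_comp.mul_const Complex.I).cexp
  have hb : ∃ B : ℝ, ∀ (i : PhaseIdx c c₁), ∀ s ∈ phaseInt c₁,
      ‖Complex.exp (((-(2 * Real.pi * s ^ 2 * i.1.2) : ℝ) : ℂ) * Complex.I)‖ ≤ B :=
    ⟨1, fun i s _ => (Complex.norm_exp_ofReal_mul_I _).le⟩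
  induction N with
  | zero => exact ⟨fun i s _ => (hder i s).continuousAt.continuousWithinAt, hb⟩
  | succ N ih =>
    have hw : PhaseSymbol (c := c) (c₁ := c₁) N
        fun i _ => ((-(4 * Real.pi) * (i.1.2 / (1 + |i.1.2|)) : ℝ) : ℂ) * Complex.I := by
      refine SymbolClass.const (B := 4 * Real.pi) fun i => ?_
      rw [norm_mul, Complex.norm_I, mul_one, Complex.norm_real, norm_mul, norm_neg,
        Real.norm_of_nonneg (by positivity), norm_div, Real.norm_eq_abs, Real.norm_eq_abs,
        abs_of_pos (show 0 < 1 + |i.1.2| by positivity)]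
      refine mul_le_of_le_one_right (by positivity) ((div_le_one (by positivity)).2 (by simp))
    refine SymbolClass.succ_of_deriv (fun i s hs => ?_) hb
      (hw.mul ((phaseSymbol_id hc₁ N).mul ((phaseSymbol_inv_and_deriv hc₁ N).1.mul ih)))
    refine (hder i s).congr_deriv ?_
    have h1 : ((i.1.1 1 s : ℝ) : ℂ) ≠ 0 :=
      Complex.ofReal_ne_zero.2 (i.2.one_pos hc₁ (phaseInt_pos hc₁ hs)).ne'
    have h2 : ((1 + |i.1.2| : ℝ) : ℂ) ≠ 0 := Complex.ofReal_ne_zero.2 (by positivity)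
    generalize Complex.exp _ = E
    unfold phaseWt
    push_cast at h2 ⊢
    field_simp
    ring

/-- The unit-scale oscillating factor, as a function of `q = ‖t‖ ^ 2`. -/
def oscFactor (η : ℝ → ℝ) (g : ℕ → ℝ → ℝ) (μ q : ℝ) : ℂ :=
  Complex.exp (Complex.I * (μ * g 0 (√q) : ℝ)) * (η (g 0 (√q)) : ℝ)

lemma UnitPhase.cutoff_eq_zero {g : ℕ → ℝ → ℝ} (hg : UnitPhase c c₁ g) (hc₁ : 0 < c₁) {η : ℝ → ℝ}
    (hη0 : ∀ y ∉ Icc (1 / 2 : ℝ) 2, η y = 0) {s : ℝ}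
    (hs : s ∉ Icc (shellRad c₁)⁻¹ (shellRad c₁)) : η (g 0 s) = 0 :=
  hη0 _ fun h => hs (hg.mem_shell hc₁ h)

/-- Rapid decay of the Fourier transform of the oscillating factor at low frequencies. -/
lemma exists_norm_fourier_oscFactor_le (c : ℕ → ℝ) (hc₁ : 0 < c₁) {η : ℝ → ℝ}
    (hη : ContDiff ℝ (⊤ : ℕ∞) η) (hη0 : ∀ y ∉ Icc (1 / 2 : ℝ) 2, η y = 0) (N : ℕ) :
    ∃ C : ℝ, 0 ≤ C ∧ ∀ g, UnitPhase c c₁ g → ∀ w μ : ℝ, 0 < μ →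
      ‖𝓕 (oscFactor η g μ) w‖ ≤ C * ((1 + |w|) / μ) ^ N := by
  have hβ := one_lt_shellRad hc₁
  have hηc : HasCompactSupport η := HasCompactSupport.of_support_subset_isCompact
    (K := Icc (1 / 2 : ℝ) 2) isCompact_Icc (fun y hy => by
      by_contra h
      exact hy (hη0 y h))
  have hf := (phaseSymbol_cutoff (c := c) hc₁ N hη hηc).mul
    ((phaseSymbol_exp hc₁ N).mul ((phaseSymbol_id hc₁ N).mul
      ((phaseSymbol_inv_and_deriv hc₁ N).1.mul
        (SymbolClass.const (a := fun _ => (2 : ℂ)) (B := 2) (by simp)))))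
  obtain ⟨B', -, hB'⟩ := UnitPhase.exists_bound c hc₁ 1
  obtain ⟨C, hC, hCi⟩ := SymbolClass.exists_integral_le (ι := PhaseIdx c c₁)
    (W := fun i => 1 + |i.1.2|) (γ := fun i => i.1.1 0) (γ' := fun i => i.1.1 1)
    (fun i => by positivity) (a := (3 * shellRad c₁)⁻¹) (b := 3 * shellRad c₁)
    (a' := (shellRad c₁)⁻¹) (b' := shellRad c₁)
    (inv_strictAnti₀ (by linarith) (by linarith))
    ((inv_le_one_of_one_le₀ hβ.le).trans hβ.le) (by linarith)
    (fun i s hs => i.2.hasDerivAt 0 s (phaseInt_pos hc₁ hs))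
    (fun i s hs => (i.2.hasDerivAt 1 s (phaseInt_pos hc₁ hs)).continuousAt.continuousWithinAt)
    (fun i s hs => i.2.one_pos hc₁ (phaseInt_pos hc₁ hs))
    (B' := B') (fun i s hs => (le_abs_self _).trans (hB' _ i.2 s hs)) hf
    (fun i s hs hs' => by rw [i.2.cutoff_eq_zero hc₁ hη0 hs']; simp)
  refine ⟨C, hC, fun g hg w μ hμ => ?_⟩
  refine le_trans (le_of_eq ?_) (hCi ⟨(g, w), hg⟩ μ hμ)
  congr 1
  set J := Ioo (3 * shellRad c₁)⁻¹ (3 * shellRad c₁) with hJ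
  have hJpos : ∀ s ∈ J, 0 < s := fun s hs => phaseInt_pos hc₁ hs
  have himg : ∫ q : ℝ, Complex.exp (((-2 * Real.pi * q * w : ℝ) : ℂ) * Complex.I) •
      oscFactor η g μ q = ∫ q in (fun s : ℝ => s ^ 2) '' J,
        Complex.exp (((-2 * Real.pi * q * w : ℝ) : ℂ) * Complex.I) • oscFactor η g μ q := by
    refine (setIntegral_eq_integral_of_forall_compl_eq_zero fun q hq => ?_).symm
    have : η (g 0 √q) = 0 := by
      refine hg.cutoff_eq_zero hc₁ hη0 fun h => hq ⟨√q, ⟨?_, ?_⟩, Real.sq_sqrt ?_⟩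
      · exact (inv_strictAnti₀ (by linarith) (by linarith)).trans_le h.1
      · exact h.2.trans_lt (by linarith)
      · by_contra! h0
        rw [Real.sqrt_eq_zero_of_nonpos h0.le] at h
        have := h.1
        have : 0 < (shellRad c₁)⁻¹ := by positivity
        linarith
    simp [oscFactor, this]
  rw [Real.fourier_real_eq_integral_exp_smul, himg, integral_image_eq_integral_abs_deriv_smul
    (f' := fun s => 2 * s) measurableSet_Ioo
    (fun s _ => by simpa using (hasDerivAt_pow 2 s).hasDerivWithinAt)
    (fun x hx y hy hxy => (pow_left_inj₀ (hJpos x hx).le (hJpos y hy).le two_ne_zero).1 hxy)]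
  refine setIntegral_congr_fun measurableSet_Ioo fun s hs => ?_
  have hs0 := hJpos s hs
  have h1 : ((g 1 s : ℝ) : ℂ) ≠ 0 := Complex.ofReal_ne_zero.2 (hg.one_pos hc₁ hs0).ne'
  simp only [oscFactor, smul_eq_mul, Real.sqrt_sq hs0.le, abs_of_pos (show 0 < 2 * s by positivity),
    Complex.real_smul]
  rw [show -2 * Real.pi * s ^ 2 * w = -(2 * Real.pi * s ^ 2 * w) by ring]
  push_cast
  field_simp

end PhaseSymbols

section Chirp

variable {n : ℕ}

/-- The Fourier transform of `a` multiplied by a quadratic phase. -/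
def chirp (a : Rn n → ℂ) (ξ : Rn n) (w : ℝ) : ℂ :=
  ∫ t, Complex.exp (Complex.I * (2 * Real.pi * (w * ‖t‖ ^ 2 - inner ℝ ξ t) : ℝ)) * a t

lemma norm_cexp_I_mul (x : ℝ) : ‖Complex.exp (Complex.I * x)‖ = 1 := by
  rw [mul_comm]; exact Complex.norm_exp_ofReal_mul_I x

lemma norm_chirp_le (a : Rn n → ℂ) (ξ : Rn n) (w : ℝ) : ‖chirp a ξ w‖ ≤ ∫ t, ‖a t‖ := by
  refine (norm_integral_le_integral_norm _).trans (le_of_eq ?_)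
  simp_rw [norm_mul, norm_cexp_I_mul, one_mul]

lemma continuous_chirp {a : Rn n → ℂ} (ha : Integrable a) (ξ : Rn n) : Continuous (chirp a ξ) := by
  refine continuous_of_dominated (bound := fun t => ‖a t‖) (fun w => ?_) (fun w => ?_) ha.norm ?_
  · exact (Continuous.aestronglyMeasurable (by fun_prop)).mul ha.aestronglyMeasurable
  · exact Eventually.of_forall fun t => by rw [norm_mul, norm_cexp_I_mul, one_mul]
  · exact Eventually.of_forall fun t => by fun_prop

lemma norm_integral_gaussian_le (b : SchwartzMap (Rn n) ℂ) (x : Rn n) {B : ℂ} (hB : 0 < B.re) :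
    ‖∫ t, 𝓕 (⇑b) t * Complex.exp (-B * ‖t‖ ^ 2 + 2 * Real.pi * Complex.I * inner ℝ x t)‖ ≤
      (Real.pi / ‖B‖) ^ ((n : ℝ) / 2) * ∫ t, ‖b t‖ := by
  have J : Integrable fun t : Rn n =>
      Complex.exp (-B * ‖t‖ ^ 2 + 2 * Real.pi * Complex.I * inner ℝ x t) :=
    GaussianFourier.integrable_cexp_neg_mul_sq_norm_add hB _ _
  have h1 : ∫ t, 𝓕 (⇑b) t * Complex.exp (-B * ‖t‖ ^ 2 + 2 * Real.pi * Complex.I * inner ℝ x t) =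
      ∫ t, b t * 𝓕 (fun t : Rn n =>
        Complex.exp (-B * ‖t‖ ^ 2 + 2 * Real.pi * Complex.I * inner ℝ x t)) t := by
    simpa using! (VectorFourier.integral_fourierIntegral_smul_eq_flip (L := innerₗ (Rn n))
      Real.continuous_fourierChar continuous_inner b.integrable J)
  rw [h1, ← integral_const_mul]
  refine norm_integral_le_of_norm_le (b.integrable.norm.const_mul _)
    (Eventually.of_forall fun t => ?_)
  rw [fourier_gaussian_innerProductSpace' hB, norm_mul, norm_mul, mul_comm]
  refine mul_le_mul_of_nonneg_right ?_ (norm_nonneg _)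
  have h2 : ‖((Real.pi : ℂ) / B) ^ ((Module.finrank ℝ (Rn n) : ℂ) / 2)‖ =
      (Real.pi / ‖B‖) ^ ((n : ℝ) / 2) := by
    rw [show ((Module.finrank ℝ (Rn n) : ℂ) / 2) = (((n : ℝ) / 2 : ℝ) : ℂ) by simp,
      Complex.norm_cpow_real, norm_div, Complex.norm_real, Real.norm_of_nonneg Real.pi_pos.le]
  rw [h2]
  refine mul_le_of_le_one_right (by positivity) ?_
  rw [Complex.norm_exp, Real.exp_le_one_iff,
    show -(Real.pi : ℂ) ^ 2 * ‖x - t‖ ^ 2 / B = ((-(Real.pi ^ 2 * ‖x - t‖ ^ 2) : ℝ) : ℂ) / B by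
      push_cast; ring, Complex.div_re, Complex.ofReal_re, Complex.ofReal_im, zero_mul, zero_div,
    add_zero]
  refine div_nonpos_of_nonpos_of_nonneg (mul_nonpos_of_nonpos_of_nonneg ?_ hB.le)
    (Complex.normSq_nonneg _)
  rw [neg_nonpos]
  positivity

lemma exists_norm_chirp_le_rpow (a : SchwartzMap (Rn n) ℂ) :
    ∃ C : ℝ, 0 ≤ C ∧ ∀ ξ w, w ≠ 0 → ‖chirp a ξ w‖ ≤ C * |w| ^ (-((n : ℝ) / 2)) := by
  set b : SchwartzMap (Rn n) ℂ := 𝓕⁻ a with hb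
  have hab : 𝓕 (⇑b) = ⇑a := by
    rw [← SchwartzMap.fourier_coe, hb, FourierTransform.fourier_fourierInv_eq]
  refine ⟨∫ t, ‖b t‖, by positivity, fun ξ w hw => ?_⟩
  set B : ℕ → ℂ := fun k => (Real.pi : ℂ) * (((1 / ((k : ℝ) + 1) : ℝ) : ℂ) - 2 * w * Complex.I)
    with hB
  have hre : ∀ k, (B k).re = Real.pi * (1 / ((k : ℝ) + 1)) := fun k => by
    simp only [hB]
    rw [Complex.re_ofReal_mul, Complex.sub_re, Complex.ofReal_re]
    simp
  have him : ∀ k, (B k).im = -(Real.pi * (2 * w)) := fun k => by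
    simp [hB]
  have hk : ∀ k : ℕ, (0 : ℝ) < 1 / ((k : ℝ) + 1) := fun k => by positivity
  have hlim : Tendsto (fun k => ∫ t, 𝓕 (⇑b) t * Complex.exp
      (-B k * ‖t‖ ^ 2 + 2 * Real.pi * Complex.I * inner ℝ (-ξ) t)) atTop (𝓝 (chirp a ξ w)) := by
    rw [hab]
    refine tendsto_integral_of_dominated_convergence (fun t => ‖a t‖) (fun k => ?_)
      a.integrable.norm (fun k => Eventually.of_forall fun t => ?_)
      (Eventually.of_forall fun t => ?_)
    · exact Continuous.aestronglyMeasurable (by fun_prop)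
    · rw [norm_mul]
      refine mul_le_of_le_one_right (norm_nonneg _) ?_
      rw [Complex.norm_exp, Real.exp_le_one_iff]
      have : (-B k * (‖t‖ : ℂ) ^ 2 + 2 * Real.pi * Complex.I * inner ℝ (-ξ) t).re =
          -((B k).re * ‖t‖ ^ 2) := by
        simp [← Complex.ofReal_pow]
      rw [this, hre, neg_nonpos]
      have := hk k
      positivity
    · have h1 : Tendsto B atTop (𝓝 ((Real.pi : ℂ) * (((0 : ℝ) : ℂ) - 2 * w * Complex.I))) :=
        (((Complex.continuous_ofReal.tendsto _).comp
          tendsto_one_div_add_atTop_nhds_zero_nat).sub_const _).const_mul _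
      have h2 := ((Complex.continuous_exp.tendsto _).comp (((h1.neg.mul_const
        ((‖t‖ : ℂ) ^ 2)).add_const (2 * Real.pi * Complex.I * inner ℝ (-ξ) t)))).const_mul (a t)
      have h3 : Complex.exp (Complex.I * (2 * Real.pi * (w * ‖t‖ ^ 2 - inner ℝ ξ t) : ℝ)) * a t =
          a t * Complex.exp (-((Real.pi : ℂ) * (((0 : ℝ) : ℂ) - 2 * w * Complex.I)) *
            (‖t‖ : ℂ) ^ 2 + 2 * Real.pi * Complex.I * inner ℝ (-ξ) t) := by
        rw [mul_comm]
        congr 2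
        rw [inner_neg_left]
        push_cast
        ring
      rw [h3]
      exact h2
  refine le_of_tendsto' hlim.norm fun k => ?_
  refine (norm_integral_gaussian_le b (-ξ) (by rw [hre]; have := hk k; positivity)).trans ?_
  rw [mul_comm]
  refine mul_le_mul_of_nonneg_left ?_ (by positivity)
  have hw0 : 0 < |w| := abs_pos.2 hw
  rw [Real.rpow_neg hw0.le, ← Real.inv_rpow hw0.le]
  refine Real.rpow_le_rpow (by positivity) ?_ (by positivity)
  have h3 : Real.pi * |w| ≤ ‖B k‖ := by
    refine le_trans ?_ (Complex.abs_im_le_norm _)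
    rw [him, abs_neg, abs_mul, abs_mul, abs_of_pos Real.pi_pos, abs_two]
    nlinarith [Real.pi_pos]
  have h4 : 0 < ‖B k‖ := lt_of_lt_of_le (by positivity) h3
  rw [div_le_iff₀ h4, inv_mul_eq_div, le_div_iff₀ hw0]
  exact h3

end Chirp

section OscillatoryMultiplier

variable {n : ℕ} {c : ℕ → ℝ} {c₁ : ℝ} {g : ℕ → ℝ → ℝ} {η : ℝ → ℝ}

lemma UnitPhase.exists_expanding (c : ℕ → ℝ) (hc₁ : 0 < c₁) :
    ∃ m : ℝ, 0 < m ∧ ∀ g, UnitPhase c c₁ g →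
      ∀ x ∈ Icc (shellRad c₁)⁻¹ (shellRad c₁), ∀ y ∈ Icc (shellRad c₁)⁻¹ (shellRad c₁),
        m * |x - y| ≤ |g 0 x - g 0 y| := by
  have hβ := one_lt_shellRad hc₁
  obtain ⟨M, hM, hMi⟩ := UnitPhase.exists_inv_bound c hc₁
  refine ⟨M⁻¹, inv_pos.2 hM, fun g hg => ?_⟩
  have hsub : Icc (shellRad c₁)⁻¹ (shellRad c₁) ⊆ phaseInt c₁ := fun s hs =>
    ⟨(inv_strictAnti₀ (by linarith) (by linarith)).trans_le hs.1, hs.2.trans_lt (by linarith)⟩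
  have key : ∀ x ∈ Icc (shellRad c₁)⁻¹ (shellRad c₁), ∀ y ∈ Icc (shellRad c₁)⁻¹ (shellRad c₁),
      x ≤ y → M⁻¹ * (y - x) ≤ g 0 y - g 0 x := by
    refine (convex_Icc _ _).mul_sub_le_image_sub_of_le_deriv hg.cont.continuousOn
      (fun s hs => (hg.hasDerivAt 0 s (phaseInt_pos hc₁ (hsub (interior_subset
        hs)))).differentiableAt.differentiableWithinAt) fun s hs => ?_
    have hs' := hsub (interior_subset hs)
    rw [(hg.hasDerivAt 0 s (phaseInt_pos hc₁ hs')).deriv,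
      inv_le_comm₀ hM (hg.one_pos hc₁ (phaseInt_pos hc₁ hs'))]
    exact hMi g hg s hs'
  intro x hx y hy
  rcases le_total x y with h | h
  · rw [abs_sub_comm, abs_of_nonneg (sub_nonneg.2 h), abs_sub_comm]
    exact (key x hx y hy h).trans (le_abs_self _)
  · rw [abs_of_nonneg (sub_nonneg.2 h)]
    exact (key y hy x hx h).trans (le_abs_self _)

lemma oscFactor_eq_zero (hg : UnitPhase c c₁ g) (hc₁ : 0 < c₁)
    (hη0 : ∀ y ∉ Icc (1 / 2 : ℝ) 2, η y = 0) (μ : ℝ) {q : ℝ}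
    (hq : q ∉ Icc ((shellRad c₁)⁻¹ ^ 2) (shellRad c₁ ^ 2)) : oscFactor η g μ q = 0 := by
  have hβ := one_lt_shellRad hc₁
  have hβ' : 0 < (shellRad c₁)⁻¹ := by positivity
  have : η (g 0 √q) = 0 := by
    refine hg.cutoff_eq_zero hc₁ hη0 fun h => hq ⟨?_, ?_⟩
    · exact (Real.le_sqrt' hβ').1 h.1
    · exact (Real.sqrt_le_left (by linarith)).1 h.2
  simp [oscFactor, this]

lemma norm_oscFactor (μ q : ℝ) : ‖oscFactor η g μ q‖ = |η (g 0 √q)| := by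
  rw [oscFactor, norm_mul, norm_cexp_I_mul, one_mul, Complex.norm_real, Real.norm_eq_abs]

lemma contDiff_oscFactor (hg : UnitPhase c c₁ g) (hc₁ : 0 < c₁) (hη : ContDiff ℝ (⊤ : ℕ∞) η)
    (hη0 : ∀ y ∉ Icc (1 / 2 : ℝ) 2, η y = 0) (μ : ℝ) :
    ContDiff ℝ (⊤ : ℕ∞) (oscFactor η g μ) := by
  have hβ := one_lt_shellRad hc₁
  have hβ' : 0 < (shellRad c₁)⁻¹ := by positivity
  refine contDiff_iff_contDiffAt.2 fun q => ?_
  rcases le_or_gt q 0 with hq | hq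
  · have : oscFactor η g μ =ᶠ[𝓝 q] fun _ => 0 := by
      filter_upwards [Iio_mem_nhds (show q < (shellRad c₁)⁻¹ ^ 2 from
        hq.trans_lt (by positivity))] with y hy
      exact oscFactor_eq_zero hg hc₁ hη0 μ fun h => (not_lt.2 h.1) hy
    exact contDiffAt_const.congr_of_eventuallyEq this
  · have h1 : ContDiffAt ℝ (⊤ : ℕ∞) (fun q => g 0 (√q)) q :=
      ContDiffAt.comp q ((hg.smooth (√q) (Real.sqrt_pos.2 hq)).contDiffAt
        (Ioi_mem_nhds (Real.sqrt_pos.2 hq))) (Real.contDiffAt_sqrt hq.ne')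
    refine ContDiffAt.mul ?_ ?_
    · exact (contDiffAt_const.mul (Complex.ofRealCLM.contDiff.contDiffAt.comp q
        (contDiffAt_const.mul h1))).cexp
    · exact Complex.ofRealCLM.contDiff.contDiffAt.comp q (hη.contDiffAt.comp q h1)

lemma hasCompactSupport_oscFactor (hg : UnitPhase c c₁ g) (hc₁ : 0 < c₁)
    (hη0 : ∀ y ∉ Icc (1 / 2 : ℝ) 2, η y = 0) (μ : ℝ) :
    HasCompactSupport (oscFactor η g μ) :=
  HasCompactSupport.intro isCompact_Icc fun _ hq => oscFactor_eq_zero hg hc₁ hη0 μ hq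

lemma fourier_radial_mul_eq (G : SchwartzMap ℝ ℂ) {a : Rn n → ℂ} (ha : Integrable a) (ξ : Rn n) :
    𝓕 (fun t => G (‖t‖ ^ 2) * a t) ξ = ∫ w, 𝓕 (⇑G) w * chirp a ξ w := by
  have hG : Integrable (𝓕 (⇑G)) := by rw [← SchwartzMap.fourier_coe]; exact (𝓕 G).integrable
  have hinv : ∀ q : ℝ, G q = ∫ w, Complex.exp (((2 * Real.pi * (w * q) : ℝ) : ℂ) * Complex.I) *
      𝓕 (⇑G) w := by
    intro q
    have h1 : 𝓕⁻ (𝓕 G) q = G q := by rw [FourierTransform.fourierInv_fourier_eq]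
    rw [← h1, SchwartzMap.fourierInv_coe, SchwartzMap.fourier_coe, Real.fourierInv_eq']
    congr 1 with w
    simp [mul_comm]
  rw [Real.fourier_eq']
  have e1 : ∀ t : Rn n, Complex.exp (((-2 * Real.pi * inner ℝ t ξ : ℝ) : ℂ) * Complex.I) •
      (G (‖t‖ ^ 2) * a t) = ∫ w, 𝓕 (⇑G) w *
        (Complex.exp (Complex.I * (2 * Real.pi * (w * ‖t‖ ^ 2 - inner ℝ ξ t) : ℝ)) * a t) := by
    intro t
    rw [hinv, ← integral_mul_const, smul_eq_mul, ← integral_const_mul]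
    congr 1 with w
    rw [show Complex.exp (Complex.I * (2 * Real.pi * (w * ‖t‖ ^ 2 - inner ℝ ξ t) : ℝ)) =
      Complex.exp (((-2 * Real.pi * inner ℝ t ξ : ℝ) : ℂ) * Complex.I) *
        Complex.exp (((2 * Real.pi * (w * ‖t‖ ^ 2) : ℝ) : ℂ) * Complex.I) by
      rw [← Complex.exp_add, real_inner_comm]
      congr 1
      push_cast
      ring]
    ring
  simp_rw [e1]
  rw [integral_integral_swap]
  · simp_rw [integral_const_mul]
    rfl
  · refine (ha.mul_prod hG).mono ?_ (Eventually.of_forall fun p => ?_)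
    · have h1 : Measurable fun p : Rn n × ℝ =>
          Complex.exp (Complex.I * (2 * Real.pi * (p.2 * ‖p.1‖ ^ 2 - inner ℝ ξ p.1) : ℝ)) :=
        Continuous.measurable (by fun_prop)
      exact hG.aestronglyMeasurable.comp_snd.mul
        (h1.aestronglyMeasurable.mul ha.aestronglyMeasurable.comp_fst)
    · simp only [Function.uncurry]
      rw [norm_mul, norm_mul, norm_mul, norm_cexp_I_mul, one_mul, mul_comm]

lemma lintegral_tail_rpow_le {W : ℝ} (hW : 0 < W) (hn : 2 ≤ n) :
    ∫⁻ w in {w : ℝ | W < |w|}, ENNReal.ofReal (|w| ^ (-(n : ℝ))) ≤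
      ENNReal.ofReal (2 * W ^ (1 - (n : ℝ))) := by
  have hn' : (2 : ℝ) ≤ n := by exact_mod_cast hn
  have hset : {w : ℝ | W < |w|} ⊆ Ioi W ∪ Neg.neg ⁻¹' Ioi W := by
    intro w hw
    rcases lt_abs.1 (show W < |w| from hw) with h | h
    · exact Or.inl h
    · exact Or.inr h
  have hI : ∫⁻ w in Ioi W, ENNReal.ofReal (|w| ^ (-(n : ℝ))) ≤
      ENNReal.ofReal (W ^ (1 - (n : ℝ))) := by
    have e : ∫⁻ w in Ioi W, ENNReal.ofReal (|w| ^ (-(n : ℝ))) =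
        ∫⁻ w in Ioi W, ENNReal.ofReal (w ^ (-(n : ℝ))) :=
      setLIntegral_congr_fun measurableSet_Ioi fun w hw => by
        simp only [abs_of_pos (hW.trans hw)]
    rw [e, ← ofReal_integral_eq_lintegral_ofReal
      (integrableOn_Ioi_rpow_of_lt (by linarith) hW)
      ((ae_restrict_iff' measurableSet_Ioi).2 (Eventually.of_forall fun w hw =>
        Real.rpow_nonneg (hW.trans hw).le _)),
      integral_Ioi_rpow_of_lt (by linarith) hW]
    refine ENNReal.ofReal_le_ofReal ?_
    rw [show -W ^ (-(n : ℝ) + 1) / (-(n : ℝ) + 1) = W ^ (1 - (n : ℝ)) / ((n : ℝ) - 1) by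
      rw [show -(n : ℝ) + 1 = -((n : ℝ) - 1) by ring, neg_div_neg_eq]
      congr 2
      ring]
    exact div_le_self (by positivity) (by linarith)
  refine (lintegral_mono_set hset).trans ((lintegral_union_le _ _ _).trans ?_)
  have hneg : ∫⁻ w in Neg.neg ⁻¹' Ioi W, ENNReal.ofReal (|w| ^ (-(n : ℝ))) =
      ∫⁻ w in Ioi W, ENNReal.ofReal (|w| ^ (-(n : ℝ))) := by
    rw [← (Measure.measurePreserving_neg (volume : Measure ℝ)).setLIntegral_comp_preimage
      measurableSet_Ioi (by fun_prop)]
    simp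
  rw [hneg, two_mul, ENNReal.ofReal_add (by positivity) (by positivity)]
  exact add_le_add hI hI

end OscillatoryMultiplier

section OscillatoryMultiplier

variable {n : ℕ} {c : ℕ → ℝ} {c₁ : ℝ} {g : ℕ → ℝ → ℝ} {η : ℝ → ℝ}

lemma map_sqrt_phase_le {m : ℝ} (hm : 0 < m) (hc₁ : 0 < c₁) (hg : UnitPhase c c₁ g)
    (h : ∀ x ∈ Icc (shellRad c₁)⁻¹ (shellRad c₁), ∀ y ∈ Icc (shellRad c₁)⁻¹ (shellRad c₁),
        m * |x - y| ≤ |g 0 x - g 0 y|) :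
    (volume.restrict (Icc ((shellRad c₁)⁻¹ ^ 2) (shellRad c₁ ^ 2))).map (fun q => g 0 √q) ≤
      ENNReal.ofReal (m / (2 * shellRad c₁))⁻¹ • (volume : Measure ℝ) := by
  have hβ := one_lt_shellRad hc₁
  have hβ' : 0 < (shellRad c₁)⁻¹ := by positivity
  refine map_restrict_le_of_expanding (hg.cont.comp Real.continuous_sqrt).measurable
    (by positivity) fun x hx y hy => ?_
  have hsq : ∀ x ∈ Icc ((shellRad c₁)⁻¹ ^ 2) (shellRad c₁ ^ 2),
      √x ∈ Icc (shellRad c₁)⁻¹ (shellRad c₁) := fun x hx =>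
    ⟨(Real.le_sqrt' hβ').2 hx.1, (Real.sqrt_le_left (by linarith)).2 hx.2⟩
  refine le_trans ?_ (h _ (hsq x hx) _ (hsq y hy))
  have hx0 : 0 ≤ x := le_trans (by positivity) hx.1
  have hy0 : 0 ≤ y := le_trans (by positivity) hy.1
  have h1 : |x - y| = |√x - √y| * (√x + √y) := by
    rw [← abs_of_nonneg (show 0 ≤ √x + √y by positivity), ← abs_mul]
    congr 1
    nlinarith [Real.sq_sqrt hx0, Real.sq_sqrt hy0]
  have h2 : |x - y| ≤ |√x - √y| * (2 * shellRad c₁) := by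
    rw [h1]
    refine mul_le_mul_of_nonneg_left ?_ (abs_nonneg _)
    linarith [(hsq x hx).2, (hsq y hy).2]
  rw [div_mul_eq_mul_div, div_le_iff₀ (by positivity), mul_assoc]
  exact mul_le_mul_of_nonneg_left h2 hm.le

/-- The high-frequency part of the multiplier is small in `L²` of the parameter. -/
lemma exists_lintegral_high_freq_le (c : ℕ → ℝ) (hc₁ : 0 < c₁) (hη : ContDiff ℝ (⊤ : ℕ∞) η)
    (hη0 : ∀ y ∉ Icc (1 / 2 : ℝ) 2, η y = 0) (hn : 2 ≤ n) (a : SchwartzMap (Rn n) ℂ) :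
    ∃ C : ℝ, 0 ≤ C ∧ ∀ g, UnitPhase c c₁ g → ∀ lam W : ℝ, 0 < lam → 0 < W → ∀ (ξ : Rn n) (k : ℕ),
      ∫⁻ u in Icc (1 : ℝ) 2, ‖∫ w in {w : ℝ | W < |w|} ∩ Icc (-(k : ℝ)) k,
        𝓕 (oscFactor η g (lam * u)) w * chirp a ξ w‖ₑ ^ (2 : ℝ) ≤
          ENNReal.ofReal (C * (lam⁻¹ * W ^ (1 - (n : ℝ)))) := by
  have hβ := one_lt_shellRad hc₁
  obtain ⟨m, hm, hmg⟩ := UnitPhase.exists_expanding c hc₁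
  obtain ⟨C₀, hC₀, hch⟩ := exists_norm_chirp_le_rpow a
  obtain ⟨Mη, hMη⟩ : ∃ M, ∀ y, ‖η y‖ ≤ M :=
    (HasCompactSupport.intro isCompact_Icc fun y hy => hη0 y hy :
      HasCompactSupport η).exists_bound_of_continuous hη.continuous
  have hMη0 : 0 ≤ Mη := (norm_nonneg _).trans (hMη 0)
  set R := shellRad c₁ ^ 2 with hR
  set J := Icc ((shellRad c₁)⁻¹ ^ 2) R with hJ
  set A₁ : ℝ := Real.exp (2 ^ 2) * (4 * Real.pi) * (m / (2 * shellRad c₁))⁻¹ with hA₁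
  set A₂ : ℝ := Real.exp (R ^ 2) * (4 * Real.pi / (2 * Real.pi)) with hA₂
  refine ⟨A₁ * (Mη ^ 2 * (A₂ * (C₀ ^ 2 * 2))), by positivity, fun g hg lam W hlam hW ξ k => ?_⟩
  set S := {w : ℝ | W < |w|} ∩ Icc (-(k : ℝ)) k with hS
  have hSm : MeasurableSet S := (measurableSet_lt measurable_const (by fun_prop)).inter
    measurableSet_Icc
  have hSf : volume S ≠ ⊤ := ne_top_of_le_ne_top (by simp) (measure_mono inter_subset_right)
  have hfin : IsFiniteMeasure (volume.restrict S) := ⟨by simpa using hSf.lt_top⟩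
  have hcc := continuous_chirp a.integrable ξ
  have hSi : Integrable (S.indicator (chirp a ξ)) := by
    rw [integrable_indicator_iff hSm]
    exact Measure.integrableOn_of_bounded hSf hcc.aestronglyMeasurable
      (Eventually.of_forall fun w => norm_chirp_le (⇑a) ξ w)
  set D : ℝ → ℂ := 𝓕 (S.indicator (chirp a ξ)) with hD
  have hDeq : ∀ q, D q = ∫ w in S, Complex.exp (Complex.I * (2 * Real.pi * q * (-w) : ℝ)) *
      chirp a ξ w := by
    intro q
    rw [hD, Real.fourier_real_eq_integral_exp_smul, ← integral_indicator hSm]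
    congr 1 with w
    by_cases hw : w ∈ S
    · rw [indicator_of_mem hw, indicator_of_mem hw, smul_eq_mul, mul_comm _ Complex.I]
      congr 4
      ring
    · rw [indicator_of_notMem hw, indicator_of_notMem hw, smul_zero]
  have hDb : ∃ M, ∀ q, ‖D q‖ ≤ M := ⟨∫ w, ‖S.indicator (chirp (⇑a) ξ) w‖, fun q => by
    rw [hD, Real.fourier_eq]
    refine (norm_integral_le_integral_norm _).trans (le_of_eq ?_)
    simp_rw [Circle.norm_smul]⟩
  obtain ⟨MD, hMD⟩ := hDb
  have hDc : Continuous D := by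
    refine VectorFourier.fourierIntegral_continuous Real.continuous_fourierChar
      (L := innerₗ ℝ) continuous_inner hSi
  have hB : ∀ u, ∫ w in S, 𝓕 (oscFactor η g (lam * u)) w * chirp a ξ w =
      ∫ q in J, Complex.exp (Complex.I * (lam * u * g 0 √q : ℝ)) * ((η (g 0 √q) : ℝ) * D q) := by
    intro u
    have hGi : Integrable (oscFactor η g (lam * u)) :=
      (contDiff_oscFactor hg hc₁ hη hη0 _).continuous.integrable_of_hasCompactSupport
        (hasCompactSupport_oscFactor hg hc₁ hη0 _)
    have h1 : ∫ w, 𝓕 (oscFactor η g (lam * u)) w * S.indicator (chirp a ξ) w =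
        ∫ q, oscFactor η g (lam * u) q * D q := by
      simpa using! (VectorFourier.integral_fourierIntegral_smul_eq_flip (L := innerₗ ℝ)
        Real.continuous_fourierChar continuous_inner hGi hSi)
    rw [← integral_indicator hSm]
    have h2 : (S.indicator fun w => 𝓕 (oscFactor η g (lam * u)) w * chirp a ξ w) =
        fun w => 𝓕 (oscFactor η g (lam * u)) w * S.indicator (chirp a ξ) w := by
      ext w
      by_cases hw : w ∈ S <;> simp [hw]
    rw [h2, h1, ← setIntegral_eq_integral_of_forall_compl_eq_zero (s := J)
      fun q hq => by rw [oscFactor_eq_zero hg hc₁ hη0 _ hq, zero_mul]]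
    congr 1 with q
    rw [oscFactor, mul_assoc]
  have hJfin : IsFiniteMeasure (volume.restrict J) := ⟨by simp [hJ]⟩
  have hηc : Continuous fun q => η (g 0 √q) :=
    hη.continuous.comp (hg.cont.comp Real.continuous_sqrt)
  have h1 := lintegral_oscillatory_sq_le (ν := volume.restrict J) (φ := fun q => g 0 √q)
    (hg.cont.comp Real.continuous_sqrt).measurable (map_sqrt_phase_le hm hc₁ hg (hmg g hg))
    hlam 2 (w := fun q => ((η (g 0 √q) : ℝ) : ℂ) * D q)
    ((Complex.continuous_ofReal.comp hηc).mul hDc).aestronglyMeasurable (M := Mη * MD)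
    (fun q => by
      rw [norm_mul, Complex.norm_real]
      exact mul_le_mul (hMη _) (hMD q) (norm_nonneg _) hMη0)
  have h2 := lintegral_oscillatory_sq_le (ν := volume.restrict S) (φ := fun w => -w)
    measurable_neg (D := 1) (by
      rw [one_smul]
      refine (Measure.map_mono Measure.restrict_le_self measurable_neg).trans (le_of_eq ?_)
      exact (Measure.measurePreserving_neg (volume : Measure ℝ)).map_eq)
    (lam := 2 * Real.pi) (by positivity) R (w := chirp a ξ) hcc.aestronglyMeasurable
    (norm_chirp_le (⇑a) ξ)
  have h3 : ∫⁻ w in S, ‖chirp a ξ w‖ₑ ^ (2 : ℝ) ≤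
      ENNReal.ofReal (C₀ ^ 2 * (2 * W ^ (1 - (n : ℝ)))) := by
    have hpt : ∀ w ∈ S, ‖chirp a ξ w‖ₑ ^ (2 : ℝ) ≤
        ENNReal.ofReal (C₀ ^ 2) * ENNReal.ofReal (|w| ^ (-(n : ℝ))) := by
      intro w hw
      have hw0 : 0 < |w| := hW.trans hw.1
      rw [enorm_rpow_two_eq, ← ENNReal.ofReal_mul (by positivity)]
      refine ENNReal.ofReal_le_ofReal ?_
      have h4 := hch ξ w (abs_pos.1 hw0)
      calc ‖chirp a ξ w‖ ^ 2 ≤ (C₀ * |w| ^ (-((n : ℝ) / 2))) ^ 2 := by gcongr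
        _ = C₀ ^ 2 * |w| ^ (-(n : ℝ)) := by
          rw [mul_pow, ← Real.rpow_natCast (|w| ^ _), ← Real.rpow_mul hw0.le]
          congr 2
          push_cast
          ring
    refine (setLIntegral_mono' hSm hpt).trans ?_
    rw [lintegral_const_mul _ (by fun_prop), ENNReal.ofReal_mul (by positivity)]
    exact mul_le_mul' le_rfl ((lintegral_mono_set inter_subset_left).trans
      (lintegral_tail_rpow_le hW hn))
  simp_rw [hB]
  refine (lintegral_mono_set (show Icc (1 : ℝ) 2 ⊆ Icc (-2) 2 from
    Icc_subset_Icc (by norm_num) le_rfl)).trans (h1.trans ?_)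
  have h5 : ∫⁻ q in J, ‖((η (g 0 √q) : ℝ) : ℂ) * D q‖ₑ ^ (2 : ℝ) ≤
      ENNReal.ofReal (Mη ^ 2) * ∫⁻ q in Icc (-R) R, ‖D q‖ₑ ^ (2 : ℝ) := by
    rw [← lintegral_const_mul _ (hDc.enorm.measurable.pow_const _)]
    refine (lintegral_mono fun q => ?_).trans (lintegral_mono_set
      (Icc_subset_Icc (by
        have : 0 ≤ (shellRad c₁)⁻¹ ^ 2 := by positivity
        have : 0 ≤ R := by positivity
        linarith) le_rfl))
    rw [enorm_rpow_two_eq, enorm_rpow_two_eq, ← ENNReal.ofReal_mul (by positivity)]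
    refine ENNReal.ofReal_le_ofReal ?_
    rw [norm_mul, mul_pow, Complex.norm_real]
    have := hMη (g 0 √q)
    gcongr
  have h6 : ∫⁻ q in Icc (-R) R, ‖D q‖ₑ ^ (2 : ℝ) ≤
      ENNReal.ofReal A₂ * ENNReal.ofReal (C₀ ^ 2 * (2 * W ^ (1 - (n : ℝ)))) := by
    simp_rw [hDeq]
    refine h2.trans ?_
    rw [mul_one]
    exact mul_le_mul' le_rfl h3
  calc _ ≤ ENNReal.ofReal (Real.exp (2 ^ 2) * (4 * Real.pi / lam)) *
        ENNReal.ofReal (m / (2 * shellRad c₁))⁻¹ * (ENNReal.ofReal (Mη ^ 2) *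
          (ENNReal.ofReal A₂ * ENNReal.ofReal (C₀ ^ 2 * (2 * W ^ (1 - (n : ℝ)))))) :=
        mul_le_mul' le_rfl (h5.trans (mul_le_mul' le_rfl h6))
    _ = _ := by
        rw [← ENNReal.ofReal_mul (by positivity), ← ENNReal.ofReal_mul (by positivity),
          ← ENNReal.ofReal_mul (by positivity), ← ENNReal.ofReal_mul (by positivity)]
        congr 1
        rw [hA₁]
        ring

end OscillatoryMultiplier

section MultiplierDecay

variable {n : ℕ} {c : ℕ → ℝ} {c₁ : ℝ} {g : ℕ → ℝ → ℝ} {η : ℝ → ℝ}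

lemma UnitPhase.continuous_oscFactor (hg : UnitPhase c c₁ g) (hη : Continuous η) :
    Continuous fun p : ℝ × ℝ => oscFactor η g p.1 p.2 := by
  have := hg.cont
  unfold oscFactor
  fun_prop

lemma UnitPhase.stronglyMeasurable_fourier_oscFactor (hg : UnitPhase c c₁ g)
    (hη : Continuous η) (lam : ℝ) :
    StronglyMeasurable fun p : ℝ × ℝ => 𝓕 (oscFactor η g (lam * p.1)) p.2 := by
  simp_rw [Real.fourier_eq, Circle.smul_def]
  have hc := hg.continuous_oscFactor hη
  have h : Continuous fun z : (ℝ × ℝ) × ℝ =>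
      ((Real.fourierChar (-inner ℝ z.2 z.1.2) : Circle) : ℂ) • oscFactor η g (lam * z.1.1) z.2 := by
    refine Continuous.mul ?_ ?_
    · exact continuous_subtype_val.comp (Real.continuous_fourierChar.comp (by fun_prop))
    · exact hc.comp (by fun_prop : Continuous fun z : (ℝ × ℝ) × ℝ => (lam * z.1.1, z.2))
  exact h.stronglyMeasurable.integral_prod_right

lemma UnitPhase.measurable_setIntegral (hg : UnitPhase c c₁ g) (hη : Continuous η) (lam : ℝ)
    {b : ℝ → ℂ} (hb : Continuous b) (S : Set ℝ) :
    Measurable fun u => ‖∫ w in S, 𝓕 (oscFactor η g (lam * u)) w * b w‖ₑ ^ (2 : ℝ) := by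
  have h : StronglyMeasurable fun p : ℝ × ℝ => 𝓕 (oscFactor η g (lam * p.1)) p.2 * b p.2 :=
    (hg.stronglyMeasurable_fourier_oscFactor hη lam).mul
      (hb.comp continuous_snd).stronglyMeasurable
  exact (h.integral_prod_right (ν := volume.restrict S)).enorm.pow_const _

/-- Decay, in `L²` of the parameter, of the multipliers with an oscillating radial factor. -/
lemma exists_lintegral_multiplier_le (c : ℕ → ℝ) (hc₁ : 0 < c₁) (hη : ContDiff ℝ (⊤ : ℕ∞) η)
    (hη0 : ∀ y ∉ Icc (1 / 2 : ℝ) 2, η y = 0) (hn : 2 ≤ n) (a : SchwartzMap (Rn n) ℂ)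
    {ε : ℝ} (hε : 0 < ε) (hε1 : ε ≤ 1) :
    ∃ C : ℝ, 0 < C ∧ ∀ g, UnitPhase c c₁ g → ∀ lam : ℝ, 1 ≤ lam → ∀ ξ : Rn n,
      ∫⁻ u in Icc (1 : ℝ) 2, ‖𝓕 (fun t => oscFactor η g (lam * u) (‖t‖ ^ 2) * a t) ξ‖ₑ ^ (2 : ℝ) ≤
        ENNReal.ofReal (C * lam ^ (-(n : ℝ) + ε)) := by
  have hn' : (2 : ℝ) ≤ n := by exact_mod_cast hn
  set θ := ε / n with hθ
  have hθ0 : 0 < θ := by positivity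
  have hθ1 : θ ≤ 1 := by rw [hθ, div_le_one (by positivity)]; linarith
  obtain ⟨N, hN⟩ := exists_nat_ge ((1 + n / 2) / θ)
  rw [div_le_iff₀ hθ0] at hN
  obtain ⟨C₁, hC₁, h₁⟩ := exists_norm_fourier_oscFactor_le c hc₁ hη hη0 N
  obtain ⟨C₂, hC₂, h₂⟩ := exists_lintegral_high_freq_le c hc₁ hη hη0 hn a
  set I := ∫ t, ‖a t‖ with hI
  have hI0 : 0 ≤ I := integral_nonneg fun t => norm_nonneg _
  refine ⟨2 * (2 * (C₁ * 2 ^ N * I)) ^ 2 + 2 * C₂ + 1, by positivity, fun g hg lam hlam ξ => ?_⟩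
  have hl0 : 0 < lam := by linarith
  set W := lam ^ (1 - θ) with hW
  have hW0 : 0 < W := by positivity
  have hcc := continuous_chirp a.integrable ξ
  set m : ℝ → ℂ := fun u => 𝓕 (fun t => oscFactor η g (lam * u) (‖t‖ ^ 2) * a t) ξ with hm
  set A : ℝ → ℂ := fun u => ∫ w in {w : ℝ | W < |w|}ᶜ, 𝓕 (oscFactor η g (lam * u)) w * chirp a ξ w
    with hA
  set B : ℝ → ℂ := fun u => ∫ w in {w : ℝ | W < |w|}, 𝓕 (oscFactor η g (lam * u)) w * chirp a ξ w
    with hB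
  have hSm : MeasurableSet {w : ℝ | W < |w|} := measurableSet_lt measurable_const (by fun_prop)
  have hint : ∀ u, Integrable fun w => 𝓕 (oscFactor η g (lam * u)) w * chirp a ξ w := by
    intro u
    set G := (hasCompactSupport_oscFactor hg hc₁ hη0 (lam * u)).toSchwartzMap
      (contDiff_oscFactor hg hc₁ hη hη0 (lam * u)) with hG
    have hGi : Integrable (𝓕 (⇑G)) := by rw [← SchwartzMap.fourier_coe]; exact (𝓕 G).integrable
    exact hGi.mul_bdd hcc.aestronglyMeasurable (Eventually.of_forall fun w => norm_chirp_le (⇑a) ξ w)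
  have hmAB : ∀ u, m u = B u + A u := by
    intro u
    set G := (hasCompactSupport_oscFactor hg hc₁ hη0 (lam * u)).toSchwartzMap
      (contDiff_oscFactor hg hc₁ hη hη0 (lam * u)) with hG
    exact (fourier_radial_mul_eq G a.integrable ξ).trans
      (integral_add_compl hSm (hint u)).symm
  have hAle : ∀ u ∈ Icc (1 : ℝ) 2, ‖A u‖ ≤ 2 * (C₁ * 2 ^ N * I) * lam ^ (-((n : ℝ) / 2)) := by
    intro u hu
    have hvol : volume {w : ℝ | W < |w|}ᶜ = ENNReal.ofReal (2 * W) := by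
      have : {w : ℝ | W < |w|}ᶜ = Icc (-W) W := by
        ext w
        simp [abs_le]
      rw [this, Real.volume_Icc]
      ring_nf
    have hle : ∀ w ∈ {w : ℝ | W < |w|}ᶜ, ‖𝓕 (oscFactor η g (lam * u)) w * chirp a ξ w‖ ≤
        C₁ * 2 ^ N * I * lam ^ (-(1 + (n : ℝ) / 2)) := by
      intro w hw
      have hw' : |w| ≤ W := not_lt.1 hw
      have h3 : ((1 + |w|) / (lam * u)) ^ N ≤ 2 ^ N * lam ^ (-(1 + (n : ℝ) / 2)) := by
        have h4 : (1 + |w|) / (lam * u) ≤ 2 * lam ^ (-θ) := by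
          rw [div_le_iff₀ (mul_pos hl0 (by linarith [hu.1]))]
          have h5 : lam ^ (-θ) * lam = W := by
            rw [hW, sub_eq_neg_add, Real.rpow_add hl0, Real.rpow_one]
          have h6 : 1 ≤ W := Real.one_le_rpow hlam (by linarith)
          have h7 : W * 1 ≤ W * u := by gcongr; exact hu.1
          calc 1 + |w| ≤ 2 * (W * u) := by linarith
            _ = _ := by rw [← h5]; ring
        calc _ ≤ (2 * lam ^ (-θ)) ^ N :=
            pow_le_pow_left₀ (div_nonneg (by positivity) (mul_nonneg hl0.le (by linarith [hu.1]))) h4 N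
          _ = 2 ^ N * lam ^ (-(N * θ)) := by
            rw [mul_pow, ← Real.rpow_natCast (lam ^ _), ← Real.rpow_mul hl0.le]
            ring_nf
          _ ≤ _ := by
            gcongr
      rw [norm_mul]
      calc _ ≤ (C₁ * ((1 + |w|) / (lam * u)) ^ N) * I :=
            mul_le_mul (h₁ g hg w _ (mul_pos hl0 (by linarith [hu.1]))) (norm_chirp_le (⇑a) ξ w)
              (norm_nonneg _) (by have := hu.1; positivity)
        _ ≤ (C₁ * (2 ^ N * lam ^ (-(1 + (n : ℝ) / 2)))) * I := by gcongr
        _ = _ := by ring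
    refine (norm_setIntegral_le_of_norm_le_const (by rw [hvol]; exact ENNReal.ofReal_lt_top)
      hle).trans ?_
    rw [measureReal_def, hvol, ENNReal.toReal_ofReal (by positivity)]
    have h8 : W ≤ lam := by
      rw [hW]
      exact (Real.rpow_le_rpow_of_exponent_le hlam (by linarith)).trans (Real.rpow_one _).le
    have h9 : lam ^ (-(1 + (n : ℝ) / 2)) * lam = lam ^ (-((n : ℝ) / 2)) := by
      rw [neg_add, Real.rpow_add hl0, Real.rpow_neg_one]
      field_simp
    calc _ ≤ C₁ * 2 ^ N * I * lam ^ (-(1 + (n : ℝ) / 2)) * (2 * lam) := by gcongr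
      _ = 2 * (C₁ * 2 ^ N * I) * (lam ^ (-(1 + (n : ℝ) / 2)) * lam) := by ring
      _ = _ := by rw [h9]
  have hBle : ∫⁻ u in Icc (1 : ℝ) 2, ‖B u‖ₑ ^ (2 : ℝ) ≤
      ENNReal.ofReal (C₂ * (lam⁻¹ * W ^ (1 - (n : ℝ)))) := by
    refine lintegral_le_of_tendsto (g := fun k u => ‖∫ w in {w : ℝ | W < |w|} ∩ Icc (-(k : ℝ)) k,
        𝓕 (oscFactor η g (lam * u)) w * chirp a ξ w‖ₑ ^ (2 : ℝ))
      (fun k => hg.measurable_setIntegral hη.continuous lam hcc _) (fun u => ?_)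
      fun k => h₂ g hg lam W hl0 hW0 ξ k
    refine (ENNReal.continuous_rpow_const.tendsto _).comp ((continuous_enorm.tendsto _).comp ?_)
    have hU : ⋃ k : ℕ, {w : ℝ | W < |w|} ∩ Icc (-(k : ℝ)) k = {w : ℝ | W < |w|} := by
      rw [← inter_iUnion]
      refine inter_eq_left.2 fun w _ => ?_
      obtain ⟨k, hk⟩ := exists_nat_ge |w|
      exact mem_iUnion.2 ⟨k, abs_le.1 hk⟩
    have h3 := tendsto_setIntegral_of_monotone (μ := volume)
      (s := fun k : ℕ => {w : ℝ | W < |w|} ∩ Icc (-(k : ℝ)) k)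
      (f := fun w => 𝓕 (oscFactor η g (lam * u)) w * chirp a ξ w)
      (fun k => hSm.inter measurableSet_Icc)
      (fun i j hij => inter_subset_inter_right _ (Icc_subset_Icc (by simpa using hij)
        (by simpa using hij))) (hint u).integrableOn
    rw [hU] at h3
    exact h3
  have hexp : lam⁻¹ * W ^ (1 - (n : ℝ)) ≤ lam ^ (-(n : ℝ) + ε) := by
    rw [hW, ← Real.rpow_mul hl0.le, ← Real.rpow_neg_one, ← Real.rpow_add hl0]
    refine Real.rpow_le_rpow_of_exponent_le hlam ?_
    have : θ * n = ε := by rw [hθ]; field_simp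
    nlinarith
  have hsq : ∀ u ∈ Icc (1 : ℝ) 2, ‖m u‖ₑ ^ (2 : ℝ) ≤
      ENNReal.ofReal (2 * (2 * (C₁ * 2 ^ N * I)) ^ 2 * lam ^ (-(n : ℝ) + ε)) +
        2 * ‖B u‖ₑ ^ (2 : ℝ) := by
    intro u hu
    have h3 := hAle u hu
    have h5 : (lam ^ (-((n : ℝ) / 2))) ^ 2 ≤ lam ^ (-(n : ℝ) + ε) := by
      rw [← Real.rpow_natCast, ← Real.rpow_mul hl0.le]
      refine Real.rpow_le_rpow_of_exponent_le hlam ?_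
      push_cast
      linarith
    have h4 : ‖m u‖ ^ 2 ≤ 2 * (2 * (C₁ * 2 ^ N * I)) ^ 2 * lam ^ (-(n : ℝ) + ε) +
        2 * ‖B u‖ ^ 2 := by
      have h6 : ‖m u‖ ≤ ‖B u‖ + ‖A u‖ := by rw [hmAB]; exact norm_add_le _ _
      have h7 : ‖A u‖ ^ 2 ≤ (2 * (C₁ * 2 ^ N * I)) ^ 2 * lam ^ (-(n : ℝ) + ε) := by
        calc ‖A u‖ ^ 2 ≤ (2 * (C₁ * 2 ^ N * I) * lam ^ (-((n : ℝ) / 2))) ^ 2 := by gcongr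
          _ = (2 * (C₁ * 2 ^ N * I)) ^ 2 * (lam ^ (-((n : ℝ) / 2))) ^ 2 := by ring
          _ ≤ _ := by gcongr
      have h8 : ‖m u‖ ^ 2 ≤ (‖B u‖ + ‖A u‖) ^ 2 := by gcongr
      nlinarith [sq_nonneg (‖B u‖ - ‖A u‖)]
    rw [enorm_rpow_two_eq, enorm_rpow_two_eq, show (2 : ℝ≥0∞) = ENNReal.ofReal 2 by simp,
      ← ENNReal.ofReal_mul (by norm_num), ← ENNReal.ofReal_add (by positivity) (by positivity)]
    exact ENNReal.ofReal_le_ofReal h4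
  refine (setLIntegral_mono' measurableSet_Icc hsq).trans ?_
  rw [lintegral_add_left measurable_const, lintegral_const_mul' _ _ (by simp), lintegral_const]
  have hv : (volume.restrict (Icc (1 : ℝ) 2)) univ = 1 := by
    rw [Measure.restrict_apply_univ, Real.volume_Icc]
    norm_num
  rw [hv, mul_one]
  refine (add_le_add le_rfl (mul_le_mul' le_rfl hBle)).trans ?_
  rw [show (2 : ℝ≥0∞) = ENNReal.ofReal 2 by simp,
    ← ENNReal.ofReal_mul (by norm_num), ← ENNReal.ofReal_add (by positivity) (by positivity)]
  refine ENNReal.ofReal_le_ofReal ?_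
  have h10 : 0 ≤ lam ^ (-(n : ℝ) + ε) := by positivity
  nlinarith

end MultiplierDecay

section UnitKernel

variable {n : ℕ} {c : ℕ → ℝ} {c₁ : ℝ} {g : ℕ → ℝ → ℝ} {η : ℝ → ℝ}

/-- A smooth function agrees with `K` on a shell around the unit sphere. -/
lemma exists_amplitude {K : Rn n → ℝ} (hK : IsHomCZKernel n K) {β : ℝ} (hβ : 1 < β) :
    ∃ a : SchwartzMap (Rn n) ℂ, ∀ t ∈ shell n β⁻¹ β, a t = K t := by
  obtain ⟨Ω, hΩ, -, -, hKΩ⟩ := hK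
  have hβ0 : 0 < β := by linarith
  have hβ1 : β⁻¹ < 1 := inv_lt_one_of_one_lt₀ hβ
  let f₁ : ContDiffBump (0 : Rn n) := ⟨β, 2 * β, hβ0, by linarith⟩
  let f₂ : ContDiffBump (0 : Rn n) := ⟨β⁻¹ / 4, β⁻¹ / 2, by positivity, by
    have : 0 < β⁻¹ := by positivity
    linarith⟩
  set b : Rn n → ℝ := fun t => Ω t / ‖t‖ ^ n * (f₁ t - f₂ t) with hb
  have hb0 : ∀ t, ‖t‖ ≤ β⁻¹ / 4 → b t = 0 := by
    intro t ht
    have h1 : f₁ t = 1 := f₁.one_of_mem_closedBall (by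
      rw [mem_closedBall_zero_iff]; exact ht.trans (show β⁻¹ / 4 ≤ β by linarith))
    have h2 : f₂ t = 1 := f₂.one_of_mem_closedBall (by rwa [mem_closedBall_zero_iff])
    rw [hb]
    simp only [h1, h2, sub_self, mul_zero]
  have hb1 : ∀ t, 2 * β ≤ ‖t‖ → b t = 0 := by
    intro t ht
    have h1 : f₁ t = 0 := f₁.zero_of_le_dist (by rwa [dist_zero_right])
    have h2 : f₂ t = 0 := f₂.zero_of_le_dist (by
      rw [dist_zero_right]; exact le_trans (show β⁻¹ / 2 ≤ 2 * β by linarith) ht)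
    rw [hb]
    simp only [h1, h2, sub_self, mul_zero]
  have hbs : ContDiff ℝ (⊤ : ℕ∞) b := by
    refine contDiff_iff_contDiffAt.2 fun t => ?_
    by_cases ht : t = 0
    · subst ht
      refine (contDiffAt_const (c := (0 : ℝ))).congr_of_eventuallyEq ?_
      filter_upwards [Metric.closedBall_mem_nhds (0 : Rn n) (show 0 < β⁻¹ / 4 by positivity)]
        with s hs
      exact hb0 s (by rwa [mem_closedBall_zero_iff] at hs)
    · refine ContDiffAt.mul (ContDiffAt.div (hΩ.contDiffAt (isOpen_ne.mem_nhds ht)) ?_ ?_) ?_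
      · exact (contDiffAt_norm ℝ ht).pow n
      · exact pow_ne_zero _ (norm_ne_zero_iff.2 ht)
      · exact f₁.contDiffAt.sub f₂.contDiffAt
  have hbc : HasCompactSupport fun t => (b t : ℂ) :=
    HasCompactSupport.intro (isCompact_closedBall (0 : Rn n) (2 * β)) fun t ht => by
      rw [mem_closedBall_zero_iff, not_le] at ht
      simp [hb1 t ht.le]
  have hbs' : ContDiff ℝ (⊤ : ℕ∞) fun t => (b t : ℂ) := Complex.ofRealCLM.contDiff.comp hbs
  refine ⟨hbc.toSchwartzMap hbs', fun t ht => ?_⟩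
  have ht0 : t ≠ 0 := by
    rintro rfl
    have := ht.1
    rw [norm_zero] at this
    have : 0 < β⁻¹ := by positivity
    linarith
  have h1 : f₁ t = 1 := f₁.one_of_mem_closedBall (by rw [mem_closedBall_zero_iff]; exact ht.2)
  have h2 : f₂ t = 0 := f₂.zero_of_le_dist (by
    rw [dist_zero_right]
    refine le_trans (show β⁻¹ / 2 ≤ β⁻¹ from ?_) ht.1
    have : 0 < β⁻¹ := by positivity
    linarith)
  change (b t : ℂ) = K t
  rw [hb, hKΩ t ht0]
  simp only [h1, h2, sub_zero, mul_one]

/-- The kernel at unit scale. -/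
def unitKer (η : ℝ → ℝ) (g : ℕ → ℝ → ℝ) (a : Rn n → ℂ) (μ : ℝ) (t : Rn n) : ℂ :=
  oscFactor η g μ (‖t‖ ^ 2) * a t

lemma oscFactor_sq_eq (η : ℝ → ℝ) (g : ℕ → ℝ → ℝ) (μ : ℝ) {s : ℝ} (hs : 0 ≤ s) :
    oscFactor η g μ (s ^ 2) = Complex.exp (Complex.I * (μ * g 0 s : ℝ)) * (η (g 0 s) : ℝ) := by
  rw [oscFactor, Real.sqrt_sq hs]

lemma unitKer_eq_zero (hg : UnitPhase c c₁ g) (hc₁ : 0 < c₁)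
    (hη0 : ∀ y ∉ Icc (1 / 2 : ℝ) 2, η y = 0) (a : Rn n → ℂ) (μ : ℝ) {t : Rn n}
    (ht : t ∉ shell n (shellRad c₁)⁻¹ (shellRad c₁)) : unitKer η g a μ t = 0 := by
  rw [unitKer, oscFactor_sq_eq _ _ _ (norm_nonneg t), hg.cutoff_eq_zero hc₁ hη0 ht]
  simp

lemma exists_bound_of_cutoff (hη : ContDiff ℝ (⊤ : ℕ∞) η)
    (hη0 : ∀ y ∉ Icc (1 / 2 : ℝ) 2, η y = 0) : ∃ M : ℝ, 0 ≤ M ∧ ∀ y, |η y| ≤ M := by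
  obtain ⟨M, hM⟩ := (HasCompactSupport.intro isCompact_Icc fun y hy => hη0 y hy :
      HasCompactSupport η).exists_bound_of_continuous hη.continuous
  exact ⟨M, (norm_nonneg _).trans (hM 0), hM⟩

lemma exists_norm_unitKer_le (hη : ContDiff ℝ (⊤ : ℕ∞) η)
    (hη0 : ∀ y ∉ Icc (1 / 2 : ℝ) 2, η y = 0) (a : SchwartzMap (Rn n) ℂ) :
    ∃ M : ℝ, 0 ≤ M ∧ ∀ g μ t, ‖unitKer η g a μ t‖ ≤ M := by
  obtain ⟨M, hM0, hM⟩ := exists_bound_of_cutoff hη hη0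
  obtain ⟨A, hA⟩ : ∃ A, ∀ t, ‖a t‖ ≤ A := ⟨_, fun t => SchwartzMap.norm_le_seminorm ℝ a t⟩
  have hA0 : 0 ≤ A := (norm_nonneg _).trans (hA 0)
  refine ⟨M * A, by positivity, fun g μ t => ?_⟩
  rw [unitKer, norm_mul, norm_oscFactor]
  exact mul_le_mul (hM _) (hA t) (norm_nonneg _) hM0

lemma UnitPhase.continuous_unitKer (hg : UnitPhase c c₁ g) (hη : Continuous η) {a : Rn n → ℂ}
    (ha : Continuous a) : Continuous fun p : ℝ × Rn n => unitKer η g a p.1 p.2 :=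
  ((hg.continuous_oscFactor hη).comp
    (by fun_prop : Continuous fun p : ℝ × Rn n => (p.1, ‖p.2‖ ^ 2))).mul
    (ha.comp continuous_snd)

lemma contDiff_unitKer (hg : UnitPhase c c₁ g) (hc₁ : 0 < c₁) (hη : ContDiff ℝ (⊤ : ℕ∞) η)
    (hη0 : ∀ y ∉ Icc (1 / 2 : ℝ) 2, η y = 0) (a : SchwartzMap (Rn n) ℂ) (μ : ℝ) :
    ContDiff ℝ (⊤ : ℕ∞) (unitKer η g a μ) :=
  ((contDiff_oscFactor hg hc₁ hη hη0 μ).comp (contDiff_norm_sq ℝ)).mul (a.smooth ⊤)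

lemma integral_unitKer_eq_zero (hn : n ≠ 0) {K : Rn n → ℝ} (hK : IsHomCZKernel n K)
    (hg : UnitPhase c c₁ g) (hc₁ : 0 < c₁) (hη0 : ∀ y ∉ Icc (1 / 2 : ℝ) 2, η y = 0)
    {a : Rn n → ℂ} (ha : ∀ t ∈ shell n (shellRad c₁)⁻¹ (shellRad c₁), a t = K t) (μ : ℝ) :
    ∫ t, unitKer η g a μ t = 0 := by
  obtain ⟨Ω, -, hΩ, hΩ0, hKΩ⟩ := hK
  rw [← integral_radial_mul_eq_zero hn hΩ hΩ0
    fun s => oscFactor η g μ (s ^ 2) * ((s ^ n : ℝ) : ℂ)⁻¹]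
  congr 1 with t
  by_cases ht : t ∈ shell n (shellRad c₁)⁻¹ (shellRad c₁)
  · have ht0 : t ≠ 0 := by
      rintro rfl
      have h1 := ht.1
      rw [norm_zero] at h1
      have : 0 < (shellRad c₁)⁻¹ := by have := one_lt_shellRad hc₁; positivity
      linarith
    rw [unitKer, ha t ht, hKΩ t ht0]
    push_cast
    ring
  · have h1 := oscFactor_sq_eq η g μ (norm_nonneg t)
    rw [hg.cutoff_eq_zero hc₁ hη0 ht, Complex.ofReal_zero, mul_zero] at h1
    rw [unitKer_eq_zero hg hc₁ hη0 a μ ht, h1]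
    simp

lemma exists_oscFactor_sq_sub_le (c : ℕ → ℝ) (hc₁ : 0 < c₁) (hη : ContDiff ℝ (⊤ : ℕ∞) η)
    (hη0 : ∀ y ∉ Icc (1 / 2 : ℝ) 2, η y = 0) :
    ∃ L : ℝ, 0 ≤ L ∧ ∀ g, UnitPhase c c₁ g → ∀ μ s t : ℝ, 0 ≤ s → 0 ≤ t →
      ‖oscFactor η g μ (s ^ 2) - oscFactor η g μ (t ^ 2)‖ ≤ L * (1 + |μ|) * |s - t| := by
  have hβ := one_lt_shellRad hc₁
  have hβ0 : 0 < shellRad c₁ := by linarith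
  obtain ⟨M, hM0, hM⟩ := exists_bound_of_cutoff hη hη0
  obtain ⟨M', hM'⟩ : ∃ M', ∀ y, ‖deriv η y‖ ≤ M' := by
    have hcs : HasCompactSupport η := HasCompactSupport.intro isCompact_Icc fun y hy => hη0 y hy
    exact hcs.deriv.exists_bound_of_continuous (hη.continuous_deriv (by simp))
  have hM'0 : 0 ≤ M' := (norm_nonneg _).trans (hM' 0)
  obtain ⟨G, hG0, hG⟩ := UnitPhase.exists_bound c hc₁ 1
  refine ⟨(M + M') * G, by positivity, fun g hg μ => ?_⟩
  set f : ℝ → ℂ := fun s => Complex.exp (Complex.I * (μ * g 0 s : ℝ)) * (η (g 0 s) : ℝ) with hf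
  have hfL : ∀ x ∈ phaseInt c₁, ∀ y ∈ phaseInt c₁,
      ‖f y - f x‖ ≤ (M + M') * G * (1 + |μ|) * ‖y - x‖ := by
    intro x hx y hy
    refine Convex.norm_image_sub_le_of_norm_hasDerivWithin_le (s := phaseInt c₁)
      (f' := fun s => Complex.exp (Complex.I * (μ * g 0 s : ℝ)) *
          (Complex.I * (μ * g 1 s : ℝ)) * (η (g 0 s) : ℝ) +
        Complex.exp (Complex.I * (μ * g 0 s : ℝ)) * ((deriv η (g 0 s) * g 1 s : ℝ) : ℂ))
      (fun s hs => ?_) (fun s hs => ?_) (convex_Ioo _ _) hx hy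
    · have h1 := hg.hasDerivAt 0 s (phaseInt_pos hc₁ hs)
      have h2 : HasDerivAt (fun s => Complex.exp (Complex.I * (μ * g 0 s : ℝ)))
          (Complex.exp (Complex.I * (μ * g 0 s : ℝ)) * (Complex.I * (μ * g 1 s : ℝ))) s :=
        (((h1.const_mul μ).ofReal_comp).const_mul Complex.I).cexp
      have h3 : HasDerivAt (fun s => ((η (g 0 s) : ℝ) : ℂ))
          ((deriv η (g 0 s) * g 1 s : ℝ) : ℂ) s :=
        (((hη.differentiable (by simp)) _).hasDerivAt.comp s h1).ofReal_comp
      exact (h2.mul h3).hasDerivWithinAt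
    · have h1 := hG g hg s hs
      have h2 := hM (g 0 s)
      have h3 := hM' (g 0 s)
      rw [Real.norm_eq_abs] at h3
      refine (norm_add_le _ _).trans ?_
      simp only [norm_mul, norm_cexp_I_mul, Complex.norm_I, Complex.norm_real, Real.norm_eq_abs,
        one_mul]
      calc |μ| * |g 1 s| * |η (g 0 s)| + |deriv η (g 0 s)| * |g 1 s|
          ≤ |μ| * G * M + M' * G := by gcongr
        _ ≤ (M + M') * G * (1 + |μ|) := by
          have : 0 ≤ M * G + M' * G * |μ| := by positivity
          nlinarith
  have hf0 : ∀ s ∉ Icc (shellRad c₁)⁻¹ (shellRad c₁), f s = 0 := fun s hs => by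
    rw [hf]
    simp only [hg.cutoff_eq_zero hc₁ hη0 hs, Complex.ofReal_zero, mul_zero]
  have hinv : (3 * shellRad c₁)⁻¹ < (2 * shellRad c₁)⁻¹ :=
    inv_strictAnti₀ (by positivity) (by linarith)
  have hinv2 : (2 * shellRad c₁)⁻¹ < (shellRad c₁)⁻¹ :=
    inv_strictAnti₀ (by positivity) (by linarith)
  have hinv3 : (shellRad c₁)⁻¹ < 1 := inv_lt_one_of_one_lt₀ hβ
  have hsub : ∀ x ∈ Icc (shellRad c₁)⁻¹ (shellRad c₁), x ∈ phaseInt c₁ := fun x hx =>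
    ⟨by linarith [hx.1], by linarith [hx.2]⟩
  have hC0 : 0 ≤ (M + M') * G * (1 + |μ|) := by positivity
  have hone : ∀ x ∈ Icc (shellRad c₁)⁻¹ (shellRad c₁), ∀ y,
      ‖f x - f y‖ ≤ (M + M') * G * (1 + |μ|) * |x - y| := by
    intro x hx y
    by_cases hy : y ∈ phaseInt c₁
    · exact hfL y hy x (hsub x hx)
    · have hy0 : y ∉ Icc (shellRad c₁)⁻¹ (shellRad c₁) := fun h => hy (hsub y h)
      obtain ⟨y', hy', hy'0, hyy⟩ : ∃ y' ∈ phaseInt c₁,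
          y' ∉ Icc (shellRad c₁)⁻¹ (shellRad c₁) ∧ |x - y'| ≤ |x - y| := by
        rcases le_or_gt y (3 * shellRad c₁)⁻¹ with h | h
        · refine ⟨(2 * shellRad c₁)⁻¹, ⟨hinv, by linarith⟩, fun h' => by linarith [h'.1], ?_⟩
          rw [abs_of_nonneg (by linarith [hx.1]), abs_of_nonneg (by linarith [hx.1])]
          linarith
        · have h' : 3 * shellRad c₁ ≤ y := by
            by_contra! h''
            exact hy ⟨h, h''⟩
          refine ⟨2 * shellRad c₁, ⟨by linarith, by linarith⟩, fun h' => by linarith [h'.2], ?_⟩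
          rw [abs_sub_comm x, abs_sub_comm x, abs_of_nonneg (by linarith [hx.2]),
            abs_of_nonneg (by linarith [hx.2])]
          linarith
      rw [hf0 y hy0, ← hf0 y' hy'0]
      exact (hfL y' hy' x (hsub x hx)).trans (mul_le_mul_of_nonneg_left hyy hC0)
  intro s t hs ht
  rw [oscFactor_sq_eq _ _ _ hs, oscFactor_sq_eq _ _ _ ht]
  change ‖f s - f t‖ ≤ _
  by_cases h : s ∈ Icc (shellRad c₁)⁻¹ (shellRad c₁)
  · exact hone s h t
  by_cases h' : t ∈ Icc (shellRad c₁)⁻¹ (shellRad c₁)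
  · rw [norm_sub_rev, abs_sub_comm]
    exact hone t h' s
  · rw [hf0 s h, hf0 t h', sub_zero, norm_zero]
    positivity

lemma exists_unitKer_sub_le (c : ℕ → ℝ) (hc₁ : 0 < c₁) (hη : ContDiff ℝ (⊤ : ℕ∞) η)
    (hη0 : ∀ y ∉ Icc (1 / 2 : ℝ) 2, η y = 0) (a : SchwartzMap (Rn n) ℂ) :
    ∃ L : ℝ, 0 ≤ L ∧ ∀ g, UnitPhase c c₁ g → ∀ (μ : ℝ) (s t : Rn n),
      ‖unitKer η g a μ s - unitKer η g a μ t‖ ≤ L * (1 + |μ|) * ‖s - t‖ := by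
  obtain ⟨L, hL0, hL⟩ := exists_oscFactor_sq_sub_le c hc₁ hη hη0
  obtain ⟨M, hM0, hM⟩ := exists_bound_of_cutoff hη hη0
  obtain ⟨A, hA⟩ : ∃ A, ∀ t, ‖a t‖ ≤ A := ⟨_, fun t => SchwartzMap.norm_le_seminorm ℝ a t⟩
  have hA0 : 0 ≤ A := (norm_nonneg _).trans (hA 0)
  obtain ⟨A', hA'⟩ : ∃ A', ∀ t, ‖fderiv ℝ a t‖ ≤ A' :=
    ⟨_, fun t => SchwartzMap.norm_le_seminorm ℝ (SchwartzMap.fderivCLM ℝ (Rn n) ℂ a) t⟩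
  have hA'0 : 0 ≤ A' := (norm_nonneg _).trans (hA' 0)
  have haL : ∀ s t, ‖a s - a t‖ ≤ A' * ‖s - t‖ := fun s t =>
    Convex.norm_image_sub_le_of_norm_fderiv_le (fun x _ => a.differentiableAt)
      (fun x _ => hA' x) convex_univ (mem_univ t) (mem_univ s)
  refine ⟨L * A + M * A', by positivity, fun g hg μ s t => ?_⟩
  have e : unitKer η g a μ s - unitKer η g a μ t =
      (oscFactor η g μ (‖s‖ ^ 2) - oscFactor η g μ (‖t‖ ^ 2)) * a s +
        oscFactor η g μ (‖t‖ ^ 2) * (a s - a t) := by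
    unfold unitKer
    ring
  have h1 := hL g hg μ ‖s‖ ‖t‖ (norm_nonneg _) (norm_nonneg _)
  have h2 : |‖s‖ - ‖t‖| ≤ ‖s - t‖ := abs_norm_sub_norm_le s t
  rw [e]
  refine (norm_add_le _ _).trans ?_
  rw [norm_mul, norm_mul, norm_oscFactor]
  calc _ ≤ L * (1 + |μ|) * ‖s - t‖ * A + M * (A' * ‖s - t‖) := by
        refine add_le_add (mul_le_mul (h1.trans ?_) (hA s) (norm_nonneg _) (by positivity))
          (mul_le_mul (hM _) (haL s t) (norm_nonneg _) hM0)
        gcongr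
    _ ≤ (L * A + M * A') * (1 + |μ|) * ‖s - t‖ := by
        have : 0 ≤ M * A' * |μ| * ‖s - t‖ := by positivity
        nlinarith

end UnitKernel

section ScaledKernel

variable {n : ℕ} {c : ℕ → ℝ} {c₁ : ℝ} {η : ℝ → ℝ} {ρ : ℤ → ℝ} {G : ℤ → ℕ → ℝ → ℝ} {lam : ℝ}

/-- The family of kernels obtained from the unit-scale kernels by dilation. -/
def scaledKer (ρ : ℤ → ℝ) (η : ℝ → ℝ) (G : ℤ → ℕ → ℝ → ℝ) (a : Rn n → ℂ) (lam : ℝ) (k : ℤ)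
    (v : ℝ) (t : Rn n) : ℂ :=
  (((ρ k ^ n)⁻¹ : ℝ) : ℂ) * unitKer η (G k) a (lam * v) ((ρ k)⁻¹ • t)

lemma integral_inv_smul_mul {r : ℝ} (hr : 0 < r) (F : Rn n → ℂ) :
    ∫ t, (((r ^ n)⁻¹ : ℝ) : ℂ) * F (r⁻¹ • t) = ∫ t, F t := by
  rw [integral_const_mul, Measure.integral_comp_inv_smul]
  simp only [finrank_euclideanSpace, Fintype.card_fin]
  rw [abs_of_pos (by positivity), Complex.real_smul, ← mul_assoc, ← Complex.ofReal_mul,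
    inv_mul_cancel₀ (by positivity), Complex.ofReal_one, one_mul]

lemma exists_kerFam (c : ℕ → ℝ) (hc₁ : 0 < c₁) (hη : ContDiff ℝ (⊤ : ℕ∞) η)
    (hη0 : ∀ y ∉ Icc (1 / 2 : ℝ) 2, η y = 0) (a : SchwartzMap (Rn n) ℂ) :
    ∃ C₀ : ℝ, 1 ≤ C₀ ∧ ∀ C : ℝ, C₀ ≤ C → ∀ ρ G lam, (∀ k, 0 < ρ k) → (∀ k, UnitPhase c c₁ (G k)) →
      0 < lam → KerFam ρ C (1 + lam) (scaledKer ρ η G a lam) := by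
  have hβ := one_lt_shellRad hc₁
  obtain ⟨M, hM0, hM⟩ := exists_norm_unitKer_le hη hη0 a
  obtain ⟨L, hL0, hL⟩ := exists_unitKer_sub_le c hc₁ hη hη0 a
  refine ⟨shellRad c₁ + M + 2 * L, by linarith, fun C hC ρ G lam hρ hG hlam =>
    ⟨fun k => ?_, fun k v t ht => ?_, fun k v t => ?_, fun k v hv t s => ?_⟩⟩
  · unfold scaledKer
    exact continuous_const.mul (((hG k).continuous_unitKer hη.continuous a.continuous).comp
      (by fun_prop : Continuous fun p : ℝ × Rn n => (lam * p.1, (ρ k)⁻¹ • p.2)))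
  · have hk := hρ k
    rw [scaledKer, unitKer_eq_zero (hG k) hc₁ hη0 _ _ fun h => ?_, mul_zero]
    have h1 := h.2
    rw [norm_smul, norm_inv, Real.norm_of_nonneg hk.le, inv_mul_le_iff₀ hk] at h1
    have : ρ k * shellRad c₁ ≤ C * ρ k := by
      rw [mul_comm]
      gcongr
      linarith
    linarith
  · have hk := hρ k
    rw [scaledKer, norm_mul, Complex.norm_real, Real.norm_of_nonneg (by positivity),
      inv_mul_eq_div]
    gcongr
    exact (hM _ _ _).trans (by linarith)
  · have hk := hρ k
    have h1 := hL (G k) (hG k) (lam * v) ((ρ k)⁻¹ • t) ((ρ k)⁻¹ • s)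
    rw [scaledKer, scaledKer, ← mul_sub, norm_mul, Complex.norm_real,
      Real.norm_of_nonneg (by positivity)]
    rw [← smul_sub, norm_smul, norm_inv, Real.norm_of_nonneg hk.le] at h1
    have h2 : 1 + |lam * v| ≤ 2 * (1 + lam) := by
      rw [abs_of_nonneg (mul_nonneg hlam.le (by linarith [hv.1]))]
      nlinarith [hv.2]
    calc _ ≤ (ρ k ^ n)⁻¹ * (L * (2 * (1 + lam)) * ((ρ k)⁻¹ * ‖t - s‖)) := by
          refine mul_le_mul_of_nonneg_left (h1.trans ?_) (by positivity)
          gcongr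
      _ = 2 * L * (1 + lam) / ρ k ^ (n + 1) * ‖t - s‖ := by
          rw [pow_succ]
          field_simp
      _ ≤ _ := by
          gcongr
          linarith

lemma contDiff_scaledKer (hG : ∀ k, UnitPhase c c₁ (G k)) (hc₁ : 0 < c₁)
    (hη : ContDiff ℝ (⊤ : ℕ∞) η) (hη0 : ∀ y ∉ Icc (1 / 2 : ℝ) 2, η y = 0)
    (a : SchwartzMap (Rn n) ℂ) (k : ℤ) (v : ℝ) :
    ContDiff ℝ (⊤ : ℕ∞) (scaledKer ρ η G a lam k v) :=
  contDiff_const.mul ((contDiff_unitKer (hG k) hc₁ hη hη0 a _).comp (contDiff_const_smul _))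

lemma integral_scaledKer_eq_zero (hn : n ≠ 0) {K : Rn n → ℝ} (hK : IsHomCZKernel n K)
    (hρ : ∀ k, 0 < ρ k) (hG : ∀ k, UnitPhase c c₁ (G k)) (hc₁ : 0 < c₁)
    (hη0 : ∀ y ∉ Icc (1 / 2 : ℝ) 2, η y = 0) {a : Rn n → ℂ}
    (ha : ∀ t ∈ shell n (shellRad c₁)⁻¹ (shellRad c₁), a t = K t) (k : ℤ) (v : ℝ) :
    ∫ t, scaledKer ρ η G a lam k v t = 0 :=
  (integral_inv_smul_mul (hρ k) _).trans (integral_unitKer_eq_zero hn hK (hG k) hc₁ hη0 ha _)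

lemma fourier_scaledKer (hρ : ∀ k, 0 < ρ k) (a : Rn n → ℂ) (k : ℤ) (v : ℝ) (ξ : Rn n) :
    𝓕 (scaledKer ρ η G a lam k v) ξ = 𝓕 (unitKer η (G k) a (lam * v)) (ρ k • ξ) := by
  have hk := hρ k
  rw [Real.fourier_eq, Real.fourier_eq]
  refine Eq.trans ?_ (integral_inv_smul_mul hk _)
  congr 1 with t
  rw [scaledKer, inner_smul_left, inner_smul_right, Circle.smul_def, Circle.smul_def,
    smul_eq_mul, smul_eq_mul]
  have : (starRingEnd ℝ) (ρ k)⁻¹ * (ρ k * inner ℝ t ξ) = inner ℝ t ξ := by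
    simp only [conj_trivial]
    field_simp
  rw [this]
  ring

lemma exists_lintegral_fourier_scaledKer_le (c : ℕ → ℝ) (hc₁ : 0 < c₁)
    (hη : ContDiff ℝ (⊤ : ℕ∞) η) (hη0 : ∀ y ∉ Icc (1 / 2 : ℝ) 2, η y = 0) (hn : 2 ≤ n)
    (a : SchwartzMap (Rn n) ℂ) {ε : ℝ} (hε : 0 < ε) (hε1 : ε ≤ 1) :
    ∃ C : ℝ, 0 < C ∧ ∀ ρ G lam, (∀ k, 0 < ρ k) → (∀ k, UnitPhase c c₁ (G k)) → 0 < lam →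
      ∀ k ξ, ∫⁻ v in Icc (1 : ℝ) 2, ‖𝓕 (scaledKer ρ η G a lam k v) ξ‖ₑ ^ (2 : ℝ) ≤
        ENNReal.ofReal (C * (1 + lam) ^ (-((n : ℝ) - ε))) := by
  have hn' : (2 : ℝ) ≤ n := by exact_mod_cast hn
  obtain ⟨C, hC, h⟩ := exists_lintegral_multiplier_le c hc₁ hη hη0 hn a hε hε1
  obtain ⟨M, hM0, hM⟩ := exists_bound_of_cutoff hη hη0
  set I := ∫ t, ‖a t‖ with hI
  have hI0 : 0 ≤ I := integral_nonneg fun t => norm_nonneg _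
  set s : ℝ := (n : ℝ) - ε with hs
  have hs0 : 0 ≤ s := by linarith
  refine ⟨(C + (M * I) ^ 2) * 2 ^ s, by positivity, fun ρ G lam hρ hG hlam k ξ => ?_⟩
  simp_rw [fourier_scaledKer hρ]
  set ζ := ρ k • ξ
  have hX : (2 : ℝ) ^ s * (1 + lam) ^ (-s) = ((1 + lam) / 2) ^ (-s) := by
    rw [Real.div_rpow (by positivity) (by positivity), Real.rpow_neg zero_le_two]
    field_simp
  rw [mul_assoc, hX]
  rcases le_or_gt 1 lam with h1 | h1
  · refine (h (G k) (hG k) lam h1 ζ).trans (ENNReal.ofReal_le_ofReal ?_)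
    rw [show -(n : ℝ) + ε = -s by rw [hs]; ring]
    have h2 : lam ^ (-s) ≤ ((1 + lam) / 2) ^ (-s) :=
      Real.rpow_le_rpow_of_nonpos (by positivity) (by linarith) (by linarith)
    have h3 : 0 ≤ (M * I) ^ 2 := by positivity
    gcongr
    linarith
  · have hle : ∀ v, ‖𝓕 (unitKer η (G k) a (lam * v)) ζ‖ ≤ M * I := by
      intro v
      rw [Real.fourier_eq]
      refine (norm_integral_le_integral_norm _).trans ?_
      rw [hI, ← integral_const_mul]
      refine integral_mono_of_nonneg (Eventually.of_forall fun t => norm_nonneg _)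
        (a.integrable.norm.const_mul _) (Eventually.of_forall fun t => ?_)
      simp only [Circle.norm_smul, unitKer, norm_mul, norm_oscFactor]
      gcongr
      exact hM _
    have h2 : (1 : ℝ) ≤ ((1 + lam) / 2) ^ (-s) := by
      refine Real.one_le_rpow_of_pos_of_le_one_of_nonpos (by positivity) (by linarith) (by linarith)
    calc _ ≤ ∫⁻ _ in Icc (1 : ℝ) 2, ENNReal.ofReal ((M * I) ^ 2) := by
          refine lintegral_mono fun v => ?_
          rw [enorm_rpow_two_eq]
          refine ENNReal.ofReal_le_ofReal ?_
          have := hle v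
          gcongr
      _ = ENNReal.ofReal ((M * I) ^ 2) := by
          rw [lintegral_const, Measure.restrict_apply_univ, Real.volume_Icc]
          norm_num
      _ ≤ _ := by
          refine ENNReal.ofReal_le_ofReal ?_
          have h3 : 0 ≤ (M * I) ^ 2 := by positivity
          nlinarith

lemma T_scaledKer_eq (hρ : ∀ k, 0 < ρ k) (a f : Rn n → ℂ) (k : ℤ) (x : Rn n) (v : ℝ) :
    T (scaledKer ρ η G a lam) k f x v =
      ∫ t, f (x - ρ k • t) * unitKer η (G k) a (lam * v) t := by
  have hk := hρ k
  rw [← integral_inv_smul_mul hk]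
  unfold T
  rw [← integral_sub_left_eq_self _ _ x]
  congr 1 with t
  rw [scaledKer, sub_sub_cancel, smul_inv_smul₀ hk.ne']
  ring

lemma exists_ptDecay (c : ℕ → ℝ) (hc₁ : 0 < c₁)
    (hη : ContDiff ℝ (⊤ : ℕ∞) η) (hη0 : ∀ y ∉ Icc (1 / 2 : ℝ) 2, η y = 0) (hn : 2 ≤ n)
    (a : SchwartzMap (Rn n) ℂ) :
    ∃ C : ℝ, 0 ≤ C ∧ ∀ ρ G lam, (∀ k, 0 < ρ k) → (∀ k, UnitPhase c c₁ (G k)) → 0 < lam →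
      PtDecay (scaledKer ρ η G a lam) (C / (1 + lam)) := by
  have hβ := one_lt_shellRad hc₁
  have hβ' : 0 < (shellRad c₁)⁻¹ := by positivity
  obtain ⟨m, hm, hmg⟩ := UnitPhase.exists_expanding c hc₁
  obtain ⟨M, hM0, hM⟩ := exists_bound_of_cutoff hη hη0
  obtain ⟨A, hA⟩ : ∃ A, ∀ t, ‖a t‖ ≤ A := ⟨_, fun t => SchwartzMap.norm_le_seminorm ℝ a t⟩
  have hA0 : 0 ≤ A := (norm_nonneg _).trans (hA 0)
  set S := shell n (shellRad c₁)⁻¹ (shellRad c₁) with hS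
  have hSm : MeasurableSet S := measurableSet_shell _ _
  have hSf : volume S ≠ ⊤ := volume_shell_ne_top _ _
  have hfin : IsFiniteMeasure (volume.restrict S) := ⟨by simpa using hSf.lt_top⟩
  set V := volume.real S with hV
  have hV0 : 0 ≤ V := measureReal_nonneg
  set D : ℝ := n * volume.real (Metric.ball (0 : Rn n) 1) * shellRad c₁ ^ (n - 1) * m⁻¹ with hD
  have hD0 : 0 ≤ D := by positivity
  refine ⟨2 * (Real.exp (2 ^ 2) * (4 * Real.pi) * D * ((M * A) ^ 2 * V)) + 2 * (M * A * V) ^ 2,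
    by positivity, fun ρ G lam hρ hG hlam f hf hfi hf1 k x => ?_⟩
  set w : Rn n → ℂ := fun t => f (x - ρ k • t) * ((η (G k 0 ‖t‖) : ℝ) * a t) with hw
  have hwM : ∀ t, ‖w t‖ ≤ M * A := by
    intro t
    rw [hw]
    simp only [norm_mul, Complex.norm_real]
    have h1 := hf1 (x - ρ k • t)
    calc _ ≤ 1 * (M * A) := mul_le_mul h1 (mul_le_mul (hM _) (hA t) (norm_nonneg _) hM0)
          (by positivity) zero_le_one
      _ = _ := one_mul _
  have hwm : Measurable w := by
    have h1 : Measurable fun t : Rn n => G k 0 ‖t‖ := (hG k).cont.measurable.comp measurable_norm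
    have h2 : Measurable fun t : Rn n => x - ρ k • t := by fun_prop
    exact (hf.comp h2).mul ((Complex.measurable_ofReal.comp
      (hη.continuous.measurable.comp h1)).mul a.continuous.measurable)
  have hT : ∀ v, T (scaledKer ρ η G a lam) k f x v =
      ∫ t in S, Complex.exp (Complex.I * (lam * v * G k 0 ‖t‖ : ℝ)) * w t := by
    intro v
    rw [T_scaledKer_eq hρ, ← setIntegral_eq_integral_of_forall_compl_eq_zero (s := S)
      fun t ht => by rw [unitKer_eq_zero (hG k) hc₁ hη0 _ _ ht, mul_zero]]
    congr 1 with t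
    rw [unitKer, oscFactor_sq_eq _ _ _ (norm_nonneg t), hw]
    ring
  simp_rw [hT]
  have hwint : ∫⁻ t in S, ‖w t‖ₑ ^ (2 : ℝ) ≤ ENNReal.ofReal ((M * A) ^ 2 * V) := by
    calc _ ≤ ∫⁻ _ in S, ENNReal.ofReal ((M * A) ^ 2) := by
          refine lintegral_mono fun t => ?_
          rw [enorm_rpow_two_eq]
          have := hwM t
          exact ENNReal.ofReal_le_ofReal (by gcongr)
      _ = _ := by
          rw [lintegral_const, Measure.restrict_apply_univ, ENNReal.ofReal_mul (by positivity), hV,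
            ofReal_measureReal hSf]
  rcases le_or_gt 1 lam with h1 | h1
  · have h2 := lintegral_oscillatory_sq_le (ν := volume.restrict S) (φ := fun t => G k 0 ‖t‖)
      ((hG k).cont.measurable.comp measurable_norm)
      (map_shell_le (by lia) (hG k).cont.measurable hβ' hm (hmg _ (hG k))) hlam 2
      hwm.aestronglyMeasurable hwM
    refine (lintegral_mono_set (show Icc (1 : ℝ) 2 ⊆ Icc (-2) 2 from
      Icc_subset_Icc (by norm_num) le_rfl)).trans (h2.trans ?_)
    refine (mul_le_mul' le_rfl hwint).trans ?_
    rw [← hD, ← ENNReal.ofReal_mul (by positivity), ← ENNReal.ofReal_mul (by positivity)]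
    refine ENNReal.ofReal_le_ofReal ?_
    set Q := Real.exp (2 ^ 2) * (4 * Real.pi) * D * ((M * A) ^ 2 * V) with hQ
    have hQ0 : 0 ≤ Q := by positivity
    have e : Real.exp (2 ^ 2) * (4 * Real.pi / lam) * D * ((M * A) ^ 2 * V) = Q / lam := by
      rw [hQ]
      ring
    rw [e, div_le_div_iff₀ hlam (by positivity)]
    have : 0 ≤ 2 * (M * A * V) ^ 2 * lam := by positivity
    nlinarith
  · have hle : ∀ v, ‖∫ t in S, Complex.exp (Complex.I * (lam * v * G k 0 ‖t‖ : ℝ)) * w t‖ ≤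
        M * A * V := fun v => by
      refine norm_setIntegral_le_of_norm_le_const hSf.lt_top fun t _ => ?_
      rw [norm_mul, norm_cexp_I_mul, one_mul]
      exact hwM t
    calc _ ≤ ∫⁻ _ in Icc (1 : ℝ) 2, ENNReal.ofReal ((M * A * V) ^ 2) := by
          refine lintegral_mono fun v => ?_
          rw [enorm_rpow_two_eq]
          refine ENNReal.ofReal_le_ofReal ?_
          have := hle v
          gcongr
      _ = ENNReal.ofReal ((M * A * V) ^ 2) := by
          rw [lintegral_const, Measure.restrict_apply_univ, Real.volume_Icc]
          norm_num
      _ ≤ _ := by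
          refine ENNReal.ofReal_le_ofReal ?_
          rw [le_div_iff₀ (by positivity)]
          have h3 : 0 ≤ (M * A * V) ^ 2 := by positivity
          have h4 : 0 ≤ Real.exp (2 ^ 2) * (4 * Real.pi) * D * ((M * A) ^ 2 * V) := by positivity
          nlinarith

end ScaledKernel

section Dilations

lemma contDiffOn_iteratedDeriv {f : ℝ → ℝ} {s : Set ℝ} (hs : IsOpen s)
    (hf : ContDiffOn ℝ (⊤ : ℕ∞) f s) (j : ℕ) : ContDiffOn ℝ (⊤ : ℕ∞) (iteratedDeriv j f) s := by
  induction j with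
  | zero => simpa using hf
  | succ j ih =>
    rw [iteratedDeriv_succ]
    exact ih.deriv_of_isOpen hs (by simp)

lemma hasDerivAt_iteratedDeriv {f : ℝ → ℝ} {s : Set ℝ} (hs : IsOpen s)
    (hf : ContDiffOn ℝ (⊤ : ℕ∞) f s) (j : ℕ) {x : ℝ} (hx : x ∈ s) :
    HasDerivAt (iteratedDeriv j f) (iteratedDeriv (j + 1) f x) x := by
  rw [iteratedDeriv_succ]
  exact ((contDiffOn_iteratedDeriv hs hf j).differentiableOn (by simp)
    |>.differentiableAt (hs.mem_nhds hx)).hasDerivAt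

variable {Γ : ℝ → ℝ}

lemma _root_.IsGammaU.hasDerivAt (hΓ : IsGammaU Γ) (j : ℕ) {s : ℝ} (hs : 0 < s) :
    HasDerivAt (iteratedDeriv j Γ) (iteratedDeriv (j + 1) Γ s) s :=
  hasDerivAt_iteratedDeriv isOpen_Ioi hΓ.smooth j hs

lemma _root_.IsGammaU.strictMonoOn (hΓ : IsGammaU Γ) : StrictMonoOn Γ (Ici 0) :=
  strictMonoOn_of_deriv_pos (convex_Ici 0) hΓ.continuousOn fun s hs =>
    hΓ.deriv_pos s (by simpa using hs)

lemma _root_.IsGammaU.pos (hΓ : IsGammaU Γ) {s : ℝ} (hs : 0 < s) : 0 < Γ s := by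
  have := hΓ.strictMonoOn (mem_Ici.2 le_rfl) (mem_Ici.2 hs.le) hs
  rwa [hΓ.map_zero] at this

lemma _root_.IsGammaU.exists_lower (hΓ : IsGammaU Γ) :
    ∃ c > 0, ∀ s > 0, c * Γ s ≤ s * deriv Γ s := by
  obtain ⟨c, hc, h⟩ := hΓ.lower 1 (by simp)
  refine ⟨c, hc, fun s hs => ?_⟩
  have h1 := h s hs
  have h2 := hΓ.pos hs
  have h3 := hΓ.deriv_pos s hs
  rw [pow_one, iteratedDeriv_one, abs_of_pos (by positivity), le_div_iff₀ h2] at h1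
  exact h1

lemma _root_.IsGammaU.exists_upper (hΓ : IsGammaU Γ) :
    ∃ c : ℕ → ℝ, (∀ j, 0 < c j) ∧ ∀ j, ∀ s > 0, |s ^ j * iteratedDeriv j Γ s| ≤ c j * Γ s := by
  have h : ∀ j : ℕ, ∃ c > (0 : ℝ), ∀ s > (0 : ℝ), |s ^ j * iteratedDeriv j Γ s| ≤ c * Γ s := by
    intro j
    rcases Nat.eq_zero_or_pos j with rfl | hj
    · refine ⟨1, one_pos, fun s hs => ?_⟩
      rw [pow_zero, one_mul, one_mul, iteratedDeriv_zero, abs_of_pos (hΓ.pos hs)]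
    · obtain ⟨c, hc, h⟩ := hΓ.upper j hj
      refine ⟨c, hc, fun s hs => ?_⟩
      have h1 := h s hs
      rwa [abs_div, abs_of_pos (hΓ.pos hs), div_le_iff₀ (hΓ.pos hs)] at h1
  choose c hc h using h
  exact ⟨c, hc, h⟩

lemma _root_.IsGammaU.hasDerivAt_self (hΓ : IsGammaU Γ) {s : ℝ} (hs : 0 < s) :
    HasDerivAt Γ (deriv Γ s) s := by
  have := hΓ.hasDerivAt 0 hs
  rwa [iteratedDeriv_zero, zero_add, iteratedDeriv_one] at this

lemma _root_.IsGammaU.exists_eq (hΓ : IsGammaU Γ) {y : ℝ} (hy : 0 < y) : ∃ s > 0, Γ s = y := by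
  obtain ⟨c, hc, h⟩ := hΓ.exists_lower
  obtain ⟨R, hR, hR1⟩ : ∃ R : ℝ, 1 ≤ R ∧ y ≤ Γ R := by
    have h1 : Tendsto (fun R : ℝ => R ^ c * Γ 1) atTop atTop :=
      (tendsto_rpow_atTop hc).atTop_mul_const (hΓ.pos one_pos)
    obtain ⟨R, hR⟩ := ((h1.eventually_ge_atTop y).and (eventually_ge_atTop 1)).exists
    refine ⟨R, hR.2, hR.1.trans ?_⟩
    have := monotone_div_of_deriv (fun s hs => hΓ.pos hs) (fun s hs => hΓ.hasDerivAt_self hs) h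
      one_pos hR.2
    rwa [div_one] at this
  obtain ⟨s, hs, hsy⟩ := intermediate_value_Icc (show (0 : ℝ) ≤ R by linarith)
    (hΓ.continuousOn.mono Icc_subset_Ici_self) (show y ∈ Icc (Γ 0) (Γ R) by
      rw [hΓ.map_zero]; exact ⟨hy.le, hR1⟩)
  refine ⟨s, lt_of_le_of_ne hs.1 ?_, hsy⟩
  rintro rfl
  rw [hΓ.map_zero] at hsy
  linarith

/-- The dilates of the phase normalised to be of size `2 ^ k` at the dyadic radii. -/
lemma _root_.IsGammaU.exists_unitPhase (hΓ : IsGammaU Γ) :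
    ∃ (c : ℕ → ℝ) (c₁ b : ℝ) (ρ : ℤ → ℝ) (G : ℤ → ℕ → ℝ → ℝ), 0 < c₁ ∧ IsLac ρ b ∧
      (∀ k, UnitPhase c c₁ (G k)) ∧ ∀ k s, 0 ≤ s → G k 0 s = Γ (ρ k * s) / 2 ^ k := by
  obtain ⟨c₁, hc₁, hlow⟩ := hΓ.exists_lower
  obtain ⟨c, hc, hup⟩ := hΓ.exists_upper
  choose ρ hρ hΓρ using fun k : ℤ => hΓ.exists_eq (show (0 : ℝ) < 2 ^ k by positivity)
  have hlac : IsLac ρ (2 ^ (1 / c 1)) := by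
    have hc1 := hc 1
    refine ⟨Real.one_lt_rpow one_lt_two (by positivity), hρ, fun k => ?_⟩
    have hlt : ρ k < ρ (k + 1) := by
      by_contra! h
      have h1 := hΓ.strictMonoOn.monotoneOn (mem_Ici.2 (hρ (k + 1)).le) (mem_Ici.2 (hρ k).le) h
      rw [hΓρ, hΓρ, zpow_add_one₀ two_ne_zero] at h1
      have : (0 : ℝ) < 2 ^ k := by positivity
      linarith
    have h1 := le_rpow_mul_of_deriv (c := c 1) (fun s hs => hΓ.pos hs)
      (fun s hs => hΓ.hasDerivAt_self hs) (fun s hs => by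
        have h2 := hup 1 s hs
        rw [pow_one, iteratedDeriv_one] at h2
        exact (le_abs_self _).trans h2) (hρ k) hlt.le
    rw [hΓρ, hΓρ, zpow_add_one₀ two_ne_zero, mul_comm] at h1
    have h2 := le_of_mul_le_mul_right h1 (show (0 : ℝ) < 2 ^ k by positivity)
    have h3 : (0 : ℝ) < ρ (k + 1) / ρ k := div_pos (hρ _) (hρ _)
    rw [← le_div_iff₀ (hρ k)]
    calc (2 : ℝ) ^ (1 / c 1) ≤ ((ρ (k + 1) / ρ k) ^ c 1) ^ (1 / c 1) := by gcongr
      _ = ρ (k + 1) / ρ k := by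
        rw [← Real.rpow_mul h3.le, mul_one_div_cancel hc1.ne', Real.rpow_one]
  set G : ℤ → ℕ → ℝ → ℝ := fun k j s =>
    if j = 0 then Γ (max (ρ k * s) 0) / 2 ^ k
    else ρ k ^ j * iteratedDeriv j Γ (ρ k * s) / 2 ^ k with hGdef
  have hG : ∀ k j s, 0 < s → G k j s = ρ k ^ j * iteratedDeriv j Γ (ρ k * s) / 2 ^ k := by
    intro k j s hs
    rcases Nat.eq_zero_or_pos j with rfl | hj
    · simp only [hGdef, if_true, iteratedDeriv_zero, pow_zero, one_mul]
      rw [max_eq_left (mul_pos (hρ k) hs).le]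
    · simp only [hGdef, hj.ne', if_false]
  have hG0 : ∀ k s, G k 0 s = Γ (max (ρ k * s) 0) / 2 ^ k := fun k s => by
    simp only [hGdef, if_true]
  have hcont : Continuous fun s => Γ (max s 0) :=
    hΓ.continuousOn.comp_continuous (by fun_prop) fun s => mem_Ici.2 (le_max_right s 0)
  refine ⟨c, c₁, 2 ^ (1 / c 1), ρ, G, hc₁, hlac, fun k => ⟨?_, fun s hs => ?_, ?_, fun s hs => ?_,
    ?_, fun j s hs => ?_, fun s hs => ?_, fun j s hs => ?_⟩, fun k s hs => ?_⟩
  · simp only [funext (hG0 k)]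
    exact (hcont.comp (by fun_prop : Continuous fun s => ρ k * s)).div_const _
  · rw [hG0, max_eq_right (mul_nonpos_of_nonneg_of_nonpos (hρ k).le hs), hΓ.map_zero, zero_div]
  · have h1 : ContDiffOn ℝ (⊤ : ℕ∞) (fun s => Γ (ρ k * s) / 2 ^ k) (Ioi 0) :=
      (hΓ.smooth.comp (contDiffOn_const.mul contDiffOn_id) fun s hs =>
        mul_pos (hρ k) (show 0 < s from hs)).div_const _
    refine h1.congr fun s hs => ?_
    rw [hG0, max_eq_left (mul_pos (hρ k) (show 0 < s from hs)).le]
  · rw [hG0, max_eq_left (mul_pos (hρ k) hs).le]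
    exact div_pos (hΓ.pos (mul_pos (hρ k) hs)) (by positivity)
  · rw [hG0, mul_one, max_eq_left (hρ k).le, hΓρ, div_self (by positivity)]
  · have h1 := (((hΓ.hasDerivAt j (mul_pos (hρ k) hs)).comp s
      ((hasDerivAt_id s).const_mul (ρ k))).const_mul (ρ k ^ j)).div_const (2 ^ k)
    have h2 : HasDerivAt (fun s => ρ k ^ j * iteratedDeriv j Γ (ρ k * s) / 2 ^ k)
        (G k (j + 1) s) s := h1.congr_deriv (by rw [hG k _ s hs]; ring)
    refine h2.congr_of_eventuallyEq ?_
    filter_upwards [Ioi_mem_nhds hs] with t ht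
    exact hG k j t ht
  · rw [hG k 0 s hs, hG k 1 s hs, iteratedDeriv_one, iteratedDeriv_zero, pow_zero, one_mul, pow_one,
      mul_div_assoc', mul_div_assoc']
    refine div_le_div_of_nonneg_right ?_ (by positivity)
    refine (hlow _ (mul_pos (hρ k) hs)).trans (le_of_eq ?_)
    ring
  · rw [hG k 0 s hs, hG k j s hs, iteratedDeriv_zero, pow_zero, one_mul, mul_div_assoc',
      mul_div_assoc', abs_div, abs_of_pos (show (0 : ℝ) < 2 ^ k by positivity)]
    refine div_le_div_of_nonneg_right ?_ (by positivity)
    refine (le_of_eq ?_).trans (hup j _ (mul_pos (hρ k) hs))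
    rw [mul_pow]
    ring_nf
  · rw [hG0, max_eq_left (mul_nonneg (hρ k).le hs)]

end Dilations

section FrequencyPieces

variable {n : ℕ} {ρ : ℤ → ℝ} {b C₀ : ℝ} {κ κ' : ℝ → ℤ → ℝ → Rn n → ℂ}

/-- The estimates satisfied by the families of kernels `κ lam` of frequency `lam`. -/
structure PieceFam (ρ : ℤ → ℝ) (b C₀ : ℝ) (κ : ℝ → ℤ → ℝ → Rn n → ℂ) : Prop where
  lac : IsLac ρ b
  one_le : 1 ≤ C₀
  ker : ∀ lam, 0 < lam → KerFam ρ C₀ (1 + lam) (κ lam)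
  decay : ∃ C₁ : ℝ, 0 ≤ C₁ ∧ ∀ lam, 0 < lam → PtDecay (κ lam) (C₁ / (1 + lam))
  l2 : ∀ ε, 0 < ε → ε ≤ 1 → ∃ C : ℝ≥0∞, C ≠ ⊤ ∧ ∀ lam, 0 < lam →
    L2Bdd (κ lam) (C * ENNReal.ofReal ((1 + lam) ^ (-(n : ℝ) + ε)))

lemma ofReal_rpow_mul_ofReal_rpow {X : ℝ} (hX : 0 < X) (s t : ℝ) :
    ENNReal.ofReal (X ^ s) * ENNReal.ofReal (X ^ t) = ENNReal.ofReal (X ^ (s + t)) := by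
  rw [← ENNReal.ofReal_mul (by positivity), Real.rpow_add hX]

lemma ofReal_rpow_rpow {X : ℝ} (hX : 0 < X) (s t : ℝ) :
    ENNReal.ofReal (X ^ s) ^ t = ENNReal.ofReal (X ^ (s * t)) := by
  rw [ENNReal.ofReal_rpow_of_pos (by positivity), ← Real.rpow_mul hX.le]

lemma ofReal_rpow_mono {X s t : ℝ} (hX : 1 ≤ X) (h : s ≤ t) :
    ENNReal.ofReal (X ^ s) ≤ ENNReal.ofReal (X ^ t) :=
  ENNReal.ofReal_le_ofReal (Real.rpow_le_rpow_of_exponent_le hX h)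

/-- The functions dominated by the indicator function of a set of finite measure. -/
structure SubInd (f : Rn n → ℂ) (E : Set (Rn n)) : Prop where
  meas : Measurable f
  measSet : MeasurableSet E
  ne_top : volume E ≠ ⊤
  le : ∀ s, ‖f s‖ₑ ≤ E.indicator (fun _ => 1) s

lemma SubInd.norm_le {f : Rn n → ℂ} {E : Set (Rn n)} (h : SubInd f E) (s : Rn n) : ‖f s‖ ≤ 1 := by
  have h1 : ‖f s‖ₑ ≤ 1 := (h.le s).trans (indicator_le_self' (fun _ _ => bot_le) s)
  rwa [← ofReal_norm, ENNReal.ofReal_le_one] at h1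

lemma SubInd.support_subset {f : Rn n → ℂ} {E : Set (Rn n)} (h : SubInd f E) :
    Function.support f ⊆ E := by
  intro s hs
  by_contra hE
  have h1 := h.le s
  rw [indicator_of_notMem hE] at h1
  exact hs (enorm_eq_zero.1 (le_antisymm h1 bot_le))

lemma SubInd.lintegral_rpow_le {f : Rn n → ℂ} {E : Set (Rn n)} (h : SubInd f E) {q : ℝ}
    (hq : 0 < q) : ∫⁻ s, ‖f s‖ₑ ^ q ≤ volume E := by
  calc ∫⁻ s, ‖f s‖ₑ ^ q ≤ ∫⁻ s, E.indicator (fun _ => 1) s := by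
        refine lintegral_mono fun s => (ENNReal.rpow_le_rpow (h.le s) hq.le).trans ?_
        by_cases hs : s ∈ E <;> simp [hs, hq]
    _ = volume E := by rw [lintegral_indicator h.measSet, setLIntegral_one]

lemma SubInd.integrable {f : Rn n → ℂ} {E : Set (Rn n)} (h : SubInd f E) : Integrable f := by
  refine ⟨h.meas.aestronglyMeasurable, lt_of_le_of_lt ?_ h.ne_top.lt_top⟩
  simpa using h.lintegral_rpow_le one_pos

lemma PieceFam.exists_lintegral_rpow_gt (hκ : PieceFam ρ b C₀ κ) (hn : 2 ≤ n) {q : ℝ}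
    (hq : 2 < q) :
    ∃ C : ℝ≥0∞, C ≠ ⊤ ∧ ∀ lam, 0 < lam → ∀ (f : Rn n → ℂ) (E : Set (Rn n)), SubInd f E →
      ∫⁻ x, SS (κ lam) f x ^ q ≤ C * ENNReal.ofReal ((1 + lam) ^ (-(q / 2) - 1 / 2)) * volume E := by
  set ε : ℝ := 1 / (2 * q) with hε
  have hε0 : 0 < ε := by positivity
  have hεq : ε * q = 1 / 2 := by rw [hε]; field_simp
  have hε1 : ε ≤ 1 := by nlinarith
  obtain ⟨C₂, hC₂, h2⟩ := hκ.l2 ε hε0 hε1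
  obtain ⟨C₁, hC₁, hd⟩ := hκ.decay
  obtain ⟨C, hC, h⟩ := strong_type_gt_two (n := n) hκ.lac hκ.one_le hε0 hε1 (by omega) hC₁ hq
  refine ⟨C * ((C₂ ^ (1 / (2 : ℝ)) + 1) ^ (q - 2) * C₂), ?_, fun lam hlam f E hf => ?_⟩
  · exact ENNReal.mul_ne_top hC (ENNReal.mul_ne_top (ENNReal.rpow_ne_top_of_nonneg (by linarith)
      (ENNReal.add_ne_top.2 ⟨ENNReal.rpow_ne_top_of_nonneg (by norm_num) hC₂, ENNReal.one_ne_top⟩))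
      hC₂)
  have hX : 1 ≤ 1 + lam := by linarith
  have hX0 : 0 < 1 + lam := by linarith
  have hn' : (2 : ℝ) ≤ n := by exact_mod_cast hn
  refine (h (1 + lam) (κ lam) _ hX (ENNReal.mul_ne_top hC₂ ENNReal.ofReal_ne_top) (hκ.ker lam hlam)
    (h2 lam hlam) (hd lam hlam) f E hf.meas hf.measSet hf.ne_top hf.le).trans ?_
  refine mul_le_mul' ?_ le_rfl
  have h3 : (C₂ * ENNReal.ofReal ((1 + lam) ^ (-(n : ℝ) + ε))) ^ (1 / (2 : ℝ)) ≤
      C₂ ^ (1 / (2 : ℝ)) * ENNReal.ofReal ((1 + lam) ^ (-(1 / 2) + ε)) := by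
    rw [ENNReal.mul_rpow_of_nonneg _ _ (by norm_num), ofReal_rpow_rpow hX0]
    exact mul_le_mul' le_rfl (ofReal_rpow_mono hX (by linarith))
  have h4 : ((C₂ * ENNReal.ofReal ((1 + lam) ^ (-(n : ℝ) + ε))) ^ (1 / (2 : ℝ)) +
      ENNReal.ofReal ((1 + lam) ^ (-(1 / 2) + ε))) ^ (q - 2) ≤ (C₂ ^ (1 / (2 : ℝ)) + 1) ^ (q - 2) *
        ENNReal.ofReal ((1 + lam) ^ ((-(1 / 2) + ε) * (q - 2))) := by
    rw [← ofReal_rpow_rpow hX0, ← ENNReal.mul_rpow_of_nonneg _ _ (by linarith), add_mul, one_mul]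
    exact ENNReal.rpow_le_rpow (add_le_add h3 le_rfl) (by linarith)
  have h5 : ENNReal.ofReal ((1 + lam) ^ ((-(1 / 2) + ε) * (q - 2))) *
      ENNReal.ofReal ((1 + lam) ^ (-(n : ℝ) + ε)) ≤
      ENNReal.ofReal ((1 + lam) ^ (-(q / 2) - 1 / 2)) := by
    rw [ofReal_rpow_mul_ofReal_rpow hX0]
    exact ofReal_rpow_mono hX (by nlinarith)
  calc _ ≤ C * ((C₂ ^ (1 / (2 : ℝ)) + 1) ^ (q - 2) *
        ENNReal.ofReal ((1 + lam) ^ ((-(1 / 2) + ε) * (q - 2)))) *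
        (C₂ * ENNReal.ofReal ((1 + lam) ^ (-(n : ℝ) + ε))) := by gcongr
    _ = C * ((C₂ ^ (1 / (2 : ℝ)) + 1) ^ (q - 2) * C₂) *
        (ENNReal.ofReal ((1 + lam) ^ ((-(1 / 2) + ε) * (q - 2))) *
        ENNReal.ofReal ((1 + lam) ^ (-(n : ℝ) + ε))) := by ring
    _ ≤ _ := mul_le_mul' le_rfl h5

lemma PieceFam.exists_lintegral_rpow_lt (hκ : PieceFam ρ b C₀ κ) (hn : n ≠ 0) {q ε : ℝ}
    (hq : 1 < q) (hq2 : q < 2) (hε : 0 < ε) (hε1 : ε ≤ 1) :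
    ∃ C : ℝ≥0∞, C ≠ ⊤ ∧ ∀ lam, 0 < lam → ∀ (f : Rn n → ℂ) (E : Set (Rn n)), SubInd f E →
      ∫⁻ x, SS (κ lam) f x ^ q ≤ C * ENNReal.ofReal ((1 + lam) ^ ε) * volume E := by
  obtain ⟨C₂, hC₂, h2⟩ := hκ.l2 ε hε hε1
  obtain ⟨C, hC, h⟩ := strong_type_lt_two (n := n) hκ.lac hκ.one_le hε hε1 hn hq hq2
  refine ⟨C * (C₂ + 1), by finiteness, fun lam hlam f E hf => ?_⟩
  refine (h (1 + lam) (κ lam) _ (by linarith) (hκ.ker lam hlam) (h2 lam hlam) f E hf.meas hf.measSet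
    hf.ne_top hf.le).trans (mul_le_mul' ?_ le_rfl)
  rw [mul_assoc, add_mul, one_mul]
  gcongr
  · linarith
  · linarith [(Nat.cast_nonneg n : (0 : ℝ) ≤ n)]

lemma PieceFam.exists_lintegral_sq (hκ : PieceFam ρ b C₀ κ) {ε : ℝ}
    (hε : 0 < ε) (hε1 : ε ≤ 1) :
    ∃ C : ℝ≥0∞, C ≠ ⊤ ∧ ∀ lam, 0 < lam → ∀ (f : Rn n → ℂ) (E : Set (Rn n)), SubInd f E →
      ∫⁻ x, SS (κ lam) f x ^ (2 : ℝ) ≤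
        C * ENNReal.ofReal ((1 + lam) ^ (-(n : ℝ) + ε)) * volume E := by
  obtain ⟨C₂, hC₂, h2⟩ := hκ.l2 ε hε hε1
  exact ⟨C₂, hC₂, fun lam hlam f E hf => (h2 lam hlam f hf.meas hf.integrable ⟨1, hf.norm_le⟩).trans
    (mul_le_mul' le_rfl (hf.lintegral_rpow_le zero_lt_two))⟩

/-- The sum of the two square functions controlling the variation. -/
def SSum (κ κ' : ℤ → ℝ → Rn n → ℂ) (f : Rn n → ℂ) (x : Rn n) : ℝ≥0∞ := SS κ f x + SS κ' f x

lemma lintegral_SSum_rpow_le {κ κ' : ℤ → ℝ → Rn n → ℂ} {f : Rn n → ℂ} {q : ℝ} (hq : 1 ≤ q)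
    (hm : Measurable (SS κ f)) :
    ∫⁻ x, SSum κ κ' f x ^ q ≤
      2 ^ (q - 1) * ((∫⁻ x, SS κ f x ^ q) + ∫⁻ x, SS κ' f x ^ q) := by
  rw [← lintegral_add_left (hm.pow_const q), ← lintegral_const_mul' _ _
    (ENNReal.rpow_ne_top_of_nonneg (by linarith) (by norm_num))]
  exact lintegral_mono fun x => ENNReal.rpow_add_le_mul_rpow_add_rpow _ _ hq

lemma exists_lintegral_SSum (hκ : PieceFam ρ b C₀ κ) {q : ℝ} (hq : 1 ≤ q) {w : ℝ → ℝ≥0∞}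
    (h : ∃ C : ℝ≥0∞, C ≠ ⊤ ∧ ∀ lam, 0 < lam → ∀ (f : Rn n → ℂ) (E : Set (Rn n)), SubInd f E →
      ∫⁻ x, SS (κ lam) f x ^ q ≤ C * w lam * volume E)
    (h' : ∃ C : ℝ≥0∞, C ≠ ⊤ ∧ ∀ lam, 0 < lam → ∀ (f : Rn n → ℂ) (E : Set (Rn n)), SubInd f E →
      ∫⁻ x, SS (κ' lam) f x ^ q ≤ C * w lam * volume E) :
    ∃ C : ℝ≥0∞, C ≠ ⊤ ∧ ∀ lam, 0 < lam → ∀ (f : Rn n → ℂ) (E : Set (Rn n)), SubInd f E →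
      ∫⁻ x, SSum (κ lam) (κ' lam) f x ^ q ≤ C * w lam * volume E := by
  obtain ⟨C, hC, h⟩ := h
  obtain ⟨C', hC', h'⟩ := h'
  refine ⟨2 ^ (q - 1) * (C + C'), ENNReal.mul_ne_top (ENNReal.rpow_ne_top_of_nonneg (by linarith)
    (by norm_num)) (by finiteness), fun lam hlam f E hf => ?_⟩
  refine (lintegral_SSum_rpow_le hq ((hκ.ker lam hlam).measurable_SS hf.integrable)).trans ?_
  rw [mul_assoc, mul_assoc, add_mul, ← mul_assoc, ← mul_assoc]
  exact mul_le_mul' le_rfl (add_le_add (h lam hlam f E hf) (h' lam hlam f E hf))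

end FrequencyPieces

section Majorant

variable {n : ℕ} {ρ : ℤ → ℝ} {b C₀ : ℝ} {κ κ' : ℝ → ℤ → ℝ → Rn n → ℂ}

lemma exists_interpolation_exponents {r q d : ℝ} (hr : 2 < r) (hq : 1 < q) (hq2 : q < 2)
    (h1 : r < q / (q - 1)) (h2 : q / (q - 1) < d * r) :
    ∃ q₀ α₁ α₂ α₃ : ℝ, 1 < q₀ ∧ q₀ < 2 ∧ 0 ≤ α₁ ∧ 0 ≤ α₂ ∧ 0 ≤ α₃ ∧ α₁ + α₂ + α₃ = 1 ∧
      q₀ * α₁ = (1 - 2 / r) * q ∧ q₀ * α₂ + 2 * α₃ = 2 / r * q ∧ q / r < d * α₃ := by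
  have hr0 : 0 < r := by linarith
  have hq1 : 0 < q - 1 := by linarith
  rw [lt_div_iff₀ hq1] at h1
  rw [div_lt_iff₀ hq1] at h2
  have hg : ContinuousAt (fun t : ℝ => (1 - 2 / r) * q / t + (q - t) / (2 - t)) 1 := by
    refine ContinuousAt.add (ContinuousAt.div (by fun_prop) (by fun_prop) (by norm_num))
      (ContinuousAt.div (by fun_prop) (by fun_prop) (by norm_num))
  have hh : ContinuousAt (fun t : ℝ => d * ((q - t) / (2 - t))) 1 :=
    continuousAt_const.mul (ContinuousAt.div (by fun_prop) (by fun_prop) (by norm_num))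
  have e1 := hg.eventually_lt (continuousAt_const (y := (1 : ℝ))) (by
    have : (1 - 2 / r) * q + (q - 1) - 1 = (2 * r * (q - 1) - 2 * q) / r := by field_simp; ring
    have h3 : (2 * r * (q - 1) - 2 * q) / r < 0 := div_neg_of_neg_of_pos (by linarith) hr0
    norm_num
    linarith)
  have e2 := (continuousAt_const (y := q / r)).eventually_lt hh (by
    norm_num
    rw [div_lt_iff₀ hr0]
    linarith)
  obtain ⟨t, ⟨⟨ht1, ht2⟩, ht⟩⟩ := (((e1.and e2).filter_mono nhdsWithin_le_nhds).and
    (Ioo_mem_nhdsGT hq)).exists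
  have ht0 : 0 < t := by linarith [ht.1]
  have ht3 : 0 < 2 - t := by linarith [ht.2]
  have h2r : 2 / r < 1 := by rw [div_lt_one hr0]; exact hr
  refine ⟨t, (1 - 2 / r) * q / t, 1 - ((1 - 2 / r) * q / t + (q - t) / (2 - t)), (q - t) / (2 - t),
    ht.1, by linarith [ht.2], div_nonneg (mul_nonneg (by linarith) (by linarith)) ht0.le,
    by linarith, div_nonneg (by linarith [ht.2]) ht3.le, by ring, by field_simp, ?_, ht2⟩
  field_simp
  ring

lemma zpow_rpow_mul_le {s δ : ℝ} (hs : 0 < s) (hδ : 0 < δ) (l : ℤ) :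
    ENNReal.ofReal (((2 : ℝ) ^ l) ^ s) * ENNReal.ofReal ((1 + (2 : ℝ) ^ l) ^ (-s - δ)) ≤
      two (-(min s δ * |(l : ℝ)|)) := by
  rw [two_eq_ofReal, ← ENNReal.ofReal_mul (by positivity)]
  refine ENNReal.ofReal_le_ofReal ?_
  have hl : (0 : ℝ) < 2 ^ l := by positivity
  rcases le_or_gt 0 l with h | h
  · have hl' : (0 : ℝ) ≤ l := by exact_mod_cast h
    calc ((2 : ℝ) ^ l) ^ s * (1 + (2 : ℝ) ^ l) ^ (-s - δ)
        ≤ ((2 : ℝ) ^ l) ^ s * ((2 : ℝ) ^ l) ^ (-s - δ) :=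
          mul_le_mul_of_nonneg_left (Real.rpow_le_rpow_of_nonpos hl (by linarith) (by linarith))
            (by positivity)
      _ = (2 : ℝ) ^ (-(δ * |(l : ℝ)|)) := by
          rw [← Real.rpow_add hl, ← Real.rpow_intCast, ← Real.rpow_mul zero_le_two,
            abs_of_nonneg hl']
          ring_nf
      _ ≤ _ := by gcongr <;> [norm_num; exact min_le_right _ _]
  · have hl' : (l : ℝ) < 0 := by exact_mod_cast h
    calc ((2 : ℝ) ^ l) ^ s * (1 + (2 : ℝ) ^ l) ^ (-s - δ) ≤ ((2 : ℝ) ^ l) ^ s * 1 :=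
          mul_le_mul_of_nonneg_left (Real.rpow_le_one_of_one_le_of_nonpos (by linarith)
            (by linarith)) (by positivity)
      _ = (2 : ℝ) ^ (-(s * |(l : ℝ)|)) := by
          rw [mul_one, ← Real.rpow_intCast, ← Real.rpow_mul zero_le_two, abs_of_neg hl']
          ring_nf
      _ ≤ _ := by gcongr <;> [norm_num; exact min_le_left _ _]

/-- The bound for the `ℓ²`-sum of the `2`-variations of the pieces of frequency `lam`. -/
def varBound (κ κ' : ℝ → ℤ → ℝ → Rn n → ℂ) (lam : ℝ) (f : Rn n → ℂ) (x : Rn n) : ℝ≥0∞ :=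
  ENNReal.ofReal (8 * lam) ^ (1 / (2 : ℝ)) * SSum (κ lam) (κ' lam) f x

/-- The bound for the `ℓʳ`-sum of the `r`-variations of the pieces of frequency `lam`. -/
def varMaj (ρ : ℤ → ℝ) (C₀ r : ℝ) (κ κ' : ℝ → ℤ → ℝ → Rn n → ℂ) (lam : ℝ) (f : Rn n → ℂ)
    (E : Set (Rn n)) (x : Rn n) : ℝ≥0∞ :=
  min (ENNReal.ofReal (2 * C₀) * MM ρ C₀ E x) (varBound κ κ' lam f x) ^ (1 - 2 / r) *
    varBound κ κ' lam f x ^ (2 / r)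

lemma measurable_SSum (hκ : PieceFam ρ b C₀ κ) (hκ' : PieceFam ρ b C₀ κ') {lam : ℝ}
    (hlam : 0 < lam) {f : Rn n → ℂ} (hf : Integrable f) :
    Measurable (SSum (κ lam) (κ' lam) f) :=
  ((hκ.ker lam hlam).measurable_SS hf).add ((hκ'.ker lam hlam).measurable_SS hf)

lemma measurable_varMaj (hκ : PieceFam ρ b C₀ κ) (hκ' : PieceFam ρ b C₀ κ') {lam : ℝ}
    (hlam : 0 < lam) {f : Rn n → ℂ} {E : Set (Rn n)} (hf : SubInd f E) (r : ℝ) :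
    Measurable (varMaj ρ C₀ r κ κ' lam f E) := by
  have h1 : Measurable (varBound κ κ' lam f) :=
    (measurable_SSum hκ hκ' hlam hf.integrable).const_mul _
  exact ((((measurable_MM hf.measSet).const_mul _).min h1).pow_const _).mul (h1.pow_const _)

lemma exists_lintegral_varMaj_gt (hκ : PieceFam ρ b C₀ κ) (hκ' : PieceFam ρ b C₀ κ')
    (hn : 2 ≤ n) {r q : ℝ} (hr : 2 < r) (hq : 2 < q) :
    ∃ C : ℝ≥0∞, C ≠ ⊤ ∧ ∃ δ > 0, ∀ (l : ℤ) (f : Rn n → ℂ) (E : Set (Rn n)), SubInd f E →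
      ∫⁻ x, varMaj ρ C₀ r κ κ' (2 ^ l) f E x ^ q ≤ C * two (-(δ * |(l : ℝ)|)) * volume E := by
  obtain ⟨C, hC, h⟩ := exists_lintegral_SSum (κ' := κ') (q := q) hκ (by linarith)
    (hκ.exists_lintegral_rpow_gt hn hq) (hκ'.exists_lintegral_rpow_gt hn hq)
  have hr0 : 0 < r := by linarith
  have h2r : 2 / r < 1 := by rw [div_lt_one hr0]; exact hr
  refine ⟨8 ^ (q / 2) * C, ENNReal.mul_ne_top (ENNReal.rpow_ne_top_of_nonneg (by linarith)
    (by norm_num)) hC, min (q / 2) (1 / 2), by positivity, fun l f E hf => ?_⟩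
  have hl : (0 : ℝ) < 2 ^ l := by positivity
  calc ∫⁻ x, varMaj ρ C₀ r κ κ' (2 ^ l) f E x ^ q
      ≤ ∫⁻ x, ENNReal.ofReal (8 * 2 ^ l) ^ (q / 2) * SSum (κ (2 ^ l)) (κ' (2 ^ l)) f x ^ q := by
        refine lintegral_mono fun x => ?_
        have h1 : varMaj ρ C₀ r κ κ' (2 ^ l) f E x ≤ varBound κ κ' (2 ^ l) f x := by
          refine (mul_le_mul' (ENNReal.rpow_le_rpow (min_le_right _ _) (by linarith)) le_rfl).trans
            (le_of_eq ?_)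
          rw [← ENNReal.rpow_add_of_nonneg _ _ (by linarith) (by positivity), sub_add_cancel,
            ENNReal.rpow_one]
        refine (ENNReal.rpow_le_rpow h1 (by linarith)).trans (le_of_eq ?_)
        rw [varBound, ENNReal.mul_rpow_of_nonneg _ _ (by linarith), ← ENNReal.rpow_mul]
        ring_nf
    _ = ENNReal.ofReal (8 * 2 ^ l) ^ (q / 2) *
        ∫⁻ x, SSum (κ (2 ^ l)) (κ' (2 ^ l)) f x ^ q :=
        lintegral_const_mul' _ _ (ENNReal.rpow_ne_top_of_nonneg (by linarith) ENNReal.ofReal_ne_top)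
    _ ≤ ENNReal.ofReal (8 * 2 ^ l) ^ (q / 2) *
        (C * ENNReal.ofReal ((1 + 2 ^ l) ^ (-(q / 2) - 1 / 2)) * volume E) :=
        mul_le_mul' le_rfl (h _ hl f E hf)
    _ = 8 ^ (q / 2) * C * (ENNReal.ofReal (((2 : ℝ) ^ l) ^ (q / 2)) *
        ENNReal.ofReal ((1 + (2 : ℝ) ^ l) ^ (-(q / 2) - 1 / 2))) * volume E := by
        rw [ENNReal.ofReal_mul (by norm_num), ENNReal.mul_rpow_of_nonneg _ _ (by linarith),
          ENNReal.ofReal_rpow_of_pos hl, ENNReal.ofReal_ofNat]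
        ring
    _ ≤ _ := by
        refine mul_le_mul' (mul_le_mul' le_rfl ?_) le_rfl
        exact zpow_rpow_mul_le (by linarith) (by norm_num) l

lemma lintegral_three_mul_le {α : Type*} [MeasurableSpace α] {μ : Measure α} {f g h : α → ℝ≥0∞}
    (hf : AEMeasurable f μ) (hg : AEMeasurable g μ) (hh : AEMeasurable h μ) {α₁ α₂ α₃ : ℝ}
    (h1 : 0 ≤ α₁) (h2 : 0 ≤ α₂) (h3 : 0 ≤ α₃) (hs : α₁ + α₂ + α₃ = 1) :
    ∫⁻ x, f x ^ α₁ * g x ^ α₂ * h x ^ α₃ ∂μ ≤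
      (∫⁻ x, f x ∂μ) ^ α₁ * (∫⁻ x, g x ∂μ) ^ α₂ * (∫⁻ x, h x ∂μ) ^ α₃ := by
  have := ENNReal.lintegral_prod_norm_pow_le (μ := μ) (Finset.univ : Finset (Fin 3))
    (f := ![f, g, h]) (p := ![α₁, α₂, α₃]) (fun i _ => by fin_cases i <;> assumption)
    (by simp [Fin.sum_univ_three, hs]) (fun i _ => by fin_cases i <;> assumption)
  simpa [Fin.prod_univ_three] using this

lemma exists_lintegral_varMaj_lt (hκ : PieceFam ρ b C₀ κ) (hκ' : PieceFam ρ b C₀ κ')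
    (hn : 2 ≤ n) {r q : ℝ} (hr : 2 < r) (hq : 1 < q) (hq2 : q < 2) (h1 : r < q / (q - 1))
    (h2 : q / (q - 1) < n * r) :
    ∃ C : ℝ≥0∞, C ≠ ⊤ ∧ ∃ δ > 0, ∀ (l : ℤ) (f : Rn n → ℂ) (E : Set (Rn n)), SubInd f E →
      ∫⁻ x, varMaj ρ C₀ r κ κ' (2 ^ l) f E x ^ q ≤ C * two (-(δ * |(l : ℝ)|)) * volume E := by
  obtain ⟨q₀, α₁, α₂, α₃, hq0, hq02, ha1, ha2, ha3, hsum, hex1, hex2, hex3⟩ :=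
    exists_interpolation_exponents hr hq hq2 h1 h2
  have hr0 : 0 < r := by linarith
  have h2r : 2 / r < 1 := by rw [div_lt_one hr0]; exact hr
  set ε : ℝ := min 1 ((n * α₃ - q / r) / 2) with hε
  have hε0 : 0 < ε := lt_min one_pos (by linarith)
  have hε1 : ε ≤ 1 := min_le_left _ _
  have hε2 : ε ≤ (n * α₃ - q / r) / 2 := min_le_right _ _
  obtain ⟨CM, hCM, hM⟩ := lintegral_MM_rpow_le (n := n) hκ.lac hκ.one_le (by omega) hq0
  obtain ⟨CA, hCA, hA⟩ := exists_lintegral_SSum (κ' := κ') (q := q₀) hκ hq0.le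
    (hκ.exists_lintegral_rpow_lt (by omega) hq0 hq02 hε0 hε1)
    (hκ'.exists_lintegral_rpow_lt (by omega) hq0 hq02 hε0 hε1)
  obtain ⟨CB, hCB, hB⟩ := exists_lintegral_SSum (κ' := κ') (q := 2) hκ (by norm_num)
    (hκ.exists_lintegral_sq hε0 hε1) (hκ'.exists_lintegral_sq hε0 hε1)
  have hqr : 0 < q / r := by positivity
  set c : ℝ≥0∞ := ENNReal.ofReal (2 * C₀) ^ ((1 - 2 / r) * q) with hc
  have hcT : c ≠ ⊤ := ENNReal.rpow_ne_top_of_nonneg (mul_nonneg (by linarith) (by linarith))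
    ENNReal.ofReal_ne_top
  have hn0 : (0 : ℝ) ≤ n := Nat.cast_nonneg n
  refine ⟨c * 8 ^ (q / r) * (CM ^ α₁ * CA ^ α₂ * CB ^ α₃), ?_, min (q / r) ((n * α₃ - q / r) / 2),
    lt_min hqr (by linarith), fun l f E hf => ?_⟩
  · exact ENNReal.mul_ne_top (ENNReal.mul_ne_top hcT (ENNReal.rpow_ne_top_of_nonneg hqr.le
      (by norm_num))) (ENNReal.mul_ne_top (ENNReal.mul_ne_top (ENNReal.rpow_ne_top_of_nonneg ha1 hCM)
      (ENNReal.rpow_ne_top_of_nonneg ha2 hCA)) (ENNReal.rpow_ne_top_of_nonneg ha3 hCB))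
  have hl : (0 : ℝ) < 2 ^ l := by positivity
  have hX : (1 : ℝ) ≤ 1 + 2 ^ l := by linarith
  have hX0 : (0 : ℝ) < 1 + 2 ^ l := by linarith
  set S := SSum (κ (2 ^ l)) (κ' (2 ^ l)) f with hS
  have hSm : Measurable S := measurable_SSum hκ hκ' hl hf.integrable
  have hMm := measurable_MM (ρ := ρ) (C₀ := C₀) hf.measSet
  have hpt : ∀ x, varMaj ρ C₀ r κ κ' (2 ^ l) f E x ^ q ≤
      c * ENNReal.ofReal (8 * 2 ^ l) ^ (q / r) *
        ((MM ρ C₀ E x ^ q₀) ^ α₁ * (S x ^ q₀) ^ α₂ * (S x ^ (2 : ℝ)) ^ α₃) := by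
    intro x
    rw [varMaj, ENNReal.mul_rpow_of_nonneg _ _ (by linarith), ← ENNReal.rpow_mul,
      ← ENNReal.rpow_mul, varBound, ENNReal.mul_rpow_of_nonneg _ _ (by positivity)]
    calc _ ≤ (ENNReal.ofReal (2 * C₀) * MM ρ C₀ E x) ^ ((1 - 2 / r) * q) *
          ((ENNReal.ofReal (8 * 2 ^ l) ^ (1 / (2 : ℝ))) ^ (2 / r * q) * S x ^ (2 / r * q)) :=
          mul_le_mul' (ENNReal.rpow_le_rpow (min_le_left _ _)
            (mul_nonneg (by linarith) (by linarith))) le_rfl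
      _ = _ := by
          rw [ENNReal.mul_rpow_of_nonneg _ _ (mul_nonneg (by linarith) (by linarith)),
            ← ENNReal.rpow_mul, ← ENNReal.rpow_mul, ← ENNReal.rpow_mul, ← ENNReal.rpow_mul, hex1,
            ← hex2, ENNReal.rpow_add_of_nonneg _ _ (by positivity) (by positivity), hex2,
            show 1 / 2 * (2 / r * q) = q / r by ring, ← hc]
          ring
  have hV : volume E ^ α₁ * volume E ^ α₂ * volume E ^ α₃ = volume E := by
    rw [← ENNReal.rpow_add_of_nonneg _ _ ha1 ha2, ← ENNReal.rpow_add_of_nonneg _ _ (by linarith) ha3,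
      hsum, ENNReal.rpow_one]
  calc ∫⁻ x, varMaj ρ C₀ r κ κ' (2 ^ l) f E x ^ q
      ≤ ∫⁻ x, c * ENNReal.ofReal (8 * 2 ^ l) ^ (q / r) *
        ((MM ρ C₀ E x ^ q₀) ^ α₁ * (S x ^ q₀) ^ α₂ * (S x ^ (2 : ℝ)) ^ α₃) := lintegral_mono hpt
    _ = c * ENNReal.ofReal (8 * 2 ^ l) ^ (q / r) *
        ∫⁻ x, ((MM ρ C₀ E x ^ q₀) ^ α₁ * (S x ^ q₀) ^ α₂ * (S x ^ (2 : ℝ)) ^ α₃) :=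
        lintegral_const_mul' _ _ (ENNReal.mul_ne_top hcT (ENNReal.rpow_ne_top_of_nonneg hqr.le
          ENNReal.ofReal_ne_top))
    _ ≤ c * ENNReal.ofReal (8 * 2 ^ l) ^ (q / r) *
        ((CM * volume E) ^ α₁ * (CA * ENNReal.ofReal ((1 + 2 ^ l) ^ ε) * volume E) ^ α₂ *
          (CB * ENNReal.ofReal ((1 + 2 ^ l) ^ (-(n : ℝ) + ε)) * volume E) ^ α₃) := by
        refine mul_le_mul' le_rfl ((lintegral_three_mul_le (hMm.pow_const _).aemeasurable
          (hSm.pow_const _).aemeasurable (hSm.pow_const _).aemeasurable ha1 ha2 ha3 hsum).trans ?_)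
        refine mul_le_mul' (mul_le_mul' (ENNReal.rpow_le_rpow (hM E hf.measSet hf.ne_top) ha1)
          (ENNReal.rpow_le_rpow (hA _ hl f E hf) ha2)) (ENNReal.rpow_le_rpow (hB _ hl f E hf) ha3)
    _ = c * 8 ^ (q / r) * (CM ^ α₁ * CA ^ α₂ * CB ^ α₃) * (ENNReal.ofReal (((2 : ℝ) ^ l) ^ (q / r)) *
        ENNReal.ofReal ((1 + (2 : ℝ) ^ l) ^ (ε * α₂ + (-(n : ℝ) + ε) * α₃))) *
        (volume E ^ α₁ * volume E ^ α₂ * volume E ^ α₃) := by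
        rw [ENNReal.ofReal_mul (by norm_num), ENNReal.mul_rpow_of_nonneg _ _ hqr.le,
          ENNReal.ofReal_rpow_of_pos hl, ENNReal.ofReal_ofNat, ENNReal.mul_rpow_of_nonneg _ _ ha1,
          ENNReal.mul_rpow_of_nonneg _ _ ha2, ENNReal.mul_rpow_of_nonneg _ _ ha2,
          ENNReal.mul_rpow_of_nonneg _ _ ha3, ENNReal.mul_rpow_of_nonneg _ _ ha3,
          ofReal_rpow_rpow hX0, ofReal_rpow_rpow hX0, ← ofReal_rpow_mul_ofReal_rpow hX0]
        ring
    _ ≤ _ := by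
        rw [hV]
        refine mul_le_mul' (mul_le_mul' le_rfl ?_) le_rfl
        refine le_trans (mul_le_mul' le_rfl (ofReal_rpow_mono hX ?_))
          (zpow_rpow_mul_le hqr (by linarith) l)
        nlinarith
end Majorant

section Cutoff

/-- A smooth cutoff function supported in `[1/2, 2]` generating a dyadic partition of unity. -/
def bump (y : ℝ) : ℝ := Real.smoothTransition (2 - y) - Real.smoothTransition (2 - 2 * y)

lemma contDiff_bump : ContDiff ℝ (⊤ : ℕ∞) bump :=
  (Real.smoothTransition.contDiff.comp (contDiff_const.sub contDiff_id)).sub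
    (Real.smoothTransition.contDiff.comp (contDiff_const.sub (contDiff_const.mul contDiff_id)))

lemma bump_eq_zero (y : ℝ) (hy : y ∉ Icc (1 / 2 : ℝ) 2) : bump y = 0 := by
  rw [mem_Icc, not_and_or, not_le, not_le] at hy
  rcases hy with h | h
  · rw [bump, Real.smoothTransition.one_of_one_le (by linarith),
      Real.smoothTransition.one_of_one_le (by linarith), sub_self]
  · rw [bump, Real.smoothTransition.zero_of_nonpos (by linarith),
      Real.smoothTransition.zero_of_nonpos (by linarith), sub_self]

lemma hasSum_bump {y : ℝ} (hy : 0 < y) : HasSum (fun k : ℤ => bump (y / 2 ^ k)) 1 := by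
  obtain ⟨m, hm1, hm2⟩ := exists_mem_Ico_zpow hy one_lt_two
  have hm : (0 : ℝ) < 2 ^ m := by positivity
  have hz1 : 1 ≤ y / 2 ^ m := (one_le_div hm).2 hm1
  have hz2 : y / 2 ^ m < 2 := by
    rw [div_lt_iff₀ hm, mul_comm, ← zpow_add_one₀ two_ne_zero]
    exact hm2
  have e : ∀ j : ℤ, y / 2 ^ j = y / 2 ^ m * 2 ^ (m - j) := by
    intro j
    rw [zpow_sub₀ two_ne_zero]
    field_simp
  have h0 : ∀ j ∉ ({m, m + 1} : Finset ℤ), bump (y / 2 ^ j) = 0 := by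
    intro j hj
    simp only [Finset.mem_insert, Finset.mem_singleton, not_or] at hj
    rw [e]
    rcases lt_or_gt_of_ne hj.1 with h | h
    · have h1 : (2 : ℝ) ^ (1 : ℤ) ≤ 2 ^ (m - j) := zpow_le_zpow_right₀ one_le_two (by omega)
      rw [zpow_one] at h1
      have h2 : 2 ≤ y / 2 ^ m * 2 ^ (m - j) := by nlinarith
      rw [bump, Real.smoothTransition.zero_of_nonpos (by linarith),
        Real.smoothTransition.zero_of_nonpos (by linarith), sub_self]
    · have h1 : (2 : ℝ) ^ (m - j) ≤ 2 ^ (-2 : ℤ) := zpow_le_zpow_right₀ one_le_two (by omega)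
      have h2 : (2 : ℝ) ^ (-2 : ℤ) = 1 / 4 := by norm_num
      rw [h2] at h1
      have h3 : (0 : ℝ) < 2 ^ (m - j) := by positivity
      exact bump_eq_zero _ fun h => by nlinarith [h.1]
  have h : HasSum (fun k : ℤ => bump (y / 2 ^ k)) (∑ k ∈ {m, m + 1}, bump (y / 2 ^ k)) :=
    hasSum_sum_of_ne_finset_zero h0
  convert h using 1
  rw [Finset.sum_pair (by omega), e (m + 1), show m - (m + 1) = -1 by omega, zpow_neg_one, bump,
    bump, Real.smoothTransition.zero_of_nonpos (show 2 - 2 * (y / 2 ^ m) ≤ 0 by linarith),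
    Real.smoothTransition.one_of_one_le (show 1 ≤ 2 - y / 2 ^ m * 2⁻¹ by linarith)]
  ring_nf

end Cutoff

section Variation

variable {n : ℕ} {c : ℕ → ℝ} {c₁ b : ℝ} {η : ℝ → ℝ} {ρ : ℤ → ℝ} {G : ℤ → ℕ → ℝ → ℝ} {lam : ℝ}

lemma exists_pieceFam (hn : 2 ≤ n) {K : Rn n → ℝ} (hK : IsHomCZKernel n K) (hρ : IsLac ρ b)
    (hG : ∀ k, UnitPhase c c₁ (G k)) (hc₁ : 0 < c₁) (hη : ContDiff ℝ (⊤ : ℕ∞) η)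
    (hη0 : ∀ y ∉ Icc (1 / 2 : ℝ) 2, η y = 0) {a : SchwartzMap (Rn n) ℂ}
    (ha : ∀ t ∈ shell n (shellRad c₁)⁻¹ (shellRad c₁), a t = K t) :
    ∃ C₀ : ℝ, ∀ C, C₀ ≤ C → PieceFam ρ b C (scaledKer ρ η G a) := by
  obtain ⟨C₀, hC₀, hker⟩ := exists_kerFam c hc₁ hη hη0 a
  obtain ⟨C₁, hC₁, hdec⟩ := exists_ptDecay c hc₁ hη hη0 hn a
  refine ⟨C₀, fun C hC => ⟨hρ, hC₀.trans hC, fun lam hlam => hker C hC ρ G lam hρ.pos hG hlam,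
    ⟨C₁, hC₁, fun lam hlam => hdec ρ G lam hρ.pos hG hlam⟩, fun ε hε hε1 => ?_⟩⟩
  obtain ⟨C₂, hC₂, hF⟩ := exists_lintegral_fourier_scaledKer_le c hc₁ hη hη0 hn a (half_pos hε)
    (by linarith)
  have hn' : (2 : ℝ) ≤ n := by exact_mod_cast hn
  obtain ⟨B, hB, h⟩ := l2Bdd_of_fourier (n := n) (s := n - ε / 2) (ε := ε / 2) hρ
    (by linarith : 0 < C) (by omega) (by linarith) (half_pos hε) (by linarith) hC₂
  refine ⟨B, hB, fun lam hlam => ?_⟩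
  have := h (1 + lam) (scaledKer ρ η G a lam) (by linarith) (hker C hC ρ G lam hρ.pos hG hlam)
    (fun k v => contDiff_scaledKer hG hc₁ hη hη0 a k v)
    (fun k v => integral_scaledKer_eq_zero (by omega) hK hρ.pos hG hc₁ hη0 ha k v)
    (hF ρ G lam hρ.pos hG hlam)
  rwa [show -((n : ℝ) - ε / 2) + ε / 2 = -(n : ℝ) + ε by ring] at this

lemma hasDerivAt_scaledKer (a : Rn n → ℂ) (k : ℤ) (v : ℝ) (t : Rn n) :
    HasDerivAt (fun v => scaledKer ρ η G a lam k v t)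
      (Complex.I * lam * scaledKer ρ (fun y => y * η y) G a lam k v t) v := by
  unfold scaledKer unitKer oscFactor
  set y := G k 0 √(‖(ρ k)⁻¹ • t‖ ^ 2)
  have h1 : HasDerivAt (fun v : ℝ => Complex.I * ((lam * v * y : ℝ) : ℂ))
      (Complex.I * ((lam * y : ℝ) : ℂ)) v := by
    refine HasDerivAt.const_mul _ (HasDerivAt.ofReal_comp ?_)
    exact (((hasDerivAt_id v).const_mul lam).mul_const y).congr_deriv (by ring)
  refine (((h1.cexp.mul_const ((η y : ℝ) : ℂ)).mul_const _).const_mul _).congr_deriv ?_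
  push_cast
  ring

lemma hasDerivAt_T {C X : ℝ} {a : Rn n → ℂ} (hκ : KerFam ρ C X (scaledKer ρ η G a lam))
    (hκ' : KerFam ρ C X (scaledKer ρ (fun y => y * η y) G a lam)) {f : Rn n → ℂ}
    (hf : Integrable f) (k : ℤ) (x : Rn n) (v : ℝ) :
    HasDerivAt (T (scaledKer ρ η G a lam) k f x)
      (Complex.I * lam * T (scaledKer ρ (fun y => y * η y) G a lam) k f x v) v := by
  have h := hasDerivAt_integral_of_dominated_loc_of_deriv_le (μ := volume) (𝕜 := ℝ) (s := univ)
    (bound := fun s => |lam| * (C / ρ k ^ n) * ‖f s‖)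
    (F := fun v s => f s * scaledKer ρ η G a lam k v (x - s))
    (F' := fun v s => Complex.I * lam *
      (f s * scaledKer ρ (fun y => y * η y) G a lam k v (x - s))) (x₀ := v)
    univ_mem (Eventually.of_forall fun w => (hκ.integrable hf k x w).aestronglyMeasurable)
    (hκ.integrable hf k x v) ((hκ'.integrable hf k x v).const_mul _).aestronglyMeasurable
    (Eventually.of_forall fun s w _ => ?_) (hf.norm.const_mul _)
    (Eventually.of_forall fun s w _ => ?_)
  · refine h.2.congr_deriv ?_
    rw [integral_const_mul]
    rfl
  · rw [norm_mul, norm_mul, norm_mul, Complex.norm_I, one_mul, Complex.norm_real, Real.norm_eq_abs,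
      mul_assoc, mul_comm (C / ρ k ^ n)]
    gcongr
    exact hκ'.size k w _
  · exact ((hasDerivAt_scaledKer a k w (x - s)).const_mul (f s)).congr_deriv (by ring)

lemma tsum_variation_T_rpow_le {r C : ℝ} (hr : 2 < r) {κ κ' : ℝ → ℤ → ℝ → Rn n → ℂ} (hC : 0 ≤ C)
    (h1 : KerFam ρ C (1 + lam) (κ lam)) (h2 : KerFam ρ C (1 + lam) (κ' lam)) (hlam : 0 < lam)
    {f : Rn n → ℂ} {E : Set (Rn n)} (hf : SubInd f E) (x : Rn n)
    (hd : ∀ k v, HasDerivAt (T (κ lam) k f x) (Complex.I * lam * T (κ' lam) k f x v) v) :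
    (∑' k, variation r (Icc 1 2) (T (κ lam) k f x) ^ r) ^ (1 / r) ≤
      varMaj ρ C r κ κ' lam f E x := by
  refine tsum_variation_rpow_le hr (fun k u _ v _ => ?_) ?_
  · have hT : ∀ w, ‖T (κ lam) k f x w‖ₑ ≤ ENNReal.ofReal C * MM ρ C E x := by
      intro w
      refine (h1.enorm_T_le hf.norm_le k x w).trans ?_
      rw [div_eq_mul_one_div, ENNReal.ofReal_mul hC, mul_assoc]
      refine mul_le_mul' le_rfl (le_trans ?_ (le_iSup _ k))
      exact mul_le_mul' le_rfl (measure_mono (inter_subset_inter_right _ hf.support_subset))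
    refine enorm_sub_le.trans ((add_le_add (hT u) (hT v)).trans (le_of_eq ?_))
    rw [ENNReal.ofReal_mul zero_le_two, ENNReal.ofReal_ofNat]
    ring
  · calc ∑' k, variation 2 (Icc 1 2) (T (κ lam) k f x) ^ (2 : ℝ)
        ≤ ∑' k, ENNReal.ofReal (8 * lam) *
          ((∫⁻ v in Icc (1 : ℝ) 2, ‖T (κ lam) k f x v‖ₑ ^ (2 : ℝ)) +
          ∫⁻ v in Icc (1 : ℝ) 2,
            ‖T (κ' lam) k f x v‖ₑ ^ (2 : ℝ)) := by
          refine ENNReal.tsum_le_tsum fun k => ?_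
          have hc : Continuous fun v => T (κ' lam) k f x v :=
            (h2.continuous_T hf.integrable k).comp
              (by fun_prop : Continuous fun v : ℝ => ((x, v) : Rn n × ℝ))
          simpa only [ENNReal.rpow_two] using variation_two_sq_le hlam (hd k) hc
      _ = ENNReal.ofReal (8 * lam) * (SS (κ lam) f x ^ (2 : ℝ) +
          SS (κ' lam) f x ^ (2 : ℝ)) := by
          rw [ENNReal.tsum_mul_left, ENNReal.tsum_add, h1.SS_sq hf.integrable x,
            h2.SS_sq hf.integrable x]
      _ ≤ _ := by
          rw [varBound, ENNReal.mul_rpow_of_nonneg _ _ zero_le_two, ← ENNReal.rpow_mul,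
            one_div_mul_cancel two_ne_zero, ENNReal.rpow_one]
          exact mul_le_mul' le_rfl (ENNReal.add_rpow_le_rpow_add _ _ one_le_two)

end Variation

section LpBound

variable {n : ℕ} {ρ : ℤ → ℝ} {b C₀ : ℝ} {κ κ' : ℝ → ℤ → ℝ → Rn n → ℂ} {f : Rn n → ℂ}

/-- The set on which `f` has size about `2 ^ i`. -/
def slice (f : Rn n → ℂ) (i : ℤ) : Set (Rn n) := {s | two (i - 1) < ‖f s‖ₑ ∧ ‖f s‖ₑ ≤ two i}

/-- The normalized restriction of `f` to `slice f i`. -/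
def sliceFun (f : Rn n → ℂ) (i : ℤ) : Rn n → ℂ :=
  (slice f i).indicator fun s => (((2 : ℝ) ^ i : ℝ) : ℂ)⁻¹ * f s

lemma enorm_two_zpow (i : ℤ) : ‖(((2 : ℝ) ^ i : ℝ) : ℂ)‖ₑ = two i := by
  rw [← ofReal_norm, Complex.norm_real, Real.norm_of_nonneg (by positivity), two_eq_ofReal,
    Real.rpow_intCast]

lemma measurableSet_slice (hf : Measurable f) (i : ℤ) : MeasurableSet (slice f i) :=
  (measurableSet_lt measurable_const hf.enorm).inter (measurableSet_le hf.enorm measurable_const)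

lemma pairwise_disjoint_slice (f : Rn n → ℂ) : Pairwise (Function.onFun Disjoint (slice f)) := by
  refine pairwise_disjoint_on _ |>.2 fun i j hij => disjoint_left.2 fun s hi hj => ?_
  have h : (i : ℝ) + 1 ≤ j := by exact_mod_cast hij
  exact absurd (hj.1.trans_le hi.2) (not_lt.2 (two_mono (by linarith)))

lemma mem_iUnion_slice {s : Rn n} (hs : f s ≠ 0) : s ∈ ⋃ i, slice f i := by
  obtain ⟨a, ha, ha'⟩ := ENNReal.exists_mem_Ioc_zpow (x := ‖f s‖ₑ) (enorm_ne_zero.2 hs)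
    enorm_ne_top (y := 2) (by norm_num) (by norm_num)
  rw [← ENNReal.rpow_intCast] at ha ha'
  refine mem_iUnion.2 ⟨a + 1, ?_, ha'⟩
  push_cast
  rwa [add_sub_cancel_right]

lemma two_mul_volume_slice_le (hf : Measurable f) {p : ℝ} (hp : 0 < p) (i : ℤ) :
    two (i * p) * volume (slice f i) ≤ two p * ∫⁻ s in slice f i, ‖f s‖ₑ ^ p := by
  rw [← lintegral_const_mul _ (hf.enorm.pow_const p), ← setLIntegral_const]
  refine setLIntegral_mono ((hf.enorm.pow_const p).const_mul _) fun s hs => ?_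
  calc two (i * p) = two p * two (i - 1) ^ p := by rw [two_rpow, ← two_add]; ring_nf
    _ ≤ _ := mul_le_mul' le_rfl (ENNReal.rpow_le_rpow hs.1.le hp.le)

lemma subInd_sliceFun (hf : Measurable f) (hfi : Integrable f) (i : ℤ) :
    SubInd (sliceFun f i) (slice f i) := by
  refine ⟨(hf.const_mul _).indicator (measurableSet_slice hf i), measurableSet_slice hf i, ?_,
    fun s => ?_⟩
  · have h := two_mul_volume_slice_le hf one_pos i
    have h1 : two (1 : ℝ) * ∫⁻ s in slice f i, ‖f s‖ₑ ^ (1 : ℝ) ≠ ⊤ := by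
      refine ENNReal.mul_ne_top (two_ne_top _) ?_
      simp only [ENNReal.rpow_one]
      exact ((setLIntegral_le_lintegral _ _).trans_lt hfi.hasFiniteIntegral).ne
    intro ht
    rw [ht, ENNReal.mul_top (two_pos _).ne'] at h
    exact h1 (top_le_iff.1 h)
  · by_cases hs : s ∈ slice f i
    · rw [sliceFun, indicator_of_mem hs, indicator_of_mem hs, enorm_mul,
        enorm_inv (enorm_ne_zero.1 (enorm_two_zpow i ▸ (two_pos _).ne')), enorm_two_zpow]
      exact (mul_le_mul' le_rfl hs.2).trans
        (ENNReal.inv_mul_cancel (two_pos _).ne' (two_ne_top _)).le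
    · simp [sliceFun, hs]

lemma tsum_volume_slice_le (hf : Measurable f) {p : ℝ} (hp : 0 < p) :
    ∑' i : ℤ, two (i * p) * volume (slice f i) ≤ two p * ∫⁻ s, ‖f s‖ₑ ^ p := by
  refine (ENNReal.tsum_le_tsum fun i => two_mul_volume_slice_le hf hp i).trans ?_
  rw [ENNReal.tsum_mul_left, ← lintegral_iUnion (measurableSet_slice hf) (pairwise_disjoint_slice f)]
  exact mul_le_mul' le_rfl (setLIntegral_le_lintegral _ _)

lemma hasSum_T_sliceFun {X : ℝ} {κ : ℤ → ℝ → Rn n → ℂ} (hκ : KerFam ρ C₀ X κ) (hf : Measurable f)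
    (hfi : Integrable f) (k : ℤ) (x : Rn n) (v : ℝ) :
    HasSum (fun i : ℤ => (((2 : ℝ) ^ i : ℝ) : ℂ) * T κ k (sliceFun f i) x v) (T κ k f x v) := by
  have h : HasSum (fun i => ∫ s in slice f i, f s * κ k v (x - s))
      (∫ s in ⋃ i, slice f i, f s * κ k v (x - s)) :=
    hasSum_integral_iUnion (measurableSet_slice hf) (pairwise_disjoint_slice f)
      (hκ.integrable hfi k x v).integrableOn
  rw [setIntegral_eq_integral_of_forall_compl_eq_zero] at h
  · refine h.congr_fun fun i => ?_
    unfold T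
    rw [← integral_const_mul, ← integral_indicator (measurableSet_slice hf i)]
    refine integral_congr_ae (Eventually.of_forall fun s => ?_)
    have h2 : (((2 : ℝ) ^ i : ℝ) : ℂ) ≠ 0 := by
      exact_mod_cast (zpow_pos (zero_lt_two' ℝ) i).ne'
    by_cases hs : s ∈ slice f i
    · simp only [sliceFun, indicator_of_mem hs]
      field_simp
    · simp [sliceFun, hs]
  · intro s hs
    by_contra h0
    exact hs (mem_iUnion_slice (left_ne_zero_of_mul h0))

lemma exists_strong_exponent {n : ℕ} (hn : 2 ≤ n) {p r : ℝ} (hp : 1 < p) (hr : 2 < r)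
    (hrp : p / (p - 1) / n < r) :
    ∃ q, 1 < q ∧ q < 2 ∧ q < p ∧ r < q / (q - 1) ∧ q / (q - 1) < n * r := by
  have hn' : (2 : ℝ) ≤ n := by exact_mod_cast hn
  rw [div_lt_iff₀ (by linarith), mul_comm] at hrp
  obtain ⟨s, hs, hs2⟩ := exists_between (max_lt hrp (by nlinarith : r < n * r))
  have h1 := (le_max_left _ _).trans_lt hs
  have h2 := (le_max_right _ _).trans_lt hs
  have hs1 : 0 < s - 1 := by linarith
  have hq : s / (s - 1) - 1 = 1 / (s - 1) := by field_simp; ring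
  have hqq : s / (s - 1) / (s / (s - 1) - 1) = s := by rw [hq]; field_simp
  rw [div_lt_iff₀ (by linarith)] at h1
  refine ⟨s / (s - 1), ?_, ?_, ?_, by rwa [hqq], by rwa [hqq]⟩
  · rw [lt_div_iff₀ hs1]; linarith
  · rw [div_lt_iff₀ hs1]; linarith
  · rw [div_lt_iff₀ hs1]; linarith

lemma exists_lintegral_variation_T_le (hκ : PieceFam ρ b C₀ κ) (hκ' : PieceFam ρ b C₀ κ')
    (hn : 2 ≤ n) {p r : ℝ} (hp : 1 < p) (hr : 2 < r) (hrp : p / (p - 1) / n < r)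
    (hd : ∀ lam, 0 < lam → ∀ f : Rn n → ℂ, Integrable f → ∀ k x v,
      HasDerivAt (T (κ lam) k f x) (Complex.I * lam * T (κ' lam) k f x v) v) :
    ∃ C : ℝ≥0∞, C ≠ ⊤ ∧ ∃ δ > 0, ∀ (l : ℤ) (f : Rn n → ℂ), Measurable f → Integrable f →
      ∃ M : Rn n → ℝ≥0∞, Measurable M ∧
        (∀ x, (∑' k, variation r (Icc 1 2) (T (κ (2 ^ l)) k f x) ^ r) ^ (1 / r) ≤ M x) ∧
        ∫⁻ x, M x ^ p ≤ C * two (-(δ * |(l : ℝ)|)) * ∫⁻ s, ‖f s‖ₑ ^ p := by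
  obtain ⟨q, hq1, hq2, hqp, hrq, hqn⟩ := exists_strong_exponent hn hp hr hrp
  obtain ⟨C₁, hC₁, δ₁, hδ₁, h1⟩ := exists_lintegral_varMaj_lt hκ hκ' hn hr hq1 hq2 hrq hqn
  obtain ⟨C₂, hC₂, δ₂, hδ₂, h2⟩ := exists_lintegral_varMaj_gt hκ hκ' hn hr
    (by linarith : 2 < p + 2)
  obtain ⟨C, hC, hM⟩ := marcinkiewicz (by linarith : 0 < q) hqp (by linarith : p < p + 2)
  have hp0 : 0 < p := by linarith
  refine ⟨C * (C₁ + C₂) * two p, ENNReal.mul_ne_top (ENNReal.mul_ne_top hC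
    (ENNReal.add_ne_top.2 ⟨hC₁, hC₂⟩)) (two_ne_top _), min δ₁ δ₂, lt_min hδ₁ hδ₂,
    fun l f hf hfi => ?_⟩
  have hlam : (0 : ℝ) < 2 ^ l := by positivity
  have hS := subInd_sliceFun hf hfi
  have hm i := measurable_varMaj hκ hκ' hlam (hS i) r
  refine ⟨fun x => ∑' i : ℤ, two i * varMaj ρ C₀ r κ κ' (2 ^ l) (sliceFun f i) (slice f i) x,
    Measurable.tsum fun i => (hm i).const_mul _, fun x => ?_, ?_⟩
  · have h3 (k : ℤ) : variation r (Icc 1 2) (T (κ (2 ^ l)) k f x) ≤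
        ∑' i : ℤ, two i * variation r (Icc 1 2) (T (κ (2 ^ l)) k (sliceFun f i) x) := by
      refine (variation_le_tsum (by linarith) fun v _ =>
        hasSum_T_sliceFun (hκ.ker _ hlam) hf hfi k x v).trans (ENNReal.tsum_le_tsum fun i => ?_)
      exact (variation_const_mul (by linarith) _ _).trans (by rw [enorm_two_zpow])
    refine (ENNReal.rpow_le_rpow (ENNReal.tsum_le_tsum fun k => ENNReal.rpow_le_rpow (h3 k)
      (by linarith)) (by positivity)).trans ((tsum_tsum_rpow_le (by linarith) _).trans
      (ENNReal.tsum_le_tsum fun i => ?_))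
    simp_rw [ENNReal.mul_rpow_of_nonneg _ _ (by linarith : 0 ≤ r)]
    rw [ENNReal.tsum_mul_left, ENNReal.mul_rpow_of_nonneg _ _ (by positivity), ← ENNReal.rpow_mul,
      mul_one_div_cancel (by linarith), ENNReal.rpow_one]
    exact mul_le_mul' le_rfl (tsum_variation_T_rpow_le hr (by linarith [hκ.one_le]) (hκ.ker _ hlam)
      (hκ'.ker _ hlam) hlam (hS i) x fun k v => hd _ hlam _ (hS i).integrable k x v)
  · have e1 {C' : ℝ≥0∞} {δ : ℝ} (hC' : C' ≤ C₁ + C₂) (hδ : min δ₁ δ₂ ≤ δ) :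
        C' * two (-(δ * |(l : ℝ)|)) ≤ (C₁ + C₂) * two (-(min δ₁ δ₂ * |(l : ℝ)|)) :=
      mul_le_mul' hC' (two_mono (by nlinarith [abs_nonneg (l : ℝ)]))
    refine (hM volume _ (fun i => volume (slice f i))
      ((C₁ + C₂) * two (-(min δ₁ δ₂ * |(l : ℝ)|))) hm
      (fun i => (h1 l _ _ (hS i)).trans (mul_le_mul' (e1 le_self_add (min_le_left _ _)) le_rfl))
      (fun i => (h2 l _ _ (hS i)).trans
        (mul_le_mul' (e1 le_add_self (min_le_right _ _)) le_rfl))).trans ?_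
    refine (mul_le_mul' le_rfl (tsum_volume_slice_le hf hp0)).trans (le_of_eq ?_)
    ring

end LpBound

section PrincipalValue

variable {n : ℕ} {K : Rn n → ℝ} {Γ : ℝ → ℝ}

lemma ae_ne_zero (hn : n ≠ 0) : ∀ᵐ t : Rn n, t ≠ 0 := by
  have : Nonempty (Fin n) := ⟨⟨0, Nat.pos_of_ne_zero hn⟩⟩
  exact Measure.ae_ne volume 0

lemma _root_.IsHomCZKernel.exists_abs_le (hK : IsHomCZKernel n K) :
    ∃ B : ℝ, 0 ≤ B ∧ ∀ t, t ≠ 0 → |K t| ≤ B / ‖t‖ ^ n := by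
  obtain ⟨Ω, hΩ, hΩh, -, hKΩ⟩ := hK
  have hc : ContinuousOn Ω (Metric.sphere 0 1) :=
    hΩ.continuousOn.mono fun t ht => show t ≠ 0 from ne_zero_of_mem_unit_sphere ⟨t, ht⟩
  obtain ⟨B, hB⟩ := (isCompact_sphere (0 : Rn n) 1).exists_bound_of_continuousOn hc
  refine ⟨|B|, abs_nonneg B, fun t ht => ?_⟩
  have h0 : 0 < ‖t‖ := norm_pos_iff.2 ht
  rw [hKΩ t ht, abs_div, abs_of_pos (pow_pos h0 n), ← hΩh ‖t‖⁻¹ (inv_pos.2 h0)]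
  refine div_le_div_of_nonneg_right ((hB _ ?_).trans (le_abs_self B)) (by positivity)
  simp [norm_smul, h0.ne']

lemma _root_.IsHomCZKernel.aestronglyMeasurable (hn : n ≠ 0) (hK : IsHomCZKernel n K) :
    AEStronglyMeasurable K := by
  obtain ⟨Ω, hΩ, -, -, hKΩ⟩ := hK
  have hm : MeasurableSet {t : Rn n | t ≠ 0} := (measurableSet_singleton 0).compl
  have h : AEStronglyMeasurable (fun t => Ω t / ‖t‖ ^ n)
      (volume.restrict {t : Rn n | t ≠ 0}) :=
    (hΩ.continuousOn.div (by fun_prop) fun t ht =>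
      pow_ne_zero _ (norm_ne_zero_iff.2 ht)).aestronglyMeasurable hm
  rw [Measure.restrict_eq_self_of_ae_mem (s := {t : Rn n | t ≠ 0}) (ae_ne_zero hn)] at h
  exact h.congr ((ae_ne_zero hn).mono fun t ht => (hKΩ t ht).symm)

lemma _root_.IsHomCZKernel.integral_radial_mul_eq_zero (hn : n ≠ 0) (hK : IsHomCZKernel n K)
    (h : ℝ → ℂ) : ∫ t : Rn n, h ‖t‖ * (K t : ℂ) = 0 := by
  obtain ⟨Ω, -, hΩh, hΩ0, hKΩ⟩ := hK
  rw [← ShortVar.integral_radial_mul_eq_zero hn hΩh hΩ0 fun s => h s * ((s ^ n : ℝ) : ℂ)⁻¹]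
  refine integral_congr_ae ((ae_ne_zero hn).mono fun t ht => ?_)
  simp only [hKΩ t ht]
  push_cast
  ring

/-- The oscillating factor of the modulated singular integral. -/
def phase (Γ : ℝ → ℝ) (u s : ℝ) : ℂ := Complex.exp (Complex.I * ((u * Γ s : ℝ) : ℂ))

lemma norm_phase (u s : ℝ) : ‖phase Γ u s‖ = 1 := Complex.norm_exp_I_mul_ofReal _

lemma continuous_phase (hΓ : IsGammaU Γ) (u : ℝ) : Continuous fun t : Rn n => phase Γ u ‖t‖ := by
  have h : Continuous fun t : Rn n => Γ ‖t‖ :=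
    hΓ.continuousOn.comp_continuous continuous_norm fun t => norm_nonneg t
  exact Complex.continuous_exp.comp (continuous_const.mul
    (Complex.continuous_ofReal.comp (continuous_const.mul h)))

/-- The integrand of the modulated singular integral, regularized at the origin. -/
def regIntegrand (Γ : ℝ → ℝ) (K : Rn n → ℝ) (u : ℝ) (f : Rn n → ℂ) (x t : Rn n) : ℂ :=
  (f (x - t) - (Metric.closedBall 0 1).indicator (fun _ => f x) t) * phase Γ u ‖t‖ * (K t : ℂ)

lemma integrable_norm_pow (hn : 2 ≤ n) :
    Integrable fun t : Rn n => (Iic (1 : ℝ)).indicator (fun s => (s ^ (n - 1))⁻¹) ‖t‖ := by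
  have : Nontrivial (Rn n) := by
    have : Nonempty (Fin n) := ⟨⟨0, by omega⟩⟩
    infer_instance
  rw [integrable_fun_norm_addHaar, finrank_euclideanSpace_fin]
  have h : IntegrableOn ((Iic (1 : ℝ)).indicator fun _ => (1 : ℝ)) (Ioi 0) := by
    rw [IntegrableOn, integrable_indicator_iff measurableSet_Iic, IntegrableOn,
      Measure.restrict_restrict measurableSet_Iic, inter_comm, Ioi_inter_Iic]
    exact integrableOn_const (by simp)
  refine h.congr_fun (fun s (hs : 0 < s) => ?_) measurableSet_Ioi
  by_cases h1 : s ∈ Iic (1 : ℝ)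
  · simp only [indicator_of_mem h1, smul_eq_mul]
    rw [mul_inv_cancel₀ (pow_pos hs _).ne']
  · simp [h1]

lemma exists_norm_sub_le (f : SchwartzMap (Rn n) ℂ) : ∃ L : ℝ, 0 ≤ L ∧
    ∀ x t, ‖f (x - t) - f x‖ ≤ L * ‖t‖ := by
  obtain ⟨L, hL⟩ := (SchwartzMap.fderivCLM ℝ (Rn n) ℂ f).decay 0 0
  refine ⟨L, hL.1.le, fun x t => ?_⟩
  have h := convex_univ.norm_image_sub_le_of_norm_fderiv_le (𝕜 := ℝ) (f := f) (C := L)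
    (fun y _ => f.differentiableAt) (fun y _ => by simpa using hL.2 y) (mem_univ x)
    (mem_univ (x - t))
  simpa using h

lemma integrable_regIntegrand (hn : 2 ≤ n) (hΓ : IsGammaU Γ) (hK : IsHomCZKernel n K) (u : ℝ)
    (f : SchwartzMap (Rn n) ℂ) (x : Rn n) : Integrable (regIntegrand Γ K u f x) := by
  obtain ⟨B, hB, hKB⟩ := hK.exists_abs_le
  obtain ⟨L, hL, hfL⟩ := exists_norm_sub_le f
  have hn0 : n ≠ 0 := by omega
  have hbd : Integrable fun t : Rn n =>
      B * L * (Iic (1 : ℝ)).indicator (fun s => (s ^ (n - 1))⁻¹) ‖t‖ + B * ‖f (x - t)‖ :=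
    ((integrable_norm_pow hn).const_mul _).add ((f.integrable.comp_sub_left x).norm.const_mul _)
  refine hbd.mono' ?_ ((ae_ne_zero hn0).mono fun t ht => ?_)
  · refine (AEStronglyMeasurable.mul ?_ (continuous_phase hΓ u).aestronglyMeasurable).mul
      (Complex.continuous_ofReal.comp_aestronglyMeasurable (hK.aestronglyMeasurable hn0))
    exact (f.continuous.comp (continuous_const.sub continuous_id)).aestronglyMeasurable.sub
      (aestronglyMeasurable_const.indicator Metric.isClosed_closedBall.measurableSet)
  · have h0 : 0 < ‖t‖ := norm_pos_iff.2 ht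
    rw [regIntegrand, norm_mul, norm_mul, norm_phase, mul_one, Complex.norm_real, Real.norm_eq_abs]
    by_cases h1 : ‖t‖ ≤ 1
    · rw [indicator_of_mem (by simpa using h1), indicator_of_mem (by simpa using h1)]
      have h2 : ‖t‖ ^ n = ‖t‖ ^ (n - 1) * ‖t‖ := by rw [← pow_succ, Nat.sub_add_cancel (by omega)]
      calc ‖f (x - t) - f x‖ * |K t| ≤ L * ‖t‖ * (B / ‖t‖ ^ n) :=
            mul_le_mul (hfL x t) (hKB t ht) (abs_nonneg _) (by positivity)
        _ = B * L * (‖t‖ ^ (n - 1))⁻¹ := by rw [h2]; field_simp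
        _ ≤ _ := le_add_of_nonneg_right (by positivity)
    · rw [indicator_of_notMem (by simpa using h1), indicator_of_notMem (by simpa using h1), sub_zero,
        mul_zero, zero_add, mul_comm]
      refine mul_le_mul_of_nonneg_right ((hKB t ht).trans ?_) (norm_nonneg _)
      exact div_le_self hB (one_le_pow₀ (not_le.1 h1).le)

lemma pvH_eq_integral (hn : 2 ≤ n) (hΓ : IsGammaU Γ) (hK : IsHomCZKernel n K) (u : ℝ)
    (f : SchwartzMap (Rn n) ℂ) (x : Rn n) : pvH Γ K u f x = ∫ t, regIntegrand Γ K u f x t := by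
  obtain ⟨B, hB, hKB⟩ := hK.exists_abs_le
  have hn0 : n ≠ 0 := by omega
  have hR := integrable_regIntegrand hn hΓ hK u f x
  have hA (ε : ℝ) : MeasurableSet {t : Rn n | ε < ‖t‖ ∧ ‖t‖ < ε⁻¹} :=
    (measurableSet_lt measurable_const measurable_norm).inter
      (measurableSet_lt measurable_norm measurable_const)
  refine Tendsto.limUnder_eq ?_
  have hlim : Tendsto (fun ε : ℝ => ∫ t, {t : Rn n | ε < ‖t‖ ∧ ‖t‖ < ε⁻¹}.indicator
      (regIntegrand Γ K u f x) t) (𝓝[>] (0 : ℝ)) (𝓝 (∫ t, regIntegrand Γ K u f x t)) := by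
    refine tendsto_integral_filter_of_dominated_convergence (fun t => ‖regIntegrand Γ K u f x t‖)
      (Eventually.of_forall fun ε => hR.aestronglyMeasurable.indicator (hA ε))
      (Eventually.of_forall fun ε => Eventually.of_forall fun t => norm_indicator_le_norm_self _ _)
      hR.norm ((ae_ne_zero hn0).mono fun t ht => ?_)
    refine tendsto_const_nhds.congr' ?_
    have h0 : 0 < ‖t‖ := norm_pos_iff.2 ht
    filter_upwards [self_mem_nhdsWithin, nhdsWithin_le_nhds (Iio_mem_nhds h0),
      nhdsWithin_le_nhds (Iio_mem_nhds (inv_pos.2 h0))] with ε (hε : 0 < ε) h1 h2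
    rw [indicator_of_mem]
    exact ⟨h1, (lt_inv_comm₀ hε h0).1 h2⟩
  refine hlim.congr' ?_
  filter_upwards [self_mem_nhdsWithin, nhdsWithin_le_nhds (Iio_mem_nhds one_pos)]
    with ε (hε : 0 < ε) (hε1 : ε < 1)
  have hε2 : 1 < ε⁻¹ := (one_lt_inv₀ hε).2 hε1
  have hKm := hK.aestronglyMeasurable hn0
  set g : ℝ → ℂ := fun s => (Ioc ε 1).indicator (fun s => f x * phase Γ u s) s with hg
  have hgi : Integrable fun t : Rn n => g ‖t‖ * (K t : ℂ) := by
    have hs : MeasurableSet {t : Rn n | ‖t‖ ∈ Ioc ε 1} := measurable_norm measurableSet_Ioc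
    have hm : AEStronglyMeasurable fun t : Rn n => f x * phase Γ u ‖t‖ * (K t : ℂ) :=
      ((continuous_phase hΓ u).aestronglyMeasurable.const_mul (f x)).mul
        (Complex.continuous_ofReal.comp_aestronglyMeasurable hKm)
    have h1 : IntegrableOn (fun t : Rn n => f x * phase Γ u ‖t‖ * (K t : ℂ))
        {t : Rn n | ‖t‖ ∈ Ioc ε 1} := by
      refine Measure.integrableOn_of_bounded (M := ‖f x‖ * (B / ε ^ n)) ?_ hm ?_
      · refine ((measure_mono fun t ht => ?_).trans_lt
          (measure_closedBall_lt_top (x := (0 : Rn n)) (r := 1))).ne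
        simpa using ht.2
      · refine (ae_restrict_iff' hs).2 (Eventually.of_forall fun t ht => ?_)
        rw [norm_mul, norm_mul, norm_phase, mul_one, Complex.norm_real, Real.norm_eq_abs]
        refine mul_le_mul_of_nonneg_left ((hKB t (norm_pos_iff.1 (hε.trans ht.1))).trans ?_)
          (norm_nonneg _)
        exact div_le_div_of_nonneg_left hB (by positivity) (pow_le_pow_left₀ hε.le ht.1.le n)
    refine ((integrable_indicator_iff hs).2 h1).congr (Eventually.of_forall fun t => ?_)
    by_cases ht : ‖t‖ ∈ Ioc ε 1
    · simp only [hg, indicator_of_mem ht, indicator_of_mem (show t ∈ {t : Rn n | ‖t‖ ∈ Ioc ε 1} from ht)]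
    · simp only [hg, indicator_of_notMem ht,
        indicator_of_notMem (show t ∉ {t : Rn n | ‖t‖ ∈ Ioc ε 1} from ht), zero_mul]
  have hsplit : (fun t => {t : Rn n | ε < ‖t‖ ∧ ‖t‖ < ε⁻¹}.indicator (fun t =>
      f (x - t) * Complex.exp (Complex.I * Complex.ofReal (u * Γ ‖t‖)) * Complex.ofReal (K t)) t) =
      fun t => {t : Rn n | ε < ‖t‖ ∧ ‖t‖ < ε⁻¹}.indicator (regIntegrand Γ K u f x) t +
        g ‖t‖ * (K t : ℂ) := by
    funext t
    by_cases ht : t ∈ {t : Rn n | ε < ‖t‖ ∧ ‖t‖ < ε⁻¹}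
    · rw [indicator_of_mem ht, indicator_of_mem ht, regIntegrand, hg]
      by_cases h1 : ‖t‖ ≤ 1
      · simp only [indicator_of_mem (show ‖t‖ ∈ Ioc ε 1 from ⟨ht.1, h1⟩)]
        rw [indicator_of_mem (by simpa using h1), phase]
        ring
      · simp only [indicator_of_notMem (show ‖t‖ ∉ Ioc ε 1 from fun h => h1 h.2)]
        rw [indicator_of_notMem (by simpa using h1), phase]
        ring
    · have h1 : ‖t‖ ∉ Ioc ε 1 := fun h => ht ⟨h.1, h.2.trans_lt hε2⟩
      simp only [indicator_of_notMem ht, hg, indicator_of_notMem h1, zero_mul, add_zero]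
  rw [← integral_indicator (hA ε), hsplit, integral_add (hR.indicator (hA ε)) hgi,
    hK.integral_radial_mul_eq_zero hn0, add_zero]

end PrincipalValue

section Decomposition

variable {n : ℕ} {K : Rn n → ℝ} {Γ : ℝ → ℝ} {c : ℕ → ℝ} {c₁ b : ℝ} {ρ : ℤ → ℝ} {G : ℤ → ℕ → ℝ → ℝ}

lemma bump_nonneg {y : ℝ} (hy : 0 ≤ y) : 0 ≤ bump y :=
  sub_nonneg.2 (Real.smoothTransition.monotone (by linarith))

lemma bump_le_one (y : ℝ) : bump y ≤ 1 := by
  have h1 := Real.smoothTransition.le_one (2 - y)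
  have h2 := Real.smoothTransition.nonneg (2 - 2 * y)
  unfold bump
  linarith

lemma _root_.IsGammaU.nonneg (hΓ : IsGammaU Γ) {s : ℝ} (hs : 0 ≤ s) : 0 ≤ Γ s := by
  rcases hs.eq_or_lt with rfl | h
  · exact hΓ.map_zero.ge
  · exact (hΓ.pos h).le

lemma hasSum_pvH (hn : 2 ≤ n) (hΓ : IsGammaU Γ) (hK : IsHomCZKernel n K) (u : ℝ)
    (f : SchwartzMap (Rn n) ℂ) (x : Rn n) {κ : ℤ → Rn n → ℂ} (hκi : ∀ k, Integrable (κ k))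
    (hκ : ∀ k t, κ k t = phase Γ u ‖t‖ * (bump (Γ ‖t‖ / 2 ^ k) : ℂ) * (K t : ℂ)) :
    HasSum (fun k => ∫ s, f s * κ k (x - s)) (pvH Γ K u f x) := by
  have hn0 : n ≠ 0 := by omega
  have hR := integrable_regIntegrand hn hΓ hK u f x
  have hΓc : Continuous fun t : Rn n => Γ ‖t‖ :=
    hΓ.continuousOn.comp_continuous continuous_norm fun t => norm_nonneg t
  have hb0 (k : ℤ) (t : Rn n) : 0 ≤ bump (Γ ‖t‖ / 2 ^ k) :=
    bump_nonneg (div_nonneg (hΓ.nonneg (norm_nonneg t)) (by positivity))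
  have hbm (k : ℤ) : Continuous fun t : Rn n => (bump (Γ ‖t‖ / 2 ^ k) : ℂ) :=
    Complex.continuous_ofReal.comp (contDiff_bump.continuous.comp (hΓc.div_const _))
  have hm (k : ℤ) : AEStronglyMeasurable
      fun t => (bump (Γ ‖t‖ / 2 ^ k) : ℂ) * regIntegrand Γ K u f x t :=
    (hbm k).aestronglyMeasurable.mul hR.aestronglyMeasurable
  have hnorm (k : ℤ) (t : Rn n) : ‖(bump (Γ ‖t‖ / 2 ^ k) : ℂ) * regIntegrand Γ K u f x t‖ =
      bump (Γ ‖t‖ / 2 ^ k) * ‖regIntegrand Γ K u f x t‖ := by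
    rw [norm_mul, Complex.norm_real, Real.norm_of_nonneg (hb0 k t)]
  have hbi (k : ℤ) : Integrable fun t => (bump (Γ ‖t‖ / 2 ^ k) : ℂ) * regIntegrand Γ K u f x t :=
    hR.norm.mono' (hm k) (Eventually.of_forall fun t => (hnorm k t).le.trans
      (mul_le_of_le_one_left (norm_nonneg _) (bump_le_one _)))
  have hsum {t : Rn n} (ht : t ≠ 0) : HasSum (fun k : ℤ => bump (Γ ‖t‖ / 2 ^ k)) 1 :=
    hasSum_bump (hΓ.pos (norm_pos_iff.2 ht))
  have key (k : ℤ) : ∫ s, f s * κ k (x - s) =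
      ∫ t, (bump (Γ ‖t‖ / 2 ^ k) : ℂ) * regIntegrand Γ K u f x t := by
    set g : ℝ → ℂ := fun s =>
      (Iic 1).indicator (fun s => f x * (phase Γ u s * (bump (Γ s / 2 ^ k) : ℂ))) s with hg
    have e1 (t : Rn n) : (Metric.closedBall 0 1).indicator (fun t => f x * κ k t) t =
        g ‖t‖ * (K t : ℂ) := by
      by_cases h1 : ‖t‖ ≤ 1
      · rw [indicator_of_mem (by simpa using h1), hg, hκ]
        simp only [indicator_of_mem (show ‖t‖ ∈ Iic (1 : ℝ) from h1)]
        ring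
      · rw [indicator_of_notMem (by simpa using h1), hg]
        simp only [indicator_of_notMem (show ‖t‖ ∉ Iic (1 : ℝ) from h1), zero_mul]
    have hgi : Integrable fun t : Rn n => g ‖t‖ * (K t : ℂ) :=
      (((hκi k).const_mul (f x)).indicator Metric.isClosed_closedBall.measurableSet).congr
        (Eventually.of_forall e1)
    refine Eq.trans ?_ (add_zero _)
    rw [← integral_sub_left_eq_self (fun s => f s * κ k (x - s)) volume x,
      ← hK.integral_radial_mul_eq_zero hn0 g, ← integral_add (hbi k) hgi]
    refine integral_congr_ae (Eventually.of_forall fun t => ?_)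
    beta_reduce
    rw [← e1 t, sub_sub_cancel, regIntegrand, hκ]
    by_cases h1 : t ∈ Metric.closedBall (0 : Rn n) 1
    · rw [indicator_of_mem h1, indicator_of_mem h1, hκ]
      ring
    · rw [indicator_of_notMem h1, indicator_of_notMem h1]
      ring
  simp_rw [key]
  rw [pvH_eq_integral hn hΓ hK]
  refine hasSum_integral_of_dominated_convergence
    (fun k t => bump (Γ ‖t‖ / 2 ^ k) * ‖regIntegrand Γ K u f x t‖) hm
    (fun k => Eventually.of_forall fun t => (hnorm k t).le)
    ((ae_ne_zero hn0).mono fun t ht => (hsum ht).summable.mul_right _)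
    (hR.norm.congr ((ae_ne_zero hn0).mono fun t ht => ?_)) ((ae_ne_zero hn0).mono fun t ht => ?_)
  · beta_reduce
    rw [tsum_mul_right, (hsum ht).tsum_eq, one_mul]
  · simpa using ((hsum ht).mapL Complex.ofRealCLM).mul_right (regIntegrand Γ K u f x t)

lemma scaledKer_bump_eq (hK : IsHomCZKernel n K) (hρ : IsLac ρ b)
    (hc₁ : 0 < c₁) (hG : ∀ k, UnitPhase c c₁ (G k))
    (hGΓ : ∀ k s, 0 ≤ s → G k 0 s = Γ (ρ k * s) / 2 ^ k) {a : Rn n → ℂ}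
    (ha : ∀ t ∈ shell n (shellRad c₁)⁻¹ (shellRad c₁), a t = K t) (j k : ℤ) (v : ℝ) (t : Rn n) :
    scaledKer ρ bump G a (2 ^ (j + k)) k v t =
      phase Γ (2 ^ j * v) ‖t‖ * (bump (Γ ‖t‖ / 2 ^ k) : ℂ) * (K t : ℂ) := by
  have hk := hρ.pos k
  have hnorm : ‖(ρ k)⁻¹ • t‖ = (ρ k)⁻¹ * ‖t‖ := by
    rw [norm_smul, Real.norm_of_nonneg (inv_pos.2 hk).le]
  have hGt : G k 0 ‖(ρ k)⁻¹ • t‖ = Γ ‖t‖ / 2 ^ k := by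
    rw [hGΓ k _ (norm_nonneg _), hnorm, mul_inv_cancel_left₀ hk.ne']
  by_cases ht : (ρ k)⁻¹ • t ∈ shell n (shellRad c₁)⁻¹ (shellRad c₁)
  · obtain ⟨Ω, -, hΩ, -, hKΩ⟩ := hK
    have h0 : (ρ k)⁻¹ • t ≠ 0 := by
      rintro h
      have h1 := ht.1
      rw [h, norm_zero] at h1
      exact absurd h1 (not_le.2 (inv_pos.2 (zero_lt_one.trans (one_lt_shellRad hc₁))))
    have ht0 : t ≠ 0 := fun h => h0 (by rw [h, smul_zero])
    have h2 : (2 : ℝ) ^ (j + k) * v * (Γ ‖t‖ / 2 ^ k) = 2 ^ j * v * Γ ‖t‖ := by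
      rw [zpow_add₀ two_ne_zero]
      field_simp
    rw [scaledKer, unitKer, oscFactor_sq_eq _ _ _ (norm_nonneg _), hGt, ha _ ht, hKΩ _ h0, hKΩ _ ht0,
      hΩ _ (inv_pos.2 hk), hnorm, h2, phase]
    have h3 : (ρ k : ℂ) ≠ 0 := by exact_mod_cast hk.ne'
    push_cast
    rw [mul_pow, inv_pow]
    field_simp
  · have h1 := (hG k).cutoff_eq_zero hc₁ bump_eq_zero ht
    rw [hGt] at h1
    rw [scaledKer, unitKer_eq_zero (hG k) hc₁ bump_eq_zero _ _ ht, h1]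
    simp

end Decomposition

section Main

variable {n : ℕ} {K : Rn n → ℝ} {Γ : ℝ → ℝ}

lemma exists_lintegral_variation_pvH_le (hn : 2 ≤ n) (hΓ : IsGammaU Γ) (hK : IsHomCZKernel n K)
    {p r : ℝ} (hp : 1 < p) (hr : 2 < r) (hrp : p / (p - 1) / n < r) :
    ∃ C : ℝ≥0∞, C ≠ ⊤ ∧ ∀ f : SchwartzMap (Rn n) ℂ,
      (∫⁻ x, ((∑' j : ℤ, variation r (Icc ((2 : ℝ) ^ j) (2 ^ (j + 1)))
        (fun u => pvH Γ K u f x) ^ r) ^ (1 / r)) ^ p) ^ (1 / p) ≤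
        C * (∫⁻ s, ‖f s‖ₑ ^ p) ^ (1 / p) := by
  obtain ⟨c, c₁, b, ρ, G, hc₁, hρ, hG, hGΓ⟩ := hΓ.exists_unitPhase
  obtain ⟨a, ha⟩ := exists_amplitude hK (one_lt_shellRad hc₁)
  have hη0 : ∀ y ∉ Icc (1 / 2 : ℝ) 2, y * bump y = 0 := fun y hy => by
    rw [bump_eq_zero y hy, mul_zero]
  obtain ⟨C₁, h1⟩ := exists_pieceFam hn hK hρ hG hc₁ contDiff_bump bump_eq_zero ha
  obtain ⟨C₂, h2⟩ := exists_pieceFam hn hK hρ hG hc₁ (contDiff_id.mul contDiff_bump) hη0 ha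
  have hκ := h1 (max C₁ C₂) (le_max_left _ _)
  have hκ' := h2 (max C₁ C₂) (le_max_right _ _)
  obtain ⟨C, hC, δ, hδ, hM⟩ := exists_lintegral_variation_T_le hκ hκ' hn hp hr hrp
    fun lam hlam f hf k x v => hasDerivAt_T (hκ.ker lam hlam) (hκ'.ker lam hlam) hf k x v
  have hp0 : 0 < p := by linarith
  have hr0 : 0 < r := by linarith
  refine ⟨C ^ (1 / p) * ∑' l : ℤ, two (-(δ / p * |(l : ℝ)|)),
    ENNReal.mul_ne_top (ENNReal.rpow_ne_top_of_nonneg (by positivity) hC)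
      (tsum_two_neg_abs_ne_top (by positivity)), fun f => ?_⟩
  choose M hMm hMle hMint using fun l => hM l f f.continuous.measurable f.integrable
  have hvar (x : Rn n) (j : ℤ) : variation r (Icc ((2 : ℝ) ^ j) (2 ^ (j + 1)))
      (fun u => pvH Γ K u f x) ≤
      ∑' l : ℤ, variation r (Icc 1 2) (T (scaledKer ρ bump G a (2 ^ l)) (l - j) f x) := by
    have h2j : (0 : ℝ) < 2 ^ j := by positivity
    refine (variation_comp_le (𝒦' := Icc 1 2) h2j fun u hu => ?_).trans
      (variation_le_tsum (by linarith) fun v _ => ?_)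
    · rw [← div_eq_inv_mul]
      refine ⟨(one_le_div h2j).2 hu.1, (div_le_iff₀ h2j).2 (hu.2.trans_eq ?_)⟩
      rw [zpow_add₀ two_ne_zero, zpow_one, mul_comm]
    · have h : HasSum (fun k => ∫ s, f s * scaledKer ρ bump G a (2 ^ (j + k)) k v (x - s))
          (pvH Γ K (2 ^ j * v) f x) :=
        hasSum_pvH hn hΓ hK _ f x
          (fun k => (hκ.ker _ (by positivity)).integrable_ker k v)
          (fun k t => scaledKer_bump_eq hK hρ hc₁ hG hGΓ ha j k v t)
      rw [← (Equiv.subRight j).hasSum_iff] at h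
      refine h.congr_fun fun l => ?_
      simp only [Function.comp_apply, Equiv.subRight_apply, add_sub_cancel]
      rfl
  have hpt (x : Rn n) : (∑' j : ℤ, variation r (Icc ((2 : ℝ) ^ j) (2 ^ (j + 1)))
      (fun u => pvH Γ K u f x) ^ r) ^ (1 / r) ≤ ∑' l, M l x := by
    refine (ENNReal.rpow_le_rpow (ENNReal.tsum_le_tsum fun j => ENNReal.rpow_le_rpow (hvar x j)
      hr0.le) (by positivity)).trans ((tsum_tsum_rpow_le (by linarith) _).trans
      (ENNReal.tsum_le_tsum fun l => le_trans (le_of_eq ?_) (hMle l x)))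
    congr 1
    exact (Equiv.subLeft l).tsum_eq
      fun k => variation r (Icc 1 2) (T (scaledKer ρ bump G a (2 ^ l)) k f x) ^ r
  calc _ ≤ (∫⁻ x, (∑' l, M l x) ^ p) ^ (1 / p) :=
        ENNReal.rpow_le_rpow (lintegral_mono fun x => ENNReal.rpow_le_rpow (hpt x) hp0.le)
          (by positivity)
    _ ≤ ∑' l, (∫⁻ x, M l x ^ p) ^ (1 / p) :=
        lintegral_tsum_rpow_le hp.le _ fun l => (hMm l).aemeasurable
    _ ≤ ∑' l : ℤ, C ^ (1 / p) * two (-(δ / p * |(l : ℝ)|)) * (∫⁻ s, ‖f s‖ₑ ^ p) ^ (1 / p) := by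
        refine ENNReal.tsum_le_tsum fun l =>
          (ENNReal.rpow_le_rpow (hMint l) (by positivity)).trans (le_of_eq ?_)
        rw [ENNReal.mul_rpow_of_nonneg _ _ (by positivity),
          ENNReal.mul_rpow_of_nonneg _ _ (by positivity), two_rpow]
        congr 3
        ring
    _ = _ := by rw [ENNReal.tsum_mul_right, ENNReal.tsum_mul_left]

end Main

end ShortVar

/-- Proposition 3.2: the short variation estimate. -/
theorem short_variation_estimate (n : ℕ) (hn : 2 ≤ n) (Γ : ℝ → ℝ) (hΓ : IsGammaU Γ)
    (K : Rn n → ℝ) (hK : IsHomCZKernel n K)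
    (p r : ℝ) (hp : 1 < p) (hr : 2 < r) (hrp : p / (p - 1) / n < r) :
    ∃ C > (0 : ℝ), ∀ f : SchwartzMap (Rn n) ℂ,
      lpNormENN p
          (fun x => (∑' j : ℤ,
            variation r (Set.Icc ((2 : ℝ) ^ j) ((2 : ℝ) ^ (j + 1)))
              (fun u => pvH Γ K u (⇑f) x) ^ r) ^ (1 / r)) volume
        ≤ ENNReal.ofReal C * eLpNorm (⇑f) (ENNReal.ofReal p) volume := by
  have hp0 : 0 < p := by linarith
  obtain ⟨C, hC, h⟩ := ShortVar.exists_lintegral_variation_pvH_le hn hΓ hK hp hr hrp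
  refine ⟨C.toReal + 1, by positivity, fun f => ?_⟩
  rw [eLpNorm_eq_lintegral_rpow_enorm_toReal (by simpa using hp0) ENNReal.ofReal_ne_top,
    ENNReal.toReal_ofReal hp0.le]
  refine (h f).trans (mul_le_mul' ?_ le_rfl)
  rw [ENNReal.le_ofReal_iff_toReal_le hC (by positivity)]
  linarith
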